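/- For every integer n > 2 there exist constants c = c(n) and e = e(n) such that the following holds. Let f ∈ ℤ[x_0,…,x_n] be a homogeneous polynomial of degree d ≥ 5 that is irreducible in ℚ[x_0,…,x_n], and let X ⊂ ℙ^n_ℚ be the hypersurface f = 0. Then for every real H ≥ 2, the number of rational points of X of height at most H is at most c·d^e·H^{n−1}. -/

import Mathlib

namespace DG

open Finset in
theorem tree {α ι γ : Type*} [DecidableEq α] [DecidableEq ι] [DecidableEq γ]
    (S : Finset α) (cov : ι → α → Prop) (Q : ℕ → Finset ℕ) (cls : ℕ → α → γ)
    (good : ℕ → α → Prop) (k t Nq Cq κ m : ℕ) (G τ W : ℕ → ℕ)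
    (ht : 0 < t)
    (hQ : ∀ j < k, (Q j).card = t)
    (H1 : ∀ j < k, ∀ q ∈ Q j, ∀ C : Finset γ, (∀ c ∈ C, ∃ x ∈ S, good q x ∧ cls q x = c) → C.card ≤ Nq)
    (H2 : ∀ j < k, ∀ q ∈ Q j, ∀ h, ∀ C : Finset γ,
      (∀ c ∈ C, ∃ x ∈ S, good q x ∧ cov h x ∧ cls q x = c) → C.card ≤ Cq)
    (H3 : ∀ j < k, ∀ x ∈ S, ∀ P ⊆ Q j, (∀ q ∈ P, ¬ good q x) → 4 * P.card ≤ t)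
    (H4 : ∀ j < k, ∀ x ∈ S, ∀ y ∈ S, x ≠ y → ∀ P ⊆ Q j, (∀ q ∈ P, cls q x = cls q y) → P.card ≤ κ)
    (H5 : ∀ T ⊆ S, (∀ j < k, ∃ q ∈ Q j, (∀ x ∈ T, good q x) ∧ ∀ x ∈ T, ∀ y ∈ T, cls q x = cls q y) →
      ∃ L : Finset ι, L.card ≤ G 0 ∧ (∀ x ∈ T, ∃ h ∈ L, cov h x) ∧
        ∀ h, ∀ T' ⊆ T, (∀ x ∈ T', cov h x) → τ 0 ≤ T'.card → h ∈ L)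
    (hm : 4 * (1 + κ) * m ≤ t ^ 2) (hm0 : 0 < m)
    (hG : ∀ i < k, t * Nq * G i ≤ m * G (i + 1))
    (hτ : ∀ i < k, 4 * Cq * τ i ≤ τ (i + 1)) (hτt : ∀ i < k, t ≤ τ (i + 1))
    (hW : ∀ i < k, 2 * Nq * (W i + G i * τ (i + 1)) ≤ W (i + 1)) :
    ∃ L : Finset ι, L.card ≤ G k ∧
      ∀ U ⊆ S, (∀ x ∈ U, ∀ h ∈ L, ¬ cov h x) → U.card ≤ W k := by
  classical
  suffices H : ∀ i ≤ k, ∀ T ⊆ S,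
      (∀ j < k, i ≤ j → ∃ q ∈ Q j, (∀ x ∈ T, good q x) ∧ ∀ x ∈ T, ∀ y ∈ T, cls q x = cls q y) →
      ∃ L : Finset ι, L.card ≤ G i ∧
        (∀ h, τ i ≤ (T.filter (cov h)).card → h ∈ L) ∧
        (T.filter (fun x => ∀ h ∈ L, ¬ cov h x)).card ≤ W i by
    obtain ⟨L, h1, -, h3⟩ := H k le_rfl S (Subset.refl _) (fun j hj hk => by omega)
    refine ⟨L, h1, fun U hU hx => (card_le_card ?_).trans h3⟩
    intro x hxU
    simp only [mem_filter]
    exact ⟨hU hxU, hx x hxU⟩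
  intro i
  induction i with
  | zero =>
    intro _ T hT hr
    obtain ⟨L, h1, h2, h3⟩ := H5 T hT (fun j hj => hr j hj (Nat.zero_le _))
    refine ⟨L, h1, fun h hh => h3 h _ (filter_subset _ _) (by simp) hh, ?_⟩
    rw [filter_eq_empty_iff.2]
    · simp
    · intro x hx hcon
      obtain ⟨h, hL, hc⟩ := h2 x hx
      exact hcon h hL hc
  | succ i ih =>
    intro hik T hT hr
    have hi : i < k := hik
    -- classes
    let Tc : ℕ → γ → Finset α := fun q c => T.filter (fun x => good q x ∧ cls q x = c)
    have hTc : ∀ q ∈ Q i, ∀ c, ∃ L : Finset ι, L.card ≤ G i ∧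
        (∀ h, τ i ≤ ((Tc q c).filter (cov h)).card → h ∈ L) ∧
        ((Tc q c).filter (fun x => ∀ h ∈ L, ¬ cov h x)).card ≤ W i := by
      intro q hq c
      apply ih hi.le (Tc q c) ((filter_subset _ _).trans hT)
      intro j hj hij
      rcases eq_or_lt_of_le hij with rfl | hlt
      · refine ⟨q, hq, fun x hx => (mem_filter.1 hx).2.1, fun x hx y hy => ?_⟩
        rw [(mem_filter.1 hx).2.2, (mem_filter.1 hy).2.2]
      · obtain ⟨q', hq', h1, h2⟩ := hr j hj hlt
        exact ⟨q', hq', fun x hx => h1 x (mem_filter.1 hx).1,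
          fun x hx y hy => h2 x (mem_filter.1 hx).1 y (mem_filter.1 hy).1⟩
    choose! LL hL1 hL2 hL3 using hTc
    let cl : ℕ → Finset γ := fun q => (T.filter (good q)).image (cls q)
    have hcl : ∀ q ∈ Q i, (cl q).card ≤ Nq := by
      intro q hq
      apply H1 i hi q hq
      intro c hc
      obtain ⟨x, hx, rfl⟩ := mem_image.1 hc
      exact ⟨x, hT (mem_filter.1 hx).1, (mem_filter.1 hx).2, rfl⟩
    let Pr : Finset (Σ _ : ℕ, γ) := (Q i).sigma cl
    let mult : ι → ℕ := fun h => (Pr.filter (fun p => h ∈ LL p.1 p.2)).card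
    let All : Finset ι := Pr.biUnion (fun p => LL p.1 p.2)
    let L : Finset ι := All.filter (fun h => m ≤ mult h)
    have hLmem : ∀ h, m ≤ mult h → h ∈ L := by
      intro h hh
      have : 0 < mult h := lt_of_lt_of_le hm0 hh
      obtain ⟨p, hp⟩ := card_pos.1 this
      obtain ⟨hp1, hp2⟩ := mem_filter.1 hp
      exact mem_filter.2 ⟨mem_biUnion.2 ⟨p, hp1, hp2⟩, hh⟩
    have hPr : Pr.card ≤ t * Nq := by
      rw [card_sigma, ← hQ i hi, ← smul_eq_mul]
      exact sum_le_card_nsmul _ _ _ hcl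
    -- (card)
    have hLcard : L.card ≤ G (i + 1) := by
      have h1 : m * L.card ≤ ∑ h ∈ L, mult h := by
        rw [mul_comm, ← smul_eq_mul]
        exact card_nsmul_le_sum _ _ _ (fun h hh => (mem_filter.1 hh).2)
      have h2 : ∑ h ∈ L, mult h ≤ ∑ p ∈ Pr, (LL p.1 p.2).card := by
        simp only [mult, card_filter]
        rw [sum_comm]
        apply sum_le_sum
        intro p hp
        rw [← card_filter]
        apply card_le_card
        intro h hh
        exact (mem_filter.1 hh).2
      have h3 : ∑ p ∈ Pr, (LL p.1 p.2).card ≤ Pr.card * G i := by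
        rw [← smul_eq_mul]
        apply sum_le_card_nsmul
        intro p hp
        exact hL1 _ (mem_sigma.1 hp).1 _
      have h4 : m * L.card ≤ m * G (i + 1) :=
        ((h1.trans h2).trans h3).trans ((Nat.mul_le_mul_right _ hPr).trans (hG i hi))
      exact Nat.le_of_mul_le_mul_left h4 hm0
    -- (a)
    have ha : ∀ h, τ (i + 1) ≤ (T.filter (cov h)).card → h ∈ L := by
      intro h hh
      apply hLmem
      set Th := T.filter (cov h) with hTh
      set n := Th.card with hn
      let r : (Σ _ : ℕ, γ) → ℕ := fun p => ((Tc p.1 p.2).filter (cov h)).card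
      let Rich := Pr.filter (fun p => h ∈ LL p.1 p.2)
      -- lower bound
      have low : t * n ≤ 2 * ∑ p ∈ Rich, r p := by
        have e1 : ∀ q ∈ Q i, (Th.filter (good q)).card ≤
            ∑ c ∈ (cl q).filter (fun c => h ∈ LL q c), r ⟨q, c⟩ + Cq * τ i := by
          intro q hq
          have : (Th.filter (good q)).card = ∑ c ∈ cl q, r ⟨q, c⟩ := by
            rw [card_eq_sum_card_fiberwise (f := cls q) (t := cl q)]
            · apply sum_congr rfl
              intro c hc
              simp only [r, Tc, hTh]
              congr 1
              ext x
              simp only [mem_filter]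
              tauto
            · intro x hx
              simp only [coe_filter, Set.mem_setOf_eq, hTh, mem_filter] at hx
              exact mem_image.2 ⟨x, mem_filter.2 ⟨hx.1.1, hx.2⟩, rfl⟩
          rw [this, ← sum_filter_add_sum_filter_not (cl q) (fun c => h ∈ LL q c)]
          apply Nat.add_le_add_left
          have hz : ∑ c ∈ (cl q).filter (fun c => ¬ h ∈ LL q c), r ⟨q, c⟩ =
              ∑ c ∈ ((cl q).filter (fun c => ¬ h ∈ LL q c)).filter (fun c => r ⟨q, c⟩ ≠ 0), r ⟨q, c⟩ := by
            rw [sum_filter_ne_zero]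
          rw [hz]
          refine (sum_le_card_nsmul _ _ (τ i) ?_).trans ?_
          · intro c hc
            have := (mem_filter.1 (mem_filter.1 hc).1).2
            by_contra hcon
            exact this (hL2 q hq c h (le_of_lt (not_le.1 hcon)))
          · rw [smul_eq_mul]
            apply Nat.mul_le_mul_right
            apply H2 i hi q hq h
            intro c hc
            have := (mem_filter.1 hc).2
            obtain ⟨x, hx⟩ := card_pos.1 (Nat.pos_of_ne_zero this)
            simp only [Tc, mem_filter] at hx
            exact ⟨x, hT hx.1.1, hx.1.2.1, hx.2, hx.1.2.2⟩
        have e2 : ∑ q ∈ Q i, (Th.filter (good q)).card ≤ ∑ p ∈ Rich, r p + t * (Cq * τ i) := by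
          refine (sum_le_sum e1).trans ?_
          rw [sum_add_distrib, sum_const, hQ i hi, smul_eq_mul]
          apply Nat.add_le_add_right
          simp only [Rich, Pr]
          rw [sum_filter, sum_sigma]
          apply le_of_eq
          apply sum_congr rfl
          intro q hq
          rw [sum_filter]
        have e3 : 4 * ∑ q ∈ Q i, (Th.filter (fun x => ¬ good q x)).card ≤ t * n := by
          simp only [card_filter]
          rw [sum_comm, mul_sum, mul_comm t n, hn, ← smul_eq_mul]
          apply sum_le_card_nsmul
          intro x hx
          rw [← card_filter]
          exact H3 i hi x (hT (mem_filter.1 hx).1) _ (filter_subset _ _) (by simp)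
        have e4 : ∑ q ∈ Q i, (Th.filter (good q)).card +
            ∑ q ∈ Q i, (Th.filter (fun x => ¬ good q x)).card = t * n := by
          rw [← sum_add_distrib, ← hQ i hi, ← smul_eq_mul, ← sum_const]
          apply sum_congr rfl
          intro q hq
          rw [card_filter_add_card_filter_not]
        have e5 : 4 * (t * (Cq * τ i)) ≤ t * n := by
          have := Nat.mul_le_mul_left t ((hτ i hi).trans hh)
          calc 4 * (t * (Cq * τ i)) = t * (4 * Cq * τ i) := by ring
            _ ≤ _ := this
        omega
      -- upper bound for sum of squares
      have up : ∑ p ∈ Rich, r p ^ 2 ≤ n ^ 2 * (1 + κ) := by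
        have u1 : ∑ p ∈ Rich, r p ^ 2 ≤ ∑ p ∈ Pr, r p ^ 2 :=
          sum_le_sum_of_subset (filter_subset _ _)
        have u2 : ∑ p ∈ Pr, r p ^ 2 ≤ ∑ q ∈ Q i, ((Th ×ˢ Th).filter (fun z => cls q z.1 = cls q z.2)).card := by
          simp only [Pr]
          rw [sum_sigma]
          apply sum_le_sum
          intro q hq
          have : ∀ c ∈ cl q, r ⟨q, c⟩ ^ 2 ≤ (((Th ×ˢ Th).filter (fun z => cls q z.1 = cls q z.2)).filter (fun z => cls q z.1 = c)).card := by
            intro c hc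
            rw [sq]
            simp only [r]
            rw [← card_product]
            apply card_le_card
            intro z hz
            simp only [Tc, mem_product, mem_filter, hTh] at hz ⊢
            obtain ⟨⟨⟨h1, h2, h3⟩, h4⟩, ⟨h5, h6, h7⟩, h8⟩ := hz
            exact ⟨⟨⟨⟨h1, h4⟩, h5, h8⟩, by rw [h3, h7]⟩, h3⟩
          refine (sum_le_sum this).trans ?_
          rw [← card_biUnion]
          · apply card_le_card
            intro z hz
            obtain ⟨c, _, hz⟩ := mem_biUnion.1 hz
            exact (mem_filter.1 hz).1
          · intro c _ c' _ hcc
            rw [Function.onFun, disjoint_left]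
            intro z hz hz'
            exact hcc ((mem_filter.1 hz).2.symm.trans (mem_filter.1 hz').2)
        have u3 : ∑ q ∈ Q i, ((Th ×ˢ Th).filter (fun z => cls q z.1 = cls q z.2)).card ≤ n * t + n ^ 2 * κ := by
          simp only [card_filter]
          rw [sum_comm]
          simp only [← card_filter]
          have : ∀ z ∈ Th ×ˢ Th, ((Q i).filter (fun q => cls q z.1 = cls q z.2)).card ≤ (if z.1 = z.2 then t else 0) + κ := by
            intro z hz
            obtain ⟨hz1, hz2⟩ := mem_product.1 hz
            split_ifs with heq
            · refine (card_filter_le _ _).trans ?_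
              rw [hQ i hi]; omega
            · rw [zero_add]
              exact H4 i hi z.1 (hT (mem_filter.1 hz1).1) z.2 (hT (mem_filter.1 hz2).1) heq _ (filter_subset _ _) (by simp)
          refine (sum_le_sum this).trans ?_
          rw [sum_add_distrib, sum_const, card_product, smul_eq_mul, ← sq]
          apply Nat.add_le_add_right
          rw [sum_product]
          simp
          rfl
        have u4 : n * t ≤ n ^ 2 := by
          rw [sq]; exact Nat.mul_le_mul_left _ ((hτt i hi).trans hh)
        calc _ ≤ n * t + n ^ 2 * κ := u1.trans (u2.trans u3)
          _ ≤ n ^ 2 + n ^ 2 * κ := by omega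
          _ = _ := by ring
      have cs : (∑ p ∈ Rich, r p) ^ 2 ≤ Rich.card * ∑ p ∈ Rich, r p ^ 2 := sq_sum_le_card_mul_sum_sq
      have hnpos : 0 < n := lt_of_lt_of_le ht ((hτt i hi).trans hh)
      have f1 : (t * n) ^ 2 ≤ 4 * (mult h * (n ^ 2 * (1 + κ))) := by
        calc (t * n) ^ 2 ≤ (2 * ∑ p ∈ Rich, r p) ^ 2 := Nat.pow_le_pow_left low 2
          _ = 4 * (∑ p ∈ Rich, r p) ^ 2 := by ring
          _ ≤ 4 * (Rich.card * ∑ p ∈ Rich, r p ^ 2) := by gcongr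
          _ ≤ _ := by gcongr
      have f2 : n ^ 2 * t ^ 2 ≤ n ^ 2 * (4 * (1 + κ) * mult h) := by
        calc n ^ 2 * t ^ 2 = (t * n) ^ 2 := by ring
          _ ≤ _ := f1
          _ = _ := by ring
      have f3 : t ^ 2 ≤ 4 * (1 + κ) * mult h := Nat.le_of_mul_le_mul_left f2 (by positivity)
      exact Nat.le_of_mul_le_mul_left (hm.trans f3) (by positivity)
    refine ⟨L, hLcard, ha, ?_⟩
    set U := T.filter (fun x => ∀ h ∈ L, ¬ cov h x) with hU
    -- choose q
    have hQne : (Q i).Nonempty := by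
      rw [← card_pos, hQ i hi]; exact ht
    obtain ⟨q, hq, hqU⟩ : ∃ q ∈ Q i, 4 * (U.filter (fun x => ¬ good q x)).card ≤ U.card := by
      apply exists_le_of_sum_le hQne
      rw [sum_const, hQ i hi, ← mul_sum]
      simp only [card_filter (fun x => ¬ good _ x) U]
      rw [sum_comm, mul_sum, smul_eq_mul, mul_comm t, ← smul_eq_mul]
      apply sum_le_card_nsmul
      intro x hx
      rw [← card_filter]
      exact H3 i hi x (hT (mem_filter.1 hx).1) _ (filter_subset _ _) (by simp)
    have hg : U.card ≤ 2 * (U.filter (good q)).card := by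
      have := card_filter_add_card_filter_not (s := U) (good q)
      omega
    have hg2 : (U.filter (good q)).card ≤ Nq * (W i + G i * τ (i + 1)) := by
      rw [card_eq_sum_card_fiberwise (f := cls q) (t := cl q)]
      · refine (sum_le_card_nsmul _ _ (W i + G i * τ (i + 1)) ?_).trans ?_
        · intro c hc
          have hsub : ((U.filter (good q)).filter (fun x => cls q x = c)) ⊆
              ((Tc q c).filter (fun x => ∀ h ∈ LL q c, ¬ cov h x)) ∪
              ((LL q c).filter (fun h => h ∉ L)).biUnion (fun h => T.filter (cov h)) := by
            intro x hx
            simp only [mem_filter, hU] at hx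
            obtain ⟨⟨⟨hxT, hxL⟩, hxg⟩, hxc⟩ := hx
            by_cases hcov : ∀ h ∈ LL q c, ¬ cov h x
            · apply mem_union_left
              simp only [Tc, mem_filter]
              exact ⟨⟨hxT, hxg, hxc⟩, hcov⟩
            · push Not at hcov
              obtain ⟨h, hh1, hh2⟩ := hcov
              apply mem_union_right
              refine mem_biUnion.2 ⟨h, mem_filter.2 ⟨hh1, fun hL => hxL h hL hh2⟩, mem_filter.2 ⟨hxT, hh2⟩⟩
          refine (card_le_card hsub).trans ((card_union_le _ _).trans ?_)
          apply Nat.add_le_add (hL3 q hq c)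
          refine (card_biUnion_le_card_mul _ _ (τ (i + 1)) ?_).trans ?_
          · intro h hh
            by_contra hcon
            exact (mem_filter.1 hh).2 (ha h (le_of_lt (not_le.1 hcon)))
          · exact Nat.mul_le_mul_right _ ((card_filter_le _ _).trans (hL1 q hq c))
        · rw [smul_eq_mul]
          exact Nat.mul_le_mul_right _ (hcl q hq)
      · intro x hx
        simp only [coe_filter, Set.mem_setOf_eq, hU, mem_filter] at hx
        exact mem_image.2 ⟨x, mem_filter.2 ⟨hx.1.1, hx.2⟩, rfl⟩
    calc U.card ≤ 2 * (Nq * (W i + G i * τ (i + 1))) := by omega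
      _ = 2 * Nq * (W i + G i * τ (i + 1)) := by ring
      _ ≤ _ := hW i hi

end DG

namespace DG
open MvPolynomial

theorem taylor0 {R : Type*} [CommRing R] {r : ℕ} (f : MvPolynomial (Fin (r + 1)) R)
    (x : Fin r → R) (z t : R) :
    ∃ k, eval (Fin.cons (z + t) x) f = eval (Fin.cons z x : Fin (r+1) → R) f +
      t * eval (Fin.cons z x : Fin (r+1) → R) (pderiv 0 f) + t ^ 2 * k := by
  induction f using MvPolynomial.induction_on with
  | C a => exact ⟨0, by simp⟩
  | add p q hp hq =>
    obtain ⟨k, hk⟩ := hp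
    obtain ⟨l, hl⟩ := hq
    exact ⟨k + l, by simp only [map_add, hk, hl]; ring⟩
  | mul_X p i hp =>
    obtain ⟨k, hk⟩ := hp
    refine Fin.cases ?_ (fun i => ?_) i
    · refine ⟨k * (z + t) + eval (Fin.cons z x : Fin (r+1) → R) (pderiv 0 p), ?_⟩
      simp only [map_mul, hk, Derivation.leibniz, pderiv_X_self, eval_X, Fin.cons_zero, smul_eq_mul,
        map_add, map_one]
      ring
    · refine ⟨k * x i, ?_⟩
      simp only [map_mul, hk, Derivation.leibniz, eval_X, Fin.cons_succ, smul_eq_mul,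
        map_add]
      rw [pderiv_X_of_ne (Fin.succ_ne_zero i)]
      simp only [map_zero]
      ring

theorem eval_congr_dvd {R σ : Type*} [CommRing R] (ϖ : R) (f : MvPolynomial σ R)
    (p q : σ → R) (h : ∀ i, ϖ ∣ p i - q i) : ϖ ∣ eval p f - eval q f := by
  induction f using MvPolynomial.induction_on with
  | C a => simp
  | add a b ha hb =>
    simp only [map_add]
    have := dvd_add ha hb
    convert this using 1; ring
  | mul_X a i ha =>
    simp only [map_mul, eval_X]
    have : eval p a * p i - eval q a * q i = (eval p a - eval q a) * p i + eval q a * (p i - q i) := by ring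
    rw [this]
    exact dvd_add (ha.mul_right _) ((h i).mul_left _)

/-- local parametrization -/
theorem local_param {R : Type*} [CommRing R] {r e : ℕ} (ϖ : R) (hϖ : ϖ ^ e = 0)
    (f : MvPolynomial (Fin (r + 1)) R) (p0 : Fin (r + 1) → R)
    (hu : IsUnit (eval p0 (pderiv 0 f))) :
    ∃ φ : MvPolynomial (Fin r) R, ∀ p : Fin (r + 1) → R, (∀ i, ϖ ∣ p i - p0 i) → eval p f = 0 →
      p 0 = eval (fun j : Fin r => p j.succ - p0 j.succ) φ := by
  obtain ⟨l, hl⟩ := hu.exists_left_inv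
  let step : MvPolynomial (Fin r) R → MvPolynomial (Fin r) R := fun φ =>
    φ - C l * aeval (Fin.cons φ (fun j => C (p0 j.succ) + X j) : Fin (r+1) → MvPolynomial (Fin r) R) f
  let φ : ℕ → MvPolynomial (Fin r) R := fun n => step^[n] (C (p0 0))
  have key : ∀ p : Fin (r + 1) → R, (∀ i, ϖ ∣ p i - p0 i) → eval p f = 0 → ∀ n,
      ϖ ^ (n + 1) ∣ eval (fun j : Fin r => p j.succ - p0 j.succ) (φ n) - p 0 := by
    intro p hp hf n
    induction n with
    | zero =>
      simp only [φ, Function.iterate_zero, id, eval_C]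
      rw [zero_add, pow_one, ← dvd_neg]
      simpa using hp 0
    | succ n ih =>
      have hs : φ (n + 1) = step (φ n) := by
        simp only [φ, Function.iterate_succ_apply']
      rw [hs]
      set u : Fin r → R := fun j : Fin r => p j.succ - p0 j.succ with hu'
      set a := eval u (φ n) with ha
      have h1 : eval u (step (φ n)) = a - l * eval (Fin.cons a (fun j => p j.succ) : Fin (r+1) → R) f := by
        simp only [step, map_sub, map_mul, eval_C]
        congr 2
        have hcomp : (eval u : MvPolynomial (Fin r) R →+* R).comp
            (aeval (Fin.cons (φ n) (fun j => C (p0 j.succ) + X j) : Fin (r+1) → MvPolynomial (Fin r) R)).toRingHom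
            = eval (Fin.cons a (fun j => p j.succ) : Fin (r+1) → R) := by
          apply MvPolynomial.ringHom_ext
          · intro c; simp
          · intro i
            refine Fin.cases ?_ (fun i => ?_) i
            · simp [ha]
            · simp [hu']
        have := RingHom.congr_fun hcomp f
        simpa using this
      obtain ⟨k, hk⟩ := taylor0 f (fun j => p j.succ) (p 0) (a - p 0)
      have hc : (Fin.cons (p 0) (fun j => p j.succ) : Fin (r+1) → R) = p := Fin.cons_self_tail p
      rw [add_sub_cancel, hc, hf, zero_add] at hk
      rw [h1, hk]
      have h2 : a - l * ((a - p 0) * eval p (pderiv 0 f) + (a - p 0) ^ 2 * k) - p 0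
          = (a - p 0) * (1 - l * eval p (pderiv 0 f) - l * ((a - p 0) * k)) := by ring
      rw [h2, pow_succ]
      apply mul_dvd_mul ih
      have h3 : ϖ ∣ a - p 0 := (dvd_pow_self ϖ (Nat.succ_ne_zero n)).trans ih
      apply dvd_sub
      · have := eval_congr_dvd ϖ (pderiv 0 f) p p0 hp
        have h4 : 1 - l * eval p (pderiv 0 f) = - (l * (eval p (pderiv 0 f) - eval p0 (pderiv 0 f))) := by
          rw [mul_sub, hl]; ring
        rw [h4, dvd_neg]
        exact this.mul_left _
      · exact (h3.mul_right _).mul_left _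
  refine ⟨φ e, fun p hp hf => ?_⟩
  have := key p hp hf e
  rw [pow_succ, hϖ, zero_mul, zero_dvd_iff, sub_eq_zero] at this
  exact this.symm

/-- determinant of polynomial functions at points close to zero vanishes -/
theorem det_poly_zero {R : Type*} [CommRing R] {r e s : ℕ} (ϖ : R) (hϖ : ϖ ^ e = 0)
    (E K : ℕ) (hK : ∀ A : Finset (Fin r →₀ ℕ), ∑ β ∈ A, (E - β.degree) ≤ K)
    (hs : e + K ≤ s * E)
    (g : Fin s → MvPolynomial (Fin r) R) (v : Fin s → Fin r → R) :
    (Matrix.of fun j i => eval (fun l => ϖ * v i l) (g j)).det = 0 := by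
  classical
  let w : (Fin r →₀ ℕ) → Fin s → R := fun α i => ∏ l, (ϖ * v i l) ^ α l
  have hrow : (Matrix.of fun j i => eval (fun l => ϖ * v i l) (g j)) =
      Matrix.of (fun j => ∑ α ∈ (g j).support, coeff α (g j) • w α) := by
    ext j i
    simp only [Matrix.of_apply, Finset.sum_apply, Pi.smul_apply, smul_eq_mul, w]
    rw [eval_eq']
  rw [hrow]
  have := (Matrix.detRowAlternating (R := R) (n := Fin s)).toMultilinearMap.map_sum_finset
    (fun j α => coeff α (g j) • w α) (fun j => (g j).support)
  rw [show (Matrix.of (fun j => ∑ α ∈ (g j).support, coeff α (g j) • w α)).det =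
    (Matrix.detRowAlternating (R := R) (n := Fin s)).toMultilinearMap
      (fun j => ∑ α ∈ (g j).support, coeff α (g j) • w α) from rfl, this]
  apply Finset.sum_eq_zero
  intro a ha
  rw [MultilinearMap.map_smul_univ]
  by_cases hinj : Function.Injective a
  · have hw : ∀ α i, w α i = ϖ ^ α.degree * ∏ l, v i l ^ α l := by
      intro α i
      simp only [w, mul_pow, Finset.prod_mul_distrib, Finset.prod_pow_eq_pow_sum]
      congr 2
      rw [Finsupp.degree_eq_sum]
    have : (fun j => w (a j)) = fun j => (ϖ ^ (a j).degree) • (fun i => ∏ l, v i l ^ a j l) := by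
      ext j i
      simp [hw]
    rw [this, MultilinearMap.map_smul_univ, Finset.prod_pow_eq_pow_sum]
    have hle : e ≤ ∑ j, (a j).degree := by
      have h1 : ∑ j, (E - (a j).degree) ≤ K := by
        have := hK (Finset.univ.image a)
        rwa [Finset.sum_image (fun x _ y _ h => hinj h)] at this
      have h2 : s * E ≤ ∑ j, (E - (a j).degree) + ∑ j, (a j).degree := by
        rw [← Finset.sum_add_distrib]
        calc s * E = ∑ _j : Fin s, E := by simp
          _ ≤ _ := Finset.sum_le_sum (fun j _ => by omega)
      omega
    have hz : ϖ ^ (∑ j, (a j).degree) = 0 := by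
      rw [← Nat.sub_add_cancel hle, pow_add, hϖ, mul_zero]
    rw [hz, zero_smul, smul_zero]
  · have : (Matrix.detRowAlternating (R := R) (n := Fin s)).toMultilinearMap (fun j => w (a j)) = 0 := by
      rw [Function.Injective] at hinj
      push Not at hinj
      obtain ⟨i, j, hij, hne⟩ := hinj
      exact (Matrix.detRowAlternating (R := R) (n := Fin s)).map_eq_zero_of_eq _ (by rw [hij]) hne
    rw [this, smul_zero]

/-- combined local determinant lemma -/
theorem local_det {R : Type*} [CommRing R] {r e s : ℕ} (ϖ : R) (hϖ : ϖ ^ e = 0)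
    (E K : ℕ) (hK : ∀ A : Finset (Fin r →₀ ℕ), ∑ β ∈ A, (E - β.degree) ≤ K)
    (hs : e + K ≤ s * E)
    (f : MvPolynomial (Fin (r + 1)) R) (p0 : Fin (r + 1) → R)
    (hu : IsUnit (eval p0 (pderiv 0 f)))
    (g : Fin s → MvPolynomial (Fin (r + 1)) R) (p : Fin s → Fin (r + 1) → R)
    (hp : ∀ i j, ϖ ∣ p i j - p0 j) (hf : ∀ i, eval (p i) f = 0) :
    (Matrix.of fun j i => eval (p i) (g j)).det = 0 := by
  obtain ⟨φ, hφ⟩ := local_param ϖ hϖ f p0 hu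
  choose v hv using hp
  have := det_poly_zero ϖ hϖ E K hK hs
    (fun j => aeval (Fin.cons φ (fun l => C (p0 l.succ) + X l) : Fin (r+1) → MvPolynomial (Fin r) R) (g j))
    (fun i l => v i l.succ)
  rw [← this]
  congr 1
  ext j i
  simp only [Matrix.of_apply]
  have hcomp : (eval (fun l => ϖ * v i l.succ) : MvPolynomial (Fin r) R →+* R).comp
      (aeval (Fin.cons φ (fun l => C (p0 l.succ) + X l) : Fin (r+1) → MvPolynomial (Fin r) R)).toRingHom
      = eval (p i) := by
    apply MvPolynomial.ringHom_ext
    · intro c; simp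
    · intro l
      refine Fin.cases ?_ (fun l => ?_) l
      · have := hφ (p i) (fun l => ⟨v i l, hv i l⟩) (hf i)
        simp only [RingHom.comp_apply, AlgHom.toRingHom_eq_coe, RingHom.coe_coe, aeval_X, Fin.cons_zero, eval_X]
        rw [this]
        simp only [hv]
      · simp only [RingHom.comp_apply, AlgHom.toRingHom_eq_coe, RingHom.coe_coe, aeval_X, Fin.cons_succ, eval_X,
          map_add, eval_C]
        rw [← hv]; ring
  have := RingHom.congr_fun hcomp (g j)
  simpa using this.symm

theorem K_one (E : ℕ) (A : Finset (Fin 1 →₀ ℕ)) : ∑ β ∈ A, (E - β.degree) ≤ E * (E + 1) / 2 := by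
  have h1 : ∑ β ∈ A, (E - β.degree) = ∑ b ∈ A.image (fun β => β 0), (E - b) := by
    rw [Finset.sum_image]
    · apply Finset.sum_congr rfl
      intro β _
      simp [Finsupp.degree_eq_sum]
    · intro a _ b _ h
      refine Finsupp.ext fun i => ?_
      fin_cases i
      exact h
  rw [h1]
  have h2 : ∑ b ∈ A.image (fun β => β 0), (E - b) ≤ ∑ b ∈ Finset.range E, (E - b) := by
    apply Finset.sum_le_sum_of_ne_zero
    intro b _ hb
    simp; omega
  refine h2.trans ?_
  rw [← Finset.sum_range_reflect]
  have : ∀ n, (∑ j ∈ Finset.range n, (j + 1)) * 2 = n * (n + 1) := by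
    intro n
    induction n with
    | zero => simp
    | succ n ih => rw [Finset.sum_range_succ, add_mul, ih]; ring
  rw [Nat.le_div_iff_mul_le (by norm_num), ← this]
  apply Nat.mul_le_mul_right
  apply Finset.sum_le_sum
  intro j hj
  have := Finset.mem_range.1 hj
  omega

theorem K_two (E : ℕ) (A : Finset (Fin 2 →₀ ℕ)) : 6 * ∑ β ∈ A, (E - β.degree) ≤ E * (E + 1) * (E + 2) := by
  have h1 : ∑ β ∈ A, (E - β.degree) = ∑ b ∈ A.image (fun β => (β 0, β 1)), (E - (b.1 + b.2)) := by
    rw [Finset.sum_image]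
    · apply Finset.sum_congr rfl
      intro β _
      simp [Finsupp.degree_eq_sum]
    · intro a _ b _ h
      simp only [Prod.mk.injEq] at h
      ext i
      fin_cases i
      exacts [h.1, h.2]
  rw [h1]
  have h2 : ∑ b ∈ A.image (fun β => (β 0, β 1)), (E - (b.1 + b.2)) ≤
      ∑ b ∈ Finset.range E ×ˢ Finset.range E, (E - (b.1 + b.2)) := by
    apply Finset.sum_le_sum_of_ne_zero
    intro b _ hb
    simp; omega
  refine (Nat.mul_le_mul_left _ h2).trans ?_
  rw [Finset.sum_product]
  have h3 : ∀ n m, n ≤ m → (∑ j ∈ Finset.range m, (n - j)) * 2 = n * (n + 1) := by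
    intro n
    induction n with
    | zero => simp
    | succ n ih =>
      intro m hm
      obtain ⟨m, rfl⟩ : ∃ k, m = k + 1 := ⟨m - 1, by omega⟩
      rw [Finset.sum_range_succ']
      simp only [Nat.add_sub_add_right, add_mul, ih m (by omega)]
      simp; ring
  have h4 : ∀ n m, n ≤ m → (∑ i ∈ Finset.range n, ∑ j ∈ Finset.range m, (n - (i + j))) * 6 = n * (n + 1) * (n + 2) := by
    intro n
    induction n with
    | zero => simp
    | succ n ih =>
      intro m hm
      rw [Finset.sum_range_succ', add_mul]
      have : ∀ i j, n + 1 - (i + 1 + j) = n - (i + j) := by intros; omega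
      simp only [this, ih m (by omega), zero_add]
      have := h3 (n + 1) m hm
      linarith
  have := h4 E E le_rfl
  simp only at this ⊢
  linarith

end DG

namespace DG
open Module

theorem exists_rel_of_det {K T : Type*} [Field K] {s : ℕ} (F : Fin s → T → K)
    (h : ∀ t : Fin s → T, (Matrix.of fun j i => F j (t i)).det = 0) :
    ∃ a : Fin s → K, a ≠ 0 ∧ ∀ t, ∑ j, a j * F j t = 0 := by
  let col : T → (Fin s → K) := fun t j => F j t
  by_cases hlt : Submodule.span K (Set.range col) < ⊤
  · obtain ⟨φ, hφ, hle⟩ := Submodule.exists_le_ker_of_lt_top _ hlt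
    refine ⟨fun j => φ (Pi.single j 1), fun h0 => hφ ?_, fun t => ?_⟩
    · apply LinearMap.pi_ext'
      intro j
      ext
      simpa using congrFun h0 j
    · have h1 : φ (col t) = 0 := hle (Submodule.subset_span ⟨t, rfl⟩)
      rw [← h1]
      conv_rhs => rw [pi_eq_sum_univ' (col t)]
      rw [map_sum]
      apply Finset.sum_congr rfl
      intro j _
      rw [map_smul, smul_eq_mul, mul_comm]
  · exfalso
    have htop : Submodule.span K (Set.range col) = ⊤ := by
      by_contra hne; exact hlt (lt_top_iff_ne_top.2 hne)
    obtain ⟨f, hf1, hf2, hf3⟩ := Submodule.exists_fun_fin_finrank_span_eq K (Set.range col)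
    have hr : finrank K (Submodule.span K (Set.range col)) = s := by
      rw [htop, finrank_top]; simp
    choose t ht using hf1
    have hli : LinearIndependent K (fun i : Fin s => f (Fin.cast hr.symm i)) :=
      hf3.comp _ (Fin.cast_injective _)
    have hu : IsUnit (Matrix.of fun j i => F j (t (Fin.cast hr.symm i))) := by
      rw [← Matrix.linearIndependent_cols_iff_isUnit]
      convert hli using 1
      ext i j
      rw [← ht]
      rfl
    rw [Matrix.isUnit_iff_isUnit_det, h] at hu
    simp at hu

theorem exists_int_rel_of_det {T : Type*} {s : ℕ} (F : Fin s → T → ℤ)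
    (h : ∀ t : Fin s → T, (Matrix.of fun j i => F j (t i)).det = 0) :
    ∃ a : Fin s → ℤ, a ≠ 0 ∧ ∀ t, ∑ j, a j * F j t = 0 := by
  obtain ⟨a, ha, hr⟩ := exists_rel_of_det (K := ℚ) (fun j t => (F j t : ℚ)) (by
    intro t
    have := congrArg (Int.castRingHom ℚ) (h t)
    rw [RingHom.map_det] at this
    rw [map_zero] at this
    rw [← this]
    congr 1)
  obtain ⟨b, hb⟩ := IsLocalization.exist_integer_multiples_of_finset (nonZeroDivisors ℤ) (Finset.univ.image a)
  have hb' : ∀ j, ∃ c : ℤ, (c : ℚ) = (b : ℤ) * a j := by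
    intro j
    obtain ⟨c, hc⟩ := hb (a j) (Finset.mem_image_of_mem _ (Finset.mem_univ _))
    refine ⟨c, ?_⟩
    simpa [Algebra.smul_def] using hc
  choose c hc using hb'
  have hb0 : ((b : ℤ) : ℚ) ≠ 0 := by
    exact_mod_cast nonZeroDivisors.coe_ne_zero b
  refine ⟨c, fun h0 => ha ?_, fun t => ?_⟩
  · ext j
    have := hc j
    rw [h0] at this
    simp only [Pi.zero_apply, Int.cast_zero] at this
    rcases mul_eq_zero.1 this.symm with h1 | h1
    · exact absurd h1 hb0
    · exact h1
  · have : ((∑ j, c j * F j t : ℤ) : ℚ) = 0 := by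
      push_cast
      simp only [hc, mul_assoc]
      rw [← Finset.mul_sum, hr, mul_zero]
    exact_mod_cast this

theorem det_abs_le {s : ℕ} (A : Matrix (Fin s) (Fin s) ℤ) (w : Fin s → ℕ)
    (h : ∀ j i, |A j i| ≤ w j) : |A.det| ≤ (s.factorial : ℤ) * ∏ j, (w j : ℤ) := by
  rw [← Matrix.det_transpose, Matrix.det_apply]
  refine (Finset.abs_sum_le_sum_abs _ _).trans ?_
  have : ∀ σ ∈ (Finset.univ : Finset (Equiv.Perm (Fin s))),
      |Equiv.Perm.sign σ • ∏ i, A.transpose (σ i) i| ≤ ∏ j, (w j : ℤ) := by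
    intro σ _
    have h1 : |Equiv.Perm.sign σ • ∏ i, A.transpose (σ i) i| = |∏ i, A.transpose (σ i) i| := by
      rcases Int.units_eq_one_or (Equiv.Perm.sign σ) with h | h <;> rw [h] <;> simp
    rw [h1, Finset.abs_prod]
    exact Finset.prod_le_prod (fun i _ => abs_nonneg _) (fun i _ => h i (σ i))
  refine (Finset.sum_le_card_nsmul _ _ _ this).trans ?_
  rw [Finset.card_univ, Fintype.card_perm, Fintype.card_fin, nsmul_eq_mul]

theorem det_zero_of_dvd {s : ℕ} (A : Matrix (Fin s) (Fin s) ℤ) (w : Fin s → ℕ)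
    (h : ∀ j i, |A j i| ≤ w j) (M : ℕ) (hM : (M : ℤ) ∣ A.det)
    (hlt : s.factorial * ∏ j, w j < M) : A.det = 0 := by
  apply Int.eq_zero_of_abs_lt_dvd hM
  refine (det_abs_le A w h).trans_lt ?_
  exact_mod_cast hlt

section
attribute [local instance] Matrix.seminormedAddCommGroup

/-- Bounded integer relation (Siegel). -/
theorem bounded_rel {ι T : Type*} [Fintype ι] (F : ι → T → ℤ) (W : ℕ) (hW : 1 ≤ W)
    (hF : ∀ i t, |F i t| ≤ W) (a : ι → ℤ) (ha : a ≠ 0) (hr : ∀ t, ∑ j, a j * F j t = 0) :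
    ∃ a' : ι → ℤ, a' ≠ 0 ∧ (∀ t, ∑ j, a' j * F j t = 0) ∧
      ∀ j, |a' j| ≤ ((Fintype.card ι * W) ^ Fintype.card ι : ℕ) := by
  classical
  have hne : Nonempty ι := by
    by_contra hcon
    rw [not_nonempty_iff] at hcon
    exact ha (Subsingleton.elim _ _)
  have hcard : 1 ≤ Fintype.card ι := Fintype.card_pos
  let col : T → (ι → ℚ) := fun t j => (F j t : ℚ)
  obtain ⟨f, hf1, hf2, hf3⟩ := Submodule.exists_fun_fin_finrank_span_eq ℚ (Set.range col)
  set ρ := finrank ℚ (Submodule.span ℚ (Set.range col)) with hρ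
  have hlt : ρ < Fintype.card ι := by
    rw [hρ, ← Module.finrank_fintype_fun_eq_card (R := ℚ) (η := ι)]
    apply Submodule.finrank_lt
    intro htop
    let φ : (ι → ℚ) →ₗ[ℚ] ℚ := ∑ j, (a j : ℚ) • LinearMap.proj j
    have hle : Submodule.span ℚ (Set.range col) ≤ LinearMap.ker φ := by
      rw [Submodule.span_le]
      rintro _ ⟨t, rfl⟩
      simp only [SetLike.mem_coe, LinearMap.mem_ker, φ, LinearMap.sum_apply, LinearMap.smul_apply,
        LinearMap.proj_apply, smul_eq_mul, col]
      exact_mod_cast hr t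
    rw [htop] at hle
    apply ha
    ext j
    have h1 : φ (Pi.single j 1) = 0 := hle (Submodule.mem_top)
    simp only [φ, LinearMap.sum_apply, LinearMap.smul_apply, LinearMap.proj_apply, smul_eq_mul] at h1
    rw [Finset.sum_eq_single j] at h1
    · simpa using h1
    · intro b _ hb; simp [hb]
    · simp
  choose t ht using hf1
  -- every column is in the span
  have spanrel : ∀ a' : ι → ℤ, (∀ i, ∑ j, a' j * F j (t i) = 0) → ∀ t', ∑ j, a' j * F j t' = 0 := by
    intro a' h t'
    let φ : (ι → ℚ) →ₗ[ℚ] ℚ := ∑ j, (a' j : ℚ) • LinearMap.proj j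
    have hφ : ∀ t, φ (col t) = ((∑ j, a' j * F j t : ℤ) : ℚ) := by
      intro t
      simp [φ, LinearMap.sum_apply, col]
    have hle : Submodule.span ℚ (Set.range col) ≤ LinearMap.ker φ := by
      rw [← hf2, Submodule.span_le]
      rintro _ ⟨i, rfl⟩
      rw [SetLike.mem_coe, LinearMap.mem_ker, ← ht, hφ, h]
      simp
    have h1 : φ (col t') = 0 := hle (Submodule.subset_span ⟨t', rfl⟩)
    rw [hφ] at h1
    exact_mod_cast h1
  have hbig : 1 ≤ (Fintype.card ι * W) ^ Fintype.card ι :=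
    Nat.one_le_pow _ _ (Nat.mul_pos hcard hW)
  rcases Nat.eq_zero_or_pos ρ with h0 | hpos
  · refine ⟨fun _ => 1, ?_, ?_, ?_⟩
    · intro h
      have := congrFun h hne.some
      simp at this
    · apply spanrel
      intro i
      exact absurd i.2 (by omega)
    · intro j
      rw [abs_one]
      exact_mod_cast hbig
  · let A : Matrix (Fin ρ) ι ℤ := fun i j => F j (t i)
    obtain ⟨x, hx, hAx, hn⟩ := Int.Matrix.exists_ne_zero_int_vec_norm_le A (by simpa using hlt) (by simpa using hpos)
    refine ⟨x, hx, ?_, ?_⟩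
    · apply spanrel
      intro i
      have := congrFun hAx i
      simp only [Matrix.mulVec, dotProduct, A, Pi.zero_apply] at this
      rw [← this]
      exact Finset.sum_congr rfl (fun j _ => mul_comm _ _)
    · intro j
      have h1 : ‖x j‖ ≤ ‖x‖ := norm_le_pi_norm x j
      have h2 : max 1 ‖A‖ ≤ W := by
        apply max_le
        · exact_mod_cast hW
        · change ‖(A : Matrix (Fin ρ) ι ℤ)‖ ≤ W
          rw [Matrix.norm_le_iff (by positivity)]
          intro i j
          rw [Int.norm_eq_abs]
          exact_mod_cast hF j (t i)
      rw [Fintype.card_fin] at hn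
      have h3 : ‖x‖ ≤ ((Fintype.card ι : ℝ) * W) ^ (Fintype.card ι : ℝ) := by
        refine hn.trans ?_
        have hb1 : (1 : ℝ) ≤ (Fintype.card ι : ℝ) * W := by
          have : 1 ≤ Fintype.card ι * W := Nat.mul_pos hcard hW
          exact_mod_cast this
        have hgap : (1 : ℝ) ≤ (Fintype.card ι : ℝ) - ρ := by
          have : ρ + 1 ≤ Fintype.card ι := hlt
          have : (ρ : ℝ) + 1 ≤ Fintype.card ι := by exact_mod_cast this
          linarith
        have hexp0 : (0 : ℝ) ≤ (ρ : ℝ) / ((Fintype.card ι : ℝ) - ρ) := by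
          apply div_nonneg (by positivity) (by linarith)
        have hexp : (ρ : ℝ) / ((Fintype.card ι : ℝ) - ρ) ≤ Fintype.card ι := by
          rw [div_le_iff₀ (by linarith)]
          have : (ρ : ℝ) ≤ Fintype.card ι := by exact_mod_cast hlt.le
          nlinarith
        calc _ ≤ ((Fintype.card ι : ℝ) * W) ^ ((ρ : ℝ) / ((Fintype.card ι : ℝ) - ρ)) := by
              apply Real.rpow_le_rpow (by positivity) _ hexp0
              gcongr
          _ ≤ _ := Real.rpow_le_rpow_of_exponent_le hb1 hexp
      rw [Real.rpow_natCast] at h3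
      have h4 := h1.trans h3
      rw [Int.norm_eq_abs] at h4
      have h5 : ((|x j| : ℤ) : ℝ) ≤ (((Fintype.card ι * W) ^ Fintype.card ι : ℕ) : ℝ) := by
        push_cast
        exact h4
      exact_mod_cast h5

end

end DG

namespace DG
open Nat

theorem log_le_two_sqrt (x : ℝ) (hx : 0 < x) : Real.log x ≤ 2 * Real.sqrt x := by
  have h : Real.log x = 2 * Real.log (Real.sqrt x) := by
    rw [Real.log_sqrt hx.le]; ring
  rw [h]
  have := Real.log_le_sub_one_of_pos (Real.sqrt_pos.2 hx)
  linarith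

theorem many_primes (m c b : ℕ) (hm : 1 ≤ m) (hc : 1 ≤ c) (hb : 16 * (m + 1) ^ 2 * (c + 1) ^ 2 ≤ b) :
    c * b ^ m ≤ ((Finset.Ioc (b ^ m) (b ^ (m + 1))).filter Nat.Prime).card := by
  set N := b ^ (m + 1) with hN
  have hb256 : 256 ≤ b := by
    refine le_trans ?_ hb
    have h1 : 2 ^ 2 ≤ (m + 1) ^ 2 := Nat.pow_le_pow_left (by omega) 2
    have h2 : 2 ^ 2 ≤ (c + 1) ^ 2 := Nat.pow_le_pow_left (by omega) 2
    have := Nat.mul_le_mul h1 h2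
    nlinarith
  have hNb : b ≤ N := by
    rw [hN]; exact Nat.le_self_pow (by omega) b
  have hpi := Chebyshev.pi_ge N
  have key : ((c + 1) * b ^ m : ℕ) ≤ Nat.primeCounting N := by
    have hb0 : (0 : ℝ) < b := by positivity
    have hlogN : Real.log N = (m + 1) * Real.log b := by
      rw [hN]; push_cast; rw [Real.log_pow]; push_cast; ring
    have hNR : (256 : ℝ) ≤ N := by exact_mod_cast hb256.trans hNb
    have hlogpos : 0 < Real.log N := Real.log_pos (by linarith)
    have h1 : (N : ℝ) / 2 ≤ N * Real.log 2 - Real.log (N + 1) := by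
      have e1 := log_le_two_sqrt ((N : ℝ) + 1) (by positivity)
      have e2 := Real.log_two_gt_d9
      have e3 : Real.sqrt ((N : ℝ) + 1) ≤ (N : ℝ) / 16 + 1 / 2 := by
        rw [Real.sqrt_le_left (by positivity)]
        nlinarith
      nlinarith
    have h2 : Real.log N ≤ 2 * (m + 1) * Real.sqrt b := by
      rw [hlogN]
      have := log_le_two_sqrt b hb0
      have hm0 : (0 : ℝ) ≤ (m : ℝ) + 1 := by positivity
      nlinarith
    have h3 : 4 * ((m : ℝ) + 1) * (c + 1) ≤ Real.sqrt b := by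
      apply Real.le_sqrt_of_sq_le
      have : ((16 * (m + 1) ^ 2 * (c + 1) ^ 2 : ℕ) : ℝ) ≤ b := by exact_mod_cast hb
      push_cast at this
      nlinarith
    have h4 : (((c + 1) * b ^ m : ℕ) : ℝ) ≤ (N * Real.log 2 - Real.log (N + 1)) / Real.log N := by
      rw [le_div_iff₀ hlogpos]
      refine le_trans ?_ h1
      push_cast
      have hs : Real.sqrt b * Real.sqrt b = b := Real.mul_self_sqrt hb0.le
      have hNeq : (N : ℝ) = b ^ m * b := by rw [hN]; push_cast; ring
      have hbm : (0 : ℝ) < (b : ℝ) ^ m := by positivity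
      have hsq : 0 ≤ Real.sqrt b := Real.sqrt_nonneg _
      calc ((c : ℝ) + 1) * b ^ m * Real.log N ≤ ((c : ℝ) + 1) * b ^ m * (2 * (m + 1) * Real.sqrt b) := by gcongr
        _ = b ^ m * ((4 * ((m : ℝ) + 1) * (c + 1)) * Real.sqrt b) / 2 := by ring
        _ ≤ b ^ m * (Real.sqrt b * Real.sqrt b) / 2 := by gcongr
        _ = N / 2 := by rw [hs, hNeq]
    exact_mod_cast h4.trans hpi
  have h5 : Nat.primeCounting N ≤ ((Finset.Ioc (b ^ m) N).filter Nat.Prime).card + b ^ m := by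
    rw [Nat.primeCounting, Nat.primeCounting', Nat.count_eq_card_filter_range]
    have : (Finset.range (N + 1)).filter Nat.Prime ⊆
        ((Finset.Ioc (b ^ m) N).filter Nat.Prime) ∪ (Finset.Ioc 0 (b ^ m)) := by
      intro p hp
      simp only [Finset.mem_filter, Finset.mem_range, Finset.mem_union, Finset.mem_Ioc] at hp ⊢
      have := hp.2.pos
      by_cases h : p ≤ b ^ m
      · right; exact ⟨this, h⟩
      · left; exact ⟨⟨by omega, by omega⟩, hp.2⟩
    refine (Finset.card_le_card this).trans ((Finset.card_union_le _ _).trans ?_)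
    simp
  have h6 : (c + 1) * b ^ m = c * b ^ m + b ^ m := by ring
  omega

end DG

namespace DG
open MvPolynomial
open scoped Finset

theorem finSucc_rename {R : Type*} [CommRing R] {r : ℕ} (a : MvPolynomial (Fin r) R) :
    finSuccEquiv R r (rename Fin.succ a) = Polynomial.C a := by
  induction a using MvPolynomial.induction_on with
  | C c => simp [finSuccEquiv_apply]
  | add p q hp hq => simp [hp, hq]
  | mul_X p i hp => simp only [map_mul, hp, rename_X, finSuccEquiv_X_succ]

theorem totalDegree_coeff_le {R : Type*} [CommRing R] {r : ℕ} (f : MvPolynomial (Fin (r+1)) R) (i : ℕ) :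
    ((finSuccEquiv R r f).coeff i).totalDegree ≤ f.totalDegree := by
  by_cases h : (finSuccEquiv R r f).coeff i = 0
  · simp [h]
  · have := totalDegree_coeff_finSuccEquiv_add_le f i h
    omega

theorem totalDegree_det_le {R : Type*} [CommRing R] {σ n : Type*} [Fintype n] [DecidableEq n]
    (A : Matrix n n (MvPolynomial σ R)) (D : ℕ) (h : ∀ i j, (A i j).totalDegree ≤ D) :
    A.det.totalDegree ≤ Fintype.card n * D := by
  rw [Matrix.det_apply]
  apply totalDegree_finsetSum_le
  intro s _
  have h1 : (Equiv.Perm.sign s • ∏ i, A (s i) i).totalDegree ≤ (∏ i, A (s i) i).totalDegree := by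
    rcases Int.units_eq_one_or (Equiv.Perm.sign s) with h | h <;> rw [h] <;> simp
  refine h1.trans ((totalDegree_finsetProd _ _).trans ?_)
  refine (Finset.sum_le_card_nsmul _ _ D (fun i _ => h _ _)).trans ?_
  simp

theorem elim {K : Type*} [Field K] {r : ℕ} (f g : MvPolynomial (Fin (r + 1)) K)
    (hf : Irreducible f) (hfg : ¬ f ∣ g) :
    ∃ r0 : MvPolynomial (Fin r) K, r0 ≠ 0 ∧ r0.totalDegree ≤ (f.totalDegree + g.totalDegree) ^ 2 ∧
      ∃ A B, A * f + B * g = rename Fin.succ r0 := by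
  set F := finSuccEquiv K r f with hF
  set G := finSuccEquiv K r g with hG
  by_cases hd : F.natDegree = 0
  · have hFC := Polynomial.eq_C_of_natDegree_eq_zero hd
    have hfr : f = rename Fin.succ (F.coeff 0) := by
      apply (finSuccEquiv K r).injective
      rw [finSucc_rename, ← hFC]
    refine ⟨F.coeff 0, ?_, ?_, 1, 0, ?_⟩
    · intro h0
      rw [h0, map_zero] at hfr
      exact hf.ne_zero hfr
    · refine (totalDegree_coeff_le f 0).trans ?_
      nlinarith [Nat.zero_le g.totalDegree, Nat.zero_le f.totalDegree, Nat.le_self_pow (two_ne_zero) (f.totalDegree + g.totalDegree)]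
    · rw [← hfr]; simp
  · have hirr : Irreducible F := (MulEquiv.irreducible_iff (finSuccEquiv K r)).2 hf
    have hFG : ¬ F ∣ G := fun h => hfg ((map_dvd_iff (finSuccEquiv K r)).1 h)
    have hprim := hirr.isPrimitive hd
    let k := FractionRing (MvPolynomial (Fin r) K)
    have hirr' : Irreducible (F.map (algebraMap _ k)) :=
      (hprim.irreducible_iff_irreducible_map_fraction_map).1 hirr
    have hnd : ¬ F.map (algebraMap _ k) ∣ G.map (algebraMap _ k) := by
      rintro ⟨Q, hQ⟩
      obtain ⟨b, hb, hb'⟩ := IsLocalization.integerNormalization_spec (nonZeroDivisors (MvPolynomial (Fin r) K)) Q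
      set Q' := IsLocalization.integerNormalization (nonZeroDivisors (MvPolynomial (Fin r) K)) Q
      have h1 : F ∣ Polynomial.C b * G := by
        refine ⟨Q', ?_⟩
        apply Polynomial.map_injective (algebraMap _ k) (IsFractionRing.injective _ k)
        rw [Polynomial.map_mul, Polynomial.map_mul, hQ, hb', Polynomial.map_C, Algebra.smul_def,
          Polynomial.algebraMap_apply]
        ring
      have hp : Prime F := UniqueFactorizationMonoid.irreducible_iff_prime.1 hirr
      rcases hp.dvd_or_dvd h1 with h2 | h2
      · have hb0 : Polynomial.C b ≠ 0 := Polynomial.C_ne_zero.2 (nonZeroDivisors.ne_zero hb)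
        have := Polynomial.natDegree_le_of_dvd h2 hb0
        rw [Polynomial.natDegree_C] at this
        omega
      · exact hFG h2
    have hcop : IsCoprime (F.map (algebraMap _ k)) (G.map (algebraMap _ k)) :=
      (hirr'.coprime_iff_not_dvd).2 hnd
    have hres : F.resultant G ≠ 0 := by
      intro h0
      have h1 := Polynomial.resultant_ne_zero _ _ hcop
      apply h1
      rw [Polynomial.natDegree_map_eq_of_injective (IsFractionRing.injective _ k),
        Polynomial.natDegree_map_eq_of_injective (IsFractionRing.injective _ k),
        Polynomial.resultant_map_map, h0, map_zero]
    refine ⟨F.resultant G, hres, ?_, ?_⟩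
    · rw [Polynomial.resultant]
      refine (totalDegree_det_le _ (f.totalDegree + g.totalDegree) ?_).trans ?_
      · intro i j
        rw [Polynomial.sylvester, Matrix.of_apply]
        refine Fin.addCases (fun j => ?_) (fun j => ?_) j
        · rw [Fin.addCases_left]
          split_ifs
          · exact (totalDegree_coeff_le g _).trans (by omega)
          · simp
        · rw [Fin.addCases_right]
          split_ifs
          · exact (totalDegree_coeff_le f _).trans (by omega)
          · simp
      · rw [Fintype.card_fin, sq]
        apply Nat.mul_le_mul_right
        rw [hF, hG, natDegree_finSuccEquiv, natDegree_finSuccEquiv]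
        exact Nat.add_le_add (degreeOf_le_totalDegree _ _) (degreeOf_le_totalDegree _ _)
    · obtain ⟨p, q, -, -, hpq⟩ := Polynomial.exists_mul_add_mul_eq_C_resultant F G le_rfl le_rfl (Or.inl hd)
      refine ⟨(finSuccEquiv K r).symm p, (finSuccEquiv K r).symm q, ?_⟩
      apply (finSuccEquiv K r).injective
      rw [finSucc_rename, ← hpq]
      simp [mul_comm]
      rfl

theorem eval_rename_succ {K : Type*} [CommRing K] {r : ℕ} (a : MvPolynomial (Fin r) K) (p : Fin (r+1) → K) :
    eval p (rename Fin.succ a) = eval (fun i => p i.succ) a := by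
  rw [eval_rename]; rfl

theorem elim_eval {K : Type*} [Field K] {r : ℕ} (f g : MvPolynomial (Fin (r + 1)) K)
    (hf : Irreducible f) (hfg : ¬ f ∣ g) :
    ∃ r0 : MvPolynomial (Fin r) K, r0 ≠ 0 ∧ r0.totalDegree ≤ (f.totalDegree + g.totalDegree) ^ 2 ∧
      ∀ p : Fin (r+1) → K, eval p f = 0 → eval p g = 0 → eval (fun i => p i.succ) r0 = 0 := by
  obtain ⟨r0, h1, h2, A, B, h3⟩ := elim f g hf hfg
  refine ⟨r0, h1, h2, fun p hp hq => ?_⟩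
  rw [← eval_rename_succ, ← h3]
  simp [hp, hq]

/-- zeros of a nonzero one variable MvPolynomial -/
theorem card_zeros_one {K : Type*} [Field K] (a : MvPolynomial (Fin 1) K) (ha : a ≠ 0)
    (S : Finset K) (hS : ∀ x ∈ S, eval (fun _ => x) a = 0) : S.card ≤ a.totalDegree := by
  classical
  have h := schwartz_zippel_totalDegree ha S
  have h2 : S.card ≤ #{f ∈ Fintype.piFinset fun (_ : Fin 1) => S | (eval f) a = 0} := by
    apply Finset.card_le_card_of_injOn (fun x _ => x)
    · intro x hx
      simp only [Finset.coe_filter, Fintype.mem_piFinset, Set.mem_ofPred_eq]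
      exact ⟨fun _ => hx, hS x hx⟩
    · intro x _ y _ hxy
      exact congrFun hxy 0
  rcases Nat.eq_zero_or_pos S.card with h0 | hpos
  · omega
  · rw [pow_one, div_le_div_iff_of_pos_right (by exact_mod_cast hpos)] at h
    exact h2.trans (by exact_mod_cast h)

theorem bezout {K : Type*} [Field K] (h g : MvPolynomial (Fin 2) K) (hh : Irreducible h) (hg : ¬ h ∣ g)
    (S : Finset (Fin 2 → K)) (hS : ∀ p ∈ S, eval p h = 0 ∧ eval p g = 0) :
    S.card ≤ (h.totalDegree + g.totalDegree) ^ 4 := by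
  classical
  obtain ⟨r0, h1, h2, h3⟩ := elim_eval h g hh hg
  let e : Fin 2 ≃ Fin 2 := Equiv.swap 0 1
  have tdr : ∀ q : MvPolynomial (Fin 2) K, (rename e q).totalDegree = q.totalDegree := by
    intro q
    exact totalDegree_renameEquiv e q
  have hh' : Irreducible (rename e h) := (MulEquiv.irreducible_iff (renameEquiv K e)).2 hh
  have hg' : ¬ (rename e h) ∣ rename e g := fun hd => hg ((map_dvd_iff (renameEquiv K e)).1 hd)
  obtain ⟨s0, k1, k2, k3⟩ := elim_eval (rename e h) (rename e g) hh' hg'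
  rw [tdr, tdr] at k2
  have A1 : (S.image (fun p => p 1)).card ≤ (h.totalDegree + g.totalDegree) ^ 2 := by
    refine (card_zeros_one r0 h1 _ ?_).trans h2
    intro x hx
    obtain ⟨p, hp, rfl⟩ := Finset.mem_image.1 hx
    have := h3 p (hS p hp).1 (hS p hp).2
    rw [← this]
    congr 2
    ext j
    obtain rfl : j = 0 := Subsingleton.elim _ _
    rfl
  have A2 : (S.image (fun p => p 0)).card ≤ (h.totalDegree + g.totalDegree) ^ 2 := by
    refine (card_zeros_one s0 k1 _ ?_).trans k2
    intro x hx
    obtain ⟨p, hp, rfl⟩ := Finset.mem_image.1 hx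
    have hpe : (p ∘ e) ∘ e = p := by
      ext i; simp [e]
    have := k3 (p ∘ e) (by rw [eval_rename, hpe]; exact (hS p hp).1) (by rw [eval_rename, hpe]; exact (hS p hp).2)
    rw [← this]
    congr 2
    ext j
    obtain rfl : j = 0 := Subsingleton.elim _ _
    rfl
  have : S.card ≤ ((S.image (fun p => p 0)) ×ˢ (S.image (fun p => p 1))).card := by
    apply Finset.card_le_card_of_injOn (fun p => (p 0, p 1))
    · intro p hp
      simp only [Finset.coe_product, Set.mem_prod, Finset.mem_coe, Finset.mem_image]
      exact ⟨⟨p, hp, rfl⟩, ⟨p, hp, rfl⟩⟩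
    · intro p _ q _ hpq
      simp only [Prod.mk.injEq] at hpq
      ext i
      fin_cases i
      exacts [hpq.1, hpq.2]
  rw [Finset.card_product] at this
  calc S.card ≤ _ := this
    _ ≤ (h.totalDegree + g.totalDegree) ^ 2 * (h.totalDegree + g.totalDegree) ^ 2 := Nat.mul_le_mul A2 A1
    _ = _ := by ring

/-- box -/
theorem card_zeros_box {K : Type*} [Field K] [CharZero K] {r : ℕ} (a : MvPolynomial (Fin (r + 1)) K) (ha : a ≠ 0) (B : ℕ)
    (S : Finset (Fin (r + 1) → ℤ)) (hS : ∀ x ∈ S, (∀ i, |x i| ≤ B) ∧ eval (fun i => (x i : K)) a = 0) :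
    S.card ≤ a.totalDegree * (2 * B + 1) ^ r := by
  classical
  let I : Finset K := (Finset.Icc (-(B:ℤ)) B).image (Int.cast : ℤ → K)
  have hI : I.card = 2 * B + 1 := by
    rw [Finset.card_image_of_injective _ Int.cast_injective, Int.card_Icc]
    omega
  have h := schwartz_zippel_totalDegree ha I
  have h2 : S.card ≤ #{f ∈ Fintype.piFinset fun (_ : Fin (r+1)) => I | (eval f) a = 0} := by
    apply Finset.card_le_card_of_injOn (fun x i => (x i : K))
    · intro x hx
      simp only [Finset.coe_filter, Fintype.mem_piFinset, Set.mem_ofPred_eq]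
      refine ⟨fun i => Finset.mem_image_of_mem _ ?_, (hS x hx).2⟩
      rw [Finset.mem_Icc, ← abs_le]
      exact (hS x hx).1 i
    · intro x _ y _ hxy
      ext i
      exact Int.cast_injective (α := K) (congrFun hxy i)
  refine h2.trans ?_
  rw [hI, div_le_div_iff₀ (by positivity) (by positivity)] at h
  have h4 : #{f ∈ Fintype.piFinset fun (_ : Fin (r+1)) => I | (eval f) a = 0} * (2 * B + 1) ≤ a.totalDegree * (2 * B + 1) ^ (r+1) := by
    exact_mod_cast h
  rw [pow_succ, ← mul_assoc] at h4
  exact Nat.le_of_mul_le_mul_right h4 (by omega)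

/-- top coefficient in variable 0 -/
theorem coeff_top {K : Type*} [CommRing K] {r d : ℕ} (f : MvPolynomial (Fin (r + 1)) K) (hd : f.totalDegree ≤ d) :
    (finSuccEquiv K r f).coeff d = C (coeff (Finsupp.single 0 d) f) := by
  have h0 : ((finSuccEquiv K r f).coeff d).totalDegree = 0 := by
    by_cases h : (finSuccEquiv K r f).coeff d = 0
    · simp [h]
    · have := totalDegree_coeff_finSuccEquiv_add_le f d h
      omega
  rw [totalDegree_eq_zero_iff_eq_C.1 h0]
  congr 1
  rw [finSuccEquiv_coeff_coeff]
  congr 1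
  ext i
  refine Fin.cases ?_ (fun i => ?_) i
  · simp
  · simp

/-- number of roots z above a given base point -/
theorem card_fiber {K : Type*} [Field K] {r d : ℕ} (f : MvPolynomial (Fin (r + 1)) K)
    (hd : f.totalDegree ≤ d) (hc : coeff (Finsupp.single 0 d) f ≠ 0) (x : Fin r → K) (S : Finset K)
    (hS : ∀ z ∈ S, eval (Fin.cons z x : Fin (r+1) → K) f = 0) : S.card ≤ d := by
  classical
  set P := Polynomial.map (eval x) (finSuccEquiv K r f) with hP
  have hcd : P.coeff d = coeff (Finsupp.single 0 d) f := by
    rw [hP, Polynomial.coeff_map, coeff_top f hd, eval_C]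
  have hP0 : P ≠ 0 := by
    intro h0
    rw [h0] at hcd
    exact hc (by simpa using hcd.symm)
  have hsub : S ⊆ P.roots.toFinset := by
    intro z hz
    rw [Multiset.mem_toFinset, Polynomial.mem_roots hP0, Polynomial.IsRoot, hP, ← eval_eq_eval_mv_eval']
    exact hS z hz
  refine (Finset.card_le_card hsub).trans ((Multiset.toFinset_card_le _).trans ((Polynomial.card_roots' _).trans ?_))
  refine Polynomial.natDegree_map_le.trans ?_
  rw [natDegree_finSuccEquiv]
  exact (degreeOf_le_totalDegree _ _).trans hd

theorem card_le_fiber {K : Type*} [Field K] [CharZero K] {r d : ℕ} (f : MvPolynomial (Fin (r + 1)) K)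
    (hd : f.totalDegree ≤ d) (hc : coeff (Finsupp.single 0 d) f ≠ 0)
    (S : Finset (Fin (r + 1) → ℤ)) (hS : ∀ x ∈ S, eval (fun i => (x i : K)) f = 0) :
    S.card ≤ d * (S.image (fun x (i : Fin r) => x i.succ)).card := by
  classical
  apply Finset.card_le_mul_card_image_of_maps_to (fun x hx => Finset.mem_image_of_mem _ hx)
  intro b hb
  have := card_fiber f hd hc (fun i => (b i : K))
    ((S.filter (fun x => (fun i : Fin r => x i.succ) = b)).image (fun x => (x 0 : K))) (by
      intro z hz
      obtain ⟨x, hx, rfl⟩ := Finset.mem_image.1 hz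
      obtain ⟨hx1, hx2⟩ := Finset.mem_filter.1 hx
      have := hS x hx1
      convert this using 2
      congr 1
      ext i
      refine Fin.cases ?_ (fun i => ?_) i
      · simp
      · simp [← hx2])
  rwa [Finset.card_image_of_injOn] at this
  intro x hx y hy hxy
  simp only [Finset.coe_filter, Set.mem_ofPred_eq] at hx hy
  ext i
  refine Fin.cases ?_ (fun i => ?_) i
  · exact Int.cast_injective (α := K) hxy
  · exact congrFun (hx.2.trans hy.2.symm) i

/-- codimension two count -/
theorem codim_two {K : Type*} [Field K] [CharZero K] {r d : ℕ} (f g : MvPolynomial (Fin (r + 2)) K)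
    (hd : f.totalDegree ≤ d) (hc : coeff (Finsupp.single 0 d) f ≠ 0)
    (hf : Irreducible f) (hfg : ¬ f ∣ g) (B : ℕ)
    (S : Finset (Fin (r + 2) → ℤ)) (hS : ∀ x ∈ S, (∀ i, |x i| ≤ B) ∧ eval (fun i => (x i : K)) f = 0
      ∧ eval (fun i => (x i : K)) g = 0) :
    S.card ≤ d * ((d + g.totalDegree) ^ 2 * (2 * B + 1) ^ r) := by
  classical
  obtain ⟨r0, h1, h2, h3⟩ := elim_eval f g hf hfg
  refine (card_le_fiber f hd hc S (fun x hx => (hS x hx).2.1)).trans ?_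
  apply Nat.mul_le_mul_left
  refine (card_zeros_box r0 h1 B _ ?_).trans ?_
  · intro x hx
    obtain ⟨y, hy, rfl⟩ := Finset.mem_image.1 hx
    exact ⟨fun i => (hS y hy).1 _, h3 (fun i => (y i : K)) (hS y hy).2.1 (hS y hy).2.2⟩
  · apply Nat.mul_le_mul_right
    exact h2.trans (Nat.pow_le_pow_left (by omega) 2)

end DG

namespace DG
open MvPolynomial

theorem aux_general {T : Type*} {r s e E K : ℕ}
    (hK : ∀ A : Finset (Fin r →₀ ℕ), ∑ β ∈ A, (E - β.degree) ≤ K)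
    (hs : e + K ≤ s * E) (F : Fin s → T → ℤ) (w : Fin s → ℕ) (hw : ∀ j t, |F j t| ≤ w j)
    (P : Finset ℕ) (hP : ∀ q ∈ P, q.Prime) (hlt : s.factorial * ∏ j, w j < ∏ q ∈ P, q ^ e)
    (hloc : ∀ q ∈ P, ∃ (f : MvPolynomial (Fin (r + 1)) (ZMod (q ^ e))) (p0 : Fin (r + 1) → ZMod (q ^ e))
      (g : Fin s → MvPolynomial (Fin (r + 1)) (ZMod (q ^ e))) (p : T → Fin (r + 1) → ZMod (q ^ e))
      (c : T → ZMod (q ^ e)), IsUnit (eval p0 (pderiv 0 f)) ∧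
      (∀ t j, (q : ZMod (q ^ e)) ∣ p t j - p0 j) ∧ (∀ t, eval (p t) f = 0) ∧
      ∀ j t, (F j t : ZMod (q ^ e)) = c t * eval (p t) (g j)) :
    ∃ a : Fin s → ℤ, a ≠ 0 ∧ ∀ t, ∑ j, a j * F j t = 0 := by
  apply exists_int_rel_of_det
  intro t
  apply det_zero_of_dvd _ w (fun j i => hw j (t i)) (∏ q ∈ P, q ^ e) _ hlt
  push_cast
  apply Finset.prod_dvd_of_coprime
  · intro a ha b hb hab
    have : Nat.Coprime (a ^ e) (b ^ e) :=
      Nat.Coprime.pow _ _ ((Nat.coprime_primes (hP a ha) (hP b hb)).2 hab)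
    have := Nat.isCoprime_iff_coprime.2 this
    simpa [Function.onFun] using this
  · intro q hq
    obtain ⟨f, p0, g, p, c, hu, hp, hf, hF⟩ := hloc q hq
    have hq0 : ((q : ZMod (q ^ e))) ^ e = 0 := by
      have := ZMod.natCast_self (q ^ e)
      push_cast at this
      exact this
    have hdet := local_det (q : ZMod (q ^ e)) hq0 E K hK hs f p0 hu g (fun i => p (t i))
      (fun i j => hp _ j) (fun i => hf _)
    have : (((Matrix.of fun j i => F j (t i)).det : ℤ) : ZMod (q ^ e)) = 0 := by
      change (Int.castRingHom (ZMod (q ^ e))) _ = 0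
      rw [RingHom.map_det]
      have : (Int.castRingHom (ZMod (q ^ e))).mapMatrix (Matrix.of fun j i => F j (t i)) =
          (Matrix.of fun j i => c (t i) * (Matrix.of fun j i => eval (p (t i)) (g j)) j i) := by
        ext j i
        simp [hF]
      rw [this]
      refine (Matrix.det_mul_row (fun i => c (t i)) (Matrix.of fun j i => eval (p (t i)) (g j))).trans ?_
      rw [hdet, mul_zero]
    have h3 := (ZMod.intCast_zmod_eq_zero_iff_dvd _ (q ^ e)).1 this
    push_cast at h3
    exact h3

/-- number of multi-indices -/
theorem normalize {r δ : ℕ} (f : MvPolynomial (Fin r) ℤ) (hδ : f.totalDegree ≤ δ) (hf0 : f ≠ 0)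
    {T : Type*} (E : (Fin r →₀ ℕ) → T → ℤ) (W : ℕ) (hW : 1 ≤ W)
    (hE : ∀ m t, m.degree ≤ δ → |E m t| ≤ W)
    (hf : ∀ t, ∑ m ∈ f.support, coeff m f * E m t = 0) :
    ∃ f' : MvPolynomial (Fin r) ℤ, f' ≠ 0 ∧ f'.totalDegree ≤ δ ∧
      (∀ m, |coeff m f'| ≤ (((δ + 1) ^ r * W) ^ ((δ + 1) ^ r) : ℕ)) ∧
      ∀ t, ∑ m ∈ f'.support, coeff m f' * E m t = 0 := by
  classical
  let J : Finset (Fin r →₀ ℕ) := (Finset.univ : Finset (Fin r → Fin (δ + 1))).image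
    (fun v => Finsupp.equivFunOnFinite.symm (fun i => (v i : ℕ)))
  let I : Finset (Fin r →₀ ℕ) := J.filter (fun m => m.degree ≤ δ)
  have hIcard : I.card ≤ (δ + 1) ^ r := by
    refine (Finset.card_filter_le _ _).trans (Finset.card_image_le.trans ?_)
    simp
  have hmemI : ∀ m : Fin r →₀ ℕ, m.degree ≤ δ → m ∈ I := by
    intro m hm
    refine Finset.mem_filter.2 ⟨Finset.mem_image.2 ⟨fun i => ⟨m i, ?_⟩, Finset.mem_univ _, ?_⟩, hm⟩
    · have := Finsupp.le_degree i m
      omega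
    · ext i; simp
  have hsupp : ∀ g : MvPolynomial (Fin r) ℤ, g.totalDegree ≤ δ → g.support ⊆ I := by
    intro g hg m hm
    apply hmemI
    refine le_trans ?_ hg
    exact le_totalDegree hm
  have hsum : ∀ g : MvPolynomial (Fin r) ℤ, g.totalDegree ≤ δ → ∀ t,
      ∑ m ∈ g.support, coeff m g * E m t = ∑ m : I, coeff m.1 g * E m.1 t := by
    intro g hg t
    rw [Finset.sum_subset (hsupp g hg)]
    · rw [Finset.sum_coe_sort I (fun m => coeff m g * E m t)]
    · intro m _ hm
      rw [notMem_support_iff.1 hm, zero_mul]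
  obtain ⟨a, ha, hr, hb⟩ := bounded_rel (ι := I) (fun m t => E m.1 t) W hW
    (fun m t => hE _ _ (Finset.mem_filter.1 m.2).2) (fun m => coeff m.1 f) (by
      intro h0
      apply hf0
      ext m
      by_cases hm : m ∈ I
      · have := congrFun h0 ⟨m, hm⟩
        simpa using this
      · have : m ∉ f.support := fun h => hm (hsupp f hδ h)
        simpa using this) (by
      intro t
      rw [← hsum f hδ]
      exact hf t)
  let f' : MvPolynomial (Fin r) ℤ := ∑ m : I, monomial m.1 (a m)
  have hco : ∀ m : I, coeff m.1 f' = a m := by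
    intro m
    simp only [f', coeff_sum, coeff_monomial]
    rw [Finset.sum_eq_single m]
    · simp
    · intro b _ hb
      rw [if_neg]
      intro h
      exact hb (Subtype.ext h)
    · simp
  have hco' : ∀ m, m ∉ I → coeff m f' = 0 := by
    intro m hm
    simp only [f', coeff_sum, coeff_monomial]
    apply Finset.sum_eq_zero
    intro b _
    rw [if_neg]
    intro h
    exact hm (h ▸ b.2)
  have htd : f'.totalDegree ≤ δ := by
    refine Finset.sup_le fun m hm => ?_
    have hmI : m ∈ I := by
      by_contra h
      exact (mem_support_iff.1 hm) (hco' m h)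
    exact (Finset.mem_filter.1 hmI).2
  refine ⟨f', ?_, htd, ?_, ?_⟩
  · intro h0
    apply ha
    ext m
    rw [← hco, h0]; simp
  · intro m
    by_cases hm : m ∈ I
    · rw [hco ⟨m, hm⟩]
      refine (hb ⟨m, hm⟩).trans ?_
      rw [Fintype.card_coe]
      have hI1 : 1 ≤ I.card := Finset.card_pos.2 ⟨m, hm⟩
      have : (I.card * W) ^ I.card ≤ ((δ + 1) ^ r * W) ^ ((δ + 1) ^ r) := by
        calc (I.card * W) ^ I.card ≤ ((δ + 1) ^ r * W) ^ I.card :=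
              Nat.pow_le_pow_left (Nat.mul_le_mul_right _ hIcard) _
          _ ≤ _ := Nat.pow_le_pow_right (Nat.mul_pos (by positivity) hW) hIcard
      exact_mod_cast this
    · rw [hco' m hm, abs_zero]; positivity
  · intro t
    rw [hsum f' htd]
    simp only [hco]
    exact hr t

/-- a multiple of the same degree is associated -/
theorem irr_of_dvd {r : ℕ} {K : Type*} [Field K] (f f' : MvPolynomial (Fin r) K) (hf : Irreducible f)
    (hf' : f' ≠ 0) (hd : f ∣ f') (htd : f'.totalDegree ≤ f.totalDegree) : ∃ c : K, c ≠ 0 ∧ f' = C c * f := by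
  obtain ⟨q, rfl⟩ := hd
  have hq : q ≠ 0 := right_ne_zero_of_mul hf'
  rw [totalDegree_mul_of_isDomain hf.ne_zero hq] at htd
  have h0 : q.totalDegree = 0 := by omega
  rw [totalDegree_eq_zero_iff_eq_C] at h0
  refine ⟨coeff 0 q, ?_, ?_⟩
  · intro h; rw [h, C_0] at h0; exact hq h0
  · rw [← h0, mul_comm]

end DG

namespace DG
open MvPolynomial

/-- homogenised evaluation of `g(z,y)` at the point `(z,x,y)` -/
noncomputable def homE (g : MvPolynomial (Fin 2) ℤ) (N : ℕ) (t : Fin 3 → ℤ) : ℤ :=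
  ∑ m ∈ g.support, coeff m g * (t 0 ^ m 0 * t 2 ^ m 1 * t 1 ^ (N - m.degree))

theorem degree_two (m : Fin 2 →₀ ℕ) : m.degree = m 0 + m 1 := by
  simp [Finsupp.degree_eq_sum]

theorem eval_map_eq_sum {R : Type*} [CommRing R] (g : MvPolynomial (Fin 2) ℤ) (v : Fin 2 → R) :
    eval v (map (Int.castRingHom R) g) = ∑ m ∈ g.support, ((coeff m g : ℤ) : R) * (v 0 ^ m 0 * v 1 ^ m 1) := by
  rw [eval_map, eval₂_eq']
  simp [Fin.prod_univ_two]

theorem homE_eq {R : Type*} [CommRing R] (g : MvPolynomial (Fin 2) ℤ) (N : ℕ) (t : Fin 3 → ℤ)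
    (hg : g.totalDegree ≤ N) (u : R) (hu : (t 1 : R) * u = 1) :
    ((homE g N t : ℤ) : R) = (t 1 : R) ^ N * eval ![(t 0 : R) * u, (t 2 : R) * u] (map (Int.castRingHom R) g) := by
  rw [eval_map_eq_sum, homE, Finset.mul_sum]
  push_cast
  apply Finset.sum_congr rfl
  intro m hm
  have hd : m.degree ≤ N := (le_totalDegree hm).trans hg
  obtain ⟨l, hl⟩ := Nat.exists_eq_add_of_le hd
  have : N - m.degree = l := by omega
  rw [this, hl, degree_two]
  change _ = _ * (_ * (((t 0 : R) * u) ^ m 0 * ((t 2 : R) * u) ^ m 1))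
  simp only [mul_pow]
  have h1 : (t 1 : R) ^ (m 0 + m 1) * (u ^ m 0 * u ^ m 1) = 1 := by
    rw [← pow_add, ← mul_pow, hu, one_pow]
  calc _ = ((coeff m g : ℤ) : R) * ((t 0 : R) ^ m 0 * (t 2 : R) ^ m 1 * (t 1 : R) ^ l) *
        ((t 1 : R) ^ (m 0 + m 1) * (u ^ m 0 * u ^ m 1)) := by rw [h1, mul_one]
    _ = _ := by ring

theorem abs_mon_le (t : Fin 3 → ℤ) (M : ℕ) (ht : ∀ i, |t i| ≤ M) (a b c : ℕ) :
    |t 0 ^ a * t 2 ^ b * t 1 ^ c| ≤ (M : ℤ) ^ (a + b + c) := by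
  rw [abs_mul, abs_mul, abs_pow, abs_pow, abs_pow, pow_add, pow_add]
  gcongr <;> apply ht

theorem homE_le (g : MvPolynomial (Fin 2) ℤ) (N : ℕ) (t : Fin 3 → ℤ)
    (hg : g.totalDegree ≤ N) (A M : ℕ) (hA : ∀ m, |coeff m g| ≤ A) (ht : ∀ i, |t i| ≤ M) :
    |homE g N t| ≤ (((N + 1) ^ 2 * (A * M ^ N) : ℕ) : ℤ) := by
  classical
  have hcard : g.support.card ≤ (N + 1) ^ 2 := by
    have : g.support.card ≤ ((Finset.range (N + 1)) ×ˢ (Finset.range (N + 1))).card := by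
      apply Finset.card_le_card_of_injOn (fun m => (m 0, m 1))
      · intro m hm
        have hd : m.degree ≤ N := (le_totalDegree hm).trans hg
        rw [degree_two] at hd
        simp only [Finset.coe_product, Finset.coe_range, Set.mem_prod, Set.mem_Iio]
        omega
      · intro a _ b _ hab
        simp only [Prod.mk.injEq] at hab
        refine Finsupp.ext fun i => ?_
        fin_cases i
        · exact hab.1
        · exact hab.2
    rw [Finset.card_product, Finset.card_range] at this
    nlinarith
  unfold homE
  refine (Finset.abs_sum_le_sum_abs _ _).trans ?_
  have : ∀ m ∈ g.support, |coeff m g * (t 0 ^ m 0 * t 2 ^ m 1 * t 1 ^ (N - m.degree))| ≤ (A : ℤ) * (M : ℤ) ^ N := by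
    intro m hm
    have hd : m.degree ≤ N := (le_totalDegree hm).trans hg
    rw [abs_mul]
    have h1 := abs_mon_le t M ht (m 0) (m 1) (N - m.degree)
    have h2 : m 0 + m 1 + (N - m.degree) = N := by rw [degree_two] at *; omega
    rw [h2] at h1
    exact mul_le_mul (hA m) h1 (abs_nonneg _) (by positivity)
  refine (Finset.sum_le_card_nsmul _ _ _ this).trans ?_
  rw [nsmul_eq_mul]
  push_cast
  have : (g.support.card : ℤ) ≤ ((N : ℤ) + 1) ^ 2 := by exact_mod_cast hcard
  gcongr

theorem primes_count (b R : ℕ) (hb : 2 ≤ b) (N : ℤ) (hN : N ≠ 0) (hNR : |N| ≤ ((b ^ R : ℕ) : ℤ))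
    (P : Finset ℕ) (hP : ∀ p ∈ P, p.Prime ∧ b ≤ p ∧ (p : ℤ) ∣ N) : P.card ≤ R := by
  have h1 : (∏ p ∈ P, p) ∣ N.natAbs := by
    apply Finset.prod_primes_dvd
    · intro p hp; exact (hP p hp).1.prime
    · intro p hp
      exact Int.natCast_dvd.1 (hP p hp).2.2
  have h2 := Nat.le_of_dvd (Int.natAbs_pos.2 hN) h1
  have h3 : b ^ P.card ≤ ∏ p ∈ P, p := Finset.pow_card_le_prod _ _ _ (fun p hp => (hP p hp).2.1)
  have h4 : N.natAbs ≤ b ^ R := by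
    have : ((N.natAbs : ℕ) : ℤ) ≤ ((b ^ R : ℕ) : ℤ) := by rw [Int.natCast_natAbs]; exact hNR
    exact_mod_cast this
  exact (Nat.pow_le_pow_iff_right hb).1 (h3.trans (h2.trans h4))

theorem card_zeros_zmod {p r : ℕ} [Fact p.Prime] (a : MvPolynomial (Fin (r + 1)) (ZMod p)) (ha : a ≠ 0)
    (S : Finset (Fin (r + 1) → ZMod p)) (hS : ∀ x ∈ S, eval x a = 0) : S.card ≤ a.totalDegree * p ^ r := by
  classical
  have h := schwartz_zippel_totalDegree ha (Finset.univ : Finset (ZMod p))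
  have h2 : S.card ≤ (Finset.filter (fun f => (eval f) a = 0)
      (Fintype.piFinset fun (_ : Fin (r+1)) => (Finset.univ : Finset (ZMod p)))).card := by
    apply Finset.card_le_card
    intro x hx
    simp [hS x hx]
  have hp : (0:ℚ≥0) < p := by exact_mod_cast (Fact.out : p.Prime).pos
  rw [Finset.card_univ, ZMod.card, div_le_div_iff₀ (by positivity) hp] at h
  have h3 : (Finset.filter (fun f => (eval f) a = 0)
      (Fintype.piFinset fun (_ : Fin (r+1)) => (Finset.univ : Finset (ZMod p)))).card * p ≤ a.totalDegree * p ^ (r + 1) := by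
    exact_mod_cast h
  have h4 : 0 < p := (Fact.out : p.Prime).pos
  rw [pow_succ, ← mul_assoc] at h3
  exact h2.trans (Nat.le_of_mul_le_mul_right h3 h4)

/-- the rational point -/
noncomputable def rpt (t : Fin 3 → ℤ) : Fin 2 → ℚ := ![(t 0 : ℚ) * (t 1 : ℚ)⁻¹, (t 2 : ℚ) * (t 1 : ℚ)⁻¹]

theorem homE_zero_iff (g : MvPolynomial (Fin 2) ℤ) (N : ℕ) (t : Fin 3 → ℤ)
    (hg : g.totalDegree ≤ N) (hx : t 1 ≠ 0) :
    homE g N t = 0 ↔ eval (rpt t) (map (Int.castRingHom ℚ) g) = 0 := by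
  have hx' : (t 1 : ℚ) ≠ 0 := by exact_mod_cast hx
  have := homE_eq (R := ℚ) g N t hg _ (mul_inv_cancel₀ hx')
  rw [rpt, ← Int.cast_inj (α := ℚ), this]
  simp [hx']

theorem rpt_inj {t t' : Fin 3 → ℤ} (hx : t 1 ≠ 0) (hx' : t' 1 ≠ 0) (h : rpt t = rpt t') :
    t 0 * t' 1 = t' 0 * t 1 ∧ t 2 * t' 1 = t' 2 * t 1 := by
  have h1 : (t 1 : ℚ) ≠ 0 := by exact_mod_cast hx
  have h2 : (t' 1 : ℚ) ≠ 0 := by exact_mod_cast hx'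
  have e0 := congrFun h 0
  have e1 := congrFun h 1
  simp only [rpt, Matrix.cons_val_zero, Matrix.cons_val_one] at e0 e1
  field_simp at e0 e1
  constructor
  · have : ((t 0 * t' 1 : ℤ) : ℚ) = ((t' 0 * t 1 : ℤ) : ℚ) := by push_cast; linarith
    exact_mod_cast this
  · have : ((t 2 * t' 1 : ℤ) : ℚ) = ((t' 2 * t 1 : ℤ) : ℚ) := by push_cast; linarith
    exact_mod_cast this

theorem degreeOf_map_Q (h : MvPolynomial (Fin 2) ℤ) (i : Fin 2) :
    degreeOf i (map (Int.castRingHom ℚ) h) = degreeOf i h := by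
  rw [degreeOf_eq_sup, degreeOf_eq_sup, support_map_of_injective _ (RingHom.injective_int _)]

theorem totalDegree_pderiv_le {R σ : Type*} [CommRing R] (i : σ) (h : MvPolynomial σ R) :
    (pderiv i h).totalDegree ≤ h.totalDegree := by
  refine Finset.sup_le fun m hm => ?_
  rw [mem_support_iff, coeff_pderiv] at hm
  have h1 : m + Finsupp.single i 1 ∈ h.support := by
    rw [mem_support_iff]
    intro h0
    rw [h0] at hm
    simp at hm
  have h2 := le_totalDegree h1
  change m.degree ≤ _
  change (m + Finsupp.single i 1).degree ≤ _ at h2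
  rw [map_add] at h2
  omega

theorem unit_zmod {p e : ℕ} (hp : p.Prime) (a : ℤ) (ha : ¬ (p : ℤ) ∣ a) : IsUnit (a : ZMod (p ^ e)) := by
  rw [ZMod.coe_int_isUnit_iff_isCoprime]
  push_cast
  apply IsCoprime.pow_left
  exact ((Nat.prime_iff_prime_int.1 hp).coprime_iff_not_dvd).2 ha

theorem totalDegree_map_Q {r : ℕ} (h : MvPolynomial (Fin r) ℤ) :
    (map (Int.castRingHom ℚ) h).totalDegree = h.totalDegree := by
  unfold totalDegree
  rw [support_map_of_injective _ (RingHom.injective_int _)]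

theorem totalDegree_map_le {R S σ : Type*} [CommRing R] [CommRing S] (φ : R →+* S) (h : MvPolynomial σ R) :
    (map φ h).totalDegree ≤ h.totalDegree :=
  Finset.sup_mono (support_map_subset _ _)

/-- points in one good residue class -/
theorem pc_class (k D μ b : ℕ) (V : ℕ → ℕ → ℕ)
    (hV : 1 + ∑ c ∈ Finset.range k, ∑ j ∈ Finset.range (D + 1), V c j ≤ μ * (k * (D + 1) * (k * (D + 1) - 1) / 2))
    (hfac : (k * (D + 1)).factorial ≤ b) (hb : 1 ≤ b)
    (h : MvPolynomial (Fin 2) ℤ) (hirr : Irreducible (map (Int.castRingHom ℚ) h))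
    (hk : k ≤ degreeOf 0 h) (T : Finset (Fin 3 → ℤ))
    (hx : ∀ t ∈ T, t 1 ≠ 0)
    (hmon : ∀ t ∈ T, ∀ c < k, ∀ j ≤ D, |t 0 ^ c * t 2 ^ j * t 1 ^ (D + k - 1 - c - j)| ≤ ((b ^ V c j : ℕ) : ℤ))
    (hinj : ∀ t ∈ T, ∀ t' ∈ T, t 0 * t' 1 = t' 0 * t 1 → t 2 * t' 1 = t' 2 * t 1 → t = t')
    (hz : ∀ t ∈ T, homE h h.totalDegree t = 0)
    (p : ℕ) (hp : p.Prime) (hpb : b ^ μ < p)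
    (hpx : ∀ t ∈ T, ¬ (p : ℤ) ∣ t 1) (hgood : ∀ t ∈ T, ¬ (p : ℤ) ∣ homE (pderiv 0 h) h.totalDegree t)
    (hcls : ∀ t ∈ T, ∀ t' ∈ T, (p : ℤ) ∣ t 0 * t' 1 - t' 0 * t 1 ∧ (p : ℤ) ∣ t 2 * t' 1 - t' 2 * t 1) :
    T.card ≤ (h.totalDegree + (D + k)) ^ 4 := by
  classical
  rcases T.eq_empty_or_nonempty with rfl | ⟨t0, ht0⟩
  · simp
  obtain ⟨s, hs⟩ : ∃ s, s = k * (D + 1) := ⟨_, rfl⟩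
  obtain ⟨e, he⟩ : ∃ e, e = s * (s - 1) / 2 := ⟨_, rfl⟩
  rw [← hs] at hV hfac
  rw [← he] at hV
  have hk1 : 1 ≤ k := by
    by_contra hk0
    have : k = 0 := by omega
    subst this
    rw [zero_mul] at hs; subst hs; simp at he; subst he; simp at hV
  have he1 : 1 ≤ e := by
    by_contra h0
    have : e = 0 := by omega
    rw [this] at hV
    omega
  let ε : Fin k × Fin (D + 1) ≃ Fin s := finProdFinEquiv.trans (finCongr hs.symm)
  let F : Fin s → T → ℤ := fun i t => t.1 0 ^ ((ε.symm i).1 : ℕ) * t.1 2 ^ ((ε.symm i).2 : ℕ) *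
    t.1 1 ^ (D + k - 1 - ((ε.symm i).1 : ℕ) - ((ε.symm i).2 : ℕ))
  have hpd : (pderiv 0 h).totalDegree ≤ h.totalDegree := (totalDegree_pderiv_le _ _)
  have hunit : ∀ a : ℤ, ¬ (p : ℤ) ∣ a → IsUnit (a : ZMod (p ^ e)) := fun a ha => unit_zmod hp a ha
  obtain ⟨a, ha, hrel⟩ := aux_general (r := 1) (s := s) (e := e) (E := s) (K := s * (s + 1) / 2) (K_one s)
    (by
      subst he
      have h1 : 2 ∣ s * (s - 1) := (Nat.even_mul_pred_self s).two_dvd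
      have h2 : 2 ∣ s * (s + 1) := (Nat.even_mul_succ_self s).two_dvd
      have h3 : s * (s - 1) + s * (s + 1) = 2 * (s * s) := by
        rcases s with _ | s
        · simp
        · simp only [Nat.add_sub_cancel]; ring
      omega) F (fun i => b ^ V ((ε.symm i).1 : ℕ) ((ε.symm i).2 : ℕ))
    (fun i t => hmon t.1 t.2 _ (ε.symm i).1.2 _ (Nat.lt_succ_iff.1 (ε.symm i).2.2)) {p} (by simpa using hp)
    (by
      rw [Finset.prod_singleton, Finset.prod_pow_eq_pow_sum]
      have h1 : ∑ i : Fin s, V ((ε.symm i).1 : ℕ) ((ε.symm i).2 : ℕ) =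
          ∑ c ∈ Finset.range k, ∑ j ∈ Finset.range (D + 1), V c j := by
        rw [Equiv.sum_comp ε.symm (fun q : Fin k × Fin (D + 1) => V (q.1 : ℕ) (q.2 : ℕ)), Fintype.sum_prod_type]
        rw [← Fin.sum_univ_eq_sum_range (fun c => ∑ j ∈ Finset.range (D + 1), V c j)]
        apply Finset.sum_congr rfl
        intro c _
        rw [← Fin.sum_univ_eq_sum_range (fun j => V c j)]
      rw [h1]
      calc _ ≤ b * b ^ (∑ c ∈ Finset.range k, ∑ j ∈ Finset.range (D + 1), V c j) := Nat.mul_le_mul_right _ hfac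
        _ = b ^ (1 + ∑ c ∈ Finset.range k, ∑ j ∈ Finset.range (D + 1), V c j) := by rw [pow_add, pow_one]
        _ ≤ b ^ (μ * e) := Nat.pow_le_pow_right hb hV
        _ = (b ^ μ) ^ e := pow_mul _ _ _
        _ < p ^ e := Nat.pow_lt_pow_left hpb (by omega)) (by
      intro q hq
      rw [Finset.mem_singleton] at hq
      subst hq
      have hu : ∀ t : T, ∃ u : ZMod (q ^ e), ((t.1 1 : ℤ) : ZMod (q ^ e)) * u = 1 := fun t =>
        (hunit _ (hpx t.1 t.2)).exists_right_inv
      choose u hu using hu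
      refine ⟨map (Int.castRingHom (ZMod (q ^ e))) h, ![(t0 0 : ZMod (q ^ e)) * u ⟨t0, ht0⟩, (t0 2 : ZMod (q ^ e)) * u ⟨t0, ht0⟩],
        fun i => X 0 ^ ((ε.symm i).1 : ℕ) * X 1 ^ ((ε.symm i).2 : ℕ),
        fun t => ![(t.1 0 : ZMod (q ^ e)) * u t, (t.1 2 : ZMod (q ^ e)) * u t], fun t => (t.1 1 : ZMod (q ^ e)) ^ (D + k - 1), ?_, ?_, ?_, ?_⟩
      · have := homE_eq (R := (ZMod (q ^ e))) (pderiv 0 h) h.totalDegree t0 hpd (u ⟨t0, ht0⟩) (hu ⟨t0, ht0⟩)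
        have h2 := hunit _ (hgood t0 ht0)
        rw [this, ← pderiv_map] at h2
        exact isUnit_of_mul_isUnit_right h2
      · intro t j
        have hc := hcls t.1 t.2 t0 ht0
        have hdv : ∀ x y : ℤ, (q : ℤ) ∣ x * t0 1 - y * t.1 1 →
            (q : ZMod (q ^ e)) ∣ (x : ZMod (q ^ e)) * u t - (y : ZMod (q ^ e)) * u ⟨t0, ht0⟩ := by
          intro x y hxy
          obtain ⟨w, hw⟩ := hxy
          have hw' := congrArg (Int.cast : ℤ → (ZMod (q ^ e))) hw
          push_cast at hw'
          refine ⟨w * (u t * u ⟨t0, ht0⟩), ?_⟩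
          have e1 := hu t
          have e2 := hu ⟨t0, ht0⟩
          linear_combination (u t * u ⟨t0, ht0⟩) * hw' - (x : ZMod (q ^ e)) * u t * e2 + (y : ZMod (q ^ e)) * u ⟨t0, ht0⟩ * e1
        fin_cases j
        · exact hdv _ _ hc.1
        · exact hdv _ _ hc.2
      · intro t
        have := homE_eq (R := (ZMod (q ^ e))) h h.totalDegree t.1 le_rfl (u t) (hu t)
        rw [hz t.1 t.2] at this
        have h2 : IsUnit (((t.1 1 : ℤ) : ZMod (q ^ e)) ^ h.totalDegree) := (hunit _ (hpx t.1 t.2)).pow _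
        simpa using (h2.mul_right_eq_zero.1 (by simpa using this.symm))
      · intro j t
        simp only [F]
        push_cast
        simp only [map_mul, map_pow, eval_X, Matrix.cons_val_zero, Matrix.cons_val_one]
        set c := ((ε.symm j).1 : ℕ)
        set l := ((ε.symm j).2 : ℕ)
        have hcl : c + l ≤ D + k - 1 := by
          have := (ε.symm j).1.2
          have := (ε.symm j).2.2
          omega
        obtain ⟨o, ho⟩ := Nat.exists_eq_add_of_le hcl
        have ho2 : D + k - 1 - c - l = o := by omega
        rw [ho2, ho]
        have h1 : (t.1 1 : ZMod (q ^ e)) ^ (c + l) * (u t ^ c * u t ^ l) = 1 := by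
          rw [← pow_add, ← mul_pow, hu, one_pow]
        calc _ = ((t.1 0 : ZMod (q ^ e)) ^ c * (t.1 2 : ZMod (q ^ e)) ^ l * (t.1 1 : ZMod (q ^ e)) ^ o) *
              ((t.1 1 : ZMod (q ^ e)) ^ (c + l) * (u t ^ c * u t ^ l)) := by rw [h1, mul_one]
          _ = _ := by ring)
  -- the auxiliary polynomial
  let mm : Fin s → (Fin 2 →₀ ℕ) := fun i => Finsupp.single 0 ((ε.symm i).1 : ℕ) + Finsupp.single 1 ((ε.symm i).2 : ℕ)
  have hmm0 : ∀ i, mm i 0 = ((ε.symm i).1 : ℕ) := by intro i; simp [mm]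
  have hmm1 : ∀ i, mm i 1 = ((ε.symm i).2 : ℕ) := by intro i; simp [mm]
  have hmminj : Function.Injective mm := by
    intro i j hij
    apply ε.symm.injective
    apply Prod.ext
    · apply Fin.ext; rw [← hmm0, ← hmm0, hij]
    · apply Fin.ext; rw [← hmm1, ← hmm1, hij]
  let g : MvPolynomial (Fin 2) ℚ := ∑ i, monomial (mm i) (a i : ℚ)
  have hg0 : g ≠ 0 := by
    intro h0
    apply ha
    funext i
    have : coeff (mm i) g = 0 := by rw [h0]; simp
    simp only [g, coeff_sum, coeff_monomial] at this
    rw [Finset.sum_eq_single i (fun j _ hj => if_neg (fun hh => hj (hmminj hh))) (by simp)] at this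
    simpa using this
  have hgd : degreeOf 0 g < k := by
    refine lt_of_le_of_lt (degreeOf_sum_le _ _ _) ?_
    rw [Finset.sup_lt_iff (by rw [Nat.bot_eq_zero]; omega)]
    intro i _
    refine lt_of_le_of_lt ?_ (ε.symm i).1.2
    by_cases hai : (a i : ℚ) = 0
    · rw [hai]; simp
    · rw [degreeOf_monomial_eq _ _ hai, hmm0]
  have hgt : g.totalDegree ≤ D + k := by
    apply totalDegree_finsetSum_le
    intro i _
    refine (totalDegree_monomial_le _ _).trans ?_
    change (mm i).degree ≤ _
    rw [degree_two, hmm0, hmm1]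
    have := (ε.symm i).1.2
    have := (ε.symm i).2.2
    omega
  have hnd : ¬ (map (Int.castRingHom ℚ) h) ∣ g := by
    rintro ⟨w, hw⟩
    have hw0 : w ≠ 0 := by rintro rfl; exact hg0 (by simpa using hw)
    have := degreeOf_mul_eq (n := (0 : Fin 2)) hirr.ne_zero hw0
    rw [← hw, degreeOf_map_Q] at this
    omega
  have hB := bezout _ g hirr hnd (T.image rpt) (by
    intro q hq
    obtain ⟨t, ht, rfl⟩ := Finset.mem_image.1 hq
    refine ⟨(homE_zero_iff h _ t le_rfl (hx t ht)).1 (hz t ht), ?_⟩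
    have hx' : (t 1 : ℚ) ≠ 0 := by exact_mod_cast hx t ht
    have h1 := congrArg (Int.cast : ℤ → ℚ) (hrel ⟨t, ht⟩)
    push_cast at h1
    have h2 : (t 1 : ℚ) ^ (D + k - 1) * eval (rpt t) g = 0 := by
      rw [← h1]
      simp only [g, map_sum, Finset.mul_sum]
      apply Finset.sum_congr rfl
      intro i _
      rw [eval_monomial, Finsupp.prod_fintype _ _ (by simp), Fin.prod_univ_two, hmm0, hmm1]
      simp only [F, rpt, Matrix.cons_val_zero, Matrix.cons_val_one]
      push_cast
      set c := ((ε.symm i).1 : ℕ)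
      set l := ((ε.symm i).2 : ℕ)
      have hcl : c + l ≤ D + k - 1 := by
        have := (ε.symm i).1.2
        have := (ε.symm i).2.2
        omega
      obtain ⟨o, ho⟩ := Nat.exists_eq_add_of_le hcl
      have ho2 : D + k - 1 - c - l = o := by omega
      rw [ho2, ho, mul_pow, mul_pow, inv_pow, inv_pow]
      field_simp
      ring
    simpa [hx'] using h2)
  rw [Finset.card_image_of_injOn, totalDegree_map_Q] at hB
  · refine hB.trans ?_
    gcongr
  · intro t ht t' ht' heq
    have := rpt_inj (hx t ht) (hx t' ht') heq
    exact hinj t ht t' ht' this.1 this.2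

theorem not_dvd_pderiv {K σ : Type*} [Field K] [CharZero K] (i : σ) (h : MvPolynomial σ K)
    (hd : 0 < degreeOf i h) : pderiv i h ≠ 0 ∧ ¬ h ∣ pderiv i h := by
  classical
  have hh0 : h ≠ 0 := by rintro rfl; simp at hd
  have h1 : pderiv i h ≠ 0 := by
    have hne : h.support.Nonempty := support_nonempty.2 hh0
    obtain ⟨m, hm, hmi⟩ := Finset.exists_mem_eq_sup h.support hne (fun m => m i)
    rw [← degreeOf_eq_sup] at hmi
    intro h0
    have hc := coeff_pderiv (i := i) h (m - Finsupp.single i 1)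
    have hle : Finsupp.single i 1 ≤ m := by
      rw [Finsupp.single_le_iff]; omega
    rw [h0, tsub_add_cancel_of_le hle, coeff_zero] at hc
    have h2 : coeff m h ≠ 0 := mem_support_iff.1 hm
    have h3 : (((m - Finsupp.single i 1 : σ →₀ ℕ) i : ℕ) : K) + 1 ≠ 0 := by
      exact Nat.cast_add_one_ne_zero _
    exact (mul_ne_zero h2 h3) hc.symm
  refine ⟨h1, ?_⟩
  rintro ⟨w, hw⟩
  have hw0 : w ≠ 0 := by rintro rfl; exact h1 (by simpa using hw)
  have hlt : degreeOf i (pderiv i h) < degreeOf i h := by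
    rw [degreeOf_lt_iff hd]
    intro m hm
    rw [mem_support_iff, coeff_pderiv] at hm
    have h1 : m + Finsupp.single i 1 ∈ h.support := by
      rw [mem_support_iff]
      intro h0
      rw [h0] at hm
      simp at hm
    have := monomial_le_degreeOf i h1
    simp at this
    omega
  rw [hw, degreeOf_mul_eq hh0 hw0] at hlt
  omega

theorem pc_core (k D μ b R : ℕ) (hμ : 1 ≤ μ) (V : ℕ → ℕ → ℕ)
    (hV : 1 + ∑ c ∈ Finset.range k, ∑ j ∈ Finset.range (D + 1), V c j ≤ μ * (k * (D + 1) * (k * (D + 1) - 1) / 2))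
    (hfac : (k * (D + 1)).factorial ≤ b) (hb : 16 * (μ + 1) ^ 2 * (1 + 1) ^ 2 ≤ b) (hR : R + 1 ≤ b)
    (h : MvPolynomial (Fin 2) ℤ) (hirr : Irreducible (map (Int.castRingHom ℚ) h))
    (hk1 : 1 ≤ k) (hk : k ≤ degreeOf 0 h) (T : Finset (Fin 3 → ℤ))
    (hx : ∀ t ∈ T, t 1 ≠ 0)
    (hmon : ∀ t ∈ T, ∀ c < k, ∀ j ≤ D, |t 0 ^ c * t 2 ^ j * t 1 ^ (D + k - 1 - c - j)| ≤ ((b ^ V c j : ℕ) : ℤ))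
    (hinj : ∀ t ∈ T, ∀ t' ∈ T, t 0 * t' 1 = t' 0 * t 1 → t 2 * t' 1 = t' 2 * t 1 → t = t')
    (hz : ∀ t ∈ T, homE h h.totalDegree t = 0)
    (hbd : ∀ t ∈ T, |t 1 * homE (pderiv 0 h) h.totalDegree t| ≤ ((b ^ R : ℕ) : ℤ)) :
    T.card ≤ (h.totalDegree + h.totalDegree) ^ 4 +
      (R + 1) * ((h.totalDegree + (D + k)) ^ 4 * (h.totalDegree * b ^ (μ + 1))) := by
  classical
  have hb1 : 2 ≤ b := by nlinarith
  have hpd := totalDegree_pderiv_le 0 h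
  set T1 := T.filter (fun t => homE (pderiv 0 h) h.totalDegree t = 0) with hT1
  set T2 := T.filter (fun t => ¬ homE (pderiv 0 h) h.totalDegree t = 0) with hT2
  have hsplit : T.card = T1.card + T2.card := (Finset.card_filter_add_card_filter_not _).symm
  have hc1 : T1.card ≤ (h.totalDegree + h.totalDegree) ^ 4 := by
    have hnd := (not_dvd_pderiv 0 (map (Int.castRingHom ℚ) h) (by rw [degreeOf_map_Q]; omega)).2
    have hB := bezout _ _ hirr hnd (T1.image rpt) (by
      intro q hq
      obtain ⟨t, ht, rfl⟩ := Finset.mem_image.1 hq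
      have ht' := Finset.mem_filter.1 ht
      refine ⟨(homE_zero_iff h _ t le_rfl (hx t ht'.1)).1 (hz t ht'.1), ?_⟩
      rw [pderiv_map]
      exact (homE_zero_iff _ _ t hpd (hx t ht'.1)).1 ht'.2)
    rw [Finset.card_image_of_injOn, pderiv_map, totalDegree_map_Q, totalDegree_map_Q] at hB
    · refine hB.trans ?_
      gcongr
    · intro t ht t' ht' heq
      have h1 := (Finset.mem_filter.1 ht).1
      have h2 := (Finset.mem_filter.1 ht').1
      have := rpt_inj (hx t h1) (hx t' h2) heq
      exact hinj t h1 t' h2 this.1 this.2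
  have hmany := many_primes μ 1 b hμ le_rfl hb
  have hbμ : b ≤ b ^ μ := Nat.le_self_pow (by omega) b
  obtain ⟨P, hPs, hPc⟩ := Finset.exists_subset_card_eq (s := (Finset.Ioc (b ^ μ) (b ^ (μ + 1))).filter Nat.Prime) (n := R + 1)
    (by omega)
  have hPp : ∀ p ∈ P, p.Prime ∧ b ^ μ < p ∧ p ≤ b ^ (μ + 1) := by
    intro p hp
    have := Finset.mem_filter.1 (hPs hp)
    have h2 := Finset.mem_Ioc.1 this.1
    exact ⟨this.2, h2.1, h2.2⟩
  let G : ℕ → Finset (Fin 3 → ℤ) := fun p => T2.filter (fun t => ¬ (p : ℤ) ∣ t 1 * homE (pderiv 0 h) h.totalDegree t)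
  have hcov : T2 ⊆ P.biUnion G := by
    intro t ht
    have ht' := Finset.mem_filter.1 ht
    by_contra hcon
    have hall : ∀ p ∈ P, (p : ℤ) ∣ t 1 * homE (pderiv 0 h) h.totalDegree t := by
      intro p hp
      by_contra hc
      exact hcon (Finset.mem_biUnion.2 ⟨p, hp, Finset.mem_filter.2 ⟨ht, hc⟩⟩)
    have := primes_count b R hb1 _ (mul_ne_zero (hx t ht'.1) ht'.2) (hbd t ht'.1) P
      (fun p hp => ⟨(hPp p hp).1, by have := (hPp p hp).2.1; omega, hall p hp⟩)
    omega
  have hGp : ∀ p ∈ P, (G p).card ≤ (h.totalDegree + (D + k)) ^ 4 * (h.totalDegree * b ^ (μ + 1)) := by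
    intro p hp
    obtain ⟨hpp, hpb, hpb2⟩ := hPp p hp
    have : Fact p.Prime := ⟨hpp⟩
    have hmem : ∀ t ∈ G p, t ∈ T ∧ ¬ (p : ℤ) ∣ t 1 ∧ ¬ (p : ℤ) ∣ homE (pderiv 0 h) h.totalDegree t := by
      intro t ht
      have h1 := Finset.mem_filter.1 ht
      have h2 := Finset.mem_filter.1 h1.1
      exact ⟨h2.1, fun h => h1.2 (dvd_mul_of_dvd_left h _), fun h => h1.2 (dvd_mul_of_dvd_right h _)⟩
    have hx1 : ∀ t ∈ G p, ((t 1 : ℤ) : ZMod p) ≠ 0 := by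
      intro t ht h0
      exact (hmem t ht).2.1 ((ZMod.intCast_zmod_eq_zero_iff_dvd _ _).1 h0)
    let cls : (Fin 3 → ℤ) → (Fin 2 → ZMod p) := fun t =>
      ![(t 0 : ZMod p) * (t 1 : ZMod p)⁻¹, (t 2 : ZMod p) * (t 1 : ZMod p)⁻¹]
    rcases (G p).eq_empty_or_nonempty with h0 | ⟨t0, ht0⟩
    · rw [h0]; simp
    refine (Finset.card_le_mul_card_image (f := cls) (G p) ((h.totalDegree + (D + k)) ^ 4) ?_).trans ?_
    · intro a _
      refine pc_class k D μ b V hV hfac (by omega) h hirr hk _ ?_ ?_ ?_ ?_ p hpp hpb ?_ ?_ ?_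
      · intro t ht; exact hx t (hmem t (Finset.mem_filter.1 ht).1).1
      · intro t ht; exact hmon t (hmem t (Finset.mem_filter.1 ht).1).1
      · intro t ht t' ht'
        exact hinj t (hmem t (Finset.mem_filter.1 ht).1).1 t' (hmem t' (Finset.mem_filter.1 ht').1).1
      · intro t ht; exact hz t (hmem t (Finset.mem_filter.1 ht).1).1
      · intro t ht; exact (hmem t (Finset.mem_filter.1 ht).1).2.1
      · intro t ht; exact (hmem t (Finset.mem_filter.1 ht).1).2.2
      · intro t ht t' ht'
        have h1 := Finset.mem_filter.1 ht
        have h2 := Finset.mem_filter.1 ht'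
        have heq := h1.2.trans h2.2.symm
        have n1 := hx1 t h1.1
        have n2 := hx1 t' h2.1
        have e0 := congrFun heq 0
        have e1 := congrFun heq 1
        simp only [cls, Matrix.cons_val_zero, Matrix.cons_val_one] at e0 e1
        field_simp at e0 e1
        constructor
        · rw [← ZMod.intCast_zmod_eq_zero_iff_dvd]
          push_cast
          linear_combination e0
        · rw [← ZMod.intCast_zmod_eq_zero_iff_dvd]
          push_cast
          linear_combination e1
    · apply Nat.mul_le_mul_left
      have hne : map (Int.castRingHom (ZMod p)) h ≠ 0 := by
        intro h0
        have h1 := homE_eq (R := ZMod p) (pderiv 0 h) h.totalDegree t0 hpd _ (mul_inv_cancel₀ (hx1 t0 ht0))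
        rw [← pderiv_map, h0] at h1
        exact (hmem t0 ht0).2.2 ((ZMod.intCast_zmod_eq_zero_iff_dvd _ _).1 (by simpa using h1))
      have := card_zeros_zmod (r := 1) _ hne ((G p).image cls) (by
        intro v hv
        obtain ⟨t, ht, rfl⟩ := Finset.mem_image.1 hv
        have h1 := homE_eq (R := ZMod p) h h.totalDegree t le_rfl _ (mul_inv_cancel₀ (hx1 t ht))
        rw [hz t (hmem t ht).1] at h1
        simpa [hx1 t ht] using h1.symm)
      refine this.trans ?_
      rw [pow_one]
      exact Nat.mul_le_mul (totalDegree_map_le _ _) hpb2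
  rw [hsplit]
  refine Nat.add_le_add hc1 ?_
  refine (Finset.card_le_card hcov).trans (Finset.card_biUnion_le.trans ?_)
  refine (Finset.sum_le_card_nsmul _ _ _ hGp).trans ?_
  rw [hPc, smul_eq_mul]

theorem coeff_pderiv_le {r δ A : ℕ} (i : Fin r) (h : MvPolynomial (Fin r) ℤ) (hδ : h.totalDegree ≤ δ)
    (hA : ∀ m, |coeff m h| ≤ A) (m) : |coeff m (pderiv i h)| ≤ ((A * (δ + 1) : ℕ) : ℤ) := by
  rw [coeff_pderiv]
  by_cases h0 : coeff (m + Finsupp.single i 1) h = 0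
  · rw [h0]; simp
  · have h1 := le_totalDegree (mem_support_iff.2 h0)
    change (m + Finsupp.single i 1).degree ≤ _ at h1
    have h2 := Finsupp.le_degree i (m + Finsupp.single i 1)
    simp only [Finsupp.coe_add, Pi.add_apply, Finsupp.single_eq_same] at h2
    rw [abs_mul]
    push_cast
    have h3 : |(m i : ℤ) + 1| ≤ (δ : ℤ) + 1 := by
      rw [abs_of_nonneg (by positivity)]
      have : m i + 1 ≤ δ := by omega
      omega
    exact mul_le_mul (hA _) h3 (abs_nonneg _) (by positivity)

set_option maxHeartbeats 1000000 in
theorem pc_gen (k D κ μ : ℕ) (hk1 : 1 ≤ k) (hμ : 1 ≤ μ) (V : ℕ → ℕ → ℕ)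
    (hV : 1 + ∑ c ∈ Finset.range k, ∑ j ∈ Finset.range (D + 1), V c j ≤ μ * (k * (D + 1) * (k * (D + 1) - 1) / 2)) :
    ∃ C : ℕ, 1 ≤ C ∧ ∀ (δ b : ℕ) (h : MvPolynomial (Fin 2) ℤ) (T : Finset (Fin 3 → ℤ)),
    C * (δ + 1) ^ 8 ≤ b → Irreducible (map (Int.castRingHom ℚ) h) → k ≤ degreeOf 0 h → h.totalDegree ≤ δ →
    (∀ t ∈ T, t 1 ≠ 0) → (∀ t ∈ T, ∀ i, |t i| ≤ ((b ^ κ : ℕ) : ℤ)) →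
    (∀ t ∈ T, ∀ c < k, ∀ j ≤ D, |t 0 ^ c * t 2 ^ j * t 1 ^ (D + k - 1 - c - j)| ≤ ((b ^ V c j : ℕ) : ℤ)) →
    (∀ t ∈ T, ∀ t' ∈ T, t 0 * t' 1 = t' 0 * t 1 → t 2 * t' 1 = t' 2 * t 1 → t = t') →
    (∀ t ∈ T, eval (rpt t) (map (Int.castRingHom ℚ) h) = 0) →
    T.card ≤ C * (δ + 1) ^ 8 * b ^ (μ + 1) := by
  classical
  obtain ⟨C1, hC1⟩ : ∃ C1, C1 = 16 + (2 * κ + 3) * (D + k + 1) ^ 4 := ⟨_, rfl⟩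
  refine ⟨C1 + (k * (D + 1)).factorial + 64 * (μ + 1) ^ 2, by omega, ?_⟩
  intro δ b h T hb hirr hk hδ hx hbox hmon hinj hz
  -- reduce to exact degree
  have hmono : (h.totalDegree + 1) ^ 8 ≤ (δ + 1) ^ 8 := Nat.pow_le_pow_left (by omega) 8
  replace hb := (Nat.mul_le_mul_left _ hmono).trans hb
  refine le_trans ?_ (Nat.mul_le_mul_right (b ^ (μ + 1)) (Nat.mul_le_mul_left _ hmono))
  clear hmono hδ δ
  obtain ⟨δ, hδ⟩ : ∃ δ, δ = h.totalDegree := ⟨_, rfl⟩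
  rw [← hδ] at hb ⊢
  obtain ⟨n, hn⟩ : ∃ n, n = δ + 1 := ⟨_, rfl⟩
  rw [← hn] at hb ⊢
  have hn1 : 1 ≤ n := by omega
  have hn8 : 1 ≤ n ^ 8 := Nat.one_le_pow _ _ hn1
  have hCb : C1 + (k * (D + 1)).factorial + 64 * (μ + 1) ^ 2 ≤ b := (Nat.le_mul_of_pos_right _ hn8).trans hb
  have hb2 : 2 ≤ b := by omega
  have hbμ : 1 ≤ b ^ (μ + 1) := Nat.one_le_pow _ _ (by omega)
  have hCn : C1 * n ^ 8 ≤ b := le_trans (Nat.mul_le_mul_right _ (by omega)) hb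
  have hfin : ∀ X, X ≤ C1 * n ^ 8 * b ^ (μ + 1) →
      X ≤ (C1 + (k * (D + 1)).factorial + 64 * (μ + 1) ^ 2) * n ^ 8 * b ^ (μ + 1) := by
    intro X hX
    refine hX.trans ?_
    gcongr
    omega
  apply hfin
  have h48 : n ^ 4 ≤ n ^ 8 := Nat.pow_le_pow_right hn1 (by norm_num)
  have h38 : n ^ 3 ≤ n ^ 8 := Nat.pow_le_pow_right hn1 (by norm_num)
  have hbz : (δ + δ) ^ 4 ≤ 16 * n ^ 8 := by
    calc (δ + δ) ^ 4 ≤ (2 * n) ^ 4 := Nat.pow_le_pow_left (by omega) 4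
      _ = 16 * n ^ 4 := by ring
      _ ≤ _ := by omega
  have hbz2 : 16 * n ^ 8 ≤ C1 * n ^ 8 * b ^ (μ + 1) := by
    calc 16 * n ^ 8 ≤ C1 * n ^ 8 := Nat.mul_le_mul_right _ (by omega)
      _ ≤ _ := Nat.le_mul_of_pos_right _ hbμ
  have hh0 : h ≠ 0 := by
    rintro rfl
    exact hirr.ne_zero (by simp)
  obtain ⟨h', hh'0, hh'd, hh'c, hh'r⟩ := normalize (r := 2) (δ := δ) h hδ.ge hh0 (T := T)
    (fun m t => t.1 0 ^ m 0 * t.1 2 ^ m 1 * t.1 1 ^ (δ - m.degree)) (b ^ (κ * δ)) (Nat.one_le_pow _ _ (by omega))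
    (by
      intro m t hm
      have := abs_mon_le t.1 (b ^ κ) (hbox t.1 t.2) (m 0) (m 1) (δ - m.degree)
      refine this.trans ?_
      have h2 : m 0 + m 1 + (δ - m.degree) = δ := by rw [degree_two] at *; omega
      rw [h2]
      push_cast
      rw [pow_mul])
    (by
      intro t
      exact (homE_zero_iff h δ t.1 hδ.ge (hx t.1 t.2)).2 (hz t.1 t.2))
  have hz' : ∀ t ∈ T, homE h' δ t = 0 := fun t ht => hh'r ⟨t, ht⟩
  by_cases hdv : map (Int.castRingHom ℚ) h ∣ map (Int.castRingHom ℚ) h'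
  · have hh'Q : map (Int.castRingHom ℚ) h' ≠ 0 := by
      intro h0
      exact hh'0 (map_injective _ (RingHom.injective_int _) (by simpa using h0))
    obtain ⟨c, hc0, hc⟩ := irr_of_dvd _ _ hirr hh'Q hdv (by rw [totalDegree_map_Q, totalDegree_map_Q, ← hδ]; exact hh'd)
    have hassoc : Associated (map (Int.castRingHom ℚ) h) (map (Int.castRingHom ℚ) h') := by
      rw [hc, mul_comm]
      exact (associated_mul_unit_right _ _ ((isUnit_iff_ne_zero.2 hc0).map (C (σ := Fin 2))))
    have hirr' := hassoc.irreducible hirr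
    have htd' : h'.totalDegree = δ := by
      rw [hδ, ← totalDegree_map_Q, ← totalDegree_map_Q h, hc, totalDegree_mul_of_isDomain (by simpa using hc0) hirr.ne_zero]
      simp
    have hdeg' : degreeOf 0 h' = degreeOf 0 h := by
      rw [← degreeOf_map_Q, ← degreeOf_map_Q h, hc, degreeOf_mul_eq (by simpa using hc0) hirr.ne_zero]
      simp
    obtain ⟨R, hR⟩ : ∃ R, R = κ + 1 + κ * δ + (1 + κ * δ) * n ^ 2 := ⟨_, rfl⟩
    have hRn : R + 1 ≤ (2 * κ + 3) * n ^ 3 := by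
      have e1 : n ≤ n ^ 3 := Nat.le_self_pow (by norm_num) n
      have e2 : 1 ≤ n ^ 3 := Nat.one_le_pow _ _ hn1
      have e3 : (1 + κ * δ) * n ^ 2 ≤ (1 + κ) * n ^ 3 := by
        calc (1 + κ * δ) * n ^ 2 ≤ ((1 + κ) * n) * n ^ 2 := by
              apply Nat.mul_le_mul_right
              rw [hn]
              have : (1 + κ) * (δ + 1) = 1 + κ + δ + κ * δ := by ring
              omega
          _ = _ := by ring
      have e4 : κ + κ * δ ≤ κ * n ^ 3 := by
        calc κ + κ * δ = κ * n := by rw [hn]; ring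
          _ ≤ _ := Nat.mul_le_mul_left _ e1
      have e5 : (2 * κ + 3) * n ^ 3 = κ * n ^ 3 + (1 + κ) * n ^ 3 + 2 * n ^ 3 := by ring
      omega
    have hRC : R + 1 ≤ C1 * n ^ 8 := by
      refine hRn.trans ?_
      apply Nat.mul_le_mul _ h38
      have : 1 ≤ (D + k + 1) ^ 4 := Nat.one_le_pow _ _ (by omega)
      have := Nat.le_mul_of_pos_right (2 * κ + 3) this
      omega
    have hcore := pc_core k D μ b R hμ V hV (by omega) (by omega) (by omega) h' hirr' hk1 (by omega) T hx hmon hinj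
      (by rw [htd']; exact hz') (by
        intro t ht
        rw [htd']
        have h1 := homE_le (pderiv 0 h') δ t ((totalDegree_pderiv_le _ _).trans hh'd) _ (b ^ κ)
          (coeff_pderiv_le 0 h' hh'd hh'c) (hbox t ht)
        rw [abs_mul]
        refine (mul_le_mul (hbox t ht 1) h1 (abs_nonneg _) (by positivity)).trans ?_
        have hn3 : n ^ 3 ≤ b := by
          refine le_trans ?_ hCn
          exact h38.trans (Nat.le_mul_of_pos_left _ (by omega))
        have hn2 : n ^ 2 ≤ b := le_trans (Nat.pow_le_pow_right hn1 (by norm_num)) hn3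
        have : b ^ κ * ((δ + 1) ^ 2 * ((((δ + 1) ^ 2 * b ^ (κ * δ)) ^ ((δ + 1) ^ 2) * (δ + 1)) * (b ^ κ) ^ δ)) ≤ b ^ R := by
          rw [← hn, hR, ← pow_mul b κ δ]
          calc b ^ κ * (n ^ 2 * (((n ^ 2 * b ^ (κ * δ)) ^ (n ^ 2) * n) * b ^ (κ * δ)))
              = b ^ κ * n ^ 3 * b ^ (κ * δ) * (n ^ 2 * b ^ (κ * δ)) ^ (n ^ 2) := by ring
            _ ≤ b ^ κ * b * b ^ (κ * δ) * (b * b ^ (κ * δ)) ^ (n ^ 2) := by gcongr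
            _ = _ := by
                rw [← pow_succ', ← pow_mul, ← pow_succ, ← pow_add, ← pow_add]
                congr 2
                ring
        exact_mod_cast this)
    refine hcore.trans ?_
    rw [htd']
    have e5 : (δ + (D + k)) ^ 4 ≤ (D + k + 1) ^ 4 * n ^ 4 := by
      rw [← mul_pow]
      apply Nat.pow_le_pow_left
      have e6 : (D + k + 1) * n = (D + k) * δ + δ + (D + k) + 1 := by rw [hn]; ring
      have := Nat.zero_le ((D + k) * δ)
      omega
    calc (δ + δ) ^ 4 + (R + 1) * ((δ + (D + k)) ^ 4 * (δ * b ^ (μ + 1)))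
        ≤ 16 * n ^ 8 * b ^ (μ + 1) + ((2 * κ + 3) * n ^ 3) * (((D + k + 1) ^ 4 * n ^ 4) * (n * b ^ (μ + 1))) := by
          apply Nat.add_le_add
          · exact hbz.trans (Nat.le_mul_of_pos_right _ hbμ)
          · gcongr
            omega
      _ = C1 * n ^ 8 * b ^ (μ + 1) := by rw [hC1]; ring
  · have hB := bezout _ _ hirr hdv (T.image rpt) (by
      intro q hq
      obtain ⟨t, ht, rfl⟩ := Finset.mem_image.1 hq
      exact ⟨hz t ht, (homE_zero_iff h' _ t hh'd (hx t ht)).1 (hz' t ht)⟩)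
    rw [Finset.card_image_of_injOn, totalDegree_map_Q, totalDegree_map_Q, ← hδ] at hB
    · refine hB.trans (le_trans ?_ (hbz.trans hbz2))
      gcongr
    · intro t ht t' ht' heq
      have := rpt_inj (hx t ht) (hx t' ht') heq
      exact hinj t ht t' ht' this.1 this.2

end DG

namespace DG
open MvPolynomial

theorem hom_eval_smul {R σ : Type*} [CommRing R] [Fintype σ] {n : ℕ} (g : MvPolynomial σ R) (hg : g.IsHomogeneous n)
    (s : R) (v : σ → R) : eval (fun i => s * v i) g = s ^ n * eval v g := by
  rw [eval_eq', eval_eq', Finset.mul_sum]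
  apply Finset.sum_congr rfl
  intro m hm
  have h1 : m.degree = n := hg.degree_eq_sum_deg_support hm ▸ rfl
  simp only [mul_pow, Finset.prod_mul_distrib]
  rw [Finset.prod_pow_eq_pow_sum, ← Finsupp.degree_eq_sum, h1]
  ring

theorem totalDegree_aeval_le {R σ τ : Type*} [CommRing R] [Fintype σ] (G : σ → MvPolynomial τ R)
    (k : ℕ) (hG : ∀ i, (G i).totalDegree ≤ k) (f : MvPolynomial σ R) : (aeval G f).totalDegree ≤ k * f.totalDegree := by
  rw [aeval_def, eval₂_eq']
  apply totalDegree_finsetSum_le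
  intro m hm
  refine (totalDegree_mul _ _).trans ?_
  rw [algebraMap_eq, totalDegree_C, zero_add]
  refine (totalDegree_finsetProd _ _).trans ?_
  have h1 := le_totalDegree hm
  change m.degree ≤ _ at h1
  refine le_trans ?_ (Nat.mul_le_mul_left k h1)
  rw [Finsupp.degree_eq_sum, Finset.mul_sum]
  apply Finset.sum_le_sum
  intro i _
  refine (totalDegree_pow _ _).trans ?_
  rw [mul_comm]
  exact Nat.mul_le_mul_right _ (hG i)

theorem totalDegree_aeval_linear {R σ τ : Type*} [CommRing R] [Fintype σ] (G : σ → MvPolynomial τ R)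
    (hG : ∀ i, (G i).totalDegree ≤ 1) (f : MvPolynomial σ R) : (aeval G f).totalDegree ≤ f.totalDegree := by
  simpa using totalDegree_aeval_le G 1 hG f

theorem totalDegree_X_le {R σ : Type*} [CommRing R] (i : σ) : (X i : MvPolynomial σ R).totalDegree ≤ 1 :=
  (isHomogeneous_X R i).totalDegree_le

/-- restriction to a line -/
theorem coeff_line {R σ : Type*} [CommRing R] [Fintype σ] (f : MvPolynomial σ R) (d : ℕ) (hd : f.totalDegree ≤ d)
    (v p : σ → R) :
    (aeval (fun i => Polynomial.C (v i) * Polynomial.X + Polynomial.C (p i)) f).coeff d =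
      eval v (homogeneousComponent d f) := by
  classical
  have key : ∀ (s : Finset σ) (m : σ → ℕ),
      (∏ i ∈ s, (Polynomial.C (v i) * Polynomial.X + Polynomial.C (p i)) ^ m i).natDegree ≤ ∑ i ∈ s, m i ∧
      (∏ i ∈ s, (Polynomial.C (v i) * Polynomial.X + Polynomial.C (p i)) ^ m i).coeff (∑ i ∈ s, m i) =
        ∏ i ∈ s, v i ^ m i := by
    intro s m
    induction s using Finset.induction_on with
    | empty => simp
    | insert a s ha ih =>
      rw [Finset.prod_insert ha, Finset.sum_insert ha, Finset.prod_insert ha]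
      have h1 : (Polynomial.C (v a) * Polynomial.X + Polynomial.C (p a)).natDegree ≤ 1 :=
        Polynomial.natDegree_linear_le
      have h2 : ((Polynomial.C (v a) * Polynomial.X + Polynomial.C (p a)) ^ m a).natDegree ≤ m a := by
        refine Polynomial.natDegree_pow_le.trans ?_
        nlinarith
      constructor
      · exact Polynomial.natDegree_mul_le.trans (add_le_add h2 ih.1)
      · rw [Polynomial.coeff_mul_add_eq_of_natDegree_le h2 ih.1, ih.2]
        congr 1
        have := Polynomial.coeff_pow_of_natDegree_le (m := m a) h1
        rw [mul_one] at this
        rw [this]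
        simp
  rw [aeval_def, eval₂_eq', Polynomial.finsetSum_coeff, homogeneousComponent_apply, map_sum, Finset.sum_filter]
  apply Finset.sum_congr rfl
  intro m hm
  have h1 := le_totalDegree hm
  change m.degree ≤ _ at h1
  have hk := key Finset.univ m
  rw [← Finsupp.degree_eq_sum] at hk
  rw [Polynomial.algebraMap_eq, Polynomial.coeff_C_mul]
  split_ifs with h2
  · rw [eval_monomial, ← h2, hk.2, Finsupp.prod_fintype _ _ (by simp)]
  · rw [Polynomial.coeff_eq_zero_of_natDegree_lt (lt_of_le_of_lt hk.1 (by omega)), mul_zero]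

theorem exists_grid {K σ : Type*} [CommRing K] [IsDomain K] [CharZero K] [Finite σ] (a : MvPolynomial σ K) (ha : a ≠ 0)
    (n : ℕ) (hn : a.totalDegree ≤ n) : ∃ c : σ → ℕ, (∀ i, c i ≤ n) ∧ eval (fun i => (c i : K)) a ≠ 0 := by
  classical
  by_contra hcon
  push Not at hcon
  apply ha
  apply eq_zero_of_eval_zero_at_prod_finset a (fun _ => (Finset.range (n + 1)).image (Nat.cast : ℕ → K))
  · intro i
    rw [Finset.card_image_of_injective _ Nat.cast_injective, Finset.card_range]
    have := degreeOf_le_totalDegree a i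
    omega
  · intro x hx
    have : ∀ i, ∃ c : ℕ, c ≤ n ∧ (c : K) = x i := by
      intro i
      obtain ⟨c, hc, hcx⟩ := Finset.mem_image.1 (hx i)
      exact ⟨c, by simpa [Nat.lt_succ_iff] using hc, hcx⟩
    choose c hc hcx using this
    have := hcon c hc
    simpa only [hcx] using this

noncomputable def shearHom {R : Type*} [CommRing R] {r : ℕ} (c : Fin r → R) :
    MvPolynomial (Fin (r + 1)) R →ₐ[R] MvPolynomial (Fin (r + 1)) R :=
  aeval (Fin.cons (X 0) (fun i => X i.succ + C (c i) * X 0) : Fin (r + 1) → MvPolynomial (Fin (r + 1)) R)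

theorem shearHom_comp {R : Type*} [CommRing R] {r : ℕ} (c c' : Fin r → R) (h : ∀ i, c i + c' i = 0) :
    (shearHom c).comp (shearHom c') = AlgHom.id R _ := by
  apply algHom_ext
  intro i
  refine Fin.cases ?_ (fun i => ?_) i
  · simp [shearHom]
  · have := h i
    simp only [shearHom, AlgHom.comp_apply, aeval_X, Fin.cons_succ, map_add, map_mul, Fin.cons_zero, AlgHom.id_apply]
    rw [algHom_C, algebraMap_eq, add_assoc, ← add_mul, ← C_add, this]
    simp

noncomputable def shear {R : Type*} [CommRing R] {r : ℕ} (c : Fin r → R) :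
    MvPolynomial (Fin (r + 1)) R ≃ₐ[R] MvPolynomial (Fin (r + 1)) R :=
  AlgEquiv.ofAlgHom (shearHom c) (shearHom (fun i => - c i)) (shearHom_comp _ _ (by simp)) (shearHom_comp _ _ (by simp))

theorem shear_apply {R : Type*} [CommRing R] {r : ℕ} (c : Fin r → R) (g) : shear c g =
  aeval (Fin.cons (X 0) (fun i => X i.succ + C (c i) * X 0) : Fin (r + 1) → MvPolynomial (Fin (r + 1)) R) g := rfl

theorem eval_shear {R : Type*} [CommRing R] {r : ℕ} (c : Fin r → R) (g) (p : Fin (r + 1) → R) :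
    eval p (shear c g) = eval (Fin.cons (p 0) (fun i => p i.succ + c i * p 0) : Fin (r+1) → R) g := by
  rw [shear_apply]
  induction g using MvPolynomial.induction_on with
  | C a => simp
  | add a b ha hb => simp only [map_add, ha, hb]
  | mul_X a i ha =>
    simp only [map_mul, ha, aeval_X, eval_X]
    congr 1
    refine Fin.cases ?_ (fun i => ?_) i <;> simp

theorem map_shear {R S : Type*} [CommRing R] [CommRing S] (φ : R →+* S) {r : ℕ} (c : Fin r → R) (g) :
    map φ (shear c g) = shear (fun i => φ (c i)) (map φ g) := by
  rw [shear_apply, shear_apply]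
  induction g using MvPolynomial.induction_on with
  | C a => simp
  | add a b ha hb => simp only [map_add, ha, hb]
  | mul_X a i ha =>
    simp only [map_mul, ha, aeval_X, map_X]
    congr 1
    refine Fin.cases ?_ (fun i => ?_) i <;> simp

theorem totalDegree_shear_le {R : Type*} [CommRing R] {r : ℕ} (c : Fin r → R) (g) :
    (shear c g).totalDegree ≤ g.totalDegree := by
  apply totalDegree_aeval_linear
  intro i
  refine Fin.cases ?_ (fun i => ?_) i
  · exact totalDegree_X_le _
  · rw [Fin.cons_succ]
    refine (totalDegree_add _ _).trans (max_le (totalDegree_X_le _) ?_)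
    refine (totalDegree_mul _ _).trans ?_
    rw [totalDegree_C, zero_add]
    exact totalDegree_X_le _

theorem shear_hom {R : Type*} [CommRing R] {r n : ℕ} (c : Fin r → R) (g : MvPolynomial (Fin (r+1)) R)
    (hg : g.IsHomogeneous n) : (shear c g).IsHomogeneous n := by
  rw [shear_apply]
  have := hg.aeval (n := 1) (Fin.cons (X 0) (fun i => X i.succ + C (c i) * X 0) : Fin (r + 1) → MvPolynomial (Fin (r + 1)) R)
    (by
      intro i
      refine Fin.cases ?_ (fun i => ?_) i
      · exact isHomogeneous_X _ _
      · rw [Fin.cons_succ]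
        exact (isHomogeneous_X _ _).add (isHomogeneous_C_mul_X _ _))
  simpa using this

theorem coeff_axis {R : Type*} [CommRing R] {r : ℕ} (g : MvPolynomial (Fin (r+1)) R) (n : ℕ) :
    (aeval (Fin.cons Polynomial.X (fun _ => 0) : Fin (r+1) → Polynomial R) g).coeff n = coeff (Finsupp.single 0 n) g := by
  classical
  induction g using MvPolynomial.induction_on' with
  | monomial m a =>
    rw [aeval_monomial, Finsupp.prod_fintype _ _ (by simp), Fin.prod_univ_succ, Fin.cons_zero, coeff_monomial]
    simp only [Fin.cons_succ]
    rw [Polynomial.algebraMap_eq, Polynomial.coeff_C_mul]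
    by_cases hm : ∀ i : Fin r, m i.succ = 0
    · simp only [hm, pow_zero, Finset.prod_const_one, mul_one, Polynomial.coeff_X_pow]
      have : m = Finsupp.single 0 n ↔ n = m 0 := by
        constructor
        · intro h; rw [h]; simp
        · intro h
          refine Finsupp.ext fun i => ?_
          refine Fin.cases ?_ (fun i => ?_) i
          · simp [h]
          · simp [hm]
      simp [this]
    · push Not at hm
      obtain ⟨i, hi⟩ := hm
      rw [Finset.prod_eq_zero (Finset.mem_univ i) (zero_pow hi), mul_zero, Polynomial.coeff_zero, mul_zero, if_neg]
      rintro rfl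
      simp at hi
  | add a b ha hb => simp only [map_add, Polynomial.coeff_add, coeff_add, ha, hb]

theorem coeff_shear {R : Type*} [CommRing R] {r : ℕ} (c : Fin r → R) (g : MvPolynomial (Fin (r+1)) R) (n : ℕ)
    (hn : g.totalDegree ≤ n) :
    coeff (Finsupp.single 0 n) (shear c g) = eval (Fin.cons 1 c : Fin (r+1) → R) (homogeneousComponent n g) := by
  rw [← coeff_axis, ← coeff_line g n hn _ 0]
  congr 1
  have : (aeval (Fin.cons Polynomial.X (fun _ => 0) : Fin (r+1) → Polynomial R)).comp (shearHom c) =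
      aeval (fun i => Polynomial.C ((Fin.cons 1 c : Fin (r+1) → R) i) * Polynomial.X + Polynomial.C ((0 : Fin (r+1) → R) i)) := by
    apply algHom_ext
    intro i
    refine Fin.cases ?_ (fun i => ?_) i <;> simp [shearHom]
  exact AlgHom.congr_fun this g

theorem exists_shear {r : ℕ} (g : MvPolynomial (Fin (r+1)) ℤ) (hg : g ≠ 0) :
    ∃ c : Fin r → ℕ, (∀ i, c i ≤ g.totalDegree) ∧
      coeff (Finsupp.single 0 g.totalDegree) (shear (fun i => (c i : ℤ)) g) ≠ 0 := by
  set n := g.totalDegree with hn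
  set G := homogeneousComponent n g with hG
  have hGh : G.IsHomogeneous n := homogeneousComponent_isHomogeneous _ _
  have hG0 : G ≠ 0 := by
    obtain ⟨m, hm, hmd⟩ := Finset.exists_mem_eq_sup g.support (support_nonempty.2 hg) (fun m => m.degree)
    intro h0
    have h1 := coeff_homogeneousComponent n g m
    rw [← hG, h0, if_pos, coeff_zero] at h1
    · exact mem_support_iff.1 hm h1.symm
    · rw [← hmd]; rfl
  let A : MvPolynomial (Fin r) ℤ := aeval (Fin.cons 1 X : Fin (r+1) → MvPolynomial (Fin r) ℤ) G
  have hAe : ∀ c : Fin r → ℤ, eval c A = eval (Fin.cons 1 c : Fin (r+1) → ℤ) G := by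
    intro c
    have : (eval c).comp (aeval (Fin.cons 1 X : Fin (r+1) → MvPolynomial (Fin r) ℤ)).toRingHom =
        eval (Fin.cons 1 c : Fin (r+1) → ℤ) := by
      apply ringHom_ext
      · intro a; simp
      · intro i
        refine Fin.cases ?_ (fun i => ?_) i <;> simp
    exact RingHom.congr_fun this G
  have hAd : A.totalDegree ≤ n := by
    refine (totalDegree_aeval_linear _ ?_ _).trans hGh.totalDegree_le
    intro i
    refine Fin.cases ?_ (fun i => ?_) i
    · simp
    · rw [Fin.cons_succ]; exact totalDegree_X_le _
  have hA0 : A ≠ 0 := by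
    intro hA
    obtain ⟨p, hp⟩ : ∃ p : Fin (r+1) → ℤ, eval p (X 0 * G) ≠ 0 := by
      by_contra hcon
      push Not at hcon
      have : X 0 * G = 0 := MvPolynomial.funext (fun p => by rw [hcon p, map_zero])
      exact (mul_ne_zero (X_ne_zero _) hG0) this
    rw [map_mul, eval_X] at hp
    have hp0 : (p 0 : ℚ) ≠ 0 := by exact_mod_cast left_ne_zero_of_mul hp
    apply right_ne_zero_of_mul hp
    have hQ : ∀ q : Fin r → ℚ, eval (Fin.cons 1 q : Fin (r+1) → ℚ) (map (Int.castRingHom ℚ) G) = 0 := by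
      intro q
      have h1 : (eval₂Hom (Int.castRingHom ℚ) q).comp (aeval (Fin.cons 1 X : Fin (r+1) → MvPolynomial (Fin r) ℤ)).toRingHom =
        (eval (Fin.cons 1 q : Fin (r+1) → ℚ)).comp (map (Int.castRingHom ℚ)) := by
        apply ringHom_ext
        · intro a; simp
        · intro i
          refine Fin.cases ?_ (fun i => ?_) i <;> simp
      have h2 := RingHom.congr_fun h1 G
      simp only [RingHom.comp_apply] at h2
      rw [← h2]
      change (eval₂Hom (Int.castRingHom ℚ) q) A = 0
      rw [hA, map_zero]
    have h3 := hom_eval_smul (map (Int.castRingHom ℚ) G) (hGh.map _) (p 0 : ℚ)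
      (Fin.cons 1 (fun i => (p i.succ : ℚ) / p 0))
    rw [hQ, mul_zero] at h3
    have h4 : (fun i => (p 0 : ℚ) * (Fin.cons 1 (fun i => (p i.succ : ℚ) / p 0) : Fin (r+1) → ℚ) i) =
        fun i => Int.castRingHom ℚ (p i) := by
      funext i
      refine Fin.cases ?_ (fun i => ?_) i
      · simp
      · simp only [Fin.cons_succ, eq_intCast]; field_simp
    rw [h4] at h3
    have h5 := eval₂_comp_left (Int.castRingHom ℚ) (RingHom.id ℤ) p G
    rw [eval_map] at h3
    have h6 : Int.castRingHom ℚ (eval p G) = 0 := by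
      rw [← h3]
      rw [eval₂_id] at h5 
      simpa [Function.comp_def] using h5
    simpa using h6
  obtain ⟨c, hc, hce⟩ := exists_grid A hA0 n hAd
  refine ⟨c, hc, ?_⟩
  rw [coeff_shear _ _ _ hn.ge, ← hG, ← hAe]
  exact hce

end DG

namespace DG
open MvPolynomial

theorem exists_int_mul {σ : Type*} (h : MvPolynomial σ ℚ) :
    ∃ (c : ℤ) (h' : MvPolynomial σ ℤ), c ≠ 0 ∧ map (Int.castRingHom ℚ) h' = C (c : ℚ) * h := by
  classical
  induction h using MvPolynomial.induction_on' with
  | monomial m a =>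
    refine ⟨a.den, monomial m a.num, by exact_mod_cast a.den_ne_zero, ?_⟩
    rw [map_monomial, C_mul_monomial]
    congr 1
    simp [Rat.den_mul_eq_num]
  | add p q hp hq =>
    obtain ⟨c, p', hc, hp'⟩ := hp
    obtain ⟨e, q', he, hq'⟩ := hq
    refine ⟨c * e, C e * p' + C c * q', mul_ne_zero hc he, ?_⟩
    rw [map_add, map_mul, map_mul, hp', hq', map_C, map_C]
    simp only [eq_intCast, Int.cast_mul, C_mul]
    ring

theorem irr_of_int_mul {σ : Type*} {h : MvPolynomial σ ℚ} {c : ℤ} {h' : MvPolynomial σ ℤ} (hc : c ≠ 0)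
    (hh : map (Int.castRingHom ℚ) h' = C (c : ℚ) * h) (hi : Irreducible h) :
    Irreducible (map (Int.castRingHom ℚ) h') := by
  rw [hh]
  have hu : IsUnit (C (c : ℚ) : MvPolynomial σ ℚ) := (isUnit_iff_ne_zero.2 (by exact_mod_cast hc)).map C
  exact (irreducible_isUnit_mul hu).2 hi

theorem totalDegree_of_int_mul {r : ℕ} {h : MvPolynomial (Fin r) ℚ} {c : ℤ} {h' : MvPolynomial (Fin r) ℤ} (hc : c ≠ 0)
    (hh : map (Int.castRingHom ℚ) h' = C (c : ℚ) * h) : h'.totalDegree = h.totalDegree := by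
  rw [← totalDegree_map_Q, hh]
  by_cases h0 : h = 0
  · rw [h0, mul_zero]
  rw [totalDegree_mul_of_isDomain (by simpa using hc) h0, totalDegree_C, zero_add]

theorem degreeOf_of_int_mul {h : MvPolynomial (Fin 2) ℚ} {c : ℤ} {h' : MvPolynomial (Fin 2) ℤ} (hc : c ≠ 0)
    (hh : map (Int.castRingHom ℚ) h' = C (c : ℚ) * h) (i : Fin 2) : h'.degreeOf i = h.degreeOf i := by
  rw [← degreeOf_map_Q, hh]
  by_cases h0 : h = 0
  · rw [h0, mul_zero]
  rw [degreeOf_mul_eq (by simpa using hc) h0, degreeOf_C, zero_add]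

theorem eval_of_int_mul {σ : Type*} {h : MvPolynomial σ ℚ} {c : ℤ} {h' : MvPolynomial σ ℤ} (hc : c ≠ 0)
    (hh : map (Int.castRingHom ℚ) h' = C (c : ℚ) * h) (p : σ → ℚ) :
    eval p (map (Int.castRingHom ℚ) h') = 0 ↔ eval p h = 0 := by
  rw [hh, map_mul, eval_C]
  have : (c : ℚ) ≠ 0 := by exact_mod_cast hc
  simp [this]

theorem pc_proj : ∃ C : ℕ, 1 ≤ C ∧ ∀ (δ b : ℕ) (h : MvPolynomial (Fin 2) ℚ) (T : Finset (Fin 3 → ℤ)),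
    C * (δ + 1) ^ 8 ≤ b → Irreducible h → 5 ≤ degreeOf 0 h → h.totalDegree ≤ δ →
    (∀ t ∈ T, t 1 ≠ 0) → (∀ t ∈ T, ∀ i, |t i| ≤ ((b ^ 8 : ℕ) : ℤ)) →
    (∀ t ∈ T, ∀ t' ∈ T, t 0 * t' 1 = t' 0 * t 1 → t 2 * t' 1 = t' 2 * t 1 → t = t') →
    (∀ t ∈ T, eval (rpt t) h = 0) →
    T.card ≤ C * (δ + 1) ^ 8 * b ^ 5 := by
  obtain ⟨C, hC1, hC⟩ := pc_gen 5 20 8 4 (by norm_num) (by norm_num) (fun _ _ => 192) (by simp)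
  refine ⟨C, hC1, ?_⟩
  intro δ b h T hb hi hd hδ hx hbox hinj hz
  obtain ⟨c, h', hc, hh⟩ := exists_int_mul h
  refine hC δ b h' T hb (irr_of_int_mul hc hh hi) (by rw [degreeOf_of_int_mul hc hh]; exact hd)
    (by rw [totalDegree_of_int_mul hc hh]; exact hδ) hx hbox ?_ hinj
    (fun t ht => (eval_of_int_mul hc hh _).2 (hz t ht))
  intro t ht c hc j hj
  have hb1 : 1 ≤ b := by
    refine le_trans ?_ hb
    exact Nat.mul_pos hC1 (by positivity)
  have h1 := abs_mon_le t (b ^ 8) (hbox t ht) c j (20 + 5 - 1 - c - j)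
  have h2 : (b ^ 8) ^ (c + j + (20 + 5 - 1 - c - j)) ≤ b ^ 192 := by
    rw [← pow_mul]
    apply Nat.pow_le_pow_right hb1
    omega
  refine h1.trans ?_
  exact_mod_cast h2

theorem pc_affine : ∃ C : ℕ, 1 ≤ C ∧ ∀ (δ b : ℕ) (h : MvPolynomial (Fin 2) ℚ) (T : Finset (Fin 2 → ℤ)),
    C * (δ + 1) ^ 8 ≤ b → Irreducible h → 2 ≤ h.totalDegree → h.totalDegree ≤ δ →
    (∀ t ∈ T, ∀ i, |t i| ≤ ((b ^ 10000 : ℕ) : ℤ)) →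
    (∀ t ∈ T, eval (fun i => (t i : ℚ)) h = 0) →
    T.card ≤ C * (δ + 1) ^ 8 * b ^ 5051 := by
  classical
  obtain ⟨C, hC1, hC⟩ := pc_gen 2 100 10001 5050 (by norm_num) (by norm_num) (fun c j => 10001 * (c + j))
    (by
      simp only [← Finset.mul_sum, Finset.sum_add_distrib, Finset.sum_const, Finset.card_range, smul_eq_mul,
        Finset.sum_range_succ, Finset.sum_range_zero]
      norm_num)
  refine ⟨C, hC1, ?_⟩
  intro δ b h T hb hi hd hδ hbox hz
  obtain ⟨a, h0, ha, hh⟩ := exists_int_mul h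
  have hi0 := irr_of_int_mul ha hh hi
  have hd0 := totalDegree_of_int_mul ha hh
  have hh0 : h0 ≠ 0 := by rintro rfl; simp at hi0
  obtain ⟨c, hc, hce⟩ := exists_shear h0 hh0
  obtain ⟨h', hh'⟩ : ∃ h', h' = shear (fun i => (c i : ℤ)) h0 := ⟨_, rfl⟩
  rw [← hh'] at hce
  have hb1 : δ + 1 ≤ b := by
    refine le_trans ?_ hb
    calc δ + 1 ≤ (δ + 1) ^ 8 := Nat.le_self_pow (by norm_num) _
      _ ≤ C * (δ + 1) ^ 8 := Nat.le_mul_of_pos_left _ hC1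
  let φ : (Fin 2 → ℤ) → (Fin 3 → ℤ) := fun t => ![t 0, 1, t 1 - c 0 * t 0]
  have hφ : Function.Injective φ := by
    intro t t' h
    have e0 := congrFun h 0
    have e2 := congrFun h 2
    simp only [φ, Matrix.cons_val] at e0 e2
    rw [e0] at e2
    funext i
    fin_cases i
    · exact e0
    · simpa using e2
  rw [← Finset.card_image_of_injective T hφ]
  have hbound : ∀ t ∈ T, |t 0| ≤ ((b ^ 10001 : ℕ) : ℤ) ∧ |t 1 - c 0 * t 0| ≤ ((b ^ 10001 : ℕ) : ℤ) := by
    intro t ht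
    have e0 := hbox t ht 0
    have e1 := hbox t ht 1
    have hc0 : (c 0 : ℤ) ≤ δ := by exact_mod_cast (hc 0).trans (hd0.le.trans hδ)
    have hbb : ((b ^ 10001 : ℕ) : ℤ) = b * ((b ^ 10000 : ℕ) : ℤ) := by
      rw [pow_succ]; push_cast; ring
    have hb' : (δ : ℤ) + 1 ≤ b := by exact_mod_cast hb1
    generalize ((b ^ 10000 : ℕ) : ℤ) = N at *
    have hN : 0 ≤ N := (abs_nonneg _).trans e0
    rw [hbb]
    constructor
    · nlinarith
    · calc |t 1 - c 0 * t 0| ≤ |t 1| + |(c 0 : ℤ) * t 0| := abs_sub _ _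
        _ = |t 1| + (c 0 : ℤ) * |t 0| := by rw [abs_mul, Nat.abs_cast]
        _ ≤ N + δ * N := add_le_add e1 (mul_le_mul hc0 e0 (abs_nonneg _) (by positivity))
        _ = (δ + 1) * N := by ring
        _ ≤ b * N := mul_le_mul_of_nonneg_right hb' hN
  refine hC δ b h' _ hb ?_ ?_ ?_ ?_ ?_ ?_ ?_ ?_
  · rw [hh', map_shear]
    exact (MulEquiv.irreducible_iff (shear _)).2 hi0
  · have : Finsupp.single 0 h0.totalDegree ∈ h'.support := mem_support_iff.2 hce
    have := monomial_le_degreeOf 0 this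
    simp at this
    omega
  · rw [hh']
    exact (totalDegree_shear_le _ _).trans (hd0.le.trans hδ)
  · intro t ht
    obtain ⟨u, hu, rfl⟩ := Finset.mem_image.1 ht
    simp [φ]
  · intro t ht i
    obtain ⟨u, hu, rfl⟩ := Finset.mem_image.1 ht
    fin_cases i
    · exact (hbound u hu).1
    · simp only [φ]
      simp
      exact_mod_cast Nat.one_le_pow _ _ (by omega)
    · exact (hbound u hu).2
  · intro t ht c' hc' j hj
    obtain ⟨u, hu, rfl⟩ := Finset.mem_image.1 ht
    simp only [φ, Matrix.cons_val, one_pow, mul_one, abs_mul, abs_pow]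
    rw [pow_mul, pow_add]
    push_cast
    have h1 := (hbound u hu).1
    have h2 := (hbound u hu).2
    push_cast at h1 h2
    exact mul_le_mul (pow_le_pow_left₀ (abs_nonneg _) h1 _) (pow_le_pow_left₀ (abs_nonneg _) h2 _) (by positivity) (by positivity)
  · intro t ht t' ht'
    obtain ⟨u, hu, rfl⟩ := Finset.mem_image.1 ht
    obtain ⟨u', hu', rfl⟩ := Finset.mem_image.1 ht'
    intro e0 e2
    simp only [φ, Matrix.cons_val, mul_one] at e0 e2
    simp only [φ]
    rw [e2, e0]
  · intro t ht
    obtain ⟨u, hu, rfl⟩ := Finset.mem_image.1 ht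
    rw [hh', map_shear, eval_shear]
    have := (eval_of_int_mul ha hh _).2 (hz u hu)
    convert this using 2
    congr 1
    funext i
    fin_cases i
    · simp [rpt, φ]
    · simp [rpt, φ]
end DG

namespace DG
open MvPolynomial

theorem degreeOf_zero_of_coeff {K : Type*} [CommRing K] {r d : ℕ} (f : MvPolynomial (Fin (r + 1)) K)
    (hc : coeff (Finsupp.single 0 d) f ≠ 0) : d ≤ degreeOf 0 f := by
  have := monomial_le_degreeOf 0 (mem_support_iff.2 hc)
  simpa using this

theorem sum_tri (D : ℕ) : 2 * ∑ m ∈ Finset.range (D + 1), (m + 1) = (D + 1) * (D + 2) := by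
  induction D with
  | zero => simp
  | succ D ih => rw [Finset.sum_range_succ, mul_add, ih]; ring

theorem sum_tri2 (D c : ℕ) : 6 * ∑ m ∈ Finset.range (D + 1), (m + 1) * (c + m) = (D + 1) * (D + 2) * (2 * D + 3 * c) := by
  induction D with
  | zero => simp; ring
  | succ D ih => rw [Finset.sum_range_succ, mul_add, ih]; ring

theorem surf_aux_gen (D E e s K : ℕ) (hs : 2 * s = 5 * ((D + 1) * (D + 2))) (hK : 6 * K = E * (E + 1) * (E + 2))
    (hE : e + K ≤ s * E) (he1 : 1 ≤ e)
    (hS : 1 + 10000 * ∑ c ∈ Finset.range 5, ∑ m ∈ Finset.range (D + 1), (m + 1) * (c + m) ≤ 4500 * e)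
    (d b : ℕ) (hd5 : 5 ≤ d) (hfac : s.factorial ≤ b) (f : MvPolynomial (Fin 3) ℤ)
    (hc : coeff (Finsupp.single 0 d) f ≠ 0)
    (T : Finset (Fin 3 → ℤ)) (hbox : ∀ t ∈ T, ∀ i, |t i| ≤ ((b ^ 10000 : ℕ) : ℤ))
    (hz : ∀ t ∈ T, eval t f = 0) (P : Finset ℕ) (hP : ∀ q ∈ P, q.Prime ∧ b ^ 450 < q) (hPc : P.card = 10)
    (hgood : ∀ q ∈ P, ∀ t ∈ T, ¬ (q : ℤ) ∣ eval t (pderiv 0 f))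
    (hcls : ∀ q ∈ P, ∀ t ∈ T, ∀ t' ∈ T, ∀ i, (q : ℤ) ∣ t i - t' i) :
    ∃ g : MvPolynomial (Fin 3) ℚ, g.totalDegree ≤ D + 5 ∧ ¬ map (Int.castRingHom ℚ) f ∣ g ∧
      ∀ t ∈ T, eval (fun i => (t i : ℚ)) g = 0 := by
  classical
  rcases T.eq_empty_or_nonempty with rfl | ⟨t0, ht0⟩
  · refine ⟨1, by simp, ?_, by simp⟩
    intro h
    have h1 : IsUnit (map (Int.castRingHom ℚ) f) := isUnit_of_dvd_one h
    have h2 := (MvPolynomial.isUnit_iff_eq_C_of_isReduced).1 h1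
    obtain ⟨r, hr, hr2⟩ := h2
    have h3 : coeff (Finsupp.single 0 d) (map (Int.castRingHom ℚ) f) ≠ 0 := by
      rw [coeff_map]; simpa using hc
    apply h3
    rw [hr2, coeff_C, if_neg]
    intro h4
    have := DFunLike.congr_fun h4 0
    simp at this
    omega
  have hb1 : 1 ≤ b := le_trans (Nat.factorial_pos s) hfac
  let I := Fin 5 × (Σ m : Fin (D + 1), Fin ((m : ℕ) + 1))
  have hcard : Fintype.card I = s := by
    have h1 : Fintype.card I = 5 * ∑ m : Fin (D + 1), ((m : ℕ) + 1) := by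
      simp [I]
    rw [Fin.sum_univ_eq_sum_range (fun m => m + 1)] at h1
    have := sum_tri D
    rw [h1]
    omega
  let ε : I ≃ Fin s := Fintype.equivFinOfCardEq hcard
  let mm : I → (Fin 3 →₀ ℕ) := fun i => Finsupp.single 0 (i.1 : ℕ) + Finsupp.single 1 (i.2.2 : ℕ) +
    Finsupp.single 2 ((i.2.1 : ℕ) - (i.2.2 : ℕ))
  have hmm0 : ∀ i, mm i 0 = (i.1 : ℕ) := by intro i; simp [mm]
  have hmm1 : ∀ i, mm i 1 = (i.2.2 : ℕ) := by intro i; simp [mm]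
  have hmm2 : ∀ i, mm i 2 = (i.2.1 : ℕ) - (i.2.2 : ℕ) := by intro i; simp [mm]
  have hle : ∀ i : I, (i.2.2 : ℕ) ≤ (i.2.1 : ℕ) := fun i => Nat.lt_succ_iff.1 i.2.2.2
  have hmminj : Function.Injective mm := by
    rintro ⟨c, m, i⟩ ⟨c', m', i'⟩ hij
    have e0 : (c : ℕ) = c' := by rw [← hmm0 ⟨c, m, i⟩, hij, hmm0]
    have e1 : (i : ℕ) = i' := by rw [← hmm1 ⟨c, m, i⟩, hij, hmm1]
    have e2 : (m : ℕ) - (i : ℕ) = m' - i' := by rw [← hmm2 ⟨c, m, i⟩, hij, hmm2]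
    have e3 : (m : ℕ) = m' := by
      have := hle ⟨c, m, i⟩
      have := hle ⟨c', m', i'⟩
      simp only at *
      omega
    obtain rfl := Fin.ext e0
    obtain rfl := Fin.ext e3
    obtain rfl := Fin.ext e1
    rfl
  let F : Fin s → T → ℤ := fun j t => ∏ l, t.1 l ^ (mm (ε.symm j) l)
  have hdeg : ∀ i, ∑ l, mm i l = (i.1 : ℕ) + (i.2.1 : ℕ) := by
    intro i
    rw [Fin.sum_univ_three, hmm0, hmm1, hmm2]
    have := hle i
    omega
  obtain ⟨a, ha, hrel⟩ := aux_general (r := 2) (s := s) (e := e) (E := E) (K := K)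
    (by
      intro A
      have := K_two E A
      omega) hE F (fun j => b ^ (10000 * (((ε.symm j).1 : ℕ) + ((ε.symm j).2.1 : ℕ))))
    (by
      intro j t
      simp only [F]
      rw [Finset.abs_prod, ← hdeg, pow_mul, ← Finset.prod_pow_eq_pow_sum]
      push_cast
      apply Finset.prod_le_prod
      · intro _ _; positivity
      · intro l _
        rw [abs_pow]
        have := hbox t.1 t.2 l
        push_cast at this
        exact pow_le_pow_left₀ (abs_nonneg _) this _) P (fun q hq => (hP q hq).1)
    (by
      rw [Finset.prod_pow_eq_pow_sum, ← Finset.mul_sum]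
      have h1 : ∑ j : Fin s, (((ε.symm j).1 : ℕ) + ((ε.symm j).2.1 : ℕ)) =
          ∑ c ∈ Finset.range 5, ∑ m ∈ Finset.range (D + 1), (m + 1) * (c + m) := by
        rw [Equiv.sum_comp ε.symm (fun q : I => (q.1 : ℕ) + (q.2.1 : ℕ)), Fintype.sum_prod_type]
        rw [← Fin.sum_univ_eq_sum_range (fun c => ∑ m ∈ Finset.range (D + 1), (m + 1) * (c + m))]
        apply Finset.sum_congr rfl
        intro c _
        rw [← Fin.sum_univ_eq_sum_range (fun m => (m + 1) * ((c : ℕ) + m)), Fintype.sum_sigma]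
        apply Finset.sum_congr rfl
        intro m _
        simp
      rw [h1]
      calc _ ≤ b * b ^ (10000 * ∑ c ∈ Finset.range 5, ∑ m ∈ Finset.range (D + 1), (m + 1) * (c + m)) :=
            Nat.mul_le_mul_right _ hfac
        _ = b ^ (1 + 10000 * ∑ c ∈ Finset.range 5, ∑ m ∈ Finset.range (D + 1), (m + 1) * (c + m)) := by
            rw [pow_add b 1, pow_one]
        _ ≤ b ^ (4500 * e) := Nat.pow_le_pow_right hb1 hS
        _ = ∏ q ∈ P, (b ^ 450) ^ e := by
            rw [Finset.prod_const, hPc, ← pow_mul, ← pow_mul]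
            congr 1; ring
        _ < ∏ q ∈ P, q ^ e := by
            apply Finset.prod_lt_prod_of_nonempty
            · intro q _; positivity
            · intro q hq
              exact Nat.pow_lt_pow_left (hP q hq).2 (by omega)
            · rw [← Finset.card_pos]; omega) (by
      intro q hq
      refine ⟨map (Int.castRingHom (ZMod (q ^ e))) f, fun i => (t0 i : ZMod (q ^ e)),
        fun j => monomial (mm (ε.symm j)) 1, fun t i => (t.1 i : ZMod (q ^ e)), fun _ => 1, ?_, ?_, ?_, ?_⟩
      · have h2 := unit_zmod (e := e) (hP q hq).1 _ (hgood q hq t0 ht0)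
        have h3 := eval₂_comp_left (Int.castRingHom (ZMod (q ^ e))) (RingHom.id ℤ) t0 (pderiv 0 f)
        rw [eval₂_id] at h3
        rw [pderiv_map, eval_map]
        simp only [eq_intCast, RingHom.comp_id, Function.comp_def] at h3
        rw [h3] at h2
        exact h2
      · intro t j
        obtain ⟨w, hw⟩ := hcls q hq t.1 t.2 t0 ht0 j
        refine ⟨w, ?_⟩
        have hw' := congrArg (Int.cast : ℤ → (ZMod (q ^ e))) hw
        push_cast at hw'
        exact hw'
      · intro t
        have h3 := eval₂_comp_left (Int.castRingHom (ZMod (q ^ e))) (RingHom.id ℤ) t.1 f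
        rw [eval₂_id, hz t.1 t.2] at h3
        rw [eval_map]
        simp only [eq_intCast, RingHom.comp_id, Function.comp_def, Int.cast_zero] at h3
        exact h3.symm
      · intro j t
        simp only [F]
        rw [eval_monomial, Finsupp.prod_fintype _ _ (by simp)]
        push_cast
        simp)
  let g : MvPolynomial (Fin 3) ℚ := ∑ j, monomial (mm (ε.symm j)) (a j : ℚ)
  have hg0 : g ≠ 0 := by
    intro h0
    apply ha
    funext i
    have : coeff (mm (ε.symm i)) g = 0 := by rw [h0]; simp
    simp only [g, coeff_sum, coeff_monomial] at this
    rw [Finset.sum_eq_single i (fun j _ hj => if_neg (fun hh => hj (ε.symm.injective (hmminj hh)))) (by simp)] at this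
    simpa using this
  have hgd : degreeOf 0 g < 5 := by
    refine lt_of_le_of_lt (degreeOf_sum_le _ _ _) ?_
    rw [Finset.sup_lt_iff (by rw [Nat.bot_eq_zero]; omega)]
    intro i _
    refine lt_of_le_of_lt ?_ (ε.symm i).1.2
    by_cases hai : (a i : ℚ) = 0
    · rw [hai]; simp
    · rw [degreeOf_monomial_eq _ _ hai, hmm0]
  refine ⟨g, ?_, ?_, ?_⟩
  · apply totalDegree_finsetSum_le
    intro i _
    refine (totalDegree_monomial_le _ _).trans ?_
    change (mm (ε.symm i)).degree ≤ _
    rw [Finsupp.degree_eq_sum, hdeg]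
    have := (ε.symm i).1.2
    have := (ε.symm i).2.1.2
    omega
  · rintro ⟨w, hw⟩
    have hw0 : w ≠ 0 := by rintro rfl; exact hg0 (by simpa using hw)
    have hc' : coeff (Finsupp.single 0 d) (map (Int.castRingHom ℚ) f) ≠ 0 := by
      rw [coeff_map]; simpa using hc
    have h0 : map (Int.castRingHom ℚ) f ≠ 0 := by
      intro h0; rw [h0] at hc'; simp at hc'
    have := degreeOf_mul_eq (n := (0 : Fin 3)) h0 hw0
    have h3 := degreeOf_zero_of_coeff _ hc'
    rw [← hw] at this
    omega
  · intro t ht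
    have h1 := congrArg (Int.cast : ℤ → ℚ) (hrel ⟨t, ht⟩)
    push_cast at h1
    rw [← h1]
    simp only [g, map_sum]
    apply Finset.sum_congr rfl
    intro i _
    rw [eval_monomial, Finsupp.prod_fintype _ _ (by simp)]
    simp only [F]
    push_cast
    rfl

theorem surf_aux : ∃ D C : ℕ, 1 ≤ C ∧ ∀ 
    (d b : ℕ) (_ : 5 ≤ d) (_ : C ≤ b) (f : MvPolynomial (Fin 3) ℤ)
    (_ : coeff (Finsupp.single 0 d) f ≠ 0)
    (T : Finset (Fin 3 → ℤ)) (_ : ∀ t ∈ T, ∀ i, |t i| ≤ ((b ^ 10000 : ℕ) : ℤ))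
    (_ : ∀ t ∈ T, eval t f = 0) (P : Finset ℕ) (_ : ∀ q ∈ P, q.Prime ∧ b ^ 450 < q) (_ : P.card = 10)
    (_ : ∀ q ∈ P, ∀ t ∈ T, ¬ (q : ℤ) ∣ eval t (pderiv 0 f))
    (_ : ∀ q ∈ P, ∀ t ∈ T, ∀ t' ∈ T, ∀ i, (q : ℤ) ∣ t i - t' i),
    ∃ g : MvPolynomial (Fin 3) ℚ, g.totalDegree ≤ D ∧ ¬ map (Int.castRingHom ℚ) f ∣ g ∧
      ∀ t ∈ T, eval (fun i => (t i : ℚ)) g = 0 := by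
  obtain ⟨D, E, e, s, K, h1, h2, h3, h4, h5⟩ : ∃ D E e s K : ℕ, 2 * s = 5 * ((D + 1) * (D + 2)) ∧
      6 * K = E * (E + 1) * (E + 2) ∧ e + K ≤ s * E ∧ 1 ≤ e ∧
      1 + 10000 * ∑ c ∈ Finset.range 5, ∑ m ∈ Finset.range (D + 1), (m + 1) * (c + m) ≤ 4500 * e := by
    refine ⟨1000, 2238, 2507505 * 2238 - 2238 * 2239 * 2240 / 6, 2507505, 2238 * 2239 * 2240 / 6, by norm_num, by norm_num,
      by norm_num, by norm_num, ?_⟩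
    have := sum_tri2 1000 0
    have := sum_tri2 1000 1
    have := sum_tri2 1000 2
    have := sum_tri2 1000 3
    have := sum_tri2 1000 4
    rw [Finset.sum_range_succ, Finset.sum_range_succ, Finset.sum_range_succ, Finset.sum_range_succ, Finset.sum_range_one]
    omega
  refine ⟨D + 5, s.factorial, Nat.factorial_pos s, ?_⟩
  intro d b hd hb f hc T hbox hz P hP hPc hgood hcls
  exact surf_aux_gen D E e s K h1 h2 h3 h4 h5 d b hd hb f hc T hbox hz P hP hPc hgood hcls

end DG

namespace DG
open MvPolynomial

theorem finSucc_pderiv {K : Type*} [CommRing K] {r : ℕ} (f : MvPolynomial (Fin (r + 1)) K) :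
    finSuccEquiv K r (pderiv 0 f) = Polynomial.derivative (finSuccEquiv K r f) := by
  induction f using MvPolynomial.induction_on with
  | C a => simp [finSuccEquiv_apply]
  | add a b ha hb => simp only [map_add, ha, hb]
  | mul_X a i ha =>
    rw [Derivation.leibniz]
    simp only [smul_eq_mul, map_mul, map_add, ha, Polynomial.derivative_mul]
    refine Fin.cases ?_ (fun i => ?_) i
    · simp only [pderiv_X_self, finSuccEquiv_X_zero, Polynomial.derivative_X]
      simp
      ring
    · rw [pderiv_X_of_ne (Fin.succ_ne_zero i), finSuccEquiv_X_succ]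
      simp
      ring

theorem card_fiber' {K : Type*} [Field K] {r d : ℕ} (f : MvPolynomial (Fin (r + 1)) K)
    (hd : f.totalDegree ≤ d) (x : Fin r → K) (S : Finset K)
    (hS : ∀ z ∈ S, eval (Fin.cons z x : Fin (r+1) → K) f = 0 ∧
      eval (Fin.cons z x : Fin (r+1) → K) (pderiv 0 f) ≠ 0) : S.card ≤ d := by
  classical
  rcases S.eq_empty_or_nonempty with rfl | ⟨z0, hz0⟩
  · simp
  obtain ⟨P, hP⟩ : ∃ P, P = Polynomial.map (eval x) (finSuccEquiv K r f) := ⟨_, rfl⟩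
  have hev : ∀ z, eval (Fin.cons z x : Fin (r+1) → K) f = P.eval z := by
    intro z
    rw [eval_eq_eval_mv_eval', hP]
  have hP0 : P ≠ 0 := by
    intro h0
    apply (hS z0 hz0).2
    rw [eval_eq_eval_mv_eval', finSucc_pderiv, ← Polynomial.derivative_map, ← hP, h0]
    simp
  have hdeg : P.natDegree ≤ d := by
    rw [hP]
    refine Polynomial.natDegree_map_le.trans ?_
    rw [natDegree_finSuccEquiv]
    exact (degreeOf_le_totalDegree _ _).trans hd
  calc S.card ≤ P.roots.toFinset.card := by
        apply Finset.card_le_card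
        intro z hz
        rw [Multiset.mem_toFinset, Polynomial.mem_roots hP0, Polynomial.IsRoot, ← hev]
        exact (hS z hz).1
    _ ≤ P.roots.card := Multiset.toFinset_card_le _
    _ ≤ P.natDegree := Polynomial.card_roots' P
    _ ≤ d := hdeg

theorem exists_int_mod {σ : Type*} (h : MvPolynomial σ ℚ) (h0 : h ≠ 0) (q : ℕ) (hq : q.Prime) :
    ∃ (c : ℚ) (h' : MvPolynomial σ ℤ), c ≠ 0 ∧ map (Int.castRingHom ℚ) h' = C c * h ∧
      map (Int.castRingHom (ZMod q)) h' ≠ 0 := by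
  classical
  obtain ⟨c, h', hc, hh⟩ := exists_int_mul h
  have h1 : h' ≠ 0 := by
    rintro rfl
    rw [map_zero, eq_comm, mul_eq_zero] at hh
    rcases hh with hh | hh
    · exact hc (by simpa using hh)
    · exact h0 hh
  obtain ⟨m, hm⟩ := ne_zero_iff.1 h1
  obtain ⟨N, hN⟩ : ∃ N, N = (coeff m h').natAbs := ⟨_, rfl⟩
  obtain ⟨c', hc', hh'⟩ : ∃ c' : ℚ, c' ≠ 0 ∧ map (Int.castRingHom ℚ) h' = C c' * h :=
    ⟨c, by exact_mod_cast hc, hh⟩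
  clear hh hc h1
  induction N using Nat.strong_induction_on generalizing h' c' with
  | _ N ih =>
    by_cases hz : map (Int.castRingHom (ZMod q)) h' = 0
    · rw [← C_dvd_iff_zmod] at hz
      obtain ⟨h2, rfl⟩ := hz
      rw [coeff_C_mul] at hm hN
      have hm2 := right_ne_zero_of_mul hm
      refine ih (coeff m h2).natAbs ?_ h2 hm2 rfl (c' / q) ?_ ?_
      · rw [hN, Int.natAbs_mul]
        have := Int.natAbs_pos.2 hm2
        have := hq.two_le
        simp only [Int.natAbs_natCast]
        nlinarith
      · exact div_ne_zero hc' (by exact_mod_cast hq.ne_zero)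
      · rw [map_mul, map_C] at hh'
        have hq0 : (C (q : ℚ) : MvPolynomial σ ℚ) ≠ 0 := by simpa using hq.ne_zero
        apply mul_left_cancel₀ hq0
        rw [← mul_assoc, ← C_mul, mul_div_cancel₀ _ (by exact_mod_cast hq.ne_zero), ← hh']
        simp
    · exact ⟨c', h', hc', hh', hz⟩

theorem exists_disj (A : Finset ℕ) (t k : ℕ) (h : k * t ≤ A.card) :
    ∃ Q : ℕ → Finset ℕ, (∀ j < k, Q j ⊆ A ∧ (Q j).card = t) ∧
      ∀ i < k, ∀ j < k, i ≠ j → Disjoint (Q i) (Q j) := by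
  classical
  induction k with
  | zero => exact ⟨fun _ => ∅, by simp, by simp⟩
  | succ k ih =>
    obtain ⟨Q, h1, h2⟩ := ih (by nlinarith)
    obtain ⟨U, hU⟩ : ∃ U, U = (Finset.range k).biUnion Q := ⟨_, rfl⟩
    have hUc : U.card ≤ k * t := by
      rw [hU]
      refine Finset.card_biUnion_le.trans ?_
      rw [Finset.sum_congr rfl (fun j hj => (h1 j (Finset.mem_range.1 hj)).2)]
      simp
    have h3 : t ≤ (A \ U).card := by
      have := Finset.le_card_sdiff U A
      have e : (k + 1) * t = k * t + t := by ring
      omega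
    obtain ⟨V, hV, hVc⟩ := Finset.exists_subset_card_eq h3
    have hdis : ∀ j < k, Disjoint V (Q j) := by
      intro j hj
      rw [Finset.disjoint_left]
      intro x hx hx2
      have := Finset.mem_sdiff.1 (hV hx)
      apply this.2
      rw [hU]
      exact Finset.mem_biUnion.2 ⟨j, Finset.mem_range.2 hj, hx2⟩
    refine ⟨fun j => if j = k then V else Q j, ?_, ?_⟩
    · intro j hj
      by_cases hjk : j = k
      · simp only [hjk, if_true]
        exact ⟨hV.trans Finset.sdiff_subset, hVc⟩
      · simp only [hjk, if_false]
        exact h1 j (by omega)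
    · intro i hi j hj hij
      by_cases hik : i = k
      · have : j ≠ k := by omega
        simp only [hik, this, if_true, if_false]
        exact hdis j (by omega)
      · by_cases hjk : j = k
        · simp only [hik, hjk, if_true, if_false]
          exact (hdis i (by omega)).symm
        · simp only [hik, hjk, if_false]
          exact h2 i (by omega) j (by omega) hij

theorem exists_rep {M : Type*} [CommMonoid M] : ∃ rep : M → M,
    (∀ h, Associated (rep h) h) ∧ ∀ h h', Associated h h' → rep h = rep h' := by
  refine ⟨fun h => Quot.out (Associates.mk h), ?_, ?_⟩
  · intro h
    rw [← Associates.mk_eq_mk_iff_associated]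
    exact Quot.out_eq _
  · intro h h' hh
    simp only
    rw [Associates.mk_eq_mk_iff_associated.2 hh]

theorem irr_totalDegree_pos {σ K : Type*} [Field K] {h : MvPolynomial σ K} (hi : Irreducible h) : 1 ≤ h.totalDegree := by
  by_contra hcon
  have h0 : h.totalDegree = 0 := by omega
  rw [totalDegree_eq_zero_iff_eq_C] at h0
  rw [h0] at hi
  have : coeff 0 h ≠ 0 := by
    intro h1; rw [h1] at hi; simp at hi
  exact hi.not_isUnit ((isUnit_iff_ne_zero.2 this).map C)

theorem totalDegree_le_of_dvd {σ K : Type*} [Field K] {h g : MvPolynomial σ K} (hg : g ≠ 0) (hd : h ∣ g) :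
    h.totalDegree ≤ g.totalDegree := by
  obtain ⟨w, rfl⟩ := hd
  rw [totalDegree_mul_of_isDomain (left_ne_zero_of_mul hg) (right_ne_zero_of_mul hg)]
  omega

theorem card_le_totalDegree_prod {σ K : Type*} [Field K] (s : Multiset (MvPolynomial σ K)) (hs : ∀ h ∈ s, Irreducible h) :
    s.prod ≠ 0 ∧ s.card ≤ s.prod.totalDegree := by
  induction s using Multiset.induction_on with
  | empty => simp
  | cons a s ih =>
    have h1 := ih (fun h hh => hs h (Multiset.mem_cons_of_mem hh))
    have ha := hs a (Multiset.mem_cons_self a s)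
    rw [Multiset.prod_cons]
    refine ⟨mul_ne_zero ha.ne_zero h1.1, ?_⟩
    rw [totalDegree_mul_of_isDomain ha.ne_zero h1.1, Multiset.card_cons]
    have := irr_totalDegree_pos ha
    omega

/-- finite set of irreducible factors, up to a choice of representatives -/
theorem exists_factors {σ K : Type*} [Field K] [Finite σ] (rep : MvPolynomial σ K → MvPolynomial σ K)
    (h1 : ∀ h, Associated (rep h) h) (h2 : ∀ h h', Associated h h' → rep h = rep h')
    (r : MvPolynomial σ K) (hr : r ≠ 0) : ∃ L : Finset (MvPolynomial σ K), L.card ≤ r.totalDegree ∧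
      (∀ h ∈ L, Irreducible h ∧ h ∣ r ∧ rep h = h) ∧ (∀ h, Irreducible h → h ∣ r → rep h = h → h ∈ L) ∧
      ∀ x : σ → K, eval x r = 0 → ∃ h ∈ L, eval x h = 0 := by
  classical
  let s := UniqueFactorizationMonoid.factors r
  have hs : ∀ h ∈ s, Irreducible h := fun h hh => UniqueFactorizationMonoid.irreducible_of_factor h hh
  have hp : Associated s.prod r := UniqueFactorizationMonoid.factors_prod hr
  have hc := card_le_totalDegree_prod s hs
  refine ⟨(s.map rep).toFinset, ?_, ?_, ?_, ?_⟩
  · refine (Multiset.toFinset_card_le _).trans ?_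
    rw [Multiset.card_map]
    exact hc.2.trans (totalDegree_le_of_dvd hr hp.dvd)
  · intro h hh
    obtain ⟨g, hg, rfl⟩ := Multiset.mem_map.1 (Multiset.mem_toFinset.1 hh)
    refine ⟨(h1 g).irreducible_iff.2 (hs g hg), ?_, h2 _ _ (h1 g)⟩
    exact ((h1 g).dvd).trans ((Multiset.dvd_prod hg).trans hp.dvd)
  · intro h hi hd hre
    obtain ⟨g, hg, hgh⟩ := UniqueFactorizationMonoid.exists_mem_factors_of_dvd hr hi hd
    rw [Multiset.mem_toFinset, Multiset.mem_map]
    exact ⟨g, hg, by rw [← hre]; exact (h2 _ _ hgh).symm⟩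
  · intro x hx
    have : eval x s.prod = 0 := by
      obtain ⟨u, hu⟩ := hp.symm
      rw [← hu, map_mul, hx, zero_mul]
    rw [map_multiset_prod, Multiset.prod_eq_zero_iff, Multiset.mem_map] at this
    obtain ⟨g, hg, hgx⟩ := this
    refine ⟨rep g, Multiset.mem_toFinset.2 (Multiset.mem_map.2 ⟨g, hg, rfl⟩), ?_⟩
    obtain ⟨u, hu⟩ := (h1 g).symm
    rw [← hu, map_mul, hgx, zero_mul]

end DG

namespace DG
open MvPolynomial

theorem eval_int_map {R σ : Type*} [CommRing R] (f : MvPolynomial σ ℤ) (x : σ → ℤ) :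
    eval (fun i => (x i : R)) (map (Int.castRingHom R) f) = ((eval x f : ℤ) : R) := by
  have h3 := eval₂_comp_left (Int.castRingHom R) (RingHom.id ℤ) x f
  rw [eval₂_id] at h3
  rw [eval_map]
  simp only [eq_intCast, RingHom.comp_id, Function.comp_def] at h3
  exact h3.symm

/-- counting classes -/
theorem classes_surface {q d : ℕ} (hq : q.Prime) (f : MvPolynomial (Fin 3) ℤ) (hd : f.totalDegree ≤ d)
    (S : Finset (Fin 3 → ℤ)) (hz : ∀ x ∈ S, eval x f = 0) (C : Finset (Fin 3 → ℤ))
    (hC : ∀ c ∈ C, ∃ x ∈ S, ¬ (q : ℤ) ∣ eval x (pderiv 0 f) ∧ (fun i => x i % (q : ℤ)) = c) :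
    C.card ≤ d * q ^ 2 := by
  classical
  haveI : Fact q.Prime := ⟨hq⟩
  rcases C.eq_empty_or_nonempty with rfl | ⟨c0, hc0⟩
  · simp
  have hinj : Set.InjOn (fun (c : Fin 3 → ℤ) (i : Fin 3) => (c i : ZMod q)) C := by
    intro c hc c' hc' h
    obtain ⟨x, hx, -, rfl⟩ := hC c hc
    obtain ⟨x', hx', -, rfl⟩ := hC c' hc'
    funext i
    have := congrFun h i
    simp only at this
    have h2 := (ZMod.intCast_eq_intCast_iff' _ _ _).1 this
    simpa using h2
  rw [← Finset.card_image_of_injOn hinj]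
  have hmod : ∀ x : Fin 3 → ℤ, (fun i => ((x i % (q : ℤ) : ℤ) : ZMod q)) = fun i => (x i : ZMod q) := by
    intro x; funext i; exact ZMod.intCast_mod _ _
  have hne : map (Int.castRingHom (ZMod q)) f ≠ 0 := by
    intro h0
    obtain ⟨x, hx, hg, -⟩ := hC c0 hc0
    apply hg
    rw [← ZMod.intCast_zmod_eq_zero_iff_dvd, ← eval_int_map, ← pderiv_map, h0]
    simp
  refine (card_zeros_zmod _ hne _ ?_).trans ?_
  · intro y hy
    obtain ⟨c, hc, rfl⟩ := Finset.mem_image.1 hy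
    obtain ⟨x, hx, -, rfl⟩ := hC c hc
    simp only
    rw [hmod, eval_int_map, hz x hx, Int.cast_zero]
  · apply Nat.mul_le_mul_right
    exact (totalDegree_map_le _ _).trans hd

theorem classes_curve {q d δ : ℕ} (hq : q.Prime) (f : MvPolynomial (Fin 3) ℤ) (hd : f.totalDegree ≤ d)
    (S : Finset (Fin 3 → ℤ)) (hz : ∀ x ∈ S, eval x f = 0) (h : MvPolynomial (Fin 2) ℚ) (h0 : h ≠ 0)
    (hδ : h.totalDegree ≤ δ) (C : Finset (Fin 3 → ℤ))
    (hC : ∀ c ∈ C, ∃ x ∈ S, ¬ (q : ℤ) ∣ eval x (pderiv 0 f) ∧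
      eval (fun i : Fin 2 => (x i.succ : ℚ)) h = 0 ∧ (fun i => x i % (q : ℤ)) = c) :
    C.card ≤ d * (δ * q) := by
  classical
  haveI : Fact q.Prime := ⟨hq⟩
  have hinj : Set.InjOn (fun (c : Fin 3 → ℤ) (i : Fin 3) => (c i : ZMod q)) C := by
    intro c hc c' hc' h
    obtain ⟨x, hx, -, -, rfl⟩ := hC c hc
    obtain ⟨x', hx', -, -, rfl⟩ := hC c' hc'
    funext i
    have := congrFun h i
    simp only at this
    have h2 := (ZMod.intCast_eq_intCast_iff' _ _ _).1 this
    simpa using h2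
  rw [← Finset.card_image_of_injOn hinj]
  have hmod : ∀ x : Fin 3 → ℤ, (fun i => ((x i % (q : ℤ) : ℤ) : ZMod q)) = fun i => (x i : ZMod q) := by
    intro x; funext i; exact ZMod.intCast_mod _ _
  obtain ⟨a, h', ha, hh', hh0⟩ := exists_int_mod h h0 q hq
  obtain ⟨C', hC'⟩ : ∃ C', C' = C.image (fun (c : Fin 3 → ℤ) (i : Fin 3) => (c i : ZMod q)) := ⟨_, rfl⟩
  rw [← hC']
  have hC2 : ∀ y ∈ C', ∃ x ∈ S, ¬ (q : ℤ) ∣ eval x (pderiv 0 f) ∧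
      eval (fun i : Fin 2 => (x i.succ : ℚ)) h = 0 ∧ (fun i => (x i : ZMod q)) = y := by
    intro y hy
    rw [hC'] at hy
    obtain ⟨c, hc, rfl⟩ := Finset.mem_image.1 hy
    obtain ⟨x, hx, hg, hhx, rfl⟩ := hC c hc
    exact ⟨x, hx, hg, hhx, (hmod x).symm⟩
  have hfib : C'.card ≤ d * (C'.image (fun y (i : Fin 2) => y i.succ)).card := by
    apply Finset.card_le_mul_card_image_of_maps_to (fun x hx => Finset.mem_image_of_mem _ hx)
    intro u hu
    have h1 := card_fiber' (map (Int.castRingHom (ZMod q)) f) ((totalDegree_map_le _ _).trans hd) u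
      ((C'.filter (fun y => (fun i : Fin 2 => y i.succ) = u)).image (fun y => y 0)) (by
        intro z hz'
        obtain ⟨y, hy, rfl⟩ := Finset.mem_image.1 hz'
        obtain ⟨hy1, hy2⟩ := Finset.mem_filter.1 hy
        obtain ⟨x, hx, hg, -, rfl⟩ := hC2 y hy1
        have : (Fin.cons ((x 0 : ℤ) : ZMod q) u : Fin 3 → ZMod q) = fun i => (x i : ZMod q) := by
          funext i
          rw [← hy2]
          refine Fin.cases ?_ (fun i => ?_) i <;> simp
        rw [this, pderiv_map, eval_int_map, eval_int_map, hz x hx]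
        refine ⟨by simp, ?_⟩
        rw [Ne, ZMod.intCast_zmod_eq_zero_iff_dvd]
        exact hg)
    rwa [Finset.card_image_of_injOn] at h1
    intro y hy y' hy' hyy
    have e1 := (Finset.mem_filter.1 hy).2
    have e2 := (Finset.mem_filter.1 hy').2
    funext i
    refine Fin.cases hyy (fun i => ?_) i
    exact congrFun (e1.trans e2.symm) i
  refine hfib.trans (Nat.mul_le_mul_left _ ?_)
  refine (card_zeros_zmod _ hh0 _ ?_).trans ?_
  · intro u hu
    obtain ⟨y, hy, rfl⟩ := Finset.mem_image.1 hu
    obtain ⟨x, hx, -, hhx, rfl⟩ := hC2 y hy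
    simp only
    rw [eval_int_map h' (fun i : Fin 2 => x i.succ)]
    have : ((eval (fun i : Fin 2 => x i.succ) h' : ℤ) : ℚ) = 0 := by
      rw [← eval_int_map, hh', map_mul, hhx, mul_zero]
    rw [Int.cast_eq_zero.1 this, Int.cast_zero]
  · rw [pow_one]
    apply Nat.mul_le_mul_right
    refine (totalDegree_map_le _ _).trans ?_
    rw [← totalDegree_map_Q, hh', totalDegree_mul_of_isDomain (by simpa using ha) h0, totalDegree_C, zero_add]
    exact hδ

end DG

namespace DG
open MvPolynomial

theorem surf_bottom (D d b : ℕ) (f : MvPolynomial (Fin 3) ℤ) (hd : f.totalDegree ≤ d)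
    (hc : coeff (Finsupp.single 0 d) f ≠ 0) (hirr : Irreducible (map (Int.castRingHom ℚ) f))
    (rep : MvPolynomial (Fin 2) ℚ → MvPolynomial (Fin 2) ℚ)
    (h1 : ∀ h, Associated (rep h) h) (h2 : ∀ h h', Associated h h' → rep h = rep h')
    (T : Finset (Fin 3 → ℤ)) (hz : ∀ t ∈ T, eval t f = 0) (g : MvPolynomial (Fin 3) ℚ) (hgd : g.totalDegree ≤ D)
    (hfg : ¬ map (Int.castRingHom ℚ) f ∣ g) (hg : ∀ t ∈ T, eval (fun i => (t i : ℚ)) g = 0) :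
    ∃ L : Finset (MvPolynomial (Fin 2) ℚ), L.card ≤ (d + D) ^ 2 ∧
     (∀ x ∈ T, ∃ h ∈ L, rep h = h ∧ Irreducible h ∧ h.totalDegree ≤ (d + D) ^ 2 ∧
        eval (fun i : Fin 2 => (x i.succ : ℚ)) h = 0) ∧
      ∀ h, ∀ T' ⊆ T, (∀ x ∈ T', rep h = h ∧ Irreducible h ∧ h.totalDegree ≤ (d + D) ^ 2 ∧
        eval (fun i : Fin 2 => (x i.succ : ℚ)) h = 0) → d * (2 * (d + D) ^ 2) ^ 4 + 1 ≤ T'.card → h ∈ L := by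
  classical
  obtain ⟨r, hr0, hrd, hr⟩ := elim_eval _ g hirr hfg
  have hfd : (map (Int.castRingHom ℚ) f).totalDegree ≤ d := (totalDegree_map_le _ _).trans hd
  have hrd' : r.totalDegree ≤ (d + D) ^ 2 := hrd.trans (Nat.pow_le_pow_left (add_le_add hfd hgd) 2)
  have hzQ : ∀ t ∈ T, eval (fun i => (t i : ℚ)) (map (Int.castRingHom ℚ) f) = 0 := by
    intro t ht
    rw [eval_int_map, hz t ht, Int.cast_zero]
  have hc' : coeff (Finsupp.single 0 d) (map (Int.castRingHom ℚ) f) ≠ 0 := by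
    rw [coeff_map]; simpa using hc
  obtain ⟨L, hL1, hL2, hL3, hL4⟩ := exists_factors rep h1 h2 r hr0
  refine ⟨L, hL1.trans hrd', ?_, ?_⟩
  · intro x hx
    obtain ⟨h, hh, hhx⟩ := hL4 _ (hr (fun i => (x i : ℚ)) (hzQ x hx) (hg x hx))
    obtain ⟨e1, e2, e3⟩ := hL2 h hh
    exact ⟨h, hh, e3, e1, (totalDegree_le_of_dvd hr0 e2).trans hrd', hhx⟩
  · intro h T' hT' hcov hcard
    obtain ⟨x0, hx0⟩ : T'.Nonempty := by rw [← Finset.card_pos]; omega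
    obtain ⟨e1, e2, e3, -⟩ := hcov x0 hx0
    apply hL3 h e2 _ e1
    by_contra hnd
    have hB := bezout h r e2 hnd (T'.image (fun x (i : Fin 2) => (x i.succ : ℚ))) (by
      intro p hp
      obtain ⟨x, hx, rfl⟩ := Finset.mem_image.1 hp
      exact ⟨(hcov x hx).2.2.2, hr (fun i => (x i : ℚ)) (hzQ x (hT' hx)) (hg x (hT' hx))⟩)
    have hF := card_le_fiber _ hfd hc' T' (fun x hx => hzQ x (hT' hx))
    have heq : (T'.image (fun x (i : Fin 2) => (x i.succ : ℚ))).card = (T'.image (fun x (i : Fin 2) => x i.succ)).card := by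
      have : T'.image (fun x (i : Fin 2) => (x i.succ : ℚ)) =
          (T'.image (fun x (i : Fin 2) => x i.succ)).image (fun y (i : Fin 2) => (y i : ℚ)) := by
        rw [Finset.image_image]; rfl
      rw [this, Finset.card_image_of_injective]
      intro y y' hyy
      funext i
      have := congrFun hyy i
      simpa using this
    rw [heq] at hB
    have h5 : (h.totalDegree + r.totalDegree) ^ 4 ≤ (2 * (d + D) ^ 2) ^ 4 := Nat.pow_le_pow_left (by omega) 4
    have h6 := Nat.mul_le_mul_left d (hB.trans h5)
    have h7 : T'.card ≤ d * (2 * (d + D) ^ 2) ^ 4 := by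
      refine le_trans ?_ h6
      convert hF
    omega

theorem surf_tree : ∃ D C : ℕ, ∀ (d b R : ℕ) (f : MvPolynomial (Fin 3) ℤ) (S : Finset (Fin 3 → ℤ)),
    5 ≤ d → C + 4 * R + 4 * d * (2 * (d + D) ^ 2) ^ 4 ≤ b → f.totalDegree ≤ d → coeff (Finsupp.single 0 d) f ≠ 0 →
    Irreducible (map (Int.castRingHom ℚ) f) → (∀ t ∈ S, ∀ i, |t i| ≤ ((b ^ 10000 : ℕ) : ℤ)) →
    (∀ t ∈ S, eval t f = 0) → (∀ t ∈ S, eval t (pderiv 0 f) ≠ 0) →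
    (∀ t ∈ S, |eval t (pderiv 0 f)| ≤ ((b ^ R : ℕ) : ℤ)) →
    ∃ L : Finset (MvPolynomial (Fin 2) ℚ), L.card ≤ b ^ 4541 ∧ (∀ h ∈ L, Irreducible h ∧ h.totalDegree ≤ (d + D) ^ 2) ∧
      ∀ U ⊆ S, (∀ x ∈ U, ∀ h ∈ L, eval (fun i : Fin 2 => (x i.succ : ℚ)) h ≠ 0) → U.card ≤ b ^ 9511 := by
  classical
  obtain ⟨D, C0, hC0, hsurf⟩ := surf_aux
  refine ⟨D, C0 + 16 * (450 + 1) ^ 2 * (10 + 1) ^ 2, ?_⟩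
  intro d b R f S hd5 hb hd hc hirr hbox hz hzp hzpb
  obtain ⟨δ, hδ⟩ : ∃ δ, δ = (d + D) ^ 2 := ⟨_, rfl⟩
  rw [← hδ] at hb ⊢
  have hdδ : d ≤ δ := by
    rw [hδ]
    exact (Nat.le_add_right d D).trans (Nat.le_self_pow (by norm_num) _)
  have hbig : 4 * d * δ ≤ 4 * d * (2 * δ) ^ 4 := by
    apply Nat.mul_le_mul_left
    calc δ ≤ 2 * δ := by omega
      _ ≤ _ := Nat.le_self_pow (by norm_num) _
  have hdδ2 : δ ≤ d * δ := Nat.le_mul_of_pos_left _ (by omega)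
  have e4 : 4 * d * δ = 4 * (d * δ) := by ring
  have hb4 : 4 * d * δ ≤ b := by omega
  have hbδ : δ ≤ b := by omega
  have hbd : 4 * d ≤ b := by
    have : d ≤ d * δ := Nat.le_mul_of_pos_right _ (by omega)
    omega
  have hbτ : d * (2 * δ) ^ 4 + 1 ≤ b := by
    have : 4 * d * (2 * δ) ^ 4 = 4 * (d * (2 * δ) ^ 4) := by ring
    omega
  have hb96 : 96 ≤ b := by omega
  have hb1 : 1 ≤ b := by omega
  have hbp : ∀ n, 1 ≤ n → b ≤ b ^ n := fun n hn => Nat.le_self_pow (by omega) _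
  obtain ⟨rep, hrep1, hrep2⟩ := exists_rep (M := MvPolynomial (Fin 2) ℚ)
  obtain ⟨Q, hQ1, hQ2⟩ := exists_disj _ (b ^ 450) 10 (many_primes 450 10 b (by norm_num) (by norm_num) (by omega))
  have hQm : ∀ j < 10, ∀ q ∈ Q j, q.Prime ∧ b ^ 450 < q ∧ q ≤ b ^ 451 := by
    intro j hj q hq
    have := (hQ1 j hj).1 hq
    rw [Finset.mem_filter, Finset.mem_Ioc] at this
    exact ⟨this.2, this.1.1, this.1.2⟩
  have key := tree S (fun (h : MvPolynomial (Fin 2) ℚ) (x : Fin 3 → ℤ) => rep h = h ∧ Irreducible h ∧ h.totalDegree ≤ δ ∧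
        eval (fun i : Fin 2 => (x i.succ : ℚ)) h = 0) Q (fun q x i => x i % (q : ℤ))
        (fun q x => ¬ (q : ℤ) ∣ eval x (pderiv 0 f)) 10 (b ^ 450) (d * b ^ 902) (d * (δ * b ^ 451)) 23 (b ^ 899)
        (fun i => b ^ (1 + 454 * i)) (fun i => b ^ (1 + 452 * i)) (fun i => b ^ (451 + 906 * i))
        (by positivity) (fun j hj => (hQ1 j hj).2) ?_ ?_ ?_ ?_ ?_ ?_ (by positivity) ?_ ?_ ?_ ?_
  · obtain ⟨L, hL1, hL2⟩ := key
    refine ⟨L.filter (fun h => rep h = h ∧ Irreducible h ∧ h.totalDegree ≤ δ), (Finset.card_filter_le _ _).trans hL1, ?_, ?_⟩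
    · intro h hh
      obtain ⟨-, -, e1, e2⟩ := Finset.mem_filter.1 hh
      exact ⟨e1, e2⟩
    · intro U hU hUx
      refine hL2 U hU ?_
      rintro x hx h hh ⟨e1, e2, e3, e5⟩
      exact hUx x hx h (Finset.mem_filter.2 ⟨hh, e1, e2, e3⟩) e5
  · intro j hj q hq C hC
    obtain ⟨q1, q2, q3⟩ := hQm j hj q hq
    refine (classes_surface q1 f hd S hz C hC).trans ?_
    apply Nat.mul_le_mul_left
    calc q ^ 2 ≤ (b ^ 451) ^ 2 := Nat.pow_le_pow_left q3 2
      _ = b ^ 902 := by rw [← pow_mul]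
  · intro j hj q hq h C hC
    obtain ⟨q1, q2, q3⟩ := hQm j hj q hq
    rcases C.eq_empty_or_nonempty with rfl | ⟨c0, hc0⟩
    · simp
    obtain ⟨x0, hx0, -, ⟨-, e2, e3, -⟩, -⟩ := hC c0 hc0
    refine (classes_curve q1 f hd S hz h e2.ne_zero e3 C ?_).trans ?_
    · intro c hc
      obtain ⟨x, hx, hg, ⟨-, -, -, e5⟩, e6⟩ := hC c hc
      exact ⟨x, hx, hg, e5, e6⟩
    · exact Nat.mul_le_mul_left _ (Nat.mul_le_mul_left _ q3)
  · intro j hj x hx P hP hbad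
    have := primes_count b R (by omega) _ (hzp x hx) (hzpb x hx) P (by
      intro p hp
      obtain ⟨q1, q2, q3⟩ := hQm j hj p (hP hp)
      refine ⟨q1, ?_, not_not.1 (hbad p hp)⟩
      exact (hbp 450 (by norm_num)).trans q2.le)
    have := hbp 450 (by norm_num)
    omega
  · intro j hj x hx y hy hxy P hP hcl
    obtain ⟨i, hi⟩ := Function.ne_iff.1 hxy
    refine primes_count (b ^ 450) 23 (by have := hbp 450 (by norm_num); omega) (x i - y i) (sub_ne_zero.2 hi) ?_ P ?_
    · have e1 := hbox x hx i
      have e2 := hbox y hy i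
      have e3 : b ^ 10000 + b ^ 10000 ≤ (b ^ 450) ^ 23 := by
        rw [← pow_mul]
        calc b ^ 10000 + b ^ 10000 = 2 * b ^ 10000 := by ring
          _ ≤ b * b ^ 10000 := Nat.mul_le_mul_right _ (by omega)
          _ = b ^ 10001 := by rw [pow_succ]; ring
          _ ≤ _ := Nat.pow_le_pow_right hb1 (by norm_num)
      have e5 : ((b ^ 10000 : ℕ) : ℤ) + ((b ^ 10000 : ℕ) : ℤ) ≤ (((b ^ 450) ^ 23 : ℕ) : ℤ) := by exact_mod_cast e3
      have := abs_sub (x i) (y i)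
      exact this.trans ((add_le_add e1 e2).trans e5)
    · intro p hp
      obtain ⟨q1, q2, q3⟩ := hQm j hj p (hP hp)
      refine ⟨q1, q2.le, ?_⟩
      have := congrFun (hcl p hp) i
      exact Int.ModEq.dvd (Int.ModEq.symm this)
  · intro T hT hcl
    choose q hq hqg hqc using hcl
    let P : Finset ℕ := Finset.univ.image (fun j : Fin 10 => q j.1 j.2)
    have hPc : P.card = 10 := by
      rw [Finset.card_image_of_injective, Finset.card_univ, Fintype.card_fin]
      intro i j hij
      by_contra hne
      have h1 := hq i.1 i.2
      have h2 := hq j.1 j.2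
      simp only at hij
      rw [hij] at h1
      exact Finset.disjoint_left.1 (hQ2 i.1 i.2 j.1 j.2 (fun h => hne (Fin.ext h))) h1 h2
    obtain ⟨g, g1, g2, g3⟩ := hsurf d b hd5 (by omega) f hc T (fun t ht => hbox t (hT ht)) (fun t ht => hz t (hT ht)) P
      (by
        intro p hp
        obtain ⟨j, -, rfl⟩ := Finset.mem_image.1 hp
        obtain ⟨q1, q2, q3⟩ := hQm j.1 j.2 _ (hq j.1 j.2)
        exact ⟨q1, q2⟩) hPc
      (by
        intro p hp
        obtain ⟨j, -, rfl⟩ := Finset.mem_image.1 hp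
        exact hqg j.1 j.2)
      (by
        intro p hp
        obtain ⟨j, -, rfl⟩ := Finset.mem_image.1 hp
        intro t ht t' ht' i
        have := congrFun (hqc j.1 j.2 t ht t' ht') i
        exact Int.ModEq.dvd (Int.ModEq.symm this))
    obtain ⟨L, l1, l2, l3⟩ := surf_bottom D d b f hd hc hirr rep hrep1 hrep2 T (fun t ht => hz t (hT ht)) g g1 g2 g3
    rw [← hδ] at l1 l2 l3
    refine ⟨L, ?_, l2, ?_⟩
    · simpa using l1.trans hbδ
    · intro h T' hT' hcov hcard
      refine l3 h T' hT' hcov (hbτ.trans ?_)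
      simpa using hcard
  · calc 4 * (1 + 23) * b ^ 899 = 96 * b ^ 899 := by ring
      _ ≤ b * b ^ 899 := Nat.mul_le_mul_right _ hb96
      _ = (b ^ 450) ^ 2 := by rw [← pow_mul, ← pow_succ']
  · intro i hi
    calc b ^ 450 * (d * b ^ 902) * b ^ (1 + 454 * i) = d * (b ^ 450 * b ^ 902 * b ^ (1 + 454 * i)) := by ring
      _ ≤ b * (b ^ 450 * b ^ 902 * b ^ (1 + 454 * i)) := Nat.mul_le_mul_right _ (by omega)
      _ = b ^ 899 * b ^ (1 + 454 * (i + 1)) := by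
        simp only [← pow_add]
        rw [← pow_succ']
        exact congrArg (fun k => b ^ k) (by omega)
  · intro i hi
    calc 4 * (d * (δ * b ^ 451)) * b ^ (1 + 452 * i) = (4 * d * δ) * (b ^ 451 * b ^ (1 + 452 * i)) := by ring
      _ ≤ b * (b ^ 451 * b ^ (1 + 452 * i)) := Nat.mul_le_mul_right _ hb4
      _ = b ^ (1 + 452 * (i + 1)) := by
        simp only [← pow_add]
        rw [← pow_succ']
        exact congrArg (fun k => b ^ k) (by omega)
  · intro i hi
    exact Nat.pow_le_pow_right hb1 (by omega)
  · intro i hi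
    have h1 : b ^ (451 + 906 * i) ≤ b ^ (1 + 454 * i) * b ^ (1 + 452 * (i + 1)) := by
      rw [← pow_add]
      exact Nat.pow_le_pow_right hb1 (by omega)
    calc 2 * (d * b ^ 902) * (b ^ (451 + 906 * i) + b ^ (1 + 454 * i) * b ^ (1 + 452 * (i + 1)))
        ≤ 2 * (d * b ^ 902) * (b ^ (1 + 454 * i) * b ^ (1 + 452 * (i + 1)) + b ^ (1 + 454 * i) * b ^ (1 + 452 * (i + 1))) :=
          Nat.mul_le_mul_left _ (Nat.add_le_add_right h1 _)
      _ = (4 * d) * (b ^ 902 * (b ^ (1 + 454 * i) * b ^ (1 + 452 * (i + 1)))) := by ring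
      _ ≤ b * (b ^ 902 * (b ^ (1 + 454 * i) * b ^ (1 + 452 * (i + 1)))) := Nat.mul_le_mul_right _ hbd
      _ = b ^ (451 + 906 * (i + 1)) := by
        simp only [← pow_add]
        rw [← pow_succ']
        exact congrArg (fun k => b ^ k) (by omega)

end DG

open MvPolynomial
namespace DG

theorem eval_le {r : ℕ} (g : MvPolynomial (Fin r) ℤ) (N : ℕ) (t : Fin r → ℤ)
    (hg : g.totalDegree ≤ N) (A M : ℕ) (hM : 1 ≤ M) (hA : ∀ m, |coeff m g| ≤ A) (ht : ∀ i, |t i| ≤ M) :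
    |eval t g| ≤ (((N + 1) ^ r * (A * M ^ N) : ℕ) : ℤ) := by
  classical
  have hcard : g.support.card ≤ (N + 1) ^ r := by
    have : g.support ⊆ (Finset.univ : Finset (Fin r → Fin (N + 1))).image
      (fun v => Finsupp.equivFunOnFinite.symm (fun i => (v i : ℕ))) := by
      intro m hm
      have h1 := le_totalDegree hm
      change m.degree ≤ _ at h1
      rw [Finset.mem_image]
      refine ⟨fun i => ⟨m i, ?_⟩, Finset.mem_univ _, ?_⟩
      · have := Finsupp.le_degree i m
        omega
      · exact Finsupp.ext fun i => rfl
    refine (Finset.card_le_card this).trans (Finset.card_image_le.trans ?_)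
    simp
  rw [eval_eq']
  refine (Finset.abs_sum_le_sum_abs _ _).trans ?_
  have h1 : ∀ m ∈ g.support, |coeff m g * ∏ i, t i ^ m i| ≤ ((A * M ^ N : ℕ) : ℤ) := by
    intro m hm
    have h1 := le_totalDegree hm
    change m.degree ≤ _ at h1
    rw [Finsupp.degree_eq_sum] at h1
    rw [abs_mul, Finset.abs_prod]
    push_cast
    refine mul_le_mul (hA m) ?_ (Finset.prod_nonneg fun i _ => abs_nonneg _) (by positivity)
    calc ∏ i, |t i ^ m i| ≤ ∏ i, (M : ℤ) ^ m i := by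
          refine Finset.prod_le_prod (fun i _ => abs_nonneg _) (fun i _ => ?_)
          rw [abs_pow]
          exact pow_le_pow_left₀ (abs_nonneg _) (ht i) _
      _ = (M : ℤ) ^ (∑ i, m i) := by rw [Finset.prod_pow_eq_pow_sum]
      _ ≤ _ := pow_le_pow_right₀ (by exact_mod_cast hM) (by omega)
  refine (Finset.sum_le_card_nsmul _ _ _ h1).trans ?_
  rw [nsmul_eq_mul]
  push_cast
  refine mul_le_mul_of_nonneg_right (by exact_mod_cast hcard) (by positivity)

theorem box_three (b : ℕ) (hb : 1 ≤ b) (d : ℕ) (g : ℕ) (hg : g ≤ d) (B : ℕ) (hB : 1 ≤ B) :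
    d * ((d + g) ^ 2 * (2 * B + 1) ^ 1) ≤ 12 * (d + 1) ^ 3 * B := by
  calc d * ((d + g) ^ 2 * (2 * B + 1) ^ 1) ≤ (d + 1) * ((2 * (d + 1)) ^ 2 * (3 * B) ^ 1) := by
        gcongr <;> omega
    _ = _ := by ring

set_option maxHeartbeats 1000000 in
theorem surf_cover : ∃ D C : ℕ, ∀ (d b : ℕ) (f : MvPolynomial (Fin 3) ℤ) (S : Finset (Fin 3 → ℤ)),
    5 ≤ d → C * (d + 1) ^ 9 ≤ b → f.totalDegree ≤ d → coeff (Finsupp.single 0 d) f ≠ 0 →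
    Irreducible (map (Int.castRingHom ℚ) f) → (∀ t ∈ S, ∀ i, |t i| ≤ ((b ^ 10000 : ℕ) : ℤ)) →
    (∀ t ∈ S, eval t f = 0) →
    ∃ L : Finset (MvPolynomial (Fin 2) ℚ), L.card ≤ b ^ 4541 ∧ (∀ h ∈ L, Irreducible h ∧ h.totalDegree ≤ (d + D) ^ 2) ∧
      ∀ U ⊆ S, (∀ x ∈ U, ∀ h ∈ L, eval (fun i : Fin 2 => (x i.succ : ℚ)) h ≠ 0) →
        U.card ≤ 13 * (d + 1) ^ 3 * b ^ 10000 := by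
  classical
  obtain ⟨D, C, hC⟩ := surf_tree
  refine ⟨D, C + 80028 + 64 * (D + 1) ^ 8 + 1, ?_⟩
  intro d b f S hd5 hb hd hc hirr hbox hz
  have hd9 : 1 ≤ (d + 1) ^ 9 := Nat.one_le_pow _ _ (by omega)
  have hdb : d + 1 ≤ b := by
    calc d + 1 ≤ (d + 1) ^ 9 := Nat.le_self_pow (by norm_num) _
      _ = 1 * (d + 1) ^ 9 := (one_mul _).symm
      _ ≤ _ := Nat.mul_le_mul_right _ (by omega)
      _ ≤ b := hb
  have hb1 : 1 ≤ b := by omega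
  obtain ⟨B, hB⟩ : ∃ B, B = b ^ 10000 := ⟨_, rfl⟩
  have hB1 : 1 ≤ B := by rw [hB]; exact Nat.one_le_pow _ _ hb1
  have htd : f.totalDegree = d := by
    apply le_antisymm hd
    have := le_totalDegree (mem_support_iff.2 hc)
    simpa using this
  have hf0 : f ≠ 0 := by rintro rfl; simp at hc
  have hcast : ∀ x : Fin 3 → ℤ, ∀ g : MvPolynomial (Fin 3) ℤ, eval x g = 0 →
      eval (fun i => (x i : ℚ)) (map (Int.castRingHom ℚ) g) = 0 := by
    intro x g hg
    rw [eval_int_map, hg]; simp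
  obtain ⟨f', f1, f2, f3, f4⟩ := normalize f hd hf0 (T := S) (fun m t => ∏ i, t.1 i ^ m i) (B ^ d)
    (Nat.one_le_pow _ _ hB1) (by
      intro m t hm
      rw [Finset.abs_prod]
      rw [Finsupp.degree_eq_sum] at hm
      calc ∏ i, |t.1 i ^ m i| ≤ ∏ i, (B : ℤ) ^ m i := by
            refine Finset.prod_le_prod (fun i _ => abs_nonneg _) (fun i _ => ?_)
            rw [abs_pow]
            refine pow_le_pow_left₀ (abs_nonneg _) ?_ _
            rw [hB]; exact hbox t.1 t.2 i
        _ = (B : ℤ) ^ (∑ i, m i) := by rw [Finset.prod_pow_eq_pow_sum]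
        _ ≤ (B : ℤ) ^ d := pow_le_pow_right₀ (by exact_mod_cast hB1) (by omega)
        _ = _ := by push_cast; rfl) (by
      intro t
      have := hz t.1 t.2
      rwa [eval_eq'] at this)
  have hz' : ∀ t ∈ S, eval t f' = 0 := by
    intro t ht
    have := f4 ⟨t, ht⟩
    rw [eval_eq']
    exact this
  have hcQ : coeff (Finsupp.single 0 d) (map (Int.castRingHom ℚ) f) ≠ 0 := by
    rw [coeff_map]; simpa using hc
  rw [← hB]
  by_cases hdv : map (Int.castRingHom ℚ) f ∣ map (Int.castRingHom ℚ) f'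
  swap
  · refine ⟨∅, by simp, by simp, ?_⟩
    intro U hU _
    have := codim_two (map (Int.castRingHom ℚ) f) (map (Int.castRingHom ℚ) f') (by rw [totalDegree_map_Q]; exact hd) hcQ hirr
      hdv B U (by
        intro x hx
        refine ⟨fun i => ?_, hcast x f (hz x (hU hx)), hcast x f' (hz' x (hU hx))⟩
        rw [hB]; exact hbox x (hU hx) i)
    rw [totalDegree_map_Q] at this
    refine this.trans ((box_three b hb1 d _ f2 B hB1).trans ?_)
    gcongr; norm_num
  have f1Q : map (Int.castRingHom ℚ) f' ≠ 0 := by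
    intro h
    apply f1
    apply map_injective _ (RingHom.injective_int (Int.castRingHom ℚ))
    rw [h, map_zero]
  obtain ⟨c, c1, c2⟩ := irr_of_dvd _ _ hirr f1Q hdv (by rw [totalDegree_map_Q, totalDegree_map_Q, htd]; exact f2)
  have hirr' : Irreducible (map (Int.castRingHom ℚ) f') := by
    rw [c2]
    exact (irreducible_isUnit_mul ((isUnit_iff_ne_zero.2 c1).map MvPolynomial.C)).2 hirr
  have hcQ' : coeff (Finsupp.single 0 d) (map (Int.castRingHom ℚ) f') ≠ 0 := by
    rw [c2, coeff_C_mul]; exact mul_ne_zero c1 hcQ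
  have hc' : coeff (Finsupp.single 0 d) f' ≠ 0 := by
    intro h; rw [coeff_map, h] at hcQ'; simp at hcQ'
  obtain ⟨A, hA⟩ : ∃ A, A = ((d + 1) ^ 3 * B ^ d) ^ ((d + 1) ^ 3) := ⟨_, rfl⟩
  rw [← hA] at f3
  have hev : ∀ t ∈ S, |eval t (pderiv 0 f')| ≤ (((d + 1) ^ 3 * (A * (d + 1) * B ^ d) : ℕ) : ℤ) := by
    intro t ht
    refine eval_le (pderiv 0 f') d t ((totalDegree_pderiv_le 0 f').trans f2) (A * (d + 1)) B hB1
      (coeff_pderiv_le 0 f' f2 f3) ?_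
    intro i; rw [hB]; exact hbox t ht i
  obtain ⟨R, hR⟩ : ∃ R, R = (3 + 10000 * d) * (d + 1) ^ 3 + 4 + 10000 * d := ⟨_, rfl⟩
  have hRb : (d + 1) ^ 3 * (A * (d + 1) * B ^ d) ≤ b ^ R := by
    have e1 : A ≤ b ^ ((3 + 10000 * d) * (d + 1) ^ 3) := by
      rw [hA, pow_mul]
      apply Nat.pow_le_pow_left
      rw [pow_add, pow_mul, hB]
      gcongr
    calc (d + 1) ^ 3 * (A * (d + 1) * B ^ d)
        ≤ b ^ 3 * (b ^ ((3 + 10000 * d) * (d + 1) ^ 3) * b * b ^ (10000 * d)) := by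
          rw [hB, ← pow_mul b 10000 d]
          gcongr
      _ = b ^ R := by
          rw [hR, pow_add, pow_add]
          ring
  have hRle : R ≤ 20007 * (d + 1) ^ 4 := by
    rw [hR]
    have h1 : d + 1 ≤ (d + 1) ^ 4 := Nat.le_self_pow (by norm_num) _
    have h2 : (3 + 10000 * d) * (d + 1) ^ 3 ≤ (10000 * (d + 1)) * (d + 1) ^ 3 := by
      gcongr; omega
    have h3 : (10000 * (d + 1)) * (d + 1) ^ 3 = 10000 * (d + 1) ^ 4 := by ring
    omega
  have hbig : C + 4 * R + 4 * d * (2 * (d + D) ^ 2) ^ 4 ≤ b := by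
    refine le_trans ?_ hb
    have h1 : (d + 1) ^ 4 ≤ (d + 1) ^ 9 := Nat.pow_le_pow_right (by omega) (by norm_num)
    have h2 : 4 * d * (2 * (d + D) ^ 2) ^ 4 ≤ 64 * (D + 1) ^ 8 * (d + 1) ^ 9 := by
      calc 4 * d * (2 * (d + D) ^ 2) ^ 4 = 64 * d * (d + D) ^ 8 := by ring
        _ ≤ 64 * (d + 1) * ((D + 1) * (d + 1)) ^ 8 := by
            have : d + D ≤ (D + 1) * (d + 1) := by
              have : (D + 1) * (d + 1) = D * d + D + d + 1 := by ring
              have : 0 ≤ D * d := Nat.zero_le _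
              omega
            gcongr; omega
        _ = _ := by ring
    have h3 : C ≤ C * (d + 1) ^ 9 := Nat.le_mul_of_pos_right _ hd9
    have h4 : (C + 80028 + 64 * (D + 1) ^ 8 + 1) * (d + 1) ^ 9 =
      C * (d + 1) ^ 9 + 80028 * (d + 1) ^ 9 + 64 * (D + 1) ^ 8 * (d + 1) ^ 9 + (d + 1) ^ 9 := by ring
    omega
  obtain ⟨L, l1, l2, l3⟩ := hC d b R f' (S.filter (fun t => eval t (pderiv 0 f') ≠ 0)) hd5 hbig f2 hc' hirr'
    (fun t ht => hbox t (Finset.mem_filter.1 ht).1) (fun t ht => hz' t (Finset.mem_filter.1 ht).1)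
    (fun t ht => (Finset.mem_filter.1 ht).2)
    (fun t ht => (hev t (Finset.mem_filter.1 ht).1).trans (by exact_mod_cast hRb))
  refine ⟨L, l1, l2, ?_⟩
  intro U hU hUL
  obtain ⟨U1, hU1⟩ : ∃ U1, U1 = U.filter (fun t => eval t (pderiv 0 f') ≠ 0) := ⟨_, rfl⟩
  obtain ⟨U2, hU2⟩ : ∃ U2, U2 = U.filter (fun t => eval t (pderiv 0 f') = 0) := ⟨_, rfl⟩
  have u6 : U.card ≤ U1.card + U2.card := by
    refine le_trans (Finset.card_le_card ?_) (Finset.card_union_le _ _)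
    intro x hx
    rw [hU1, hU2, Finset.mem_union, Finset.mem_filter, Finset.mem_filter]
    tauto
  have u1 := l3 U1 (fun x hx => by
      rw [hU1] at hx
      exact Finset.mem_filter.2 ⟨hU (Finset.mem_filter.1 hx).1, (Finset.mem_filter.1 hx).2⟩)
    (fun x hx => by
      rw [hU1] at hx
      exact hUL x (Finset.mem_filter.1 hx).1)
  have hdeg : 0 < degreeOf 0 (map (Int.castRingHom ℚ) f') := by
    have := degreeOf_zero_of_coeff _ hcQ'
    omega
  have u2 := codim_two (map (Int.castRingHom ℚ) f') (map (Int.castRingHom ℚ) (pderiv 0 f'))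
      (by rw [totalDegree_map_Q]; exact f2) hcQ' hirr'
      (by rw [← pderiv_map]; exact (not_dvd_pderiv 0 _ hdeg).2) B U2 (by
        intro x hx
        rw [hU2] at hx
        obtain ⟨x1, x2⟩ := Finset.mem_filter.1 hx
        refine ⟨fun i => ?_, hcast x f' (hz' x (hU x1)), hcast x _ (x2)⟩
        rw [hB]; exact hbox x (hU x1) i)
  rw [totalDegree_map_Q] at u2
  have u3 := box_three b hb1 d _ ((totalDegree_pderiv_le 0 f').trans f2) B hB1
  have u4 : b ^ 9511 ≤ 1 * 1 * B := by
    rw [hB, one_mul, one_mul]; exact Nat.pow_le_pow_right hb1 (by norm_num)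
  have u5 : 1 * 1 * B ≤ 1 * (d + 1) ^ 3 * B := by
    gcongr; exact Nat.one_le_pow _ _ (by omega)
  have u7 : 13 * (d + 1) ^ 3 * B = 12 * (d + 1) ^ 3 * B + 1 * (d + 1) ^ 3 * B := by ring
  omega

end DG

open MvPolynomial
namespace DG

theorem irr_of_map {K L σ : Type*} [Field K] [Field L] (φ : K →+* L) (p : MvPolynomial σ K)
    (h : Irreducible (map φ p)) : Irreducible p := by
  have key : ∀ a : MvPolynomial σ K, IsUnit (map φ a) → IsUnit a := by
    intro a ha
    have h0 : a.totalDegree = 0 := by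
      have h1 : (map φ a).totalDegree = 0 := by
        obtain ⟨u, hu⟩ := ha.exists_right_inv
        have hne : map φ a ≠ 0 := ha.ne_zero
        have hu0 : u ≠ 0 := by rintro rfl; simp at hu
        have := totalDegree_mul_of_isDomain hne hu0
        rw [hu, totalDegree_one] at this
        omega
      unfold totalDegree at h1 ⊢
      rwa [support_map_of_injective _ φ.injective] at h1
    rw [totalDegree_eq_zero_iff_eq_C] at h0
    have hc : coeff 0 a ≠ 0 := by
      intro hc
      rw [h0, hc] at ha
      simp at ha
    rw [h0]
    exact (isUnit_iff_ne_zero.2 hc).map C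
  constructor
  · intro hu
    exact h.not_isUnit (hu.map (map φ))
  · intro a b hab
    rw [hab, map_mul] at h
    exact (h.isUnit_or_isUnit rfl).imp (key a) (key b)

theorem homComp_mul {K σ : Type*} [Field K] [CharZero K] [Fintype σ] (p q : MvPolynomial σ K) (a b : ℕ)
    (ha : p.totalDegree ≤ a) (hb : q.totalDegree ≤ b) :
    homogeneousComponent (a + b) (p * q) = homogeneousComponent a p * homogeneousComponent b q := by
  apply MvPolynomial.funext
  intro v
  have hn : ∀ (r : MvPolynomial σ K) n, r.totalDegree ≤ n →
    (aeval (fun i => Polynomial.C (v i) * Polynomial.X + Polynomial.C ((0 : σ → K) i)) r).natDegree ≤ n := by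
    intro r n hr
    rw [← mul_one n]
    apply aeval_natDegree_le _ hr
    intro i
    exact Polynomial.natDegree_linear_le
  rw [map_mul (eval v), ← coeff_line p a ha v 0, ← coeff_line q b hb v 0,
    ← coeff_line (p * q) (a + b) ((totalDegree_mul _ _).trans (add_le_add ha hb)) v 0,
    map_mul (aeval _)]
  exact Polynomial.coeff_mul_add_eq_of_natDegree_le (hn p a ha) (hn q b hb)

theorem coeff_single_eq {R : Type*} [CommRing R] {r : ℕ} (f : MvPolynomial (Fin (r+1)) R) (d : ℕ) (hd : f.totalDegree ≤ d) :
    coeff (Finsupp.single 0 d) f = eval (Fin.cons 1 (fun _ => 0) : Fin (r+1) → R) (homogeneousComponent d f) := by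
  rw [← coeff_axis, ← coeff_line f d hd _ 0]
  congr 2
  congr 1
  funext i
  refine Fin.cases ?_ (fun i => ?_) i <;> simp

/-- dehomogenisation -/
noncomputable def dehom {R : Type*} [CommRing R] (p : MvPolynomial (Fin 3) R) : MvPolynomial (Fin 2) R :=
  aeval (![X 0, 1, X 1] : Fin 3 → MvPolynomial (Fin 2) R) p

theorem dehom_mul {R : Type*} [CommRing R] (p q : MvPolynomial (Fin 3) R) : dehom (p * q) = dehom p * dehom q := by
  unfold dehom; rw [map_mul]

theorem eval_dehom {R : Type*} [CommRing R] (p : MvPolynomial (Fin 3) R) (w : Fin 2 → R) :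
    eval w (dehom p) = eval ![w 0, 1, w 1] p := by
  unfold dehom
  have : (aeval w).comp (aeval (![X 0, 1, X 1] : Fin 3 → MvPolynomial (Fin 2) R)) =
    (aeval ![w 0, 1, w 1] : MvPolynomial (Fin 3) R →ₐ[R] R) := by
    apply algHom_ext
    intro i
    fin_cases i <;> simp
  have := DFunLike.congr_fun this p
  simpa [aeval_eq_eval] using this

theorem map_dehom {R S : Type*} [CommRing R] [CommRing S] (φ : R →+* S) (p : MvPolynomial (Fin 3) R) :
    map φ (dehom p) = dehom (map φ p) := by
  unfold dehom
  induction p using MvPolynomial.induction_on with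
  | C a => simp
  | add a b ha hb => simp only [map_add, ha, hb]
  | mul_X a i ha =>
    simp only [map_mul, ha, aeval_X, map_X]
    congr 1
    fin_cases i <;> simp

theorem totalDegree_dehom {R : Type*} [CommRing R] (p : MvPolynomial (Fin 3) R) :
    (dehom p).totalDegree ≤ p.totalDegree := by
  apply totalDegree_aeval_linear
  intro i
  fin_cases i
  · exact totalDegree_X_le _
  · change (1 : MvPolynomial (Fin 2) R).totalDegree ≤ 1
    simp
  · exact totalDegree_X_le _

theorem homComp_map {R S σ : Type*} [CommRing R] [CommRing S] (φ : R →+* S) (d : ℕ) (p : MvPolynomial σ R) :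
    map φ (homogeneousComponent d p) = homogeneousComponent d (map φ p) := by
  classical
  ext m
  rw [coeff_map, coeff_homogeneousComponent, coeff_homogeneousComponent, coeff_map]
  split_ifs <;> simp

theorem coeff_dehom {R : Type*} [CommRing R] (f : MvPolynomial (Fin 3) R) (d : ℕ) (hd : f.totalDegree ≤ d) :
    coeff (Finsupp.single 0 d) (dehom (homogeneousComponent d f)) = coeff (Finsupp.single 0 d) f := by
  have h1 : (homogeneousComponent d f).totalDegree ≤ d := (homogeneousComponent_isHomogeneous d f).totalDegree_le
  rw [coeff_single_eq f d hd, ← coeff_axis]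
  have h2 := coeff_line (homogeneousComponent d f) d h1 (Fin.cons 1 (fun _ => 0)) ![0,1,0]
  rw [homogeneousComponent_eq_self (homogeneousComponent_isHomogeneous d f)] at h2
  rw [← h2]
  congr 1
  unfold dehom
  have : (aeval (Fin.cons Polynomial.X (fun _ => 0) : Fin 2 → Polynomial R)).comp
      (aeval (![X 0, 1, X 1] : Fin 3 → MvPolynomial (Fin 2) R)) =
    (aeval (fun i => Polynomial.C ((Fin.cons 1 (fun _ => 0) : Fin 3 → R) i) * Polynomial.X +
      Polynomial.C ((![0,1,0] : Fin 3 → R) i))) := by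
    apply algHom_ext
    intro i
    fin_cases i
    · simp
    · simp
    · have : (Fin.cons 1 (fun _ => 0) : Fin 3 → R) 2 = 0 := rfl
      simp [this]
  exact DFunLike.congr_fun this _

theorem irr_of_top {K : Type*} [Field K] [CharZero K] (f : MvPolynomial (Fin 3) K) (d : ℕ) (hd1 : 1 ≤ d) (hd : f.totalDegree ≤ d)
    (hc : coeff (Finsupp.single 0 d) f ≠ 0) (hi : Irreducible (dehom (homogeneousComponent d f))) : Irreducible f := by
  have hf0 : f ≠ 0 := by rintro rfl; simp at hc
  have htd : f.totalDegree = d := by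
    apply le_antisymm hd
    have := le_totalDegree (mem_support_iff.2 hc)
    simpa using this
  have hg : d ≤ (dehom (homogeneousComponent d f)).totalDegree := by
    rw [← coeff_dehom f d hd] at hc
    have := le_totalDegree (mem_support_iff.2 hc)
    simpa using this
  constructor
  · intro hu
    obtain ⟨u, hu⟩ := hu.exists_right_inv
    have hu0 : u ≠ 0 := by rintro rfl; simp at hu
    have := totalDegree_mul_of_isDomain hf0 hu0
    rw [hu, totalDegree_one] at this
    omega
  · have key : ∀ a b : MvPolynomial (Fin 3) K, f = a * b →
        IsUnit (dehom (homogeneousComponent a.totalDegree a)) → IsUnit a := by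
      intro a b hab hu
      have ha0 : a ≠ 0 := by rintro rfl; simp at hab; exact hf0 hab
      have hb0 : b ≠ 0 := by rintro rfl; simp at hab; exact hf0 hab
      have h1 := totalDegree_mul_of_isDomain ha0 hb0
      rw [← hab, htd] at h1
      have h2 := homComp_mul a b _ _ le_rfl le_rfl
      rw [← hab, ← h1] at h2
      rw [h2, dehom_mul] at hg
      obtain ⟨u, hu'⟩ := hu.exists_right_inv
      have hu0 : u ≠ 0 := by rintro rfl; simp at hu'
      have h3 := totalDegree_mul_of_isDomain hu.ne_zero hu0
      rw [hu', totalDegree_one] at h3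
      have h4 := totalDegree_mul (dehom (homogeneousComponent a.totalDegree a)) (dehom (homogeneousComponent b.totalDegree b))
      have h5 := (totalDegree_dehom (homogeneousComponent b.totalDegree b)).trans
        (homogeneousComponent_isHomogeneous b.totalDegree b).totalDegree_le
      have h6 : a.totalDegree = 0 := by omega
      rw [totalDegree_eq_zero_iff_eq_C] at h6
      rw [h6]
      refine (isUnit_iff_ne_zero.2 ?_).map C
      intro h7
      rw [h7, C_0] at h6
      exact ha0 h6
    intro a b hab
    have ha0 : a ≠ 0 := by rintro rfl; simp at hab; exact hf0 hab
    have hb0 : b ≠ 0 := by rintro rfl; simp at hab; exact hf0 hab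
    have h1 := totalDegree_mul_of_isDomain ha0 hb0
    rw [← hab, htd] at h1
    have h2 := homComp_mul a b _ _ le_rfl le_rfl
    rw [← hab, ← h1] at h2
    rw [h2, dehom_mul] at hi
    rcases hi.isUnit_or_isUnit rfl with h | h
    · exact Or.inl (key a b hab h)
    · exact Or.inr (key b a (by rw [hab, mul_comm]) h)

theorem no_line {K : Type*} [Field K] [CharZero K] (g : MvPolynomial (Fin 2) K) (hi : Irreducible g) (hg : 2 ≤ g.totalDegree)
    (a v : Fin 2 → K) (hv : v ≠ 0) : ∃ s : K, eval (fun i => a i + s * v i) g ≠ 0 := by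
  classical
  by_contra hcon
  push Not at hcon
  let l : MvPolynomial (Fin 2) K := C (v 1) * (X 0 - C (a 0)) - C (v 0) * (X 1 - C (a 1))
  have hle : ∀ w, eval w l = v 1 * (w 0 - a 0) - v 0 * (w 1 - a 1) := by
    intro w; simp [l]
  have hl0 : l ≠ 0 := by
    intro h0
    apply hv
    have h1 := hle (fun i => a i + ![1, 0] i)
    have h2 := hle (fun i => a i + ![0, 1] i)
    rw [h0] at h1 h2
    simp at h1 h2
    funext i
    fin_cases i
    · exact h2
    · exact h1.symm
  have hl1 : l.totalDegree ≤ 1 := by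
    have hx : ∀ (c e : K) (i : Fin 2), (C c * (X i - C e) : MvPolynomial (Fin 2) K).totalDegree ≤ 1 := by
      intro c e i
      refine (totalDegree_mul _ _).trans ?_
      rw [totalDegree_C, zero_add]
      refine (totalDegree_sub _ _).trans (max_le (totalDegree_X_le _) ?_)
      rw [totalDegree_C]; omega
    exact (totalDegree_sub _ _).trans (max_le (hx _ _ _) (hx _ _ _))
  have hnd : ¬ g ∣ l := by
    intro h
    have := totalDegree_le_of_dvd hl0 h
    omega
  have hinj : Function.Injective (fun (n : ℕ) (i : Fin 2) => a i + (n : K) * v i) := by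
    intro n m hnm
    obtain ⟨i, hi⟩ := Function.ne_iff.1 hv
    have := congrFun hnm i
    simp only [add_right_inj] at this
    exact_mod_cast mul_right_cancel₀ hi this
  have := bezout g l hi hnd ((Finset.range ((g.totalDegree + l.totalDegree) ^ 4 + 1)).image
    (fun (n : ℕ) (i : Fin 2) => a i + (n : K) * v i)) (by
      intro p hp
      obtain ⟨n, -, rfl⟩ := Finset.mem_image.1 hp
      refine ⟨hcon n, ?_⟩
      rw [hle]; ring)
  rw [Finset.card_image_of_injective _ hinj, Finset.card_range] at this
  omega

/-- directional derivative -/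
noncomputable def dirD {R σ : Type*} [CommRing R] [Fintype σ] (v : σ → R) (f : MvPolynomial σ R) : MvPolynomial σ R :=
  ∑ i, C (v i) * pderiv i f

theorem derivative_aeval {R σ : Type*} [CommRing R] [Fintype σ] (v a : σ → R) (f : MvPolynomial σ R) :
    Polynomial.derivative (aeval (fun i => Polynomial.C (v i) * Polynomial.X + Polynomial.C (a i)) f) =
      aeval (fun i => Polynomial.C (v i) * Polynomial.X + Polynomial.C (a i)) (dirD v f) := by
  classical
  induction f using MvPolynomial.induction_on with
  | C c => simp [dirD]
  | add p q hp hq =>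
    rw [map_add, map_add, hp, hq, ← map_add]
    congr 1
    unfold dirD
    rw [← Finset.sum_add_distrib]
    simp only [map_add, mul_add]
  | mul_X p i hp =>
    have : dirD v (p * X i) = dirD v p * X i + p * C (v i) := by
      unfold dirD
      rw [Finset.sum_mul, Finset.sum_congr rfl (g := fun j => C (v j) * pderiv j p * X i + C (v j) * p * (Pi.single i 1 : σ → MvPolynomial σ R) j)]
      · rw [Finset.sum_add_distrib]
        congr 1
        rw [Finset.sum_eq_single i]
        · simp; ring
        · intro j _ hj; simp [hj]
        · simp
      · intro j _
        rw [pderiv_mul, pderiv_X]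
        by_cases hji : j = i
        · subst hji; simp; ring
        · rw [Pi.single_eq_of_ne (Ne.symm hji), Pi.single_eq_of_ne hji]; ring
    rw [this, map_mul, Polynomial.derivative_mul, hp, map_add, map_mul, map_mul, aeval_X, aeval_C]
    simp

theorem eval_aeval_line {R σ : Type*} [CommRing R] (v a : σ → R) (f : MvPolynomial σ R) (s : R) :
    (aeval (fun i => Polynomial.C (v i) * Polynomial.X + Polynomial.C (a i)) f).eval s = eval (fun i => a i + s * v i) f := by
  induction f using MvPolynomial.induction_on with
  | C c => simp
  | add p q hp hq => simp only [map_add, Polynomial.eval_add, hp, hq]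
  | mul_X p i hp =>
    simp only [map_mul, Polynomial.eval_mul, hp, aeval_X, eval_X]
    simp
    ring

theorem dirD_const {K σ : Type*} [Field K] [CharZero K] [Fintype σ] (v : σ → K) (f : MvPolynomial σ K) (h : dirD v f = 0)
    (a : σ → K) (s : K) : eval (fun i => a i + s * v i) f = eval a f := by
  have h1 := derivative_aeval v a f
  rw [h, map_zero] at h1
  have h2 := Polynomial.derivative_eq_zero.1 h1
  rw [Polynomial.natDegree_eq_zero] at h2
  obtain ⟨c, hc⟩ := h2
  have h3 := eval_aeval_line v a f s
  have h4 := eval_aeval_line v a f 0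
  rw [← hc] at h3 h4
  simp only [Polynomial.eval_C, zero_mul, add_zero] at h3 h4
  rw [← h3, h4]

theorem no_cylinder {K : Type*} [Field K] [CharZero K] [IsAlgClosed K] (P : MvPolynomial (Fin 3) K) (d : ℕ) (hd : 2 ≤ d)
    (hh : P.IsHomogeneous d) (hc : coeff (Finsupp.single 0 d) P ≠ 0) (hi : Irreducible (dehom P))
    (v : Fin 3 → K) (hv : v ≠ 0) : dirD v P ≠ 0 := by
  intro h0
  have hP : homogeneousComponent d P = P := homogeneousComponent_eq_self hh
  have htd : P.totalDegree ≤ d := hh.totalDegree_le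
  have hg : 2 ≤ (dehom P).totalDegree := by
    have h1 := coeff_dehom P d htd
    rw [hP] at h1
    rw [← h1] at hc
    have := le_totalDegree (mem_support_iff.2 hc)
    simp at this
    omega
  -- a root over each base point
  have hroot : ∀ p : Fin 3 → K, p 0 = 0 → ∃ κ : K, eval (fun i => p i + κ * (Fin.cons 1 (fun _ => 0) : Fin 3 → K) i) P = 0 := by
    intro p hp
    have h1 := coeff_line P d htd (Fin.cons 1 (fun _ => 0)) p
    rw [← coeff_single_eq P d htd] at h1
    obtain ⟨κ, hκ⟩ := IsAlgClosed.exists_root (aeval (fun i => Polynomial.C ((Fin.cons 1 (fun _ => 0) : Fin 3 → K) i) * Polynomial.X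
      + Polynomial.C (p i)) P) (by
        intro h2
        have h3 : d ≤ (aeval (fun i => Polynomial.C ((Fin.cons 1 (fun _ => 0) : Fin 3 → K) i) * Polynomial.X
          + Polynomial.C (p i)) P).natDegree := Polynomial.le_natDegree_of_ne_zero (by rw [h1]; exact hc)
        have h4 := Polynomial.natDegree_eq_of_degree_eq_some h2
        rw [h4] at h3
        exact absurd (hd.trans h3) (by decide))
    rw [Polynomial.IsRoot.def, eval_aeval_line] at hκ
    exact ⟨κ, hκ⟩
  by_cases hv1 : v 1 = 0
  · obtain ⟨κ, hκ⟩ := hroot ![0, 1, 0] rfl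
    obtain ⟨s, hs⟩ := no_line (dehom P) hi hg ![κ, 0] ![v 0, v 2] (by
      intro h
      apply hv
      funext i
      fin_cases i
      · exact congrFun h 0
      · exact hv1
      · exact congrFun h 1)
    apply hs
    rw [eval_dehom]
    refine Eq.trans ?_ ((dirD_const v P h0 _ s).trans hκ)
    congr 2
    funext i
    fin_cases i
    · simp
    · simp [hv1]
    · have : (Fin.cons 1 (fun _ => 0) : Fin 3 → K) 2 = 0 := rfl
      simp [this]
  · obtain ⟨κ, hκ⟩ := hroot ![0, 0, 1] rfl
    obtain ⟨s, hs⟩ := no_line (dehom P) hi hg ![v 0 / v 1, v 2 / v 1] ![κ, 1] (by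
      intro h
      have := congrFun h 1
      simp at this)
    apply hs
    have h2 : eval (fun i => s * (fun i => (![0, 0, 1] : Fin 3 → K) i + κ * (Fin.cons 1 (fun _ => 0) : Fin 3 → K) i) i) P = 0 := by
      rw [hom_eval_smul P hh, hκ, mul_zero]
    rw [eval_dehom]
    refine Eq.trans ?_ ((dirD_const v P h0 _ (1 / v 1)).trans h2)
    congr 2
    funext i
    have : (Fin.cons 1 (fun _ => 0) : Fin 3 → K) 2 = 0 := rfl
    fin_cases i
    · simp; ring
    · simp [hv1]
    · simp [this]; ring

theorem dirD_homComp {R σ : Type*} [CommRing R] [Fintype σ] (v : σ → R) (f : MvPolynomial σ R) (d : ℕ) (h : dirD v f = 0) :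
    dirD v (homogeneousComponent d f) = 0 := by
  classical
  ext m
  have h1 := congrArg (coeff m) h
  unfold dirD at h1 ⊢
  rw [coeff_sum] at h1 ⊢
  simp only [coeff_C_mul, coeff_pderiv, coeff_homogeneousComponent, coeff_zero] at h1 ⊢
  by_cases hm : m.degree + 1 = d
  · rw [← h1]
    apply Finset.sum_congr rfl
    intro i _
    rw [if_pos]
    rw [map_add, Finsupp.degree_single, hm]
  · apply Finset.sum_eq_zero
    intro i _
    rw [if_neg]
    · simp
    · rw [map_add, Finsupp.degree_single]; exact hm

theorem totalDegree_dirD_le {R σ : Type*} [CommRing R] [Fintype σ] (v : σ → R) (f : MvPolynomial σ R) :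
    (dirD v f).totalDegree ≤ f.totalDegree := by
  unfold dirD
  apply totalDegree_finsetSum_le
  intro i _
  refine (totalDegree_mul _ _).trans ?_
  rw [totalDegree_C, zero_add]
  exact totalDegree_pderiv_le i f

theorem coeff_dirD {R : Type*} [CommRing R] {r : ℕ} (v : Fin r → R) (f : MvPolynomial (Fin r) R) (d : ℕ) (hd : f.totalDegree ≤ d)
    (m) (hm : m.degree = d) : coeff m (dirD v f) = 0 := by
  unfold dirD
  rw [coeff_sum]
  apply Finset.sum_eq_zero
  intro i _
  rw [coeff_C_mul, coeff_pderiv]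
  have : coeff (m + Finsupp.single i 1) f = 0 := by
    by_contra h
    have h1 := le_totalDegree (mem_support_iff.2 h)
    change (m + Finsupp.single i 1).degree ≤ _ at h1
    rw [map_add, Finsupp.degree_single] at h1
    omega
  rw [this]; simp

theorem map_dirD {R S σ : Type*} [CommRing R] [CommRing S] [Fintype σ] (φ : R →+* S) (v : σ → R) (f : MvPolynomial σ R) :
    map φ (dirD v f) = dirD (fun i => φ (v i)) (map φ f) := by
  unfold dirD
  simp [pderiv_map]

/-- `f` does not divide its derivative in the direction `v` -/
theorem not_dvd_dirD {K : Type*} [Field K] [CharZero K] [IsAlgClosed K] (f : MvPolynomial (Fin 3) ℚ) (d : ℕ)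
    (φ : ℚ →+* K) (hd2 : 2 ≤ d) (hd : f.totalDegree ≤ d)
    (hc : coeff (Finsupp.single 0 d) f ≠ 0) (hi : Irreducible (dehom (homogeneousComponent d (map φ f))))
    (hf : Irreducible f) (v : Fin 3 → ℚ) (hv : v ≠ 0) : ¬ f ∣ dirD v f := by
  intro hdv
  have htd : f.totalDegree = d := by
    apply le_antisymm hd
    have := le_totalDegree (mem_support_iff.2 hc)
    simpa using this
  have hne : dirD v f ≠ 0 := by
    intro h0
    have h1 : dirD (fun i => φ (v i)) (map φ f) = 0 := by rw [← map_dirD, h0, map_zero]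
    refine no_cylinder (homogeneousComponent d (map φ f)) d hd2 (homogeneousComponent_isHomogeneous _ _) ?_ hi _ ?_
      (dirD_homComp _ _ d h1)
    · rw [coeff_homogeneousComponent, if_pos (by simp), coeff_map]
      exact (map_ne_zero φ).2 hc
    · intro h2
      apply hv
      funext i
      have := congrFun h2 i
      simpa using this
  obtain ⟨c, hc0, h⟩ := irr_of_dvd f _ hf hne hdv (totalDegree_dirD_le v f)
  have h1 := coeff_dirD v f d hd (Finsupp.single 0 d) (by simp)
  rw [h, coeff_C_mul] at h1
  exact mul_ne_zero hc0 hc h1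

end DG

open MvPolynomial
namespace DG

theorem card_sep (Z : Finset ℤ) (B M N : ℕ) (hM : 1 ≤ M) (hMN : M ≤ N) (hZ : ∀ z ∈ Z, |z| ≤ B)
    (hd : ∀ z ∈ Z, ∀ z' ∈ Z, (N : ℤ) ∣ z - z') : Z.card * M ≤ 2 * B + M := by
  classical
  have hN : (0 : ℤ) < N := by exact_mod_cast (by omega : 0 < N)
  have h1 : Z.card ≤ 2 * B / N + 1 := by
    have : Z.card ≤ (Finset.range (2 * B / N + 1)).card := by
      apply Finset.card_le_card_of_injOn (fun z : ℤ => ((z + (B:ℤ)) / (N:ℤ)).toNat)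
      · intro z hz
        have := abs_le.1 (hZ z hz)
        simp only [Finset.coe_range, Set.mem_Iio]
        have h2 : (z + B) / N ≤ ((2 * B : ℕ) : ℤ) / N := Int.ediv_le_ediv hN (by push_cast; omega)
        have h3 : ((2 * B : ℕ) : ℤ) / N = ((2 * B / N : ℕ) : ℤ) := by push_cast; rfl
        rw [h3] at h2
        exact Nat.lt_succ_of_le (Int.toNat_le.2 h2)
      · intro z hz z' hz' h
        have a1 := abs_le.1 (hZ z hz)
        have a2 := abs_le.1 (hZ z' hz')
        have b1 : 0 ≤ (z + B) / N := Int.ediv_nonneg (by omega) hN.le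
        have b2 : 0 ≤ (z' + B) / N := Int.ediv_nonneg (by omega) hN.le
        simp only at h
        have h2 : (z + B) / N = (z' + B) / N := by omega
        obtain ⟨k, hk⟩ := hd z hz z' hz'
        have h3 : z + B = z' + B + N * k := by linarith
        rw [h3, Int.add_mul_ediv_left _ _ hN.ne'] at h2
        have : k = 0 := by linarith
        rw [this] at hk
        linarith
    simpa using this
  calc Z.card * M ≤ (2 * B / N + 1) * M := Nat.mul_le_mul_right _ h1
    _ = 2 * B / N * M + M := by ring
    _ ≤ 2 * B / N * N + M := by gcongr
    _ ≤ 2 * B + M := Nat.add_le_add_right (Nat.div_mul_le_self _ _) _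

theorem card_roots_line (r0 : MvPolynomial (Fin 2) ℚ) (P : Fin 2 → ℚ) (hP : eval P r0 ≠ 0) (j : Fin 2) (T : Finset (Fin 2 → ℚ))
    (hT : ∀ w ∈ T, w j = P j ∧ eval w r0 = 0) : T.card ≤ r0.totalDegree := by
  classical
  obtain ⟨o, ho⟩ : ∃ o : Fin 2, ∀ i, i = j ∨ i = o := by
    refine ⟨1 - j, ?_⟩
    revert j
    intro j _ i
    fin_cases i <;> fin_cases j <;> simp
  by_cases hoj : o = j
  · exfalso
    have := ho (1 - j)
    rw [hoj, or_self] at this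
    revert this
    fin_cases j <;> simp
  let q := aeval (fun i => Polynomial.C ((Pi.single o 1 : Fin 2 → ℚ) i) * Polynomial.X + Polynomial.C (P i)) r0
  have hq0 : q ≠ 0 := by
    intro h
    have := eval_aeval_line (Pi.single o 1 : Fin 2 → ℚ) P r0 0
    change q.eval 0 = _ at this
    rw [h] at this
    simp at this
    exact hP this.symm
  have hdeg : q.natDegree ≤ r0.totalDegree := by
    have := aeval_natDegree_le r0 le_rfl (fun i => Polynomial.C ((Pi.single o 1 : Fin 2 → ℚ) i) * Polynomial.X + Polynomial.C (P i)) (n := 1)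
      (fun i => Polynomial.natDegree_linear_le)
    simpa using this
  have hw : ∀ w ∈ T, w = fun i => P i + (w o - P o) * (Pi.single o 1 : Fin 2 → ℚ) i := by
    intro w hw
    funext i
    rcases ho i with rfl | rfl
    · rw [(hT w hw).1, Pi.single_eq_of_ne (Ne.symm hoj)]; ring
    · simp
  have : T.card ≤ q.roots.toFinset.card := by
    apply Finset.card_le_card_of_injOn (fun w => w o - P o)
    · intro w hwT
      simp only [Finset.mem_coe, Multiset.mem_toFinset, Polynomial.mem_roots hq0, Polynomial.IsRoot.def]
      have := eval_aeval_line (Pi.single o 1 : Fin 2 → ℚ) P r0 (w o - P o)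
      rw [← hw w hwT, (hT w hwT).2] at this
      exact this
    · intro w hwT w' hwT' h
      simp only at h
      rw [hw w hwT, hw w' hwT', h]
  exact this.trans ((Multiset.toFinset_card_le _).trans ((Polynomial.card_roots' q).trans hdeg))

theorem line_count (f : MvPolynomial (Fin 3) ℚ) (d : ℕ) (hd : f.totalDegree ≤ d)
    (hc : coeff (Finsupp.single 0 d) f ≠ 0) (hf : Irreducible f) (v : Fin 3 → ℤ)
    (hv : ¬ f ∣ dirD (fun i => (v i : ℚ)) f) (hv0 : ∃ j : Fin 2, v j.succ ≠ 0)
    (hprim : ∃ a : Fin 3 → ℤ, ∑ i, a i * v i = 1) (B M : ℕ) (hM : 1 ≤ M) (hMB : M ≤ 2 * B) (i0 : Fin 3) (hi0 : (M : ℤ) ≤ |v i0|)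
    (S : Finset (Fin 3 → ℤ)) (hbox : ∀ x ∈ S, ∀ i, |x i| ≤ B)
    (hline : ∀ x ∈ S, ∀ s : ℚ, eval (fun i => (x i : ℚ) + s * v i) f = 0) :
    S.card * M ≤ 4 * d * (2 * d) ^ 2 * B := by
  classical
  obtain ⟨r0, hr0, hrd, hre⟩ := elim_eval f (dirD (fun i => (v i : ℚ)) f) hf hv
  have hrd' : r0.totalDegree ≤ (2 * d) ^ 2 := by
    refine hrd.trans (Nat.pow_le_pow_left ?_ 2)
    exact (add_le_add hd ((totalDegree_dirD_le _ f).trans hd)).trans (by omega)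
  obtain ⟨j, hj⟩ := hv0
  have hjq : (v j.succ : ℚ) ≠ 0 := by exact_mod_cast hj
  obtain ⟨P, hP⟩ : ∃ P : Fin 2 → ℚ, eval P r0 ≠ 0 := by
    by_contra h
    push Not at h
    exact hr0 (MvPolynomial.funext (by simpa using h))
  have hr : ∀ x ∈ S, ∀ s : ℚ, eval (fun i : Fin 2 => (x i.succ : ℚ) + s * v i.succ) r0 = 0 := by
    intro x hx s
    refine hre (fun i => (x i : ℚ) + s * v i) (hline x hx s) ?_
    have h0 : aeval (fun i => Polynomial.C (v i : ℚ) * Polynomial.X + Polynomial.C (x i : ℚ)) f = 0 := by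
      apply Polynomial.funext
      intro s
      rw [eval_aeval_line (fun i => (v i : ℚ)) (fun i => (x i : ℚ)), hline x hx s]; simp
    rw [← eval_aeval_line (fun i => (v i : ℚ)) (fun i => (x i : ℚ)), ← derivative_aeval, h0]
    simp
  let inv : (Fin 3 → ℤ) → Fin 3 → ℚ := fun x i => (x i : ℚ) + (P j - x j.succ) / v j.succ * v i
  let I := S.image inv
  have hI1 : I.card ≤ d * (I.image (fun y (i : Fin 2) => y i.succ)).card := by
    apply Finset.card_le_mul_card_image
    intro w hw
    have := card_fiber f hd hc w ((I.filter (fun y => (fun i : Fin 2 => y i.succ) = w)).image (fun y => y 0)) (by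
      intro z hz
      obtain ⟨y, hy, rfl⟩ := Finset.mem_image.1 hz
      obtain ⟨hy1, rfl⟩ := Finset.mem_filter.1 hy
      obtain ⟨x, hx, rfl⟩ := Finset.mem_image.1 hy1
      have h1 : (Fin.cons (inv x 0) (fun i : Fin 2 => inv x i.succ) : Fin 3 → ℚ) = inv x := by
        funext i
        refine Fin.cases rfl (fun i => rfl) i
      rw [h1]
      exact hline x hx _)
    rwa [Finset.card_image_of_injOn] at this
    intro y hy y' hy' h
    have h1 := (Finset.mem_filter.1 hy).2
    have h2 := (Finset.mem_filter.1 hy').2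
    funext i
    refine Fin.cases h (fun i => ?_) i
    exact congrFun (h1.trans h2.symm) i
  have hI2 : (I.image (fun y (i : Fin 2) => y i.succ)).card ≤ r0.totalDegree := by
    apply card_roots_line r0 P hP j
    intro w hw
    obtain ⟨y, hy, rfl⟩ := Finset.mem_image.1 hw
    obtain ⟨x, hx, rfl⟩ := Finset.mem_image.1 hy
    refine ⟨?_, hr x hx _⟩
    simp only [inv]
    field_simp
    ring
  obtain ⟨a, ha⟩ := hprim
  have hpar : ∀ x x', inv x = inv x' → ∃ k : ℤ, ∀ i, x i - x' i = k * v i := by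
    intro x x' h
    obtain ⟨q, hq⟩ : ∃ q : ℚ, ∀ i, (x i : ℚ) - x' i = q * v i := by
      refine ⟨(P j - x' j.succ) / v j.succ - (P j - x j.succ) / v j.succ, fun i => ?_⟩
      have := congrFun h i
      simp only [inv] at this
      linarith
    refine ⟨∑ i, a i * (x i - x' i), fun i => ?_⟩
    have : ((∑ i, a i * (x i - x' i) : ℤ) : ℚ) = q := by
      push_cast
      calc ∑ i, (a i : ℚ) * ((x i : ℚ) - x' i) = ∑ i, q * ((a i * v i : ℤ) : ℚ) := by
            apply Finset.sum_congr rfl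
            intro i _
            rw [hq i]; push_cast; ring
        _ = q * ((∑ i, a i * v i : ℤ) : ℚ) := by rw [← Finset.mul_sum]; push_cast; rfl
        _ = q := by rw [ha]; simp
    have h2 : ((x i - x' i : ℤ) : ℚ) = ((∑ i, a i * (x i - x' i)) * v i : ℤ) := by
      rw [Int.cast_mul, this]; push_cast; exact hq i
    exact_mod_cast h2
  have hvi : v i0 ≠ 0 := by
    intro h; rw [h] at hi0; simp at hi0; omega
  have hfib : S.card ≤ (4 * B / M) * I.card := by
    apply Finset.card_le_mul_card_image
    intro y hy
    rw [Nat.le_div_iff_mul_le (by omega)]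
    have := card_sep ((S.filter (fun x => inv x = y)).image (fun x => x i0)) B M (v i0).natAbs hM (by rw [Int.abs_eq_natAbs] at hi0; exact_mod_cast hi0) (by
        intro z hz
        obtain ⟨x, hx, rfl⟩ := Finset.mem_image.1 hz
        exact hbox x (Finset.mem_filter.1 hx).1 i0) (by
        intro z hz z' hz'
        obtain ⟨x, hx, rfl⟩ := Finset.mem_image.1 hz
        obtain ⟨x', hx', rfl⟩ := Finset.mem_image.1 hz'
        obtain ⟨k, hk⟩ := hpar x x' ((Finset.mem_filter.1 hx).2.trans (Finset.mem_filter.1 hx').2.symm)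
        rw [Int.natAbs_dvd, hk i0]
        exact Dvd.intro_left k rfl)
    rw [Finset.card_image_of_injOn] at this
    · omega
    · intro x hx x' hx' h
      obtain ⟨k, hk⟩ := hpar x x' ((Finset.mem_filter.1 hx).2.trans (Finset.mem_filter.1 hx').2.symm)
      have h1 := hk i0
      simp only at h
      rw [h, sub_self] at h1
      have hk0 : k = 0 := by
        rcases mul_eq_zero.1 h1.symm with h | h
        · exact h
        · exact absurd h hvi
      funext i
      have := hk i
      rw [hk0] at this
      linarith
  calc S.card * M ≤ (4 * B / M) * I.card * M := Nat.mul_le_mul_right _ hfib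
    _ = (4 * B / M * M) * I.card := by ring
    _ ≤ (4 * B) * (d * (2 * d) ^ 2) := Nat.mul_le_mul (Nat.div_mul_le_self _ _)
        (hI1.trans (Nat.mul_le_mul_left _ (hI2.trans hrd')))
    _ = _ := by ring

end DG

open MvPolynomial
namespace DG

theorem prim_eq (v v' : Fin 3 → ℤ) (hv : 0 < v 1) (hv' : 0 < v' 1) (ha : ∃ a : Fin 3 → ℤ, ∑ i, a i * v i = 1)
    (ha' : ∃ a : Fin 3 → ℤ, ∑ i, a i * v' i = 1) (h0 : v 0 * v' 1 = v' 0 * v 1) (h2 : v 2 * v' 1 = v' 2 * v 1) : v = v' := by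
  obtain ⟨a, ha⟩ := ha
  obtain ⟨a', ha'⟩ := ha'
  simp only [Fin.sum_univ_three] at ha ha'
  have d1 : v 1 ∣ v' 1 := ⟨a 0 * v' 0 + a 1 * v' 1 + a 2 * v' 2, by linear_combination (-v' 1) * ha + a 0 * h0 + a 2 * h2⟩
  have d2 : v' 1 ∣ v 1 := ⟨a' 0 * v 0 + a' 1 * v 1 + a' 2 * v 2, by linear_combination (-v 1) * ha' - a' 0 * h0 - a' 2 * h2⟩
  have h1 : v 1 = v' 1 := Int.dvd_antisymm hv.le hv'.le d1 d2
  have e0 : v 0 = v' 0 := by rw [h1] at h0; exact mul_right_cancel₀ hv'.ne' h0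
  have e2 : v 2 = v' 2 := by rw [h1] at h2; exact mul_right_cancel₀ hv'.ne' h2
  funext i
  fin_cases i
  · exact e0
  · exact h1
  · exact e2

theorem filter_card_mul {α β : Type*} [DecidableEq α] [DecidableEq β] (S : Finset α) (V : Finset β) (P : α → β → Prop) (M K : ℕ)
    (h : ∀ v ∈ V, ∀ S' ⊆ S, (∀ x ∈ S', P x v) → S'.card * M ≤ K) (Y : Finset α) (hY : Y ⊆ S) (hYV : ∀ x ∈ Y, ∃ v ∈ V, P x v) :
    Y.card * M ≤ V.card * K := by
  classical
  have h1 : Y ⊆ V.biUnion (fun v => Y.filter (fun x => P x v)) := by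
    intro x hx
    obtain ⟨v, hv, hp⟩ := hYV x hx
    exact Finset.mem_biUnion.2 ⟨v, hv, Finset.mem_filter.2 ⟨hx, hp⟩⟩
  calc Y.card * M ≤ (∑ v ∈ V, (Y.filter (fun x => P x v)).card) * M :=
        Nat.mul_le_mul_right _ ((Finset.card_le_card h1).trans Finset.card_biUnion_le)
    _ = ∑ v ∈ V, (Y.filter (fun x => P x v)).card * M := Finset.sum_mul _ _ _
    _ ≤ ∑ v ∈ V, K := Finset.sum_le_sum fun v hv => h v hv _ ((Finset.filter_subset _ _).trans hY) fun x hx => (Finset.mem_filter.1 hx).2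
    _ = V.card * K := by simp

theorem geo_count {α : Type*} [DecidableEq α] (Y : Finset α) (sc : α → ℕ) (N : ℕ)
    (h : ∀ i, (Y.filter (fun x => sc x = i)).card * 2 ^ i ≤ N) : Y.card ≤ 2 * N := by
  have h1 : Y.card ≤ ∑ i ∈ Finset.range (Y.sup sc + 1), (Y.filter (fun x => sc x = i)).card := by
    rw [← Finset.card_eq_sum_card_fiberwise]
    intro x hx
    simp only [Finset.coe_range, Set.mem_Iio]
    exact Nat.lt_succ_of_le (Finset.le_sup (f := sc) hx)
  have h2 : ∑ i ∈ Finset.range (Y.sup sc + 1), (Y.filter (fun x => sc x = i)).card ≤ ∑ i ∈ Finset.range (Y.sup sc + 1), N / 2 ^ i := by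
    apply Finset.sum_le_sum
    intro i _
    rw [Nat.le_div_iff_mul_le (by positivity)]
    exact h i
  have h3 := Nat.geom_sum_le (b := 2) le_rfl N (Y.sup sc + 1)
  simp at h3
  omega

theorem dir_sum : ∃ C : ℕ, ∀ (d K : ℕ) (g : MvPolynomial (Fin 2) ℚ) (V S : Finset (Fin 3 → ℤ)) (P : (Fin 3 → ℤ) → (Fin 3 → ℤ) → Prop),
    Irreducible g → 5 ≤ degreeOf 0 g → g.totalDegree ≤ d →
    (∀ v ∈ V, 0 < v 1 ∧ (∃ a : Fin 3 → ℤ, ∑ i, a i * v i = 1) ∧ eval (rpt v) g = 0) →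
    (∀ v ∈ V, ∀ M : ℕ, ∀ i0, 1 ≤ M → (M : ℤ) ≤ |v i0| → ∀ S' ⊆ S, (∀ x ∈ S', P x v) → S'.card * M ≤ K) →
    (∀ x ∈ S, ∃ v ∈ V, P x v) → S.card ≤ C * (d + 1) ^ 48 * K := by
  classical
  obtain ⟨C, hC1, hC⟩ := pc_proj
  refine ⟨2 * (64 * (C * C ^ 5)), ?_⟩
  intro d K g V S P hg h5 hgd hV hL hS
  obtain ⟨b0, hb0⟩ : ∃ b0, b0 = C * (d + 1) ^ 8 := ⟨_, rfl⟩
  have hb0pos : 1 ≤ b0 := by rw [hb0]; exact Nat.mul_pos hC1 (by positivity)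
  have hex : ∀ v : Fin 3 → ℤ, ∃ i : ℕ, ∀ l, |v l| ≤ (((b0 * 2 ^ i) ^ 8 : ℕ) : ℤ) := by
    intro v
    refine ⟨∑ l, (v l).natAbs, fun l => ?_⟩
    rw [Int.abs_eq_natAbs]
    have h1 : (v l).natAbs ≤ ∑ l, (v l).natAbs := Finset.single_le_sum (f := fun l => (v l).natAbs) (fun _ _ => Nat.zero_le _) (Finset.mem_univ l)
    have h2 := (Nat.lt_two_pow_self (n := ∑ l, (v l).natAbs)).le
    have h3 : 2 ^ (∑ l, (v l).natAbs) ≤ b0 * 2 ^ (∑ l, (v l).natAbs) := Nat.le_mul_of_pos_left _ hb0pos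
    have h4 : b0 * 2 ^ (∑ l, (v l).natAbs) ≤ (b0 * 2 ^ (∑ l, (v l).natAbs)) ^ 8 := Nat.le_self_pow (by norm_num) _
    exact_mod_cast h1.trans (h2.trans (h3.trans h4))
  let sc : (Fin 3 → ℤ) → ℕ := fun v => Nat.find (hex v)
  have hVi : ∀ i, (V.filter (fun v => sc v = i)).card ≤ C * (d + 1) ^ 8 * (b0 * 2 ^ i) ^ 5 := by
    intro i
    apply hC d (b0 * 2 ^ i) g
    · rw [← hb0]; exact Nat.le_mul_of_pos_right _ (by positivity)
    · exact hg
    · exact h5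
    · exact hgd
    · intro v hv
      exact (hV v (Finset.mem_filter.1 hv).1).1.ne'
    · intro v hv l
      have := Nat.find_spec (hex v) l
      have h2 : Nat.find (hex v) = i := (Finset.mem_filter.1 hv).2
      rwa [h2] at this
    · intro v hv v' hv' h0 h2
      have k := hV v (Finset.mem_filter.1 hv).1
      have k' := hV v' (Finset.mem_filter.1 hv').1
      exact prim_eq v v' k.1 k'.1 k.2.1 k'.2.1 h0 h2
    · intro v hv
      exact (hV v (Finset.mem_filter.1 hv).1).2.2
  choose! dr hdr using hS
  have key := geo_count S (fun x => sc (dr x)) (64 * (C * (d + 1) ^ 8 * b0 ^ 5 * K)) (by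
    intro i
    obtain ⟨Y, hY⟩ : ∃ Y, Y = S.filter (fun x => sc (dr x) = i) := ⟨_, rfl⟩
    rw [← hY]
    have hYS : Y ⊆ S := by rw [hY]; exact Finset.filter_subset _ _
    have hYV : ∀ x ∈ Y, ∃ v ∈ V.filter (fun v => sc v = i), P x v := by
      intro x hx
      rw [hY] at hx
      obtain ⟨hx1, hx2⟩ := Finset.mem_filter.1 hx
      exact ⟨dr x, Finset.mem_filter.2 ⟨(hdr x hx1).1, hx2⟩, (hdr x hx1).2⟩
    cases i with
    | zero =>
      have := filter_card_mul S _ P 1 K (fun v hv => hL v (Finset.mem_filter.1 hv).1 1 1 le_rfl (by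
        have := (hV v (Finset.mem_filter.1 hv).1).1
        rw [abs_of_pos this]
        exact_mod_cast this)) Y hYS hYV
      have h2 := Nat.mul_le_mul_right K (hVi 0)
      rw [pow_zero, mul_one] at h2
      rw [pow_zero]
      calc Y.card * 1 ≤ _ := this
        _ ≤ C * (d + 1) ^ 8 * b0 ^ 5 * K := h2
        _ ≤ _ := Nat.le_mul_of_pos_left _ (by norm_num)
    | succ j =>
      have := filter_card_mul S _ P ((b0 * 2 ^ j) ^ 8) K (fun v hv => by
        obtain ⟨hv1, hv2⟩ := Finset.mem_filter.1 hv
        have h3 := Nat.find_min (hex v) (m := j) (by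
          have : Nat.find (hex v) = j + 1 := hv2
          omega)
        push Not at h3
        obtain ⟨i0, hi0⟩ := h3
        exact hL v hv1 _ i0 (Nat.one_le_pow _ _ (by positivity)) hi0.le) Y hYS hYV
      have h2 := Nat.mul_le_mul_right K (hVi (j + 1))
      obtain ⟨bj, hbj⟩ : ∃ bj, bj = b0 * 2 ^ j := ⟨_, rfl⟩
      have hbj2 : b0 * 2 ^ (j + 1) = 2 * bj := by rw [hbj]; ring
      rw [← hbj] at this
      rw [hbj2] at h2
      have hbpos : 0 < bj ^ 5 := by rw [hbj]; positivity
      have h4 : Y.card * bj ^ 3 * bj ^ 5 ≤ 32 * (C * (d + 1) ^ 8 * K) * bj ^ 5 := by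
        calc Y.card * bj ^ 3 * bj ^ 5 = Y.card * bj ^ 8 := by ring
          _ ≤ _ := this.trans h2
          _ = _ := by ring
      have h5 := Nat.le_of_mul_le_mul_right h4 hbpos
      have h6 : 2 ^ j ≤ bj ^ 3 := by
        calc 2 ^ j ≤ bj := by rw [hbj]; exact Nat.le_mul_of_pos_left _ hb0pos
          _ ≤ bj ^ 3 := Nat.le_self_pow (by norm_num) _
      calc Y.card * 2 ^ (j + 1) = 2 * (Y.card * 2 ^ j) := by ring
        _ ≤ 2 * (Y.card * bj ^ 3) := by gcongr
        _ ≤ 2 * (32 * (C * (d + 1) ^ 8 * K)) := by gcongr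
        _ = 64 * (C * (d + 1) ^ 8 * 1 * K) := by ring
        _ ≤ 64 * (C * (d + 1) ^ 8 * b0 ^ 5 * K) := by
          gcongr
          exact Nat.one_le_pow _ _ hb0pos)
  refine key.trans (le_of_eq ?_)
  rw [hb0]
  ring

end DG

open MvPolynomial
namespace DG

theorem prim_dir (w : Fin 3 → ℤ) (hw : w 1 ≠ 0 ∨ w 2 ≠ 0) : ∃ (v : Fin 3 → ℤ) (k : ℤ), k ≠ 0 ∧ (∀ i, w i = k * v i) ∧
    (0 < v 1 ∨ (v 1 = 0 ∧ 0 < v 2)) ∧ ∃ a : Fin 3 → ℤ, ∑ i, a i * v i = 1 := by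
  obtain ⟨k, hk⟩ := (IsPrincipalIdealRing.principal (Ideal.span (Set.range w))).principal
  have h1 : ∀ i, ∃ v, w i = k * v := by
    intro i
    have : w i ∈ Ideal.span (Set.range w) := Ideal.subset_span ⟨i, rfl⟩
    rw [hk] at this
    obtain ⟨c, hc⟩ := Submodule.mem_span_singleton.1 this
    exact ⟨c, by rw [← hc, smul_eq_mul, mul_comm]⟩
  choose v hv using h1
  have hk0 : k ≠ 0 := by
    rintro rfl
    rcases hw with h | h
    · exact h (by rw [hv]; simp)
    · exact h (by rw [hv]; simp)
  have h2 : k ∈ Ideal.span (Set.range w) := by rw [hk]; exact Submodule.mem_span_singleton_self k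
  obtain ⟨a, ha⟩ := (Ideal.mem_span_range_iff_exists_fun).1 h2
  have ha1 : ∑ i, a i * v i = 1 := by
    apply mul_left_cancel₀ hk0
    rw [mul_one, Finset.mul_sum]
    refine Eq.trans ?_ ha
    apply Finset.sum_congr rfl
    intro i _
    rw [hv i]; ring
  have h12 : v 1 ≠ 0 ∨ v 2 ≠ 0 := by
    rcases hw with h | h
    · left; intro h'; exact h (by rw [hv, h', mul_zero])
    · right; intro h'; exact h (by rw [hv, h', mul_zero])
  by_cases hn : 0 < v 1 ∨ (v 1 = 0 ∧ 0 < v 2)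
  · exact ⟨v, k, hk0, hv, hn, a, ha1⟩
  · refine ⟨fun i => - v i, -k, neg_ne_zero.2 hk0, fun i => by rw [hv i]; ring, ?_, fun i => - a i, by simpa using ha1⟩
    simp only
    omega

theorem prim_eq' (v v' : Fin 3 → ℤ) (hv1 : v 1 = 0) (hv1' : v' 1 = 0) (hv : 0 < v 2) (hv' : 0 < v' 2)
    (ha : ∃ a : Fin 3 → ℤ, ∑ i, a i * v i = 1)
    (ha' : ∃ a : Fin 3 → ℤ, ∑ i, a i * v' i = 1) (h0 : v 0 * v' 2 = v' 0 * v 2) : v = v' := by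
  obtain ⟨a, ha⟩ := ha
  obtain ⟨a', ha'⟩ := ha'
  simp only [Fin.sum_univ_three] at ha ha'
  have := prim_eq ![v 0, v 2, v 1] ![v' 0, v' 2, v' 1] hv hv' ⟨![a 0, a 2, a 1], by
    simp [Fin.sum_univ_three]; linarith⟩ ⟨![a' 0, a' 2, a' 1], by
    simp [Fin.sum_univ_three]; linarith⟩ h0 (by simp [hv1, hv1'])
  have e0 : v 0 = v' 0 := congrFun this 0
  have e1 : v 2 = v' 2 := congrFun this 1
  have e2 : v 1 = v' 1 := congrFun this 2
  funext i
  fin_cases i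
  · exact e0
  · exact e2
  · exact e1

theorem top_zero {K : Type*} [Field K] [CharZero K] (f : MvPolynomial (Fin 3) K) (d : ℕ) (hd : f.totalDegree ≤ d) (x v : Fin 3 → K)
    (h : ∀ s : K, eval (fun i => x i + s * v i) f = 0) : eval v (homogeneousComponent d f) = 0 := by
  rw [← coeff_line f d hd v x]
  have h0 : aeval (fun i => Polynomial.C (v i) * Polynomial.X + Polynomial.C (x i)) f = 0 := by
    apply Polynomial.funext
    intro s
    rw [eval_aeval_line v x, h s]; simp
  rw [h0]; simp

theorem lines_total : ∃ C : ℕ, ∀ (d : ℕ) (f : MvPolynomial (Fin 3) ℚ) (B : ℕ) (S : Finset (Fin 3 → ℤ)), 5 ≤ d → f.totalDegree ≤ d →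
    coeff (Finsupp.single 0 d) f ≠ 0 → Irreducible f → Irreducible (dehom (homogeneousComponent d f)) →
    (∀ v : Fin 3 → ℚ, v ≠ 0 → ¬ f ∣ dirD v f) →
    (∀ x ∈ S, ∀ i, |x i| ≤ B) →
    (∀ x ∈ S, ∃ x' : Fin 3 → ℤ, x' ≠ x ∧ (∀ i, |x' i| ≤ B) ∧ ∀ s : ℚ, eval (fun i => (x i : ℚ) + s * ((x' i : ℚ) - x i)) f = 0) →
    S.card ≤ C * (d + 1) ^ 51 * B := by
  classical
  obtain ⟨C, hC⟩ := dir_sum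
  refine ⟨16 * C + 16, ?_⟩
  intro d f B S h5 hd hc hf hg hdir hbox hS
  have hΦ := homogeneousComponent_isHomogeneous d f
  have hΦ1 : eval (Fin.cons 1 (fun _ => 0) : Fin 3 → ℚ) (homogeneousComponent d f) ≠ 0 := by
    rw [← coeff_single_eq f d hd]; exact hc
  have hdr : ∀ x ∈ S, ∃ v : Fin 3 → ℤ, (∀ i, |v i| ≤ 2 * B) ∧ (0 < v 1 ∨ (v 1 = 0 ∧ 0 < v 2)) ∧
      (∃ a : Fin 3 → ℤ, ∑ i, a i * v i = 1) ∧ eval (fun i => (v i : ℚ)) (homogeneousComponent d f) = 0 ∧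
      ∀ s : ℚ, eval (fun i => (x i : ℚ) + s * v i) f = 0 := by
    intro x hx
    obtain ⟨x', hne, hb', hl⟩ := hS x hx
    have hw : x' 1 - x 1 ≠ 0 ∨ x' 2 - x 2 ≠ 0 := by
      by_contra hcon
      push Not at hcon
      have h0 := top_zero f d hd (fun i => (x i : ℚ)) (fun i => (x' i : ℚ) - x i) hl
      have h1 : (fun i => (x' i : ℚ) - x i) = fun i => ((x' 0 : ℚ) - x 0) * (Fin.cons 1 (fun _ => 0) : Fin 3 → ℚ) i := by
        funext i
        have e1 : (x' 1 : ℚ) - x 1 = 0 := by exact_mod_cast hcon.1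
        have e2 : (x' 2 : ℚ) - x 2 = 0 := by exact_mod_cast hcon.2
        fin_cases i
        · exact (mul_one _).symm
        · exact e1.trans (mul_zero _).symm
        · exact e2.trans (mul_zero _).symm
      rw [h1, hom_eval_smul _ hΦ] at h0
      rcases mul_eq_zero.1 h0 with h | h
      · have e0 : x' 0 - x 0 = 0 := by
          have := pow_eq_zero_iff (by omega) |>.1 h
          exact_mod_cast this
        apply hne
        funext i
        fin_cases i
        · exact sub_eq_zero.1 e0
        · exact sub_eq_zero.1 hcon.1
        · exact sub_eq_zero.1 hcon.2
      · exact hΦ1 h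
    obtain ⟨v, k, hk0, hkv, hn, ha⟩ := prim_dir (fun i => x' i - x i) hw
    have hkq : (k : ℚ) ≠ 0 := by exact_mod_cast hk0
    have hl2 : ∀ s : ℚ, eval (fun i => (x i : ℚ) + s * v i) f = 0 := by
      intro s
      have := hl (s / k)
      refine Eq.trans ?_ this
      congr 2
      funext i
      have e : ((x' i : ℚ) - x i) = k * v i := by exact_mod_cast hkv i
      rw [e]; field_simp
    refine ⟨v, fun i => ?_, hn, ha, top_zero f d hd (fun i => (x i : ℚ)) (fun i => (v i : ℚ)) hl2, hl2⟩
    have h1 : |x' i - x i| = |k| * |v i| := by rw [← abs_mul]; exact congrArg _ (hkv i)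
    have h2 : 1 ≤ |k| := Int.one_le_abs hk0
    have h3 : |x' i - x i| ≤ |x' i| + |x i| := abs_sub _ _
    have h4 := hb' i
    have h5 := hbox x hx i
    have h6 : |v i| ≤ |k| * |v i| := le_mul_of_one_le_left (abs_nonneg _) h2
    linarith
  choose! dr hdr using hdr
  have hL : ∀ x ∈ S, ∀ M : ℕ, ∀ i0, 1 ≤ M → (M : ℤ) ≤ |dr x i0| → ∀ S' ⊆ S,
      (∀ y ∈ S', ∀ s : ℚ, eval (fun i => (y i : ℚ) + s * dr x i) f = 0) → S'.card * M ≤ 4 * d * (2 * d) ^ 2 * B := by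
    intro x hx M i0 hM hMi S' hS' hl
    obtain ⟨h1, h2, h3, h4, -⟩ := hdr x hx
    refine line_count f d hd hc hf (dr x) (hdir _ ?_) ?_ h3 B M hM ?_ i0 hMi S' (fun y hy => hbox y (hS' hy)) hl
    · intro h
      have e1 : dr x 1 = 0 := by have := congrFun h 1; simpa using this
      have e2 : dr x 2 = 0 := by have := congrFun h 2; simpa using this
      omega
    · rcases h2 with h | h
      · exact ⟨0, h.ne'⟩
      · exact ⟨1, h.2.ne'⟩
    · exact_mod_cast hMi.trans (h1 i0)
  obtain ⟨S1, hS1⟩ : ∃ S1, S1 = S.filter (fun x => 0 < dr x 1) := ⟨_, rfl⟩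
  obtain ⟨S2, hS2⟩ : ∃ S2, S2 = S.filter (fun x => ¬ 0 < dr x 1) := ⟨_, rfl⟩
  have hsum : S1.card + S2.card = S.card := by rw [hS1, hS2]; exact Finset.card_filter_add_card_filter_not _
  have hS1S : S1 ⊆ S := by rw [hS1]; exact Finset.filter_subset _ _
  have hS2S : S2 ⊆ S := by rw [hS2]; exact Finset.filter_subset _ _
  have b1 : S1.card ≤ C * (d + 1) ^ 48 * (4 * d * (2 * d) ^ 2 * B) := by
    apply hC d (4 * d * (2 * d) ^ 2 * B) (dehom (homogeneousComponent d f)) (S1.image dr) S1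
      (fun y v => ∀ s : ℚ, eval (fun i => (y i : ℚ) + s * v i) f = 0) hg
    · exact h5.trans (degreeOf_zero_of_coeff _ (by rw [coeff_dehom f d hd]; exact hc))
    · exact (totalDegree_dehom _).trans hΦ.totalDegree_le
    · intro v hv
      obtain ⟨x, hx, rfl⟩ := Finset.mem_image.1 hv
      have hpos : 0 < dr x 1 := by rw [hS1] at hx; exact (Finset.mem_filter.1 hx).2
      have hq : (dr x 1 : ℚ) ≠ 0 := by exact_mod_cast hpos.ne'
      refine ⟨hpos, (hdr x (hS1S hx)).2.2.1, ?_⟩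
      rw [eval_dehom]
      have e : (![rpt (dr x) 0, 1, rpt (dr x) 1] : Fin 3 → ℚ) = fun i => (dr x 1 : ℚ)⁻¹ * (fun i => (dr x i : ℚ)) i := by
        funext i
        fin_cases i
        · exact mul_comm _ _
        · exact (inv_mul_cancel₀ hq).symm
        · exact mul_comm _ _
      rw [e, hom_eval_smul _ hΦ, (hdr x (hS1S hx)).2.2.2.1, mul_zero]
    · intro v hv M i0 hM hMi S' hS'
      obtain ⟨x, hx, rfl⟩ := Finset.mem_image.1 hv
      exact hL x (hS1S hx) M i0 hM hMi S' (hS'.trans hS1S)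
    · intro x hx
      exact ⟨dr x, Finset.mem_image_of_mem _ hx, (hdr x (hS1S hx)).2.2.2.2⟩
  have hz : ∀ x ∈ S2, dr x 1 = 0 ∧ 0 < dr x 2 := by
    intro x hx
    have h1 := (hdr x (hS2S hx)).2.1
    rw [hS2] at hx
    have h2 := (Finset.mem_filter.1 hx).2
    tauto
  have hV2 : (S2.image dr).card ≤ d := by
    have := card_fiber (homogeneousComponent d f) hΦ.totalDegree_le (by
      rw [coeff_homogeneousComponent, if_pos (by simp)]; exact hc) ![0, 1] ((S2.image dr).image (fun v => (v 0 : ℚ) * (v 2 : ℚ)⁻¹)) (by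
      intro z hz'
      obtain ⟨v, hv, rfl⟩ := Finset.mem_image.1 hz'
      obtain ⟨x, hx, rfl⟩ := Finset.mem_image.1 hv
      have hq : (dr x 2 : ℚ) ≠ 0 := by exact_mod_cast (hz x hx).2.ne'
      have h10 : (dr x 1 : ℚ) = 0 := by exact_mod_cast (hz x hx).1
      have e : (Fin.cons ((dr x 0 : ℚ) * (dr x 2 : ℚ)⁻¹) ![0, 1] : Fin 3 → ℚ) = fun i => (dr x 2 : ℚ)⁻¹ * (fun i => (dr x i : ℚ)) i := by
        funext i
        fin_cases i
        · exact mul_comm _ _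
        · change (0 : ℚ) = (dr x 2 : ℚ)⁻¹ * (dr x 1 : ℚ)
          rw [h10, mul_zero]
        · exact (inv_mul_cancel₀ hq).symm
      rw [e, hom_eval_smul _ hΦ, (hdr x (hS2S hx)).2.2.2.1, mul_zero])
    rwa [Finset.card_image_of_injOn] at this
    intro v hv v' hv' h
    obtain ⟨x, hx, rfl⟩ := Finset.mem_image.1 hv
    obtain ⟨x', hx', rfl⟩ := Finset.mem_image.1 hv'
    apply prim_eq' _ _ (hz x hx).1 (hz x' hx').1 (hz x hx).2 (hz x' hx').2 (hdr x (hS2S hx)).2.2.1 (hdr x' (hS2S hx')).2.2.1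
    have hq : (dr x 2 : ℚ) ≠ 0 := by exact_mod_cast (hz x hx).2.ne'
    have hq' : (dr x' 2 : ℚ) ≠ 0 := by exact_mod_cast (hz x' hx').2.ne'
    simp only at h
    field_simp at h
    have h' : (dr x 0 : ℚ) * dr x' 2 = dr x' 0 * dr x 2 := by linarith
    exact_mod_cast h'
  have b2 := filter_card_mul S2 (S2.image dr) (fun y v => ∀ s : ℚ, eval (fun i => (y i : ℚ) + s * v i) f = 0) 1 (4 * d * (2 * d) ^ 2 * B) (by
      intro v hv S' hS'
      obtain ⟨x, hx, rfl⟩ := Finset.mem_image.1 hv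
      exact hL x (hS2S hx) 1 2 le_rfl (by
        have := (hz x hx).2
        rw [abs_of_pos this]; exact_mod_cast this) S' (hS'.trans hS2S)) S2 (Finset.Subset.refl _) (by
      intro x hx
      exact ⟨dr x, Finset.mem_image_of_mem _ hx, (hdr x (hS2S hx)).2.2.2.2⟩)
  have b3 : S2.card ≤ d * (4 * d * (2 * d) ^ 2 * B) := by
    rw [mul_one] at b2
    exact b2.trans (Nat.mul_le_mul_right _ hV2)
  have hd1 : d ≤ d + 1 := by omega
  have hd48 : d ≤ (d + 1) ^ 48 := hd1.trans (Nat.le_self_pow (by norm_num) _)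
  rw [← hsum]
  calc S1.card + S2.card ≤ C * (d + 1) ^ 48 * (4 * d * (2 * d) ^ 2 * B) + d * (4 * d * (2 * d) ^ 2 * B) := add_le_add b1 b3
    _ ≤ C * (d + 1) ^ 48 * (4 * (d + 1) * (2 * (d + 1)) ^ 2 * B) + (d + 1) ^ 48 * (4 * (d + 1) * (2 * (d + 1)) ^ 2 * B) := by gcongr
    _ = _ := by ring

end DG

open MvPolynomial
namespace DG

theorem eval_lin {K : Type*} [Field K] (h : MvPolynomial (Fin 2) K) (hd : h.totalDegree ≤ 1) (w : Fin 2 → K) :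
    eval w h = coeff 0 h + coeff (Finsupp.single 0 1) h * w 0 + coeff (Finsupp.single 1 1) h * w 1 := by
  classical
  have hsub : h.support ⊆ {0, Finsupp.single 0 1, Finsupp.single 1 1} := by
    intro m hm
    have h1 := le_totalDegree hm
    change m.degree ≤ _ at h1
    rw [Finsupp.degree_eq_sum, Fin.sum_univ_two] at h1
    simp only [Finset.mem_insert, Finset.mem_singleton]
    have h2 : (m 0 = 0 ∧ m 1 = 0) ∨ (m 0 = 1 ∧ m 1 = 0) ∨ (m 0 = 0 ∧ m 1 = 1) := by omega
    rcases h2 with h | h | h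
    · left
      refine Finsupp.ext fun i => ?_
      fin_cases i
      · exact h.1
      · exact h.2
    · right; left
      refine Finsupp.ext fun i => ?_
      fin_cases i
      · simpa using h.1
      · simpa using h.2
    · right; right
      refine Finsupp.ext fun i => ?_
      fin_cases i
      · simpa using h.1
      · simpa using h.2
  have hne1 : (0 : Fin 2 →₀ ℕ) ≠ Finsupp.single 0 1 := by
    intro h; have := DFunLike.congr_fun h 0; simp at this
  have hne2 : (0 : Fin 2 →₀ ℕ) ≠ Finsupp.single 1 1 := by
    intro h; have := DFunLike.congr_fun h 1; simp at this
  have hne3 : (Finsupp.single 0 1 : Fin 2 →₀ ℕ) ≠ Finsupp.single 1 1 := by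
    intro h; have := DFunLike.congr_fun h 1; simp at this
  rw [eval_eq', Finset.sum_subset hsub (by
    intro m _ hm
    rw [notMem_support_iff.1 hm, zero_mul])]
  rw [Finset.sum_insert (by simp [hne1, hne2]), Finset.sum_insert (by simp [hne3]), Finset.sum_singleton]
  simp [Fin.prod_univ_two]
  ring

theorem lin_param (h : MvPolynomial (Fin 2) ℚ) (hi : Irreducible h) (hd : h.totalDegree ≤ 1) :
    ∃ (e : Fin 2) (p q : Fin 2 → ℚ), ∀ w : Fin 2 → ℚ, eval w h = 0 → ∀ i, w i = p i + q i * w e := by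
  by_cases h0 : coeff (Finsupp.single 0 1) h = 0
  · by_cases h1 : coeff (Finsupp.single 1 1) h = 0
    · exfalso
      have : h = C (coeff 0 h) := by
        apply MvPolynomial.funext
        intro w
        rw [eval_lin h hd, h0, h1]; simp
      have hpos := irr_totalDegree_pos hi
      rw [this, totalDegree_C] at hpos
      omega
    · refine ⟨0, ![0, -coeff 0 h / coeff (Finsupp.single 1 1) h], ![1, - coeff (Finsupp.single 0 1) h / coeff (Finsupp.single 1 1) h], ?_⟩
      intro w hw i
      rw [eval_lin h hd] at hw
      fin_cases i
      · simp
      · simp only [Fin.mk_one, Matrix.cons_val_one, Matrix.cons_val_fin_one]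
        field_simp
        linarith
  · refine ⟨1, ![-coeff 0 h / coeff (Finsupp.single 0 1) h, 0], ![- coeff (Finsupp.single 1 1) h / coeff (Finsupp.single 0 1) h, 1], ?_⟩
    intro w hw i
    rw [eval_lin h hd] at hw
    fin_cases i
    · simp only [Fin.zero_eta, Matrix.cons_val_zero]
      field_simp
      linarith
    · simp

theorem lin_case : ∃ C : ℕ, 1 ≤ C ∧ ∀ (d b : ℕ) (f : MvPolynomial (Fin 3) ℚ) (h : MvPolynomial (Fin 2) ℚ) (S : Finset (Fin 3 → ℤ)),
    C * (d + 1) ^ 8 ≤ b → f.totalDegree ≤ d → coeff (Finsupp.single 0 d) f ≠ 0 → Irreducible h → h.totalDegree ≤ 1 →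
    (∀ x ∈ S, ∀ i, |x i| ≤ ((b ^ 10000 : ℕ) : ℤ)) → (∀ x ∈ S, eval (fun i => (x i : ℚ)) f = 0) →
    (∀ x ∈ S, eval (fun i : Fin 2 => (x i.succ : ℚ)) h = 0) →
    ∃ S' ⊆ S, S'.card ≤ d * (C * (d + 1) ^ 8 * b ^ 5051 + 1) ∧ ∀ x ∈ S, x ∉ S' → ∃ x' ∈ S, x' ≠ x ∧
      ∀ s : ℚ, eval (fun i => (x i : ℚ) + s * ((x' i : ℚ) - x i)) f = 0 := by
  classical
  obtain ⟨C, hC1, hC⟩ := pc_affine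
  refine ⟨C, hC1, ?_⟩
  intro d b f h S hb hd hc hi hh hbox hf hz
  obtain ⟨e, p, q, hpq⟩ := lin_param h hi hh
  obtain ⟨k, hk⟩ : ∃ k : MvPolynomial (Fin 2) ℚ, k = aeval (Fin.cons (X 0) (fun i : Fin 2 => MvPolynomial.C (p i) + MvPolynomial.C (q i) * X 1) :
    Fin 3 → MvPolynomial (Fin 2) ℚ) f := ⟨_, rfl⟩
  have hke : ∀ u : Fin 2 → ℚ, eval u k = eval (Fin.cons (u 0) (fun i : Fin 2 => p i + q i * u 1) : Fin 3 → ℚ) f := by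
    intro u
    rw [hk, ← MvPolynomial.coe_aeval_eq_eval, ← MvPolynomial.coe_aeval_eq_eval]
    change (aeval u) (aeval _ f) = aeval _ f
    rw [← AlgHom.comp_apply, comp_aeval]
    congr 2
    funext i
    refine Fin.cases ?_ (fun i => ?_) i
    · simp
    · simp
  have hk0 : k ≠ 0 := by
    intro h0
    have hzero : ∀ z : ℚ, eval (Fin.cons z p : Fin 3 → ℚ) f = 0 := by
      intro z
      have := hke ![z, 0]
      rw [h0] at this
      simpa using this.symm
    have := card_fiber f hd hc p ((Finset.range (d + 1)).image (fun n : ℕ => (n : ℚ))) (fun z _ => hzero z)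
    rw [Finset.card_image_of_injective _ Nat.cast_injective, Finset.card_range] at this
    omega
  have hkd : k.totalDegree ≤ d := by
    rw [hk]
    refine (totalDegree_aeval_linear _ ?_ f).trans hd
    intro i
    refine Fin.cases ?_ (fun i => ?_) i
    · exact totalDegree_X_le 0
    · simp only [Fin.cons_succ]
      refine (totalDegree_add _ _).trans (max_le (by simp) ?_)
      refine (totalDegree_mul _ _).trans ?_
      have := totalDegree_X_le (R := ℚ) (1 : Fin 2)
      rw [totalDegree_C]; omega
  obtain ⟨rep, hr1, hr2⟩ := exists_rep (M := MvPolynomial (Fin 2) ℚ)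
  obtain ⟨L, hL1, hL2, -, hL3⟩ := exists_factors rep hr1 hr2 k hk0
  let pr : (Fin 3 → ℤ) → Fin 2 → ℤ := fun x => ![x 0, x e.succ]
  let pq : (Fin 3 → ℤ) → Fin 2 → ℚ := fun x i => (pr x i : ℚ)
  have hx : ∀ x ∈ S, ∀ i : Fin 2, (x i.succ : ℚ) = p i + q i * (x e.succ : ℚ) := fun x hx i => hpq _ (hz x hx) i
  have hinj : Set.InjOn pr S := by
    intro x hxS x' hxS' h
    have h0 : x 0 = x' 0 := congrFun h 0
    have h1 : x e.succ = x' e.succ := congrFun h 1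
    funext i
    refine Fin.cases h0 (fun i => ?_) i
    have := hx x hxS i
    rw [h1, ← hx x' hxS' i] at this
    exact_mod_cast this
  have hpk : ∀ x ∈ S, eval (pq x) k = 0 := by
    intro x hxS
    rw [hke]
    refine Eq.trans ?_ (hf x hxS)
    congr 2
    funext i
    refine Fin.cases rfl (fun i => ?_) i
    exact (hx x hxS i).symm
  let Sw : MvPolynomial (Fin 2) ℚ → Finset (Fin 3 → ℤ) := fun w => S.filter (fun x => eval (pq x) w = 0)
  refine ⟨(L.filter (fun w => 2 ≤ w.totalDegree ∨ (Sw w).card ≤ 1)).biUnion Sw, ?_, ?_, ?_⟩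
  · intro x hx
    obtain ⟨w, -, hw⟩ := Finset.mem_biUnion.1 hx
    exact (Finset.mem_filter.1 hw).1
  · refine (Finset.card_biUnion_le_card_mul _ _ (C * (d + 1) ^ 8 * b ^ 5051 + 1) ?_).trans ?_
    · intro w hw
      obtain ⟨hwL, hw2⟩ := Finset.mem_filter.1 hw
      rcases hw2 with hw2 | hw2
      · have hc1 : ((Sw w).image pr).card = (Sw w).card := Finset.card_image_of_injOn (hinj.mono (by
          intro x hx; exact (Finset.mem_filter.1 hx).1))
        rw [← hc1]
        refine (hC d b w _ hb (hL2 w hwL).1 hw2 ((totalDegree_le_of_dvd hk0 (hL2 w hwL).2.1).trans hkd) ?_ ?_).trans (Nat.le_succ _)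
        · intro t ht i
          obtain ⟨x, hx, rfl⟩ := Finset.mem_image.1 ht
          have := hbox x (Finset.mem_filter.1 hx).1
          fin_cases i
          · exact this 0
          · exact this e.succ
        · intro t ht
          obtain ⟨x, hx, rfl⟩ := Finset.mem_image.1 ht
          exact (Finset.mem_filter.1 hx).2
      · exact hw2.trans (Nat.le_add_left _ _)
    · exact Nat.mul_le_mul_right _ ((Finset.card_filter_le _ _).trans (hL1.trans hkd))
  · intro x hxS hxn
    obtain ⟨w, hwL, hw⟩ := hL3 (pq x) (hpk x hxS)
    have hxw : x ∈ Sw w := Finset.mem_filter.2 ⟨hxS, hw⟩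
    have hnot : ¬ (2 ≤ w.totalDegree ∨ (Sw w).card ≤ 1) := by
      intro hcon
      exact hxn (Finset.mem_biUnion.2 ⟨w, Finset.mem_filter.2 ⟨hwL, hcon⟩, hxw⟩)
    push Not at hnot
    obtain ⟨x', hx', hne⟩ := Finset.exists_mem_ne hnot.2 x
    obtain ⟨hxS', hw'⟩ := Finset.mem_filter.1 hx'
    refine ⟨x', hxS', hne, fun s => ?_⟩
    have hline : eval (fun i => pq x i + s * (pq x' i - pq x i)) w = 0 := by
      have hwd : w.totalDegree ≤ 1 := by omega
      rw [eval_lin w hwd] at hw hw' ⊢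
      linear_combination (1 - s) * hw + s * hw'
    have hkl : eval (fun i => pq x i + s * (pq x' i - pq x i)) k = 0 := by
      obtain ⟨c, hc⟩ := (hL2 w hwL).2.1
      rw [hc, map_mul, hline, zero_mul]
    rw [hke] at hkl
    refine Eq.trans ?_ hkl
    congr 2
    funext i
    refine Fin.cases rfl (fun i => ?_) i
    change (x i.succ : ℚ) + s * ((x' i.succ : ℚ) - x i.succ) = p i + q i * ((x e.succ : ℚ) + s * ((x' e.succ : ℚ) - x e.succ))
    rw [hx x hxS i, hx x' hxS' i]
    ring

end DG

open MvPolynomial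
namespace DG

theorem a3_arith (m1 b d δ8 Cp Cl : ℕ) (hb2 : 2 ≤ b) (h1 : d * (Cp * δ8) ≤ b) (h2 : d * (Cl * (d + 1) ^ 8) ≤ b) (hd : d ≤ b) :
    d * (Cp * δ8 * b ^ m1) ≤ b ^ (m1 + 2) ∧ d * (Cl * (d + 1) ^ 8 * b ^ m1 + 1) ≤ b ^ (m1 + 2) := by
  obtain ⟨P, hP⟩ : ∃ P, P = b ^ m1 := ⟨_, rfl⟩
  have hPP : b ^ (m1 + 2) = b * (b * P) := by
    rw [hP, pow_add]; ring
  have hP1 : 1 ≤ P := by rw [hP]; exact Nat.one_le_pow _ _ (by omega)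
  rw [hPP, ← hP]
  have hbP : b ≤ b * P := Nat.le_mul_of_pos_right _ hP1
  constructor
  · calc d * (Cp * δ8 * P) = d * (Cp * δ8) * P := by ring
      _ ≤ b * P := Nat.mul_le_mul_right _ h1
      _ ≤ b * (b * P) := Nat.le_mul_of_pos_left _ (by omega)
  · calc d * (Cl * (d + 1) ^ 8 * P + 1) = d * (Cl * (d + 1) ^ 8) * P + d := by ring
      _ ≤ b * P + b * P := add_le_add (Nat.mul_le_mul_right _ h2) (hd.trans hbP)
      _ = 2 * (b * P) := by ring
      _ ≤ b * (b * P) := Nat.mul_le_mul_right _ hb2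

theorem a3_thr (Cs Cp Cl C d D b : ℕ) (c1 : Cs ≤ C) (c2 : Cp ≤ C) (c3 : Cl ≤ C) (c4 : 1 ≤ C) (hb : C * (d + (D + 1)) ^ 17 ≤ b) :
    Cs * (d + 1) ^ 9 ≤ b ∧ Cp * ((d + D) ^ 2 + 1) ^ 8 ≤ b ∧ Cl * (d + 1) ^ 8 ≤ b ∧ d * (Cp * ((d + D) ^ 2 + 1) ^ 8) ≤ b ∧
      d * (Cl * (d + 1) ^ 8) ≤ b ∧ d ≤ b := by
  have hsq : (d + D) ^ 2 + 1 ≤ (d + (D + 1)) ^ 2 := by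
    have : (d + (D + 1)) ^ 2 = (d + D) ^ 2 + 2 * (d + D) + 1 := by ring
    omega
  have hd1 : d + 1 ≤ d + (D + 1) := by omega
  have hA1 : 1 ≤ d + (D + 1) := by omega
  have hdA : d ≤ d + (D + 1) := by omega
  generalize d + (D + 1) = A at *
  generalize (d + D) ^ 2 + 1 = E at *
  have hp : ∀ k, k ≤ 17 → A ^ k ≤ A ^ 17 := fun k hk => Nat.pow_le_pow_right hA1 hk
  have h8 : E ^ 8 ≤ A ^ 16 := by
    rw [show 16 = 2 * 8 from rfl, pow_mul]
    exact Nat.pow_le_pow_left hsq 8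
  have k9 : (d + 1) ^ 9 ≤ A ^ 9 := Nat.pow_le_pow_left hd1 9
  have k8 : (d + 1) ^ 8 ≤ A ^ 8 := Nat.pow_le_pow_left hd1 8
  have hd16 : d * A ^ 16 ≤ A ^ 17 := by
    rw [pow_succ' A 16]; exact Nat.mul_le_mul_right _ hdA
  have hd8 : d * A ^ 8 ≤ A ^ 9 := by
    rw [pow_succ' A 8]; exact Nat.mul_le_mul_right _ hdA
  have p8 := hp 8 (by norm_num)
  have p9 := hp 9 (by norm_num)
  have p16 := hp 16 (by norm_num)
  have p1 := hp 1 (by norm_num)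
  generalize A ^ 17 = A17 at *
  generalize A ^ 16 = A16 at *
  generalize A ^ 9 = A9 at *
  generalize A ^ 8 = A8 at *
  generalize E ^ 8 = E8 at *
  generalize (d + 1) ^ 9 = d9 at *
  generalize (d + 1) ^ 8 = d8 at *
  rw [pow_one] at p1
  have thr : ∀ c x, c ≤ C → x ≤ A17 → c * x ≤ b := fun c x h1 h2 => (Nat.mul_le_mul h1 h2).trans hb
  refine ⟨thr _ _ c1 (k9.trans p9), thr _ _ c2 (h8.trans p16), thr _ _ c3 (k8.trans p8), ?_, ?_, ?_⟩
  · rw [mul_left_comm]; exact thr _ _ c2 ((Nat.mul_le_mul_left _ h8).trans hd16)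
  · rw [mul_left_comm]; exact thr _ _ c3 ((Nat.mul_le_mul_left _ k8).trans (hd8.trans p9))
  · have := thr 1 d c4 (hdA.trans p1)
    omega

theorem a3_b : ∃ D C : ℕ, ∀ (d b : ℕ) (f : MvPolynomial (Fin 3) ℤ) (S : Finset (Fin 3 → ℤ)),
    5 ≤ d → C * (d + D) ^ 17 ≤ b → f.totalDegree ≤ d → coeff (Finsupp.single 0 d) f ≠ 0 →
    Irreducible (dehom (homogeneousComponent d (map (Int.castRingHom (AlgebraicClosure ℚ)) f))) →
    (∀ t ∈ S, ∀ i, |t i| ≤ ((b ^ 10000 : ℕ) : ℤ)) → (∀ t ∈ S, eval t f = 0) →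
    S.card ≤ C * (d + 1) ^ 51 * b ^ 10000 := by
  classical
  obtain ⟨D, Cs, hs⟩ := surf_cover
  obtain ⟨Cp, hCp1, hp⟩ := pc_affine
  obtain ⟨Cl, hCl1, hl⟩ := lin_case
  obtain ⟨Ct, ht⟩ := lines_total
  obtain ⟨m, hm⟩ : ∃ m, m = 10000 := ⟨_, rfl⟩
  obtain ⟨m1, hm1⟩ : ∃ m, m = 5051 := ⟨_, rfl⟩
  obtain ⟨m2, hm2⟩ : ∃ m, m = 4541 := ⟨_, rfl⟩
  rw [← hm, ← hm2] at hs
  rw [← hm, ← hm1] at hp hl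
  rw [← hm]
  have hmm : m2 + (m1 + 2) ≤ m := by omega
  clear hm hm1 hm2
  refine ⟨D + 1, Cs + Cp + Cl + Ct + 14, ?_⟩
  intro d b f S h5 hb hd hc hi hbox hz
  obtain ⟨t1, t2, t3, t4, t5, hdb⟩ := a3_thr Cs Cp Cl (Cs + Cp + Cl + Ct + 14) d D b (by omega) (by omega) (by omega) (by omega) hb
  clear hb
  have hb2 : 2 ≤ b := by omega
  obtain ⟨ar1, ar2⟩ := a3_arith m1 b d (((d + D) ^ 2 + 1) ^ 8) Cp Cl hb2 t4 t5 hdb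
  -- rational polynomial
  obtain ⟨fq, hfq⟩ : ∃ fq, fq = map (Int.castRingHom ℚ) f := ⟨_, rfl⟩
  have hmap : map (algebraMap ℚ (AlgebraicClosure ℚ)) fq = map (Int.castRingHom (AlgebraicClosure ℚ)) f := by
    rw [hfq, map_map]
    congr 1
  have hdq : fq.totalDegree ≤ d := by rw [hfq, totalDegree_map_Q]; exact hd
  have hcq : coeff (Finsupp.single 0 d) fq ≠ 0 := by
    rw [hfq, coeff_map]
    simpa using hc
  have hiK : Irreducible (dehom (homogeneousComponent d (map (algebraMap ℚ (AlgebraicClosure ℚ)) fq))) := by rw [hmap]; exact hi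
  have hgq : Irreducible (dehom (homogeneousComponent d fq)) := by
    apply irr_of_map (algebraMap ℚ (AlgebraicClosure ℚ))
    rw [map_dehom, homComp_map]
    exact hiK
  have hfqi : Irreducible fq := irr_of_top fq d (by omega) hdq hcq hgq
  have hdir : ∀ v : Fin 3 → ℚ, v ≠ 0 → ¬ fq ∣ dirD v fq := fun v hv =>
    not_dvd_dirD fq d (algebraMap ℚ (AlgebraicClosure ℚ)) (by omega) hdq hcq hiK hfqi v hv
  have hzq : ∀ x ∈ S, eval (fun i => (x i : ℚ)) fq = 0 := by
    intro x hx
    rw [hfq, eval_int_map, hz x hx]; simp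
  obtain ⟨L, hL1, hL2, hL3⟩ := hs d b f S h5 t1 hd hc (by rw [← hfq]; exact hfqi) hbox hz
  let Good : (Fin 3 → ℤ) → Prop := fun x => ∃ x' : Fin 3 → ℤ, x' ≠ x ∧ (∀ i, |x' i| ≤ ((b ^ m : ℕ) : ℤ)) ∧
    ∀ s : ℚ, eval (fun i => (x i : ℚ) + s * ((x' i : ℚ) - x i)) fq = 0
  have hE : ∀ h ∈ L, ∃ E : Finset (Fin 3 → ℤ), E.card ≤ b ^ (m1 + 2) ∧
      ∀ x ∈ S, eval (fun i : Fin 2 => (x i.succ : ℚ)) h = 0 → x ∈ E ∨ Good x := by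
    intro h hh
    obtain ⟨Sh, hSh⟩ : ∃ Sh, Sh = S.filter (fun x => eval (fun i : Fin 2 => (x i.succ : ℚ)) h = 0) := ⟨_, rfl⟩
    have hShS : ∀ x ∈ Sh, x ∈ S ∧ eval (fun i : Fin 2 => (x i.succ : ℚ)) h = 0 := by
      intro x hx; rw [hSh] at hx; exact Finset.mem_filter.1 hx
    have hShm : ∀ x ∈ S, eval (fun i : Fin 2 => (x i.succ : ℚ)) h = 0 → x ∈ Sh := by
      intro x hx hx2; rw [hSh]; exact Finset.mem_filter.2 ⟨hx, hx2⟩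
    by_cases hdeg : 2 ≤ h.totalDegree
    · refine ⟨Sh, ?_, fun x hx hx2 => Or.inl (hShm x hx hx2)⟩
      have h1 := card_le_fiber fq hdq hcq Sh (fun x hx => hzq x (hShS x hx).1)
      have h2 := hp ((d + D) ^ 2) b h (Sh.image (fun x (i : Fin 2) => x i.succ)) t2 (hL2 h hh).1 hdeg (hL2 h hh).2 (by
        intro t ht i
        obtain ⟨x, hx, rfl⟩ := Finset.mem_image.1 ht
        exact hbox x (hShS x hx).1 _) (by
        intro t ht
        obtain ⟨x, hx, rfl⟩ := Finset.mem_image.1 ht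
        exact (hShS x hx).2)
      exact h1.trans ((Nat.mul_le_mul_left _ h2).trans ar1)
    · obtain ⟨E, hE1, hE2, hE3⟩ := hl d b fq h Sh t3 hdq hcq (hL2 h hh).1 (by omega)
        (fun x hx => hbox x (hShS x hx).1) (fun x hx => hzq x (hShS x hx).1) (fun x hx => (hShS x hx).2)
      refine ⟨E, hE2.trans ar2, ?_⟩
      intro x hx hx2
      by_cases hxE : x ∈ E
      · exact Or.inl hxE
      · obtain ⟨x', hx', hne, hline⟩ := hE3 x (hShm x hx hx2) hxE
        exact Or.inr ⟨x', hne, hbox x' (hShS x' hx').1, hline⟩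
  choose! E hE1 hE2 using hE
  obtain ⟨U, hU⟩ : ∃ U : Finset (Fin 3 → ℤ), ∀ x, x ∈ U ↔ x ∈ S ∧ ∀ h ∈ L, eval (fun i : Fin 2 => (x i.succ : ℚ)) h ≠ 0 :=
    ⟨S.filter (fun x => ∀ h ∈ L, eval (fun i : Fin 2 => (x i.succ : ℚ)) h ≠ 0), fun x => Finset.mem_filter⟩
  obtain ⟨G, hG⟩ : ∃ G, G = S.filter Good := ⟨_, rfl⟩
  have hUc : U.card ≤ 13 * (d + 1) ^ 3 * b ^ m := by
    apply hL3 U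
    · intro x hx; exact ((hU x).1 hx).1
    · intro x hx; exact ((hU x).1 hx).2
  have hGc : G.card ≤ Ct * (d + 1) ^ 51 * b ^ m := by
    apply ht d fq (b ^ m) G h5 hdq hcq hfqi hgq hdir
    · intro x hx; rw [hG] at hx; exact hbox x (Finset.mem_filter.1 hx).1
    · intro x hx; rw [hG] at hx; exact (Finset.mem_filter.1 hx).2
  have hEc : (L.biUnion E).card ≤ b ^ m := by
    refine (Finset.card_biUnion_le_card_mul _ _ (b ^ (m1 + 2)) hE1).trans ?_
    calc L.card * b ^ (m1 + 2) ≤ b ^ m2 * b ^ (m1 + 2) := Nat.mul_le_mul_right _ hL1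
      _ = b ^ (m2 + (m1 + 2)) := (pow_add _ _ _).symm
      _ ≤ b ^ m := Nat.pow_le_pow_right (by omega) hmm
  have hcov : S ⊆ U ∪ (L.biUnion E ∪ G) := by
    intro x hx
    by_cases hxU : ∀ h ∈ L, eval (fun i : Fin 2 => (x i.succ : ℚ)) h ≠ 0
    · apply Finset.mem_union_left
      exact (hU x).2 ⟨hx, hxU⟩
    · push Not at hxU
      obtain ⟨h, hh, he⟩ := hxU
      apply Finset.mem_union_right
      rcases hE2 h hh x hx he with h1 | h1
      · exact Finset.mem_union_left _ (Finset.mem_biUnion.2 ⟨h, hh, h1⟩)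
      · apply Finset.mem_union_right
        rw [hG]; exact Finset.mem_filter.2 ⟨hx, h1⟩
  have h1 := Finset.card_le_card hcov
  have h2 := Finset.card_union_le U (L.biUnion E ∪ G)
  have h3 := Finset.card_union_le (L.biUnion E) G
  obtain ⟨P, hP⟩ : ∃ P, P = b ^ m := ⟨_, rfl⟩
  rw [← hP] at hUc hGc hEc ⊢
  obtain ⟨Q, hQ⟩ : ∃ Q, Q = (d + 1) ^ 51 := ⟨_, rfl⟩
  have hQ3 : (d + 1) ^ 3 ≤ Q := by rw [hQ]; exact Nat.pow_le_pow_right (by omega) (by norm_num)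
  have hQ1 : 1 ≤ Q := by rw [hQ]; exact Nat.one_le_pow _ _ (by omega)
  rw [← hQ] at hGc ⊢
  calc S.card ≤ U.card + ((L.biUnion E).card + G.card) := by omega
    _ ≤ 13 * (d + 1) ^ 3 * P + (P + Ct * Q * P) := by gcongr
    _ ≤ 13 * Q * P + (Q * P + Ct * Q * P) := by
      gcongr
      exact Nat.le_mul_of_pos_left _ hQ1
    _ = (Ct + 14) * Q * P := by ring
    _ ≤ _ := by gcongr; omega

theorem root_scale (m : ℕ) (hm : 1 ≤ m) (B : ℕ) (hB : 1 ≤ B) : ∃ b : ℕ, B ≤ b ^ m ∧ b ^ m ≤ 2 ^ m * B := by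
  have hex : ∃ b : ℕ, B ≤ b ^ m := ⟨B, Nat.le_self_pow (by omega) _⟩
  refine ⟨Nat.find hex, Nat.find_spec hex, ?_⟩
  obtain ⟨b, hb⟩ : ∃ b, b = Nat.find hex := ⟨_, rfl⟩
  rw [← hb]
  rcases Nat.lt_or_ge b 2 with h | h
  · calc b ^ m ≤ 2 ^ m := Nat.pow_le_pow_left h.le _
      _ ≤ 2 ^ m * B := Nat.le_mul_of_pos_right _ hB
  · have h1 := Nat.find_min hex (m := b - 1) (by omega)
    push Not at h1
    calc b ^ m ≤ (2 * (b - 1)) ^ m := Nat.pow_le_pow_left (by omega) _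
      _ = 2 ^ m * (b - 1) ^ m := mul_pow _ _ _
      _ ≤ 2 ^ m * B := Nat.mul_le_mul_left _ h1.le

theorem a3 : ∃ C e : ℕ, ∀ (d B : ℕ) (f : MvPolynomial (Fin 3) ℤ) (S : Finset (Fin 3 → ℤ)),
    5 ≤ d → 1 ≤ B → f.totalDegree ≤ d → coeff (Finsupp.single 0 d) f ≠ 0 →
    Irreducible (dehom (homogeneousComponent d (map (Int.castRingHom (AlgebraicClosure ℚ)) f))) →
    (∀ t ∈ S, ∀ i, |t i| ≤ B) → (∀ t ∈ S, eval t f = 0) →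
    S.card ≤ C * d ^ e * B := by
  classical
  obtain ⟨D, C, hC⟩ := a3_b
  obtain ⟨m, hm⟩ : ∃ m, m = 10000 := ⟨_, rfl⟩
  rw [← hm] at hC
  have hm1 : 1 ≤ m := by omega
  clear hm
  refine ⟨9 * (C * (D + 1) ^ 17) ^ m + C * 2 ^ 51 * 2 ^ m, 1 + 17 * m + 51, ?_⟩
  intro d B f S h5 hB hd hc hi hbox hz
  have hd1 : 1 ≤ d := by omega
  obtain ⟨T, hT⟩ : ∃ T, T = C * (d + D) ^ 17 := ⟨_, rfl⟩
  have hTle : T ≤ C * (D + 1) ^ 17 * d ^ 17 := by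
    rw [hT, mul_assoc, ← mul_pow]
    gcongr
    nlinarith
  rcases Nat.lt_or_ge (T ^ m) B with hlt | hge
  · obtain ⟨b, hb1, hb2⟩ := root_scale m hm1 B hB
    have hTb : T ≤ b := by
      by_contra hcon
      have := Nat.pow_le_pow_left (by omega : b ≤ T) m
      omega
    have h1 := hC d b f S h5 (by rw [← hT]; exact hTb) hd hc hi (fun t ht i => (hbox t ht i).trans (by exact_mod_cast hb1)) hz
    calc S.card ≤ _ := h1
      _ ≤ C * (2 * d) ^ 51 * (2 ^ m * B) := by gcongr; omega
      _ = C * 2 ^ 51 * 2 ^ m * d ^ 51 * B := by ring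
      _ ≤ (9 * (C * (D + 1) ^ 17) ^ m + C * 2 ^ 51 * 2 ^ m) * d ^ (1 + 17 * m + 51) * B := by
        exact Nat.mul_le_mul_right _ (Nat.mul_le_mul (Nat.le_add_left _ _) (Nat.pow_le_pow_right hd1 (Nat.le_add_left _ _)))
  · obtain ⟨fq, hfq⟩ : ∃ fq, fq = map (Int.castRingHom ℚ) f := ⟨_, rfl⟩
    have hdq : fq.totalDegree ≤ d := by rw [hfq, totalDegree_map_Q]; exact hd
    have hf0 : fq ≠ 0 := by
      intro h0
      have : coeff (Finsupp.single 0 d) fq = 0 := by rw [h0]; simp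
      rw [hfq, coeff_map] at this
      apply hc
      simpa using this
    have h1 := card_zeros_box fq hf0 B S (fun x hx => ⟨hbox x hx, by rw [hfq, eval_int_map, hz x hx]; simp⟩)
    calc S.card ≤ _ := h1
      _ ≤ d * (3 * B) ^ 2 := by gcongr; omega
      _ = 9 * d * B * B := by ring
      _ ≤ 9 * d * (C * (D + 1) ^ 17 * d ^ 17) ^ m * B := by
        gcongr
        exact hge.trans (Nat.pow_le_pow_left hTle m)
      _ = 9 * (C * (D + 1) ^ 17) ^ m * d ^ (1 + 17 * m) * B := by
        rw [mul_pow, ← pow_mul, pow_add, pow_one]; ring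
      _ ≤ (9 * (C * (D + 1) ^ 17) ^ m + C * 2 ^ 51 * 2 ^ m) * d ^ (1 + 17 * m + 51) * B := by
        exact Nat.mul_le_mul_right _ (Nat.mul_le_mul (Nat.le_add_right _ _) (Nat.pow_le_pow_right hd1 (Nat.le_add_right _ _)))

end DG

namespace DG
open MvPolynomial
open scoped Finset

theorem resultant_ne {A : Type*} [CommRing A] [IsDomain A] [UniqueFactorizationMonoid A]
    (F G : Polynomial A) (hirr : Irreducible F) (hd : F.natDegree ≠ 0) (hFG : ¬ F ∣ G) :
    F.resultant G ≠ 0 := by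
  classical
  let _ : NormalizedGCDMonoid A := Nonempty.some inferInstance
  have hprim := hirr.isPrimitive hd
  let k := FractionRing A
  have hirr' : Irreducible (F.map (algebraMap _ k)) :=
    (hprim.irreducible_iff_irreducible_map_fraction_map).1 hirr
  have hnd : ¬ F.map (algebraMap _ k) ∣ G.map (algebraMap _ k) := by
    rintro ⟨Q, hQ⟩
    obtain ⟨b, hb, hb'⟩ := IsLocalization.integerNormalization_spec (nonZeroDivisors A) Q
    have h1 : F ∣ Polynomial.C b * G := by
      refine ⟨IsLocalization.integerNormalization (nonZeroDivisors A) Q, ?_⟩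
      apply Polynomial.map_injective (algebraMap _ k) (IsFractionRing.injective _ k)
      rw [Polynomial.map_mul, Polynomial.map_mul, hQ, hb', Polynomial.map_C, Algebra.smul_def,
        Polynomial.algebraMap_apply]
      ring
    have hp : Prime F := UniqueFactorizationMonoid.irreducible_iff_prime.1 hirr
    rcases hp.dvd_or_dvd h1 with h2 | h2
    · have hb0 : Polynomial.C b ≠ 0 := Polynomial.C_ne_zero.2 (nonZeroDivisors.ne_zero hb)
      have := Polynomial.natDegree_le_of_dvd h2 hb0
      rw [Polynomial.natDegree_C] at this
      omega
    · exact hFG h2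
  have hcop : IsCoprime (F.map (algebraMap _ k)) (G.map (algebraMap _ k)) :=
    (hirr'.coprime_iff_not_dvd).2 hnd
  intro h0
  have h1 := Polynomial.resultant_ne_zero _ _ hcop
  apply h1
  rw [Polynomial.natDegree_map_eq_of_injective (IsFractionRing.injective _ k),
    Polynomial.natDegree_map_eq_of_injective (IsFractionRing.injective _ k),
    Polynomial.resultant_map_map, h0, map_zero]

theorem natDegree_det_le {R n : Type*} [CommRing R] [Fintype n] [DecidableEq n]
    (A : Matrix n n (Polynomial R)) (D : ℕ) (h : ∀ i j, (A i j).natDegree ≤ D) :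
    A.det.natDegree ≤ Fintype.card n * D := by
  rw [Matrix.det_apply]
  refine Polynomial.natDegree_sum_le_of_forall_le _ _ ?_
  intro s _
  have h1 : (Equiv.Perm.sign s • ∏ i, A (s i) i).natDegree ≤ (∏ i, A (s i) i).natDegree := by
    rcases Int.units_eq_one_or (Equiv.Perm.sign s) with h | h <;> rw [h] <;> simp
  refine h1.trans ((Polynomial.natDegree_prod_le _ _).trans ?_)
  refine (Finset.sum_le_card_nsmul _ _ D (fun i _ => h _ _)).trans ?_
  simp

/-- if `Q` is irreducible over `R[s]`, and `h` has smaller `t`-degree, then no `τ` can kill both to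
high order in `s`. -/
theorem no_high_contact {R : Type*} [CommRing R] [IsDomain R] [UniqueFactorizationMonoid R]
    (Q h : Polynomial (Polynomial R)) (hQ : Irreducible Q) (d : ℕ) (hd : 0 < d) (hQd : Q.natDegree = d)
    (hhd : h.natDegree < d) (hh : h ≠ 0) (hQs : ∀ k, (Q.coeff k).natDegree ≤ d)
    (hhs : ∀ k, (h.coeff k).natDegree ≤ d) (τ : Polynomial R) (N : ℕ) (hN : 2 * d * d < N)
    (h1 : Polynomial.X ^ N ∣ Q.eval τ) (h2 : Polynomial.X ^ N ∣ h.eval τ) : False := by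
  have hnd : ¬ Q ∣ h := by
    intro hdv
    have := Polynomial.natDegree_le_of_dvd hdv hh
    omega
  have hres := resultant_ne Q h hQ (by omega) hnd
  obtain ⟨p, q, -, -, hpq⟩ := Polynomial.exists_mul_add_mul_eq_C_resultant Q h le_rfl le_rfl
    (Or.inl (by omega))
  have hX : Polynomial.X ^ N ∣ Q.resultant h := by
    have := congrArg (Polynomial.eval τ) hpq
    rw [Polynomial.eval_C] at this
    rw [← this, Polynomial.eval_add, Polynomial.eval_mul, Polynomial.eval_mul]
    exact dvd_add (Dvd.dvd.mul_right h1 _) (Dvd.dvd.mul_right h2 _)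
  have h3 := Polynomial.natDegree_le_of_dvd hX hres
  rw [Polynomial.natDegree_X_pow] at h3
  have h4 : (Q.resultant h).natDegree ≤ 2 * d * d := by
    rw [Polynomial.resultant]
    refine (natDegree_det_le _ d ?_).trans ?_
    · intro i j
      rw [Polynomial.sylvester, Matrix.of_apply]
      refine Fin.addCases (fun j => ?_) (fun j => ?_) j
      · rw [Fin.addCases_left]
        split_ifs
        · exact hhs _
        · simp
      · rw [Fin.addCases_right]
        split_ifs
        · exact hQs _
        · simp
    · rw [Fintype.card_fin]
      apply Nat.mul_le_mul_right
      omega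
  omega

/-- the Newton iteration. -/
theorem newton {R : Type*} [CommRing R] (Q : Polynomial (Polynomial R)) (W : Subring (Polynomial R))
    (hW : ∀ τ ∈ W, Q.eval τ ∈ W) (φ l : Polynomial R) (hφ : φ ∈ W) (hl : l ∈ W)
    (h0 : Polynomial.X ∣ Q.eval φ) (h1 : Polynomial.X ∣ 1 - l * Q.derivative.eval φ) (m : ℕ) :
    ∃ τ ∈ W, Polynomial.X ∣ τ - φ ∧ Polynomial.X ^ (m + 1) ∣ Q.eval τ := by
  induction m with
  | zero => exact ⟨φ, hφ, by simp, by simpa using h0⟩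
  | succ m ih =>
    obtain ⟨τ, hτ, hc, hd⟩ := ih
    refine ⟨τ + (- (l * Q.eval τ)), W.add_mem hτ (W.neg_mem (W.mul_mem hl (hW τ hτ))), ?_, ?_⟩
    · have : Polynomial.X ∣ Q.eval τ := (Dvd.intro_left _ (pow_succ _ _).symm).trans hd
      have e : τ + (- (l * Q.eval τ)) - φ = (τ - φ) - l * Q.eval τ := by ring
      rw [e]
      exact dvd_sub hc (Dvd.dvd.mul_left this _)
    · obtain ⟨k, hk⟩ := Polynomial.binomExpansion Q τ (- (l * Q.eval τ))
      rw [hk]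
      have e : Q.eval τ + Q.derivative.eval τ * (- (l * Q.eval τ)) + k * (- (l * Q.eval τ)) ^ 2 =
        (1 - l * Q.derivative.eval τ) * Q.eval τ + k * l ^ 2 * (Q.eval τ * Q.eval τ) := by ring
      rw [e]
      have h2 : Polynomial.X ∣ 1 - l * Q.derivative.eval τ := by
        have h3 : Polynomial.X ∣ Q.derivative.eval τ - Q.derivative.eval φ :=
          hc.trans (Polynomial.sub_dvd_eval_sub _ _ _)
        have e2 : 1 - l * Q.derivative.eval τ = (1 - l * Q.derivative.eval φ) -
          l * (Q.derivative.eval τ - Q.derivative.eval φ) := by ring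
        rw [e2]
        exact dvd_sub h1 (Dvd.dvd.mul_left h3 _)
      refine dvd_add ?_ (Dvd.dvd.mul_left ?_ _)
      · rw [pow_succ' _ (m + 1)]
        exact mul_dvd_mul h2 hd
      · refine Dvd.dvd.trans ?_ (mul_dvd_mul hd hd)
        rw [← pow_add]
        exact pow_dvd_pow _ (by omega)

/-- polynomials in `R[s]`, `R = K[y]`, with coefficient of `s^j` of total degree at most `j`. -/
def wt (K : Type*) [Field K] (n : ℕ) : Subalgebra K (Polynomial (MvPolynomial (Fin n) K)) where
  carrier := {p | ∀ j, (p.coeff j).totalDegree ≤ j}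
  mul_mem' := by
    intro a b ha hb j
    rw [Polynomial.coeff_mul]
    apply totalDegree_finsetSum_le
    intro x hx
    have := Finset.HasAntidiagonal.mem_antidiagonal.1 hx
    refine (totalDegree_mul _ _).trans ?_
    have := ha x.1
    have := hb x.2
    omega
  add_mem' := by
    intro a b ha hb j
    rw [Polynomial.coeff_add]
    exact (totalDegree_add _ _).trans (max_le (ha j) (hb j))
  algebraMap_mem' := by
    intro c j
    have : algebraMap K (Polynomial (MvPolynomial (Fin n) K)) c = Polynomial.C (MvPolynomial.C c) := rfl
    rw [this, Polynomial.coeff_C]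
    split_ifs <;> simp

theorem mem_wt {K : Type*} [Field K] {n : ℕ} {p : Polynomial (MvPolynomial (Fin n) K)} :
    p ∈ wt K n ↔ ∀ j, (p.coeff j).totalDegree ≤ j := Iff.rfl

theorem X_mem_wt {K : Type*} [Field K] {n : ℕ} : (Polynomial.X : Polynomial (MvPolynomial (Fin n) K)) ∈ wt K n := by
  intro j
  rw [Polynomial.coeff_X]
  split_ifs <;> simp

theorem XX_mem_wt {K : Type*} [Field K] {n : ℕ} (i : Fin n) :
    (Polynomial.X * Polynomial.C (X i) : Polynomial (MvPolynomial (Fin n) K)) ∈ wt K n := by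
  intro j
  rw [Polynomial.coeff_mul_C, Polynomial.coeff_X]
  split_ifs with h
  · subst h; simp
  · simp

/-- `y ↦ s y`. -/
noncomputable def sg (K : Type*) [Field K] (n : ℕ) :
    MvPolynomial (Fin n) K →ₐ[K] Polynomial (MvPolynomial (Fin n) K) :=
  aeval (fun i => Polynomial.X * Polynomial.C (X i))

theorem sg_mem {K : Type*} [Field K] {n : ℕ} (p : MvPolynomial (Fin n) K) : sg K n p ∈ wt K n := by
  induction p using MvPolynomial.induction_on with
  | C c =>
    rw [← algebraMap_eq, AlgHom.commutes]
    exact (wt K n).algebraMap_mem c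
  | add p q hp hq => rw [map_add]; exact (wt K n).add_mem hp hq
  | mul_X p i hp =>
    rw [map_mul]
    refine (wt K n).mul_mem hp ?_
    rw [sg, aeval_X]
    exact XX_mem_wt i

theorem eval_one_sg {K : Type*} [Field K] {n : ℕ} (p : MvPolynomial (Fin n) K) :
    (sg K n p).eval 1 = p := by
  induction p using MvPolynomial.induction_on with
  | C c => rw [← algebraMap_eq, AlgHom.commutes]; change Polynomial.eval 1 (Polynomial.C (MvPolynomial.C c)) = _; simp
  | add p q hp hq => rw [map_add, Polynomial.eval_add, hp, hq]
  | mul_X p i hp => rw [map_mul, Polynomial.eval_mul, hp]; simp [sg]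

theorem eval_zero_sg {K : Type*} [Field K] {n : ℕ} (p : MvPolynomial (Fin n) K) :
    (sg K n p).eval 0 = MvPolynomial.C (constantCoeff p) := by
  induction p using MvPolynomial.induction_on with
  | C c => rw [← algebraMap_eq, AlgHom.commutes]; change Polynomial.eval 0 (Polynomial.C (MvPolynomial.C c)) = _; simp
  | add p q hp hq => rw [map_add, Polynomial.eval_add, hp, hq]; simp
  | mul_X p i hp => rw [map_mul, Polynomial.eval_mul, hp]; simp [sg]

theorem natDegree_sg {K : Type*} [Field K] {n : ℕ} (p : MvPolynomial (Fin n) K) :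
    (sg K n p).natDegree ≤ p.totalDegree := by
  rw [sg, aeval_def, eval₂_eq']
  refine Polynomial.natDegree_sum_le_of_forall_le _ _ ?_
  intro m hm
  have hm' := le_totalDegree hm
  change m.degree ≤ _ at hm'
  refine le_trans ?_ hm'
  refine Polynomial.natDegree_mul_le.trans ?_
  have h1 : (algebraMap K (Polynomial (MvPolynomial (Fin n) K)) (coeff m p)).natDegree = 0 :=
    Polynomial.natDegree_C _
  rw [h1, zero_add, Finsupp.degree_eq_sum]
  refine (Polynomial.natDegree_prod_le _ _).trans (Finset.sum_le_sum fun i _ => ?_)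
  refine Polynomial.natDegree_pow_le.trans ?_
  have h2 : (Polynomial.X * Polynomial.C (X i) : Polynomial (MvPolynomial (Fin n) K)).natDegree ≤ 1 := by
    refine Polynomial.natDegree_mul_le.trans ?_
    simp
  exact (Nat.mul_le_mul_left _ h2).trans (by simp)

end DG

namespace DG
open MvPolynomial
open scoped Finset

theorem eval2_finSucc {K A : Type*} [Field K] [CommRing A] [Algebra K A] {n : ℕ}
    (ρ : MvPolynomial (Fin n) K →ₐ[K] A) (τ : A) (F : MvPolynomial (Fin (n + 1)) K) :
    (finSuccEquiv K n F).eval₂ (ρ : MvPolynomial (Fin n) K →+* A) τ =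
      aeval (Fin.cons τ (fun i => ρ (X i)) : Fin (n + 1) → A) F := by
  induction F using MvPolynomial.induction_on with
  | C c =>
    simp only [finSuccEquiv_apply, eval₂Hom_C, RingHom.comp_apply, Polynomial.eval₂_C, algHom_C]
    simp only [← algebraMap_eq]
    exact ρ.commutes c
  | add p q hp hq => simp only [map_add, Polynomial.eval₂_add, hp, hq]
  | mul_X p i hp =>
    rw [map_mul, map_mul, Polynomial.eval₂_mul, hp, aeval_X]
    congr 1
    refine Fin.cases ?_ (fun j => ?_) i
    · simp [finSuccEquiv_X_zero]
    · simp [finSuccEquiv_X_succ]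

theorem finSucc_monic {K : Type*} [Field K] {n d : ℕ} (F : MvPolynomial (Fin (n + 1)) K)
    (hd : F.totalDegree ≤ d) (hc : coeff (Finsupp.single 0 d) F = 1) :
    (finSuccEquiv K n F).Monic ∧ (finSuccEquiv K n F).natDegree = d := by
  have hcons : Finsupp.cons d (0 : Fin n →₀ ℕ) = Finsupp.single 0 d := by
    refine Finsupp.ext fun i => ?_
    refine Fin.cases ?_ (fun j => ?_) i
    · simp
    · rw [Finsupp.cons_succ, Finsupp.single_eq_of_ne (Fin.succ_ne_zero j)]; rfl
  have h1 : coeff 0 ((finSuccEquiv K n F).coeff d) = 1 := by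
    rw [finSuccEquiv_coeff_coeff, hcons, hc]
  have h2 : (finSuccEquiv K n F).coeff d ≠ 0 := by
    intro h
    rw [h] at h1
    simp at h1
  have h3 := totalDegree_coeff_finSuccEquiv_add_le F d h2
  have h4 : ((finSuccEquiv K n F).coeff d).totalDegree = 0 := by omega
  have h5 : (finSuccEquiv K n F).coeff d = 1 := by
    rw [totalDegree_eq_zero_iff_eq_C.1 h4, h1, C_1]
  have h6 : (finSuccEquiv K n F).natDegree ≤ d := by
    rw [natDegree_finSuccEquiv]
    exact (degreeOf_le_totalDegree _ _).trans hd
  exact ⟨Polynomial.monic_of_natDegree_le_of_coeff_eq_one d h6 h5,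
    le_antisymm h6 (Polynomial.le_natDegree_of_ne_zero h2)⟩

/-- the exponent attached to an index. -/
noncomputable def ixe {d : ℕ} (m : Fin (d * d)) : Fin 2 →₀ ℕ :=
  Finsupp.equivFunOnFinite.symm ![((finProdFinEquiv.symm m).2 : ℕ), ((finProdFinEquiv.symm m).1 : ℕ)]

theorem ixe_inj {d : ℕ} : Function.Injective (ixe (d := d)) := by
  intro m m' h
  have h0 := DFunLike.congr_fun h 0
  have h1 := DFunLike.congr_fun h 1
  simp only [ixe, Finsupp.coe_equivFunOnFinite_symm, Matrix.cons_val_zero, Matrix.cons_val_one] at h0 h1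
  apply finProdFinEquiv.symm.injective
  exact Prod.ext (Fin.ext h1) (Fin.ext h0)

theorem ixe_surj {d : ℕ} (s : Fin 2 →₀ ℕ) (h : s.degree < d) : ∃ m : Fin (d * d), ixe m = s := by
  rw [Finsupp.degree_eq_sum, Fin.sum_univ_two] at h
  refine ⟨finProdFinEquiv (⟨s 1, by omega⟩, ⟨s 0, by omega⟩), ?_⟩
  refine Finsupp.ext fun i => ?_
  rw [ixe, Equiv.symm_apply_apply]
  fin_cases i <;> rfl

theorem aeval_pair {K A : Type*} [Field K] [CommRing A] [Algebra K A] {d : ℕ} (a : MvPolynomial (Fin 2) K)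
    (ha : a.totalDegree < d) (u v : A) :
    aeval ![u, v] a = ∑ m : Fin (d * d), algebraMap K A (coeff (ixe m) a) *
      (v ^ ((finProdFinEquiv.symm m).1 : ℕ) * u ^ ((finProdFinEquiv.symm m).2 : ℕ)) := by
  classical
  rw [aeval_def, eval₂_eq']
  have h1 : a.support ⊆ Finset.univ.image (ixe (d := d)) := by
    intro s hs
    have := le_totalDegree hs
    change s.degree ≤ _ at this
    obtain ⟨m, hm⟩ := ixe_surj (d := d) s (by omega)
    exact Finset.mem_image.2 ⟨m, Finset.mem_univ _, hm⟩
  rw [Finset.sum_subset h1, Finset.sum_image (fun _ _ _ _ h => ixe_inj h)]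
  · refine Finset.sum_congr rfl fun m _ => ?_
    congr 1
    rw [Fin.prod_univ_two, mul_comm]
    rfl
  · intro s _ hs
    rw [notMem_support_iff.1 hs, map_zero, zero_mul]

/-- generic minor. -/
theorem exists_minor {R : Type*} [CommRing R] [IsDomain R] [UniqueFactorizationMonoid R]
    (Q : Polynomial (Polynomial R)) (hQ : Irreducible Q) (d : ℕ) (hd : 0 < d) (hQd : Q.natDegree = d)
    (hQs : ∀ k, (Q.coeff k).natDegree ≤ d) (τ : Polynomial R) (N : ℕ) (hN : 2 * d * d < N)
    (h1 : Polynomial.X ^ N ∣ Q.eval τ) :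
    ∃ t : Fin (d * d) → Fin N, (Matrix.of fun (m : Fin (d * d)) (i : Fin (d * d)) =>
      (Polynomial.X ^ ((finProdFinEquiv.symm m).1 : ℕ) * τ ^ ((finProdFinEquiv.symm m).2 : ℕ)).coeff (t i : ℕ)).det ≠ 0 := by
  by_contra hcon
  push Not at hcon
  obtain ⟨a, ha, hrel⟩ := exists_rel_of_det (K := FractionRing R) (T := Fin N) (s := d * d)
    (fun m j => algebraMap R (FractionRing R)
      ((Polynomial.X ^ ((finProdFinEquiv.symm m).1 : ℕ) * τ ^ ((finProdFinEquiv.symm m).2 : ℕ)).coeff (j : ℕ))) (by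
    intro t
    have := congrArg (algebraMap R (FractionRing R)) (hcon t)
    rw [map_zero, RingHom.map_det] at this
    exact this)
  obtain ⟨b, hb⟩ := IsLocalization.exist_integer_multiples_of_finite (nonZeroDivisors R) a
  choose a' ha' using hb
  have hinj := IsFractionRing.injective R (FractionRing R)
  have hrel' : ∀ j : Fin N, ∑ m, a' m * ((Polynomial.X ^ ((finProdFinEquiv.symm m).1 : ℕ) *
      τ ^ ((finProdFinEquiv.symm m).2 : ℕ)).coeff (j : ℕ)) = 0 := by
    intro j
    apply hinj
    rw [map_sum, map_zero]
    have : ∑ m, algebraMap R (FractionRing R) (a' m * ((Polynomial.X ^ ((finProdFinEquiv.symm m).1 : ℕ) *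
      τ ^ ((finProdFinEquiv.symm m).2 : ℕ)).coeff (j : ℕ))) = algebraMap R (FractionRing R) b * ∑ m, a m *
        algebraMap R (FractionRing R)
      ((Polynomial.X ^ ((finProdFinEquiv.symm m).1 : ℕ) * τ ^ ((finProdFinEquiv.symm m).2 : ℕ)).coeff (j : ℕ)) := by
      rw [Finset.mul_sum]
      refine Finset.sum_congr rfl fun m _ => ?_
      rw [map_mul, ha', Algebra.smul_def, mul_assoc]
    rw [this, hrel, mul_zero]
  have hne : ∃ m, a' m ≠ 0 := by
    obtain ⟨m, hm⟩ := Function.ne_iff.1 ha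
    refine ⟨m, fun h => ?_⟩
    have h2 := ha' m
    rw [h, map_zero, Algebra.smul_def] at h2
    rcases mul_eq_zero.1 h2.symm with h3 | h3
    · rw [← map_zero (algebraMap R (FractionRing R))] at h3
      exact nonZeroDivisors.ne_zero b.2 (hinj h3)
    · exact hm h3
  obtain ⟨h, hh⟩ : ∃ h : Polynomial (Polynomial R), h = ∑ m : Fin (d * d),
    Polynomial.monomial ((finProdFinEquiv.symm m).2 : ℕ)
      (Polynomial.monomial ((finProdFinEquiv.symm m).1 : ℕ) (a' m)) := ⟨_, rfl⟩
  refine no_high_contact Q h hQ d hd hQd ?_ ?_ hQs ?_ τ N hN h1 ?_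
  · have : h.natDegree ≤ d - 1 := by
      rw [hh]
      refine Polynomial.natDegree_sum_le_of_forall_le _ _ ?_
      intro m _
      refine (Polynomial.natDegree_monomial_le _).trans ?_
      have := (finProdFinEquiv.symm m).2.isLt
      omega
    omega
  · obtain ⟨m0, hm0⟩ := hne
    intro h0
    apply hm0
    have h3 : (h.coeff ((finProdFinEquiv.symm m0).2 : ℕ)).coeff ((finProdFinEquiv.symm m0).1 : ℕ) = a' m0 := by
      rw [hh, Polynomial.finsetSum_coeff, Polynomial.finsetSum_coeff, Finset.sum_eq_single m0]
      · simp
      · intro m _ hne'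
        rw [Polynomial.coeff_monomial]
        split_ifs with h4
        · rw [Polynomial.coeff_monomial, if_neg]
          intro h5
          apply hne'
          apply finProdFinEquiv.symm.injective
          exact Prod.ext (Fin.ext h5) (Fin.ext h4)
        · simp
      · simp
    rw [← h3, h0]; simp
  · intro k
    rw [hh, Polynomial.finsetSum_coeff]
    refine Polynomial.natDegree_sum_le_of_forall_le _ _ ?_
    intro m _
    rw [Polynomial.coeff_monomial]
    split_ifs
    · refine (Polynomial.natDegree_monomial_le _).trans ?_
      exact (finProdFinEquiv.symm m).1.isLt.le
    · simp
  · rw [Polynomial.X_pow_dvd_iff]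
    intro j hj
    rw [hh, Polynomial.eval_finsetSum, Polynomial.finsetSum_coeff, ← hrel' ⟨j, hj⟩]
    refine Finset.sum_congr rfl fun m _ => ?_
    rw [Polynomial.eval_monomial, ← Polynomial.C_mul_X_pow_eq_monomial, mul_assoc, Polynomial.coeff_C_mul]

end DG

namespace DG
open MvPolynomial
open scoped Finset

/-- a factor vanishing to high order along `τ` kills the minor. -/
theorem det_zero_of_factor {K : Type*} [Field K] {d N : ℕ} (a b : MvPolynomial (Fin 2) K) (ha0 : a ≠ 0)
    (ha : a.totalDegree < d) (τ : Polynomial K)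
    (h : Polynomial.X ^ N ∣ aeval ![τ, Polynomial.X] (a * b))
    (hb : eval ![τ.eval 0, 0] b ≠ 0) (t : Fin (d * d) → Fin N) :
    (Matrix.of fun (m : Fin (d * d)) (i : Fin (d * d)) =>
      (Polynomial.X ^ ((finProdFinEquiv.symm m).1 : ℕ) * τ ^ ((finProdFinEquiv.symm m).2 : ℕ)).coeff (t i : ℕ)).det = 0 := by
  have hev : ∀ p : MvPolynomial (Fin 2) K, (aeval ![τ, Polynomial.X] p : Polynomial K).eval 0 =
      eval ![τ.eval 0, 0] p := by
    intro p
    induction p using MvPolynomial.induction_on with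
    | C c => simp
    | add p q hp hq => simp only [map_add, Polynomial.eval_add, hp, hq]
    | mul_X p i hp =>
      simp only [map_mul, Polynomial.eval_mul, hp, aeval_X, eval_X]
      congr 1
      fin_cases i <;> simp
  have hnd : ¬ (Polynomial.X : Polynomial K) ∣ aeval ![τ, Polynomial.X] b := by
    intro hdv
    apply hb
    rw [← hev]
    obtain ⟨q, hq⟩ := hdv
    rw [hq]; simp
  rw [map_mul] at h
  have hda := Polynomial.prime_X.pow_dvd_of_dvd_mul_right N hnd h
  rw [aeval_pair a ha, Polynomial.X_pow_dvd_iff] at hda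
  apply Matrix.exists_vecMul_eq_zero_iff.1
  refine ⟨fun m => coeff (ixe m) a, ?_, ?_⟩
  · intro h0
    obtain ⟨s, hs⟩ := MvPolynomial.exists_coeff_ne_zero ha0
    have hs' := le_totalDegree (mem_support_iff.2 hs)
    change s.degree ≤ _ at hs'
    obtain ⟨m, hm⟩ := ixe_surj (d := d) s (by omega)
    have := congrFun h0 m
    simp only [hm] at this
    exact hs this
  · funext i
    have := hda (t i) (t i).isLt
    rw [Polynomial.finsetSum_coeff] at this
    rw [Pi.zero_apply, ← this]
    rw [Matrix.vecMul, dotProduct]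
    refine Finset.sum_congr rfl fun m _ => ?_
    rw [Polynomial.algebraMap_eq, Polynomial.coeff_C_mul]
    rfl

theorem bertini_core {K : Type*} [Field K] {n d : ℕ} (F : MvPolynomial (Fin (n + 1)) K)
    (hF : Irreducible F) (hd : F.totalDegree ≤ d) (hc : coeff (Finsupp.single 0 d) F = 1) (hd0 : 0 < d)
    (φ0 : K) (h0 : ((finSuccEquiv K n F).map constantCoeff).eval φ0 = 0)
    (h1 : ((finSuccEquiv K n F).map constantCoeff).derivative.eval φ0 ≠ 0) :
    ∃ D : MvPolynomial (Fin n) K, D ≠ 0 ∧ D.totalDegree ≤ d * d * (2 * d * d + 1) ∧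
      ∀ β : Fin n → K, eval β D ≠ 0 →
        Irreducible (aeval (Fin.cons (X 0) (fun i => MvPolynomial.C (β i) * X 1) :
          Fin (n + 1) → MvPolynomial (Fin 2) K) F) := by
  obtain ⟨hPm, hPd⟩ := finSucc_monic F hd hc
  obtain ⟨P, hP⟩ : ∃ P, P = finSuccEquiv K n F := ⟨_, rfl⟩
  rw [← hP] at hPm hPd h0 h1
  have hPirr : Irreducible P := by
    rw [hP]; exact (MulEquiv.irreducible_iff (finSuccEquiv K n)).2 hF
  obtain ⟨Q, hQ⟩ : ∃ Q, Q = P.map (sg K n : MvPolynomial (Fin n) K →+* Polynomial (MvPolynomial (Fin n) K)) := ⟨_, rfl⟩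
  have hQm : Q.Monic := by rw [hQ]; exact hPm.map _
  have hQd : Q.natDegree = d := by rw [hQ, hPm.natDegree_map, hPd]
  have hQ1 : Q.map (Polynomial.evalRingHom 1) = P := by
    rw [hQ, Polynomial.map_map]
    have : (Polynomial.evalRingHom 1).comp (sg K n : MvPolynomial (Fin n) K →+* _) = RingHom.id _ :=
      RingHom.ext fun p => eval_one_sg p
    rw [this, Polynomial.map_id]
  have hQirr : Irreducible Q :=
    Polynomial.Monic.irreducible_of_irreducible_map (Polynomial.evalRingHom 1) Q hQm (by rw [hQ1]; exact hPirr)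
  have hQs : ∀ k, (Q.coeff k).natDegree ≤ d := by
    intro k
    rw [hQ, Polynomial.coeff_map, hP]
    exact (natDegree_sg _).trans ((totalDegree_coeff_le F k).trans hd)
  have hQ0 : Q.map (Polynomial.evalRingHom 0) = (P.map constantCoeff).map MvPolynomial.C := by
    rw [hQ, Polynomial.map_map, Polynomial.map_map]
    congr 1
    exact RingHom.ext fun p => eval_zero_sg p
  have hQτ : ∀ τ, Q.eval τ = aeval (Fin.cons τ (fun i => Polynomial.X * Polynomial.C (X i)) :
      Fin (n + 1) → Polynomial (MvPolynomial (Fin n) K)) F := by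
    intro τ
    rw [hQ, Polynomial.eval_map, hP, eval2_finSucc]
    congr 2
    funext i
    simp [sg]
  have hev0 : ∀ (q : Polynomial (Polynomial (MvPolynomial (Fin n) K))), (q.eval (Polynomial.C (MvPolynomial.C φ0))).eval 0 =
      (q.map (Polynomial.evalRingHom 0)).eval (MvPolynomial.C φ0) := by
    intro q
    have e : MvPolynomial.C φ0 = Polynomial.evalRingHom (0 : MvPolynomial (Fin n) K) (Polynomial.C (MvPolynomial.C φ0)) := by
      simp
    rw [Polynomial.eval_map, e, Polynomial.eval₂_at_apply]
    simp
  obtain ⟨l, hl⟩ : ∃ l, l = (P.map constantCoeff).derivative.eval φ0 := ⟨_, rfl⟩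
  have hX : ∀ p : Polynomial (MvPolynomial (Fin n) K), p.eval 0 = 0 → Polynomial.X ∣ p := by
    intro p hp
    rw [Polynomial.X_dvd_iff, Polynomial.coeff_zero_eq_eval_zero, hp]
  obtain ⟨τ, hτW, hτ0, hτ⟩ := newton Q (wt K n).toSubring (by
    intro τ hτ
    rw [Polynomial.eval_eq_sum]
    refine Subring.sum_mem _ fun k _ => Subring.mul_mem _ ?_ (Subring.pow_mem _ hτ _)
    rw [hQ, Polynomial.coeff_map]
    exact sg_mem _) (Polynomial.C (MvPolynomial.C φ0)) (Polynomial.C (MvPolynomial.C l⁻¹))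
    ((wt K n).algebraMap_mem φ0) ((wt K n).algebraMap_mem l⁻¹) (by
      apply hX
      rw [hev0, hQ0, Polynomial.eval_map, Polynomial.eval₂_at_apply, h0, map_zero]) (by
      apply hX
      rw [Polynomial.eval_sub, Polynomial.eval_mul, hev0, ← Polynomial.derivative_map, hQ0, Polynomial.derivative_map,
        Polynomial.eval_map, Polynomial.eval₂_at_apply, ← hl, Polynomial.eval_C, ← map_mul,
        inv_mul_cancel₀ (hl ▸ h1)]
      simp) (2 * d * d)
  obtain ⟨t, ht⟩ := exists_minor Q hQirr d hd0 hQd hQs τ (2 * d * d + 1) (by omega) hτ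
  refine ⟨_, ht, ?_, ?_⟩
  · refine (totalDegree_det_le _ (2 * d * d + 1) ?_).trans (by simp)
    intro m i
    rw [Matrix.of_apply]
    have hmem : Polynomial.X ^ ((finProdFinEquiv.symm m).1 : ℕ) * τ ^ ((finProdFinEquiv.symm m).2 : ℕ) ∈ wt K n :=
      (wt K n).mul_mem ((wt K n).pow_mem X_mem_wt _) ((wt K n).pow_mem hτW _)
    exact (hmem _).trans (t i).isLt.le
  · intro β hβ
    obtain ⟨G, hG⟩ : ∃ G, G = (aeval (Fin.cons (X 0) (fun i => MvPolynomial.C (β i) * X 1) :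
          Fin (n + 1) → MvPolynomial (Fin 2) K) F) := ⟨_, rfl⟩
    rw [← hG]
    obtain ⟨τ', hτ'⟩ : ∃ τ', τ' = Polynomial.mapAlgHom (aeval β : MvPolynomial (Fin n) K →ₐ[K] K) τ := ⟨_, rfl⟩
    have hdet : ∀ c : Polynomial K, c = τ' → (Matrix.of fun (m : Fin (d * d)) (i : Fin (d * d)) =>
      (Polynomial.X ^ ((finProdFinEquiv.symm m).1 : ℕ) * τ' ^ ((finProdFinEquiv.symm m).2 : ℕ)).coeff (t i : ℕ)).det ≠ 0 := by
      intro _ _ hz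
      apply hβ
      rw [RingHom.map_det, ← hz]
      congr 1
      ext m i
      simp only [RingHom.mapMatrix_apply, Matrix.map_apply, Matrix.of_apply]
      have : (Polynomial.X ^ ((finProdFinEquiv.symm m).1 : ℕ) * τ' ^ ((finProdFinEquiv.symm m).2 : ℕ)) =
        Polynomial.map (eval β) (Polynomial.X ^ ((finProdFinEquiv.symm m).1 : ℕ) * τ ^ ((finProdFinEquiv.symm m).2 : ℕ)) := by
        rw [Polynomial.map_mul, Polynomial.map_pow, Polynomial.map_pow, Polynomial.map_X, hτ']
        rfl
      rw [this, Polynomial.coeff_map]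
    have hGτ : Polynomial.X ^ (2 * d * d + 1) ∣ aeval ![τ', Polynomial.X] G := by
      have h2 := map_dvd (Polynomial.mapAlgHom (aeval β : MvPolynomial (Fin n) K →ₐ[K] K)) hτ
      have h3 : Polynomial.mapAlgHom (aeval β : MvPolynomial (Fin n) K →ₐ[K] K) (Q.eval τ) = aeval ![τ', Polynomial.X] G := by
        rw [hQτ, hG, ← AlgHom.comp_apply, comp_aeval, ← AlgHom.comp_apply, comp_aeval]
        congr 2
        funext i
        refine Fin.cases ?_ (fun j => ?_) i
        · simp only [Fin.cons_zero, aeval_X, Matrix.cons_val_zero, hτ']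
        · simp only [Fin.cons_succ, map_mul, aeval_X, Matrix.cons_val_one, algHom_C]
          rw [mul_comm]
          simp
      rw [h3] at h2
      simpa using h2
    have hτ'0 : τ'.eval 0 = φ0 := by
      obtain ⟨q, hq⟩ := hτ0
      have : τ = Polynomial.C (MvPolynomial.C φ0) + Polynomial.X * q := by rw [← hq]; ring
      rw [hτ', this]
      simp
    have hg : aeval ![Polynomial.X, 0] G = P.map constantCoeff := by
      have e1 : P.map constantCoeff = P.eval₂ ((aeval (fun _ => (0 : Polynomial K)) :
          MvPolynomial (Fin n) K →ₐ[K] Polynomial K) : MvPolynomial (Fin n) K →+* _) Polynomial.X := by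
        rw [Polynomial.map]
        congr 1
        apply MvPolynomial.ringHom_ext
        · intro c; simp
        · intro i; simp
      rw [e1, hP, eval2_finSucc, hG, ← AlgHom.comp_apply, comp_aeval]
      congr 2
      funext i
      refine Fin.cases ?_ (fun j => ?_) i
      · simp
      · simp
    have hGd : G.totalDegree ≤ d := by
      rw [hG]
      refine (totalDegree_aeval_linear _ ?_ F).trans hd
      intro i
      refine Fin.cases ?_ (fun j => ?_) i
      · simp
      · simp only [Fin.cons_succ]
        refine (totalDegree_mul _ _).trans ?_
        simp
    have hG0 : G ≠ 0 := by
      intro h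
      rw [h, map_zero] at hg
      rw [← hg] at h1
      simp at h1
    refine ⟨?_, ?_⟩
    · intro hu
      obtain ⟨u, hu', hu2⟩ := (MvPolynomial.isUnit_iff_eq_C_of_isReduced).1 hu
      rw [hu2] at hg
      rw [← hg] at h1
      simp at h1
    · intro a b hab
      by_contra hnu
      push Not at hnu
      obtain ⟨hua, hub⟩ := hnu
      have ha0 : a ≠ 0 := by rintro rfl; simp at hab; exact hG0 hab
      have hb0 : b ≠ 0 := by rintro rfl; simp at hab; exact hG0 hab
      have hpos : ∀ p : MvPolynomial (Fin 2) K, p ≠ 0 → ¬ IsUnit p → 0 < p.totalDegree := by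
        intro p hp hpu
        by_contra hz
        have hz' : p.totalDegree = 0 := by omega
        rw [totalDegree_eq_zero_iff_eq_C] at hz'
        apply hpu
        rw [hz']
        rw [hz'] at hp
        apply IsUnit.map
        rw [isUnit_iff_ne_zero]
        intro h; rw [h] at hp; simp at hp
      have hsum := totalDegree_mul_of_isDomain ha0 hb0
      rw [← hab] at hsum
      have := hpos a ha0 hua
      have := hpos b hb0 hub
      have hline : ∀ p : MvPolynomial (Fin 2) K, (aeval ![Polynomial.X, 0] p : Polynomial K).eval φ0 = eval ![φ0, 0] p := by
        intro p
        induction p using MvPolynomial.induction_on with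
        | C c => simp
        | add p q hp hq => simp only [map_add, Polynomial.eval_add, hp, hq]
        | mul_X p i hp =>
          simp only [map_mul, Polynomial.eval_mul, hp, aeval_X, eval_X]
          congr 1
          fin_cases i <;> simp
      have hnb : ¬ (eval ![φ0, 0] a = 0 ∧ eval ![φ0, 0] b = 0) := by
        rintro ⟨h2, h3⟩
        apply h1
        rw [← hg, hab, map_mul, Polynomial.derivative_mul, Polynomial.eval_add, Polynomial.eval_mul, Polynomial.eval_mul,
          hline, hline, h2, h3]
        ring
      by_cases hb : eval ![φ0, 0] b = 0
      · have ha : eval ![φ0, 0] a ≠ 0 := fun h => hnb ⟨h, hb⟩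
        refine hdet _ rfl (det_zero_of_factor b a hb0 (by omega) τ' (by rw [mul_comm b a, ← hab]; exact hGτ) (by rw [hτ'0]; exact ha) t)
      · refine hdet _ rfl (det_zero_of_factor a b ha0 (by omega) τ' (by rw [← hab]; exact hGτ) (by rw [hτ'0]; exact hb) t)

end DG

namespace DG
open MvPolynomial
open scoped Finset

/-- translation of the base variables. -/
noncomputable def transHom {R : Type*} [CommRing R] {r : ℕ} (c : Fin r → R) :
    MvPolynomial (Fin (r + 1)) R →ₐ[R] MvPolynomial (Fin (r + 1)) R :=
  aeval (Fin.cons (X 0) (fun i => X i.succ + C (c i)) : Fin (r + 1) → MvPolynomial (Fin (r + 1)) R)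

theorem transHom_comp {R : Type*} [CommRing R] {r : ℕ} (c c' : Fin r → R) (h : ∀ i, c i + c' i = 0) :
    (transHom c).comp (transHom c') = AlgHom.id R _ := by
  apply algHom_ext
  intro i
  refine Fin.cases ?_ (fun i => ?_) i
  · simp [transHom]
  · simp only [transHom, AlgHom.comp_apply, aeval_X, Fin.cons_succ, map_add, algHom_C, algebraMap_eq, AlgHom.id_apply]
    rw [add_assoc, ← C_add, h, C_0, add_zero]

noncomputable def trans {R : Type*} [CommRing R] {r : ℕ} (c : Fin r → R) :
    MvPolynomial (Fin (r + 1)) R ≃ₐ[R] MvPolynomial (Fin (r + 1)) R :=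
  AlgEquiv.ofAlgHom (transHom c) (transHom (fun i => - c i)) (transHom_comp _ _ (by simp)) (transHom_comp _ _ (by simp))

theorem trans_apply {R : Type*} [CommRing R] {r : ℕ} (c : Fin r → R) (g) : trans c g =
  aeval (Fin.cons (X 0) (fun i => X i.succ + C (c i)) : Fin (r + 1) → MvPolynomial (Fin (r + 1)) R) g := rfl

theorem map_constCoeff_finSucc {K : Type*} [Field K] {n : ℕ} (F : MvPolynomial (Fin (n + 1)) K) :
    (finSuccEquiv K n F).map constantCoeff = aeval (Fin.cons Polynomial.X (fun _ => 0) : Fin (n + 1) → Polynomial K) F := by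
  have e1 : (finSuccEquiv K n F).map constantCoeff = (finSuccEquiv K n F).eval₂ ((aeval (fun _ => (0 : Polynomial K)) :
      MvPolynomial (Fin n) K →ₐ[K] Polynomial K) : MvPolynomial (Fin n) K →+* _) Polynomial.X := by
    rw [Polynomial.map]
    congr 1
    apply MvPolynomial.ringHom_ext
    · intro c; simp
    · intro i; simp
  rw [e1, eval2_finSucc]
  congr 2
  funext i
  refine Fin.cases ?_ (fun j => ?_) i <;> simp

theorem bertini {K : Type*} [Field K] [IsAlgClosed K] [CharZero K] {r d : ℕ} (F : MvPolynomial (Fin (r + 3)) K)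
    (hF : Irreducible F) (hd : F.totalDegree ≤ d) (hc : coeff (Finsupp.single 0 d) F ≠ 0) (hd0 : 0 < d) :
    ∃ y0 b : Fin (r + 2) → ℕ, (∀ i, y0 i ≤ 5 * d ^ 4) ∧ (∀ i, b i ≤ 5 * d ^ 4) ∧ y0 0 * b 1 ≠ y0 1 * b 0 ∧
      Irreducible (aeval (Fin.cons (X 0) (fun i => MvPolynomial.C (y0 i : K) + MvPolynomial.C (b i : K) * X 1) :
          Fin (r + 3) → MvPolynomial (Fin 2) K) F) := by
  have hdeg0 : 0 < degreeOf 0 F := by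
    have h1 := monomial_le_degreeOf (R := K) 0 (mem_support_iff.2 hc)
    simp at h1
    omega
  obtain ⟨hp0, hpd⟩ := not_dvd_pderiv 0 F hdeg0
  obtain ⟨r0, hr0, hr0d, hr0e⟩ := elim_eval F (pderiv 0 F) hF hpd
  have hpdd : (pderiv 0 F).totalDegree ≤ d := by
    have := totalDegree_pderiv_le (0 : Fin (r + 3)) F
    omega
  have hr0d' : r0.totalDegree ≤ 4 * d ^ 2 := by
    refine hr0d.trans ((Nat.pow_le_pow_left (Nat.add_le_add hd hpdd) 2).trans ?_)
    ring_nf; rfl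
  have hd24 : d ^ 2 ≤ d ^ 4 := Nat.pow_le_pow_right hd0 (by omega)
  have hd04 : 1 ≤ d ^ 4 := Nat.one_le_pow _ _ hd0
  obtain ⟨y0, hy0, hy0e⟩ := exists_grid (r0 * X 0) (mul_ne_zero hr0 (X_ne_zero _)) (5 * d ^ 4) (by
    refine (totalDegree_mul _ _).trans ?_
    rw [totalDegree_X]
    omega)
  rw [map_mul, eval_X] at hy0e
  have hy0r := left_ne_zero_of_mul hy0e
  have hy00 := right_ne_zero_of_mul hy0e
  -- the translated, scaled polynomial
  obtain ⟨c, hcc⟩ : ∃ c, c = coeff (Finsupp.single 0 d) F := ⟨_, rfl⟩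
  rw [← hcc] at hc
  obtain ⟨F', hF'⟩ : ∃ F', F' = trans (fun i => (y0 i : K)) (MvPolynomial.C c⁻¹ * F) := ⟨_, rfl⟩
  have hCu : IsUnit (MvPolynomial.C c⁻¹ : MvPolynomial (Fin (r + 3)) K) :=
    (isUnit_iff_ne_zero.2 (inv_ne_zero hc)).map MvPolynomial.C
  have hF'irr : Irreducible F' := by
    rw [hF', MulEquiv.irreducible_iff]
    exact (irreducible_isUnit_mul hCu).2 hF
  have hF'd : F'.totalDegree ≤ d := by
    rw [hF', trans_apply]
    refine (totalDegree_aeval_linear _ ?_ _).trans ((totalDegree_mul _ _).trans (by simpa using hd))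
    intro i
    refine Fin.cases ?_ (fun j => ?_) i
    · simp
    · rw [Fin.cons_succ]
      refine (totalDegree_add _ _).trans (max_le (totalDegree_X_le _) ?_)
      rw [totalDegree_C]; omega
  obtain ⟨g, hg⟩ : ∃ g, g = aeval (fun i => Polynomial.C ((Fin.cons 1 (fun _ => 0) : Fin (r + 3) → K) i) * Polynomial.X
      + Polynomial.C ((Fin.cons 0 (fun i => (y0 i : K)) : Fin (r + 3) → K) i)) F := ⟨_, rfl⟩
  have hax : aeval (Fin.cons Polynomial.X (fun _ => 0) : Fin (r + 3) → Polynomial K) F' = Polynomial.C c⁻¹ * g := by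
    rw [hF', trans_apply, ← AlgHom.comp_apply, comp_aeval, map_mul, algHom_C, hg, Polynomial.algebraMap_eq]
    congr 3
    funext i
    refine Fin.cases ?_ (fun j => ?_) i <;> simp
  have hgd : g.coeff d = c := by
    rw [hg, coeff_line F d hd, ← coeff_single_eq F d hd, hcc]
  have hF'c : coeff (Finsupp.single 0 d) F' = 1 := by
    rw [← coeff_axis, hax, Polynomial.coeff_C_mul, hgd, inv_mul_cancel₀ hc]
  have hgdeg : g.degree ≠ 0 := by
    intro h
    have : g.natDegree = 0 := Polynomial.natDegree_eq_of_degree_eq_some h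
    have h2 := Polynomial.le_natDegree_of_ne_zero (p := g) (n := d) (by rw [hgd]; exact hc)
    omega
  obtain ⟨φ0, hφ0⟩ := IsAlgClosed.exists_root g hgdeg
  have hgφ : g.eval φ0 = 0 := hφ0
  have hpt : (fun i => (Fin.cons 0 (fun i => (y0 i : K)) : Fin (r + 3) → K) i + φ0 * (Fin.cons 1 (fun _ => 0) : Fin (r + 3) → K) i) =
      (Fin.cons φ0 (fun i => (y0 i : K)) : Fin (r + 3) → K) := by
    funext i
    refine Fin.cases ?_ (fun j => ?_) i <;> simp
  have hdg : g.derivative.eval φ0 ≠ 0 := by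
    intro h
    apply hy0r
    rw [hg, derivative_aeval, eval_aeval_line, hpt] at h
    have hdir : dirD (Fin.cons 1 (fun _ => 0) : Fin (r + 3) → K) F = pderiv 0 F := by
      rw [dirD, Fin.sum_univ_succ]
      simp
    rw [hdir] at h
    rw [hg, eval_aeval_line, hpt] at hgφ
    have := hr0e _ hgφ h
    simpa using this
  obtain ⟨D, hD0, hDd, hDe⟩ := bertini_core F' hF'irr hF'd hF'c hd0 φ0 (by
    rw [map_constCoeff_finSucc, hax, Polynomial.eval_mul, hgφ, mul_zero]) (by
    rw [map_constCoeff_finSucc, hax, Polynomial.derivative_C_mul, Polynomial.eval_C_mul]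
    exact mul_ne_zero (inv_ne_zero hc) hdg)
  have hlin : (MvPolynomial.C (y0 0 : K) * X 1 - MvPolynomial.C (y0 1 : K) * X 0 : MvPolynomial (Fin (r + 2)) K) ≠ 0 := by
    intro h
    have h2 := congrArg (eval (Function.update 0 1 1 : Fin (r + 2) → K)) h
    rw [map_sub, map_mul, map_mul, eval_X, eval_X, eval_C, eval_C, map_zero, Function.update_self,
      Function.update_of_ne (by simp)] at h2
    simp at h2
    simp [h2] at hy00
  obtain ⟨b, hb, hbe⟩ := exists_grid (D * (MvPolynomial.C (y0 0 : K) * X 1 - MvPolynomial.C (y0 1 : K) * X 0))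
    (mul_ne_zero hD0 hlin) (5 * d ^ 4) (by
    refine (totalDegree_mul _ _).trans ?_
    have h3 : (MvPolynomial.C (y0 0 : K) * X 1 - MvPolynomial.C (y0 1 : K) * X 0 : MvPolynomial (Fin (r + 2)) K).totalDegree ≤ 1 := by
      refine (totalDegree_sub _ _).trans (max_le ?_ ?_) <;> refine (totalDegree_mul _ _).trans (by rw [totalDegree_C, totalDegree_X])
    have h4 : d * d * (2 * d * d + 1) = 2 * d ^ 4 + d ^ 2 := by ring
    omega)
  rw [map_mul] at hbe
  refine ⟨y0, b, hy0, hb, ?_, ?_⟩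
  · intro h
    apply right_ne_zero_of_mul hbe
    simp only [map_sub, map_mul, eval_C, eval_X]
    rw [← Nat.cast_mul, ← Nat.cast_mul, h, sub_self]
  · have := hDe _ (left_ne_zero_of_mul hbe)
    rw [hF', trans_apply, ← AlgHom.comp_apply, comp_aeval, map_mul, algHom_C, algebraMap_eq] at this
    rw [irreducible_isUnit_mul ((isUnit_iff_ne_zero.2 (inv_ne_zero hc)).map MvPolynomial.C)] at this
    convert this using 3
    funext i
    refine Fin.cases ?_ (fun j => ?_) i
    · simp
    · simp [add_comm]

end DG

namespace DG
open MvPolynomial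
open scoped Finset

theorem descend {K : Type*} [Field K] [CharZero K] {r α : ℕ} (a : MvPolynomial (Fin (r + 1)) K)
    (ha : a.totalDegree ≤ α) (hc : coeff (Finsupp.single 0 α) a ≠ 0) :
    ∃ g : MvPolynomial (Fin (r + 1)) ℚ, g ≠ 0 ∧ g.totalDegree ≤ α ∧
      ∀ x : Fin (r + 1) → ℤ, eval (fun i => (x i : K)) a = 0 → eval (fun i => (x i : ℚ)) g = 0 := by
  classical
  obtain ⟨lam, hlam⟩ := LinearMap.exists_leftInverse_of_injective (Algebra.linearMap ℚ K)
    (LinearMap.ker_eq_bot.2 (algebraMap ℚ K).injective)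
  have hl : ∀ q : ℚ, lam (algebraMap ℚ K q) = q := fun q => LinearMap.congr_fun hlam q
  obtain ⟨c, hcc⟩ : ∃ c, c = coeff (Finsupp.single 0 α) a := ⟨_, rfl⟩
  rw [← hcc] at hc
  refine ⟨∑ m ∈ a.support, monomial m (lam (c⁻¹ * coeff m a)), ?_, ?_, ?_⟩
  · intro h
    have h2 := congrArg (coeff (Finsupp.single 0 α)) h
    rw [coeff_sum, coeff_zero, Finset.sum_eq_single (Finsupp.single 0 α)] at h2
    · rw [coeff_monomial, if_pos rfl, ← hcc, inv_mul_cancel₀ hc] at h2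
      have := hl 1
      rw [map_one] at this
      rw [this] at h2
      exact one_ne_zero h2
    · intro m _ hm
      rw [coeff_monomial, if_neg hm]
    · intro hm
      rw [notMem_support_iff, ← hcc] at hm
      exact absurd hm hc
  · apply totalDegree_finsetSum_le
    intro m hm
    refine (totalDegree_monomial_le _ _).trans ?_
    have := le_totalDegree hm
    change m.degree ≤ _ at this
    exact this.trans ha
  · intro x hx
    have h2 : eval (fun i => (x i : ℚ)) (∑ m ∈ a.support, monomial m (lam (c⁻¹ * coeff m a))) =
        lam (c⁻¹ * eval (fun i => (x i : K)) a) := by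
      rw [map_sum, eval_eq', Finset.mul_sum, map_sum]
      refine Finset.sum_congr rfl fun m _ => ?_
      rw [eval_monomial, Finsupp.prod_fintype _ _ (by simp)]
      have e : c⁻¹ * (coeff m a * ∏ i, (x i : K) ^ m i) = (∏ i, (x i : ℚ) ^ m i) • (c⁻¹ * coeff m a) := by
        rw [Algebra.smul_def, map_prod]
        simp only [map_pow, map_intCast]
        ring
      rw [e, map_smul, smul_eq_mul, mul_comm]
    rw [h2, hx, mul_zero, map_zero]

theorem case_red {K : Type*} [Field K] [CharZero K] {r d : ℕ} (F : MvPolynomial (Fin (r + 2)) ℚ) (hF : Irreducible F)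
    (hd : F.totalDegree ≤ d) (hc : coeff (Finsupp.single 0 d) F ≠ 0)
    (hred : ¬ Irreducible (map (algebraMap ℚ K) F)) (B : ℕ) (S : Finset (Fin (r + 2) → ℤ))
    (hS : ∀ x ∈ S, (∀ i, |x i| ≤ B) ∧ eval (fun i => (x i : ℚ)) F = 0) :
    S.card ≤ d * ((d + d) ^ 2 * (2 * B + 1) ^ r) := by
  have hle : d ≤ F.totalDegree := by
    have := le_totalDegree (mem_support_iff.2 hc)
    change (Finsupp.single 0 d).degree ≤ _ at this
    simpa using this
  have hFd : F.totalDegree = d := le_antisymm hd hle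
  have hdpos : 0 < d := by
    rw [← hFd]; exact irr_totalDegree_pos hF
  obtain ⟨FK, hFK⟩ : ∃ FK, FK = map (algebraMap ℚ K) F := ⟨_, rfl⟩
  rw [← hFK] at hred
  have hFKc : coeff (Finsupp.single 0 d) FK ≠ 0 := by
    rw [hFK, coeff_map]
    exact (map_ne_zero _).2 hc
  have hFKd : FK.totalDegree = d := by
    apply le_antisymm
    · rw [hFK]; exact (totalDegree_map_le _ _).trans hd
    · have := le_totalDegree (mem_support_iff.2 hFKc)
      change (Finsupp.single 0 d).degree ≤ _ at this
      simpa using this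
  have hFK0 : FK ≠ 0 := by rintro h; rw [h] at hFKc; simp at hFKc
  have hposu : ∀ p : MvPolynomial (Fin (r + 2)) K, p ≠ 0 → ¬ IsUnit p → 0 < p.totalDegree := by
    intro p hp hpu
    by_contra hz
    have hz' : p.totalDegree = 0 := by omega
    rw [totalDegree_eq_zero_iff_eq_C] at hz'
    apply hpu
    rw [hz']
    rw [hz'] at hp
    apply IsUnit.map
    rw [isUnit_iff_ne_zero]
    intro h; rw [h] at hp; simp at hp
  have hnu : ¬ IsUnit FK := by
    intro hu
    obtain ⟨u, hu', hu2⟩ := (MvPolynomial.isUnit_iff_eq_C_of_isReduced).1 hu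
    rw [hu2, totalDegree_C] at hFKd
    omega
  rw [irreducible_iff] at hred
  push Not at hred
  obtain ⟨a, b, hab, hua, hub⟩ := hred hnu
  have ha0 : a ≠ 0 := by rintro rfl; simp at hab; exact hFK0 hab
  have hb0 : b ≠ 0 := by rintro rfl; simp at hab; exact hFK0 hab
  have hsum := totalDegree_mul_of_isDomain ha0 hb0
  rw [← hab, hFKd] at hsum
  have hpa := hposu a ha0 hua
  have hpb := hposu b hb0 hub
  have htop : coeff (Finsupp.single 0 a.totalDegree) a * coeff (Finsupp.single 0 b.totalDegree) b ≠ 0 := by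
    rw [coeff_single_eq a _ le_rfl, coeff_single_eq b _ le_rfl, ← map_mul, ← homComp_mul a b _ _ le_rfl le_rfl,
      ← hsum, ← hab, ← coeff_single_eq FK d hFKd.le]
    exact hFKc
  obtain ⟨ga, hga0, hgad, hgae⟩ := descend a le_rfl (left_ne_zero_of_mul htop)
  obtain ⟨gb, hgb0, hgbd, hgbe⟩ := descend b le_rfl (right_ne_zero_of_mul htop)
  have hnd : ¬ F ∣ ga * gb := by
    intro h
    rcases (UniqueFactorizationMonoid.irreducible_iff_prime.1 hF).dvd_or_dvd h with h | h
    · have := totalDegree_le_of_dvd hga0 h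
      omega
    · have := totalDegree_le_of_dvd hgb0 h
      omega
  refine (codim_two F (ga * gb) hd hc hF hnd B S ?_).trans ?_
  · intro x hx
    refine ⟨(hS x hx).1, (hS x hx).2, ?_⟩
    have h1 : eval (fun i => (x i : K)) FK = 0 := by
      have h2 := congrArg (algebraMap ℚ K) (hS x hx).2
      rw [map_zero] at h2
      rw [hFK, eval_map, ← h2, eval₂_eq', eval_eq', map_sum]
      refine Finset.sum_congr rfl fun m _ => ?_
      simp
    rw [hab, map_mul] at h1
    rw [map_mul (eval _)]
    rcases mul_eq_zero.1 h1 with h | h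
    · rw [hgae x h, zero_mul]
    · rw [hgbe x h, mul_zero]
  · refine Nat.mul_le_mul_left _ (Nat.mul_le_mul_right _ (Nat.pow_le_pow_left (Nat.add_le_add_left ?_ _) 2))
    refine (totalDegree_mul _ _).trans ?_
    omega

end DG

namespace DG
open MvPolynomial
open scoped Finset

/-- the slice `F(z, x y0 + y b + ρ)`. -/
noncomputable def slice {R : Type*} [CommRing R] {n : ℕ} (y b ρ : Fin n → R) (F : MvPolynomial (Fin (n + 1)) R) :
    MvPolynomial (Fin 3) R :=
  aeval (Fin.cons (X 0) (fun i => C (y i) * X 1 + C (b i) * X 2 + C (ρ i)) : Fin (n + 1) → MvPolynomial (Fin 3) R) F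

theorem eval_slice {R : Type*} [CommRing R] {n : ℕ} (y b ρ : Fin n → R) (F : MvPolynomial (Fin (n + 1)) R)
    (t : Fin 3 → R) :
    eval t (slice y b ρ F) = eval (Fin.cons (t 0) (fun i => y i * t 1 + b i * t 2 + ρ i) : Fin (n + 1) → R) F := by
  rw [slice]
  induction F using MvPolynomial.induction_on with
  | C a => simp
  | add p q hp hq => simp only [map_add, hp, hq]
  | mul_X p i hp =>
    simp only [map_mul, hp, aeval_X, eval_X]
    congr 1
    refine Fin.cases ?_ (fun j => ?_) i <;> simp

theorem totalDegree_slice {R : Type*} [CommRing R] [Nontrivial R] {n : ℕ} (y b ρ : Fin n → R) (F : MvPolynomial (Fin (n + 1)) R) :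
    (slice y b ρ F).totalDegree ≤ F.totalDegree := by
  apply totalDegree_aeval_linear
  intro i
  refine Fin.cases ?_ (fun j => ?_) i
  · exact totalDegree_X_le _
  · rw [Fin.cons_succ]
    refine (totalDegree_add _ _).trans (max_le ((totalDegree_add _ _).trans (max_le ?_ ?_)) ?_)
    · exact (totalDegree_mul _ _).trans (by rw [totalDegree_C, totalDegree_X])
    · exact (totalDegree_mul _ _).trans (by rw [totalDegree_C, totalDegree_X])
    · rw [totalDegree_C]; omega

theorem homComp_slice {n d : ℕ} (y b ρ : Fin n → ℤ) (F : MvPolynomial (Fin (n + 1)) ℤ) (hF : F.IsHomogeneous d) :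
    homogeneousComponent d (slice y b ρ F) = slice y b 0 F := by
  apply MvPolynomial.funext
  intro v
  rw [← coeff_line _ d ((totalDegree_slice y b ρ F).trans hF.totalDegree_le) v 0, eval_slice]
  have h1 : eval (Fin.cons (v 0) (fun i => y i * v 1 + b i * v 2 + (0 : Fin n → ℤ) i) : Fin (n + 1) → ℤ) F =
      eval (Fin.cons (v 0) (fun i => y i * v 1 + b i * v 2 + (0 : Fin n → ℤ) i) : Fin (n + 1) → ℤ) (homogeneousComponent d F) := by
    rw [homogeneousComponent_eq_self hF]
  rw [h1, ← coeff_line F d hF.totalDegree_le _ (Fin.cons 0 ρ : Fin (n + 1) → ℤ), slice, ← AlgHom.comp_apply, comp_aeval]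
  congr 3
  funext i
  refine Fin.cases ?_ (fun j => ?_) i
  · simp
  · simp
    ring

theorem dehom_slice {R S : Type*} [CommRing R] [CommRing S] (φ : R →+* S) {n : ℕ} (y b : Fin n → R) (F : MvPolynomial (Fin (n + 1)) R) :
    map φ (dehom (slice y b 0 F)) = aeval (Fin.cons (X 0) (fun i => C (φ (y i)) + C (φ (b i)) * X 1) :
      Fin (n + 1) → MvPolynomial (Fin 2) S) (map φ F) := by
  rw [slice, dehom]
  induction F using MvPolynomial.induction_on with
  | C a => simp
  | add p q hp hq => simp only [map_add, hp, hq]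
  | mul_X p i hp =>
    simp only [map_mul, hp, aeval_X, map_X]
    congr 1
    refine Fin.cases ?_ (fun j => ?_) i <;> simp

theorem case_irr (r : ℕ) : ∃ C e : ℕ, ∀ (d B : ℕ) (F : MvPolynomial (Fin (r + 3)) ℤ) (S : Finset (Fin (r + 3) → ℤ)),
    5 ≤ d → 1 ≤ B → F.IsHomogeneous d → coeff (Finsupp.single 0 d) F ≠ 0 →
    Irreducible (map (Int.castRingHom (AlgebraicClosure ℚ)) F) →
    (∀ x ∈ S, ∀ i, |x i| ≤ B) → (∀ x ∈ S, eval x F = 0) → S.card ≤ C * d ^ e * B ^ (r + 1) := by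
  classical
  obtain ⟨C, e, ha3⟩ := a3
  refine ⟨C * 375 ^ (r + 1), e + 8 * (r + 1), ?_⟩
  intro d B F S hd hB hF hc hirr hbox hz
  have hcK : coeff (Finsupp.single 0 d) (map (Int.castRingHom (AlgebraicClosure ℚ)) F) ≠ 0 := by
    rw [coeff_map]
    simpa using hc
  obtain ⟨y0, b, hy0, hb, hdet, hbirr⟩ := bertini (map (Int.castRingHom (AlgebraicClosure ℚ)) F) hirr
    ((totalDegree_map_le _ _).trans hF.totalDegree_le) hcK (by omega)
  obtain ⟨M, hM⟩ : ∃ M, M = 5 * d ^ 4 := ⟨_, rfl⟩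
  rw [← hM] at hy0 hb
  obtain ⟨D, hD⟩ : ∃ D : ℤ, D = y0 0 * b 1 - y0 1 * b 0 := ⟨_, rfl⟩
  have hD0 : D ≠ 0 := by
    rw [hD]
    intro h
    apply hdet
    have := sub_eq_zero.1 h
    exact_mod_cast this
  have hyM : ∀ i, (y0 i : ℤ) ≤ M := fun i => by exact_mod_cast hy0 i
  have hbM : ∀ i, (b i : ℤ) ≤ M := fun i => by exact_mod_cast hb i
  have hy0' : ∀ i, (0 : ℤ) ≤ y0 i := fun i => by positivity
  have hb0' : ∀ i, (0 : ℤ) ≤ b i := fun i => by positivity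
  have hM1 : 1 ≤ M := by
    rw [hM]
    have := Nat.one_le_pow 4 d (by omega)
    omega
  have habs : ∀ (u w p : ℤ), 0 ≤ u → u ≤ M → |w| ≤ p → |u * w| ≤ M * p := by
    intro u w p h0 h1 h2
    rw [abs_mul, abs_of_nonneg h0]
    exact mul_le_mul h1 h2 (abs_nonneg _) (by positivity)
  have hDM : |D| ≤ M ^ 2 := by
    have h1 : (y0 0 : ℤ) * b 1 ≤ M * M := mul_le_mul (hyM _) (hbM _) (hb0' _) (by positivity)
    have h2 : (y0 1 : ℤ) * b 0 ≤ M * M := mul_le_mul (hyM _) (hbM _) (hb0' _) (by positivity)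
    have h3 : (0 : ℤ) ≤ y0 0 * b 1 := mul_nonneg (hy0' _) (hb0' _)
    have h4 : (0 : ℤ) ≤ y0 1 * b 0 := mul_nonneg (hy0' _) (hb0' _)
    rw [hD, abs_le, sq]
    constructor <;> linarith
  obtain ⟨B2, hB2⟩ : ∃ B2, B2 = 5 * M ^ 2 * B := ⟨_, rfl⟩
  have hB2c : (B2 : ℤ) = 5 * (M : ℤ) ^ 2 * B := by rw [hB2]; push_cast; ring
  have hMB : (M : ℤ) * B ≤ (M : ℤ) ^ 2 * B := by
    apply mul_le_mul_of_nonneg_right _ (by positivity)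
    have : (1 : ℤ) ≤ M := by exact_mod_cast hM1
    nlinarith
  have hMB0 : (0 : ℤ) ≤ (M : ℤ) ^ 2 * B := by positivity
  have hB1 : 1 ≤ B2 := by
    rw [hB2]
    have : 0 < 5 * M ^ 2 * B := by positivity
    omega
  -- coordinates
  obtain ⟨cx, hcx⟩ : ∃ cx : (Fin (r + 3) → ℤ) → ℤ, ∀ x, cx x = b 1 * x 1 - b 0 * x 2 := ⟨_, fun _ => rfl⟩
  obtain ⟨cy, hcy⟩ : ∃ cy : (Fin (r + 3) → ℤ) → ℤ, ∀ x, cy x = y0 0 * x 2 - y0 1 * x 1 := ⟨_, fun _ => rfl⟩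
  obtain ⟨rh, hrh⟩ : ∃ rh : (Fin (r + 3) → ℤ) → Fin (r + 2) → ℤ, ∀ x i, rh x i =
    D * x i.succ - y0 i * cx x - b i * cy x := ⟨_, fun _ _ => rfl⟩
  have hs0 : (0 : Fin (r + 2)).succ = (1 : Fin (r + 3)) := rfl
  have hs1 : (1 : Fin (r + 2)).succ = (2 : Fin (r + 3)) := rfl
  have hrh0 : ∀ x, rh x 0 = 0 := by
    intro x
    rw [hrh, hcx, hcy, hD, hs0]; ring
  have hrh1 : ∀ x, rh x 1 = 0 := by
    intro x
    rw [hrh, hcx, hcy, hD, hs1]; ring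
  have hcxB : ∀ x ∈ S, |cx x| ≤ 2 * (M * B) := by
    intro x hx
    rw [hcx]
    have h1 := habs _ _ _ (hb0' 1) (hbM 1) (hbox x hx 1)
    have h2 := habs _ _ _ (hb0' 0) (hbM 0) (hbox x hx 2)
    exact (abs_sub _ _).trans (by linarith)
  have hcyB : ∀ x ∈ S, |cy x| ≤ 2 * (M * B) := by
    intro x hx
    rw [hcy]
    have h1 := habs _ _ _ (hy0' 0) (hyM 0) (hbox x hx 2)
    have h2 := habs _ _ _ (hy0' 1) (hyM 1) (hbox x hx 1)
    exact (abs_sub _ _).trans (by linarith)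
  have hDx : ∀ x ∈ S, ∀ i, |D * x i| ≤ M ^ 2 * B := by
    intro x hx i
    rw [abs_mul]
    exact mul_le_mul hDM (hbox x hx i) (abs_nonneg _) (by positivity)
  have hrhB : ∀ x ∈ S, ∀ i, |rh x i| ≤ B2 := by
    intro x hx i
    rw [hrh, hB2c]
    have h1 := habs _ _ _ (hy0' i) (hyM i) (hcxB x hx)
    have h2 := habs _ _ _ (hb0' i) (hbM i) (hcyB x hx)
    have h3 := hDx x hx i.succ
    have h4 := abs_sub (D * x i.succ - y0 i * cx x) (b i * cy x)
    have h5 := abs_sub (D * x i.succ) (y0 i * cx x)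
    have e1 : (M : ℤ) * (2 * (M * B)) = 2 * ((M : ℤ) ^ 2 * B) := by ring
    rw [e1] at h1 h2
    linarith
  -- the fibration
  have key := Finset.card_le_mul_card_image_of_maps_to (s := S)
    (t := Fintype.piFinset fun _ : Fin r => Finset.Icc (-(B2 : ℤ)) B2)
    (f := fun x => fun j : Fin r => rh x j.succ.succ) (by
      intro x hx
      rw [Fintype.mem_piFinset]
      intro j
      rw [Finset.mem_Icc]
      exact abs_le.1 (hrhB x hx _)) (C * d ^ e * B2) (by
      intro ρ hρ
      obtain ⟨T, hT⟩ : ∃ T, T = S.filter (fun x => (fun j : Fin r => rh x j.succ.succ) = ρ) := ⟨_, rfl⟩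
      have hTm : ∀ x, x ∈ T → x ∈ S ∧ rh x = Fin.cons 0 (Fin.cons 0 ρ) := by
        intro x hx
        rw [hT, Finset.mem_filter] at hx
        refine ⟨hx.1, ?_⟩
        funext i
        refine Fin.cases ?_ (fun i => ?_) i
        · rw [Fin.cons_zero]; exact hrh0 x
        · refine Fin.cases ?_ (fun i => ?_) i
          · rw [Fin.cons_succ, Fin.cons_zero]; exact hrh1 x
          · rw [Fin.cons_succ, Fin.cons_succ]; exact congrFun hx.2 i
      rw [← hT]
      obtain ⟨ρ', hρ'⟩ : ∃ ρ' : Fin (r + 2) → ℤ, ρ' = Fin.cons 0 (Fin.cons 0 ρ) := ⟨_, rfl⟩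
      have hinj : Set.InjOn (fun x : Fin (r + 3) → ℤ => (![D * x 0, cx x, cy x] : Fin 3 → ℤ)) T := by
        intro x hx x' hx' h
        have g0 := congrFun h 0
        have g1 := congrFun h 1
        have g2 := congrFun h 2
        simp only [Matrix.cons_val] at g0 g1 g2
        funext i
        refine mul_left_cancel₀ hD0 ?_
        refine Fin.cases g0 (fun i => ?_) i
        have k1 := hrh x i
        have k2 := hrh x' i
        rw [(hTm x hx).2] at k1
        rw [(hTm x' hx').2, ← g1, ← g2] at k2
        linarith
      rw [← Finset.card_image_of_injOn hinj]
      refine ha3 d B2 (slice (fun i => (y0 i : ℤ)) (fun i => (b i : ℤ)) ρ' F) _ hd hB1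
        ((totalDegree_slice _ _ _ _).trans hF.totalDegree_le) ?_ ?_ ?_ ?_
      · rw [coeff_single_eq _ d ((totalDegree_slice _ _ _ _).trans hF.totalDegree_le), homComp_slice _ _ _ F hF, eval_slice]
        rw [coeff_single_eq F d hF.totalDegree_le, homogeneousComponent_eq_self hF] at hc
        convert hc using 3
        funext i
        refine Fin.cases ?_ (fun j => ?_) i
        · simp
        · have e1 : (Fin.cons 1 (fun _ => 0) : Fin 3 → ℤ) 1 = 0 := rfl
          have e2 : (Fin.cons 1 (fun _ => 0) : Fin 3 → ℤ) 2 = 0 := rfl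
          simp [e1, e2]
      · rw [← homComp_map, homComp_slice _ _ _ F hF, ← map_dehom, dehom_slice]
        simpa using hbirr
      · intro t ht i
        obtain ⟨x, hx, rfl⟩ := Finset.mem_image.1 ht
        have hxS := (hTm x hx).1
        have k1 := hcxB x hxS
        have k2 := hcyB x hxS
        have k3 := hDx x hxS 0
        rw [hB2c]
        fin_cases i
        · change |D * x 0| ≤ _; linarith
        · change |cx x| ≤ _; linarith
        · change |cy x| ≤ _; linarith
      · intro t ht
        obtain ⟨x, hx, rfl⟩ := Finset.mem_image.1 ht
        obtain ⟨hxS, hxr⟩ := hTm x hx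
        rw [eval_slice]
        have hpt : (Fin.cons ((![D * x 0, cx x, cy x] : Fin 3 → ℤ) 0) (fun i => (y0 i : ℤ) * (![D * x 0, cx x, cy x] : Fin 3 → ℤ) 1 +
            (b i : ℤ) * (![D * x 0, cx x, cy x] : Fin 3 → ℤ) 2 + ρ' i) : Fin (r + 3) → ℤ) = fun i => D * x i := by
          funext i
          refine Fin.cases ?_ (fun j => ?_) i
          · simp
          · rw [Fin.cons_succ, hρ', ← hxr, hrh]
            simp only [Matrix.cons_val]
            ring
        rw [hpt, hom_eval_smul F hF, hz x hxS, mul_zero])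
  refine key.trans ?_
  rw [Fintype.card_piFinset_const, Int.card_Icc]
  have e1 : ((B2 : ℤ) + 1 - -(B2 : ℤ)).toNat = 2 * B2 + 1 := by omega
  rw [e1]
  have h3 : 2 * B2 + 1 ≤ 3 * B2 := by omega
  have hB2e : B2 = 125 * d ^ 8 * B := by rw [hB2, hM]; ring
  calc C * d ^ e * B2 * (2 * B2 + 1) ^ r ≤ C * d ^ e * (3 * B2) * (3 * B2) ^ r :=
        Nat.mul_le_mul (Nat.mul_le_mul_left _ (by omega)) (Nat.pow_le_pow_left h3 r)
    _ = C * 375 ^ (r + 1) * d ^ (e + 8 * (r + 1)) * B ^ (r + 1) := by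
        rw [hB2e, mul_assoc (C * d ^ e), ← pow_succ']
        have : 3 * (125 * d ^ 8 * B) = 375 * d ^ 8 * B := by ring
        rw [this, mul_pow, mul_pow, pow_add d e, pow_mul d]
        ring

end DG

namespace DG
open MvPolynomial
open scoped Finset

theorem count_all (r : ℕ) : ∃ C e : ℕ, ∀ (d B : ℕ) (f : MvPolynomial (Fin (r + 3)) ℤ) (S : Finset (Fin (r + 3) → ℤ)),
    5 ≤ d → 1 ≤ B → f.IsHomogeneous d → Irreducible (map (Int.castRingHom ℚ) f) →
    (∀ x ∈ S, ∀ i, |x i| ≤ B) → (∀ x ∈ S, eval x f = 0) → S.card ≤ C * d ^ e * B ^ (r + 1) := by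
  classical
  obtain ⟨C, e, hirrc⟩ := case_irr r
  refine ⟨C * 2 ^ (r + 1) + 4 * 6 ^ (r + 1), e + 3 + (r + 1), ?_⟩
  intro d B f S hd hB hf hirr hbox hz
  have hf0 : f ≠ 0 := by
    rintro rfl
    rw [map_zero] at hirr
    exact hirr.ne_zero rfl
  have hdeg : f.totalDegree = d := hf.totalDegree hf0
  obtain ⟨c, hcd, hc⟩ := exists_shear f hf0
  rw [hdeg] at hc
  obtain ⟨F, hFdef⟩ : ∃ F, F = shear (fun i => (c i : ℤ)) f := ⟨_, rfl⟩
  rw [← hFdef] at hc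
  have hF : F.IsHomogeneous d := by rw [hFdef]; exact shear_hom _ _ hf
  have hFQ : Irreducible (map (Int.castRingHom ℚ) F) := by
    rw [hFdef, map_shear]
    exact (MulEquiv.irreducible_iff (shear (fun i => (Int.castRingHom ℚ) (c i : ℤ)))).2 hirr
  obtain ⟨T, hT⟩ : ∃ T : (Fin (r + 3) → ℤ) → (Fin (r + 3) → ℤ),
      T = fun x => Fin.cons (x 0) (fun i => (x i.succ - (c i : ℤ) * x 0 : ℤ)) := ⟨_, rfl⟩
  have hTinj : Function.Injective T := by
    intro x y hxy
    rw [hT] at hxy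
    have h0 : x 0 = y 0 := by simpa using congrFun hxy 0
    funext i
    refine Fin.cases h0 (fun j => ?_) i
    have := congrFun hxy j.succ
    simp only [Fin.cons_succ] at this
    rw [h0] at this
    linarith
  have hcard : (S.image T).card = S.card := Finset.card_image_of_injective _ hTinj
  have hTz : ∀ t ∈ S.image T, eval t F = 0 := by
    intro t ht
    obtain ⟨x, hx, rfl⟩ := Finset.mem_image.1 ht
    rw [hFdef, eval_shear]
    have : (Fin.cons (T x 0) (fun i => T x i.succ + (c i : ℤ) * T x 0) : Fin (r + 3) → ℤ) = x := by
      funext i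
      rw [hT]
      refine Fin.cases ?_ (fun j => ?_) i
      · simp
      · simp
    rw [this]
    exact hz x hx
  have hTb : ∀ t ∈ S.image T, ∀ i, |t i| ≤ ((2 * d * B : ℕ) : ℤ) := by
    intro t ht i
    obtain ⟨x, hx, rfl⟩ := Finset.mem_image.1 ht
    have hd1 : (1 : ℤ) ≤ d := by exact_mod_cast (by omega : 1 ≤ d)
    have hB0 : (0 : ℤ) ≤ B := by positivity
    have hdB : (B : ℤ) ≤ d * B := by nlinarith
    push_cast
    rw [hT]
    refine Fin.cases ?_ (fun j => ?_) i
    · have := hbox x hx 0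
      simp only [Fin.cons_zero]
      linarith
    · have h1 := hbox x hx 0
      have h2 := hbox x hx j.succ
      simp only [Fin.cons_succ]
      have h3 : |(c j : ℤ) * x 0| ≤ d * B := by
        rw [abs_mul, Nat.abs_cast]
        have : (c j : ℤ) ≤ d := by exact_mod_cast hdeg ▸ hcd j
        exact mul_le_mul this h1 (abs_nonneg _) (by linarith)
      have h4 := abs_sub (x j.succ) ((c j : ℤ) * x 0)
      linarith
  have hd1 : 1 ≤ d := by omega
  have hB2 : 1 ≤ 2 * d * B := Nat.mul_pos (Nat.mul_pos (by norm_num) hd1) hB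
  rw [← hcard]
  by_cases hK : Irreducible (map (Int.castRingHom (AlgebraicClosure ℚ)) F)
  · refine (hirrc d (2 * d * B) F (S.image T) hd hB2 hF hc hK hTb hTz).trans ?_
    calc C * d ^ e * (2 * d * B) ^ (r + 1) = (C * 2 ^ (r + 1)) * d ^ (e + (r + 1)) * B ^ (r + 1) := by
          rw [mul_pow, mul_pow, pow_add d e]; ring
      _ ≤ _ := Nat.mul_le_mul_right _ (Nat.mul_le_mul (Nat.le_add_right _ _)
          (Nat.pow_le_pow_right hd1 (by omega)))
  · have hK' : ¬ Irreducible (map (algebraMap ℚ (AlgebraicClosure ℚ)) (map (Int.castRingHom ℚ) F)) := by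
      have hcomp : (algebraMap ℚ (AlgebraicClosure ℚ)).comp (Int.castRingHom ℚ) =
          Int.castRingHom (AlgebraicClosure ℚ) := RingHom.ext_int _ _
      rw [map_map, hcomp]
      exact hK
    have hcQ : coeff (Finsupp.single 0 d) (map (Int.castRingHom ℚ) F) ≠ 0 := by
      rw [coeff_map]
      simpa using hc
    refine (case_red (r := r + 1) (map (Int.castRingHom ℚ) F) hFQ
      ((totalDegree_map_le _ _).trans hF.totalDegree_le) hcQ hK' (2 * d * B) (S.image T) ?_).trans ?_
    · intro x hx
      refine ⟨hTb x hx, ?_⟩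
      rw [eval_int_map, hTz x hx, Int.cast_zero]
    · calc d * ((d + d) ^ 2 * (2 * (2 * d * B) + 1) ^ (r + 1)) ≤ d * ((d + d) ^ 2 * (6 * d * B) ^ (r + 1)) := by
            refine Nat.mul_le_mul_left _ (Nat.mul_le_mul_left _ (Nat.pow_le_pow_left ?_ _))
            have : 6 * d * B = 2 * (2 * d * B) + 2 * d * B := by ring
            omega
        _ = 4 * 6 ^ (r + 1) * d ^ (3 + (r + 1)) * B ^ (r + 1) := by
            rw [mul_pow (6 * d), mul_pow 6 d, pow_add d 3]; ring
        _ ≤ _ := Nat.mul_le_mul_right _ (Nat.mul_le_mul (Nat.le_add_left _ _)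
          (Nat.pow_le_pow_right hd1 (by omega)))

end DG

theorem dimension_growth_projective_deg_ge_five (n : ℕ) (hn : 2 < n) :
    ∃ c e : ℝ, ∀ (f : MvPolynomial (Fin (n + 1)) ℤ) (d : ℕ),
      f.IsHomogeneous d → 5 ≤ d →
      Irreducible (MvPolynomial.map (Int.castRingHom ℚ) f) →
      ∀ H : ℝ, 2 ≤ H →
      ∀ S : Set (Projectivization ℚ (Fin (n + 1) → ℚ)),
        S = {p | ∃ (x : Fin (n + 1) → ℤ) (hx : (fun i => (x i : ℚ)) ≠ 0),
              Projectivization.mk ℚ (fun i => (x i : ℚ)) hx = p ∧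
              Finset.univ.gcd x = 1 ∧
              MvPolynomial.eval x f = 0 ∧
              ∀ i, (|x i| : ℝ) ≤ H} →
        S.Finite ∧ (S.ncard : ℝ) ≤ c * (d : ℝ) ^ e * H ^ ((n : ℝ) - 1) := by
  classical
  obtain ⟨r, rfl⟩ : ∃ r, n = r + 2 := ⟨n - 2, by omega⟩
  obtain ⟨C, e, h⟩ := DG.count_all r
  refine ⟨C, e, ?_⟩
  intro f d hf hd hirr H hH S hS
  obtain ⟨B, hB⟩ : ∃ B : ℕ, B = ⌊H⌋₊ := ⟨_, rfl⟩
  have hBH : (B : ℝ) ≤ H := by rw [hB]; exact Nat.floor_le (by linarith)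
  have hB1 : 1 ≤ B := by rw [hB]; exact Nat.le_floor (by push_cast; linarith)
  obtain ⟨P, hP⟩ : ∃ P : Finset (Fin (r + 3) → ℤ),
      P = (Fintype.piFinset (fun _ => Finset.Icc (-(B : ℤ)) B)).filter (fun x => MvPolynomial.eval x f = 0) := ⟨_, rfl⟩
  have hmem : ∀ x, x ∈ P ↔ (∀ i, |x i| ≤ (B : ℤ)) ∧ MvPolynomial.eval x f = 0 := by
    intro x
    rw [hP]
    simp only [Finset.mem_filter, Fintype.mem_piFinset, Finset.mem_Icc, abs_le]
  have hcard : P.card ≤ C * d ^ e * B ^ (r + 1) :=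
    h d B f P hd hB1 hf hirr (fun x hx => ((hmem x).1 hx).1) (fun x hx => ((hmem x).1 hx).2)
  have hrep : ∀ p ∈ S, ∃ x ∈ P, ∃ hx : (fun i => (x i : ℚ)) ≠ 0,
      Projectivization.mk ℚ (fun i => (x i : ℚ)) hx = p := by
    intro p hp
    rw [hS] at hp
    obtain ⟨x, hx, h1, -, h2, h3⟩ := hp
    refine ⟨x, (hmem x).2 ⟨fun i => ?_, h2⟩, hx, h1⟩
    have h4 := h3 i
    have h5 : (((x i).natAbs : ℕ) : ℝ) ≤ H := by
      rw [Nat.cast_natAbs, Int.cast_abs]; exact h4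
    have h6 : (x i).natAbs ≤ B := by rw [hB]; exact Nat.le_floor h5
    rw [Int.abs_eq_natAbs]
    exact_mod_cast h6
  choose! g hgP hgx hg using hrep
  have hinj : Set.InjOn g S := by
    intro p hp q hq hpq
    have e1 := hg p hp
    have e2 := hg q hq
    rw [← e1, ← e2]
    congr 1
    rw [hpq]
  have hmaps : Set.MapsTo g S (P : Set (Fin (r + 3) → ℤ)) := fun p hp => hgP p hp
  have hfin : S.Finite := Set.Finite.of_injOn hmaps hinj P.finite_toSet
  refine ⟨hfin, ?_⟩
  have hn1 : S.ncard ≤ P.card := by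
    rw [← Set.ncard_coe_finset P]
    exact Set.ncard_le_ncard_of_injOn g hmaps hinj P.finite_toSet
  have hexp : (((r + 2 : ℕ) : ℝ) - 1) = ((r + 1 : ℕ) : ℝ) := by push_cast; ring
  rw [hexp, Real.rpow_natCast, Real.rpow_natCast]
  calc (S.ncard : ℝ) ≤ ((C * d ^ e * B ^ (r + 1) : ℕ) : ℝ) := by exact_mod_cast hn1.trans hcard
    _ = C * (d : ℝ) ^ e * (B : ℝ) ^ (r + 1) := by push_cast; ring
    _ ≤ _ := by gcongr
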